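/- (Zeilberger) For all 1 ≤ k ≤ n, the number of (n,k) right Gog trapezoids equals the number of (n,k) right Magog trapezoids. -/

import Mathlib

/-- A Gelfand-Tsetlin triangle of size `n`: a triangular array of positive integers
`X i j` for `n ≥ i ≥ j ≥ 1` with `X (i+1) j ≤ X i j ≤ X (i+1) (j+1)`. -/
def IsGT (n : ℕ) (X : ℕ → ℕ → ℤ) : Prop :=
  (∀ i j, 1 ≤ j → j ≤ i → i ≤ n → 1 ≤ X i j) ∧
  (∀ i j, 1 ≤ j → j ≤ i → i + 1 ≤ n → X (i+1) j ≤ X i j ∧ X i j ≤ X (i+1) (j+1))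

/-- A Gog triangle of size `n`: a Gelfand-Tsetlin triangle with strictly increasing
rows and top row `X n j = j`. -/
def IsGog (n : ℕ) (X : ℕ → ℕ → ℤ) : Prop :=
  IsGT n X ∧
  (∀ i j, 1 ≤ j → j + 1 ≤ i → i ≤ n → X i j < X i (j+1)) ∧
  (∀ j, 1 ≤ j → j ≤ n → X n j = (j : ℤ))

/-- A Magog triangle of size `n`. -/
def IsMagog (n : ℕ) (X : ℕ → ℕ → ℤ) : Prop :=
  IsGT n X ∧ ∀ j, 1 ≤ j → j ≤ n → X j j ≤ (j : ℤ)

/-- A GOGAm triangle of size `n`, characterized by the family of inequalities. -/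
def IsGogam (n : ℕ) (X : ℕ → ℕ → ℤ) : Prop :=
  IsGT n X ∧ X n n ≤ (n : ℤ) ∧
  ∀ k : ℕ, 1 ≤ k → k ≤ n - 1 →
    ∀ j : ℕ → ℕ, j 0 = n → (∀ i, i < n - k → j (i+1) < j i) → 1 ≤ j (n - k) →
      (∑ i ∈ Finset.range (n - k),
        (X (j i + i) (j i) - X (j (i+1) + i) (j (i+1))))
        + X (j (n-k) + (n-k)) (j (n-k)) ≤ (k : ℤ)

/-- The number of inversions of `X` (pairs `(i,j)` with `X i j = X (i+1) j`). -/
noncomputable def invCount (n : ℕ) (X : ℕ → ℕ → ℤ) : ℕ :=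
  Set.ncard {p : ℕ × ℕ | 1 ≤ p.2 ∧ p.2 ≤ p.1 ∧ p.1 + 1 ≤ n ∧ X p.1 p.2 = X (p.1+1) p.2}

/-- The number of coinversions of `X` (pairs `(i,j)` with `X i j = X (i+1) (j+1)`). -/
noncomputable def coinvCount (n : ℕ) (X : ℕ → ℕ → ℤ) : ℕ :=
  Set.ncard {p : ℕ × ℕ | 1 ≤ p.2 ∧ p.2 ≤ p.1 ∧ p.1 + 1 ≤ n ∧ X p.1 p.2 = X (p.1+1) (p.2+1)}

/-- Index set of an `(n,k)` right trapezoid: `n ≥ i ≥ j ≥ 1` with `i - j ≤ k - 1`. -/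
def RightIdx (n k : ℕ) (i j : ℕ) : Prop := 1 ≤ j ∧ j ≤ i ∧ i ≤ n ∧ i < j + k

/-- `(n,k)` right Gog trapezoids, normalized to vanish outside the trapezoid. -/
def RightGogTrapezoids (n k : ℕ) : Set (ℕ → ℕ → ℤ) :=
  {X | (∃ Y, IsGog n Y ∧ ∀ i j, RightIdx n k i j → X i j = Y i j) ∧
    ∀ i j, ¬ RightIdx n k i j → X i j = 0}

/-- `(n,k)` right Magog trapezoids, normalized to vanish outside the trapezoid. -/
def RightMagogTrapezoids (n k : ℕ) : Set (ℕ → ℕ → ℤ) :=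
  {X | (∃ Y, IsMagog n Y ∧ ∀ i j, RightIdx n k i j → X i j = Y i j) ∧
    ∀ i j, ¬ RightIdx n k i j → X i j = 0}

section

open MeasureTheory

/-- The point of the torus of polyradius `ρ` with angles `θ`. -/
noncomputable def torusPt {k : ℕ} (ρ : Fin k → ℝ) (θ : Fin k → UnitAddCircle) : Fin k → ℂ :=
  fun i => (ρ i : ℂ) * (AddCircle.toCircle (θ i) : ℂ)

/-- The torus of polyradius `ρ`. -/
def torusSet {k : ℕ} (ρ : Fin k → ℝ) : Set (Fin k → ℂ) := {x | ∀ i, ‖x i‖ = ρ i}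

/-- The average of `f` over the torus of polyradius `ρ`. -/
noncomputable def torusAvg {k : ℕ} (ρ : Fin k → ℝ) (f : (Fin k → ℂ) → ℂ) : ℂ :=
  ∫ θ : Fin k → UnitAddCircle, f (torusPt ρ θ)

instance : IsProbabilityMeasure (volume : Measure UnitAddCircle) := ⟨UnitAddCircle.measure_univ⟩

instance (k : ℕ) : IsProbabilityMeasure (volume : Measure (Fin k → UnitAddCircle)) := by
  rw [volume_pi]; infer_instance

lemma torusPt_mem {k : ℕ} {ρ : Fin k → ℝ} (hρ : ∀ i, 0 ≤ ρ i) (θ : Fin k → UnitAddCircle) :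
    torusPt ρ θ ∈ torusSet ρ := by
  intro i
  rw [torusPt, norm_mul, Circle.norm_coe, mul_one, Complex.norm_real, Real.norm_of_nonneg (hρ i)]

lemma continuous_torusPt {k : ℕ} (ρ : Fin k → ℝ) : Continuous (torusPt ρ) := by
  refine continuous_pi fun i => continuous_const.mul ?_
  exact continuous_subtype_val.comp (AddCircle.continuous_toCircle.comp (continuous_apply i))

lemma continuous_comp_torusPt {k : ℕ} {ρ : Fin k → ℝ} (hρ : ∀ i, 0 ≤ ρ i) {f : (Fin k → ℂ) → ℂ}
    (hf : ContinuousOn f (torusSet ρ)) : Continuous fun θ => f (torusPt ρ θ) :=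
  hf.comp_continuous (continuous_torusPt ρ) (torusPt_mem hρ)

lemma integrable_torus {k : ℕ} {ρ : Fin k → ℝ} (hρ : ∀ i, 0 ≤ ρ i) {f : (Fin k → ℂ) → ℂ}
    (hf : ContinuousOn f (torusSet ρ)) : Integrable fun θ => f (torusPt ρ θ) :=
  (continuous_comp_torusPt hρ hf).integrable_of_hasCompactSupport
    (HasCompactSupport.of_compactSpace _)

lemma torusAvg_congr {k : ℕ} {ρ : Fin k → ℝ} (hρ : ∀ i, 0 ≤ ρ i) {f g : (Fin k → ℂ) → ℂ}
    (h : ∀ x ∈ torusSet ρ, f x = g x) : torusAvg ρ f = torusAvg ρ g :=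
  integral_congr_ae (Filter.Eventually.of_forall fun θ => h _ (torusPt_mem hρ θ))

lemma torusAvg_zero {k : ℕ} {ρ : Fin k → ℝ} (hρ : ∀ i, 0 ≤ ρ i) {f : (Fin k → ℂ) → ℂ}
    (h : ∀ x ∈ torusSet ρ, f x = 0) : torusAvg ρ f = 0 := by
  rw [torusAvg_congr hρ h]; simp [torusAvg]

lemma torusAvg_const {k : ℕ} (ρ : Fin k → ℝ) (c : ℂ) : torusAvg ρ (fun _ => c) = c := by
  simp [torusAvg]

lemma torusAvg_add {k : ℕ} {ρ : Fin k → ℝ} (hρ : ∀ i, 0 ≤ ρ i) {f g : (Fin k → ℂ) → ℂ}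
    (hf : ContinuousOn f (torusSet ρ)) (hg : ContinuousOn g (torusSet ρ)) :
    torusAvg ρ (fun x => f x + g x) = torusAvg ρ f + torusAvg ρ g :=
  integral_add (integrable_torus hρ hf) (integrable_torus hρ hg)

lemma torusAvg_sub {k : ℕ} {ρ : Fin k → ℝ} (hρ : ∀ i, 0 ≤ ρ i) {f g : (Fin k → ℂ) → ℂ}
    (hf : ContinuousOn f (torusSet ρ)) (hg : ContinuousOn g (torusSet ρ)) :
    torusAvg ρ (fun x => f x - g x) = torusAvg ρ f - torusAvg ρ g :=
  integral_sub (integrable_torus hρ hf) (integrable_torus hρ hg)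

lemma torusAvg_sum {k : ℕ} {ι : Type*} {ρ : Fin k → ℝ} (hρ : ∀ i, 0 ≤ ρ i) (s : Finset ι)
    {f : ι → (Fin k → ℂ) → ℂ} (hf : ∀ a ∈ s, ContinuousOn (f a) (torusSet ρ)) :
    torusAvg ρ (fun x => ∑ a ∈ s, f a x) = ∑ a ∈ s, torusAvg ρ (f a) :=
  integral_finsetSum s fun a ha => integrable_torus hρ (hf a ha)

lemma torusAvg_const_mul {k : ℕ} (ρ : Fin k → ℝ) (c : ℂ) (f : (Fin k → ℂ) → ℂ) :
    torusAvg ρ (fun x => c * f x) = c * torusAvg ρ f :=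
  integral_const_mul c _

lemma torusAvg_perm {k : ℕ} (ρ : Fin k → ℝ) (σ : Equiv.Perm (Fin k)) (f : (Fin k → ℂ) → ℂ) :
    torusAvg (ρ ∘ σ) f = torusAvg ρ (fun x => f (x ∘ σ)) := by
  have h := volume_measurePreserving_piCongrLeft (fun _ : Fin k => UnitAddCircle) σ
  have := h.integral_comp' (fun θ => f (torusPt ρ θ ∘ σ))
  rw [torusAvg, torusAvg, ← this]
  congr 1; funext θ; congr 1; funext i
  simp only [torusPt, Function.comp]
  congr 3
  have := MeasurableEquiv.coe_piCongrLeft (π := fun _ : Fin k => UnitAddCircle) σ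
  rw [this]
  exact (Equiv.piCongrLeft_apply_apply (fun _ : Fin k => UnitAddCircle) σ θ i).symm

/-- Replace the coordinates `x i` with `ε i = true` by their inverses. -/
def flipPt {K : Type*} [Inv K] {k : ℕ} (ε : Fin k → Bool) (x : Fin k → K) : Fin k → K :=
  fun i => if ε i then (x i)⁻¹ else x i

lemma torusAvg_flip {k : ℕ} (ρ : Fin k → ℝ) (ε : Fin k → Bool) (f : (Fin k → ℂ) → ℂ) :
    torusAvg (flipPt ε ρ) f = torusAvg ρ (fun x => f (flipPt ε x)) := by
  have hm : ∀ i, MeasurePreserving (fun t : UnitAddCircle => if ε i then -t else t) volume volume := by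
    intro i
    by_cases h : ε i
    · simpa [h] using Measure.measurePreserving_neg (volume : Measure UnitAddCircle)
    · simp only [h]
      exact MeasurePreserving.id (volume : Measure UnitAddCircle)
  have h := volume_preserving_pi (α' := fun _ : Fin k => UnitAddCircle)
    (β' := fun _ : Fin k => UnitAddCircle) hm
  let e : (Fin k → UnitAddCircle) ≃ᵐ (Fin k → UnitAddCircle) :=
    MeasurableEquiv.piCongrRight fun i => if ε i then MeasurableEquiv.neg _ else MeasurableEquiv.refl _
  have he : (e : (Fin k → UnitAddCircle) → (Fin k → UnitAddCircle)) =
      fun a i => if ε i then - a i else a i := by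
    funext a i
    by_cases h : ε i
    · simp [e, MeasurableEquiv.piCongrRight, h]
    · simp [e, MeasurableEquiv.piCongrRight, h]
  rw [← he] at h
  rw [torusAvg, torusAvg, ← h.integral_comp' ]
  congr 1; funext θ; congr 1; funext i
  rw [he]
  by_cases h : ε i
  · simp [flipPt, torusPt, h, AddCircle.toCircle_neg, mul_comm]
  · simp [flipPt, torusPt, h]

lemma integral_circle_eq_circleAverage (R : ℝ) (g : ℂ → ℂ) :
    ∫ t : UnitAddCircle, g ((R : ℂ) * (AddCircle.toCircle t : ℂ)) = Real.circleAverage g 0 R := by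
  rw [← UnitAddCircle.intervalIntegral_preimage 0, Real.circleAverage]
  have := intervalIntegral.smul_integral_comp_mul_left (a := 0) (b := 1)
    (fun θ => g (circleMap 0 R θ)) (2 * Real.pi)
  rw [mul_zero, mul_one] at this
  rw [← this, smul_smul, inv_mul_cancel₀ (by positivity), one_smul, zero_add]
  congr 1; funext t
  simp [circleMap, AddCircle.toCircle_apply_mk, Circle.coe_exp]

lemma torusAvg_fubini {k : ℕ} {ρ : Fin k → ℝ} (hρ : ∀ i, 0 ≤ ρ i) {f : (Fin k → ℂ) → ℂ}
    (hf : ContinuousOn f (torusSet ρ)) (i : Fin k) :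
    torusAvg ρ f = torusAvg ρ
      (fun x => Real.circleAverage (fun z => f (Function.update x i z)) 0 (ρ i)) := by
  have hc := continuous_comp_torusPt hρ hf
  have h1 : ∀ s : UnitAddCircle, ∫ θ : Fin k → UnitAddCircle,
      f (torusPt ρ (θ + Pi.single i s)) = torusAvg ρ f := by
    intro s
    exact integral_add_right_eq_self (fun θ => f (torusPt ρ θ)) _
  have h2 : torusAvg ρ f = ∫ s : UnitAddCircle, ∫ θ : Fin k → UnitAddCircle,
      f (torusPt ρ (θ + Pi.single i s)) := by
    simp [h1]
  rw [h2, integral_integral_swap]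
  · unfold torusAvg
    congr 1; funext θ
    show _ = Real.circleAverage (fun z => f (Function.update (torusPt ρ θ) i z)) 0 (ρ i)
    rw [← integral_circle_eq_circleAverage,
      ← integral_add_left_eq_self (μ := volume)
        (fun t : UnitAddCircle =>
          f (Function.update (torusPt ρ θ) i (↑(ρ i) * ↑(AddCircle.toCircle t)))) (θ i)]
    congr 1; funext s; congr 1; funext j
    by_cases hj : j = i
    · subst hj; simp [torusPt]
    · simp [torusPt, hj]
  · apply Continuous.integrable_of_hasCompactSupport
    · refine hc.comp (continuous_snd.add ?_)
      exact (continuous_single i).comp continuous_fst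
    · exact HasCompactSupport.of_compactSpace _

lemma update_mem_torusSet {k : ℕ} {ρ : Fin k → ℝ} {x : Fin k → ℂ} (hx : x ∈ torusSet ρ)
    {i : Fin k} {z : ℂ} {r : ℝ} (hz : ‖z‖ = r) :
    Function.update x i z ∈ torusSet (Function.update ρ i r) := by
  intro j
  by_cases hj : j = i
  · subst hj; simpa using hz
  · simpa [hj] using hx j

/-- Vanishing of all averages in one coordinate forces the vanishing of the torus average. -/
lemma torusAvg_eq_zero_of_coord {k : ℕ} {ρ : Fin k → ℝ} (hρ : ∀ i, 0 ≤ ρ i)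
    {f : (Fin k → ℂ) → ℂ} (hf : ContinuousOn f (torusSet ρ)) (i : Fin k)
    (h : ∀ x ∈ torusSet ρ, Real.circleAverage (fun z => f (Function.update x i z)) 0 (ρ i) = 0) :
    torusAvg ρ f = 0 := by
  rw [torusAvg_fubini hρ hf i]
  exact torusAvg_zero hρ h

lemma torusAvg_update_of_indep {k : ℕ} {ρ : Fin k → ℝ} (i : Fin k) (r : ℝ)
    {f : (Fin k → ℂ) → ℂ} (hind : ∀ x z, f (Function.update x i z) = f x) :
    torusAvg (Function.update ρ i r) f = torusAvg ρ f := by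
  unfold torusAvg
  congr 1; funext θ
  rw [← hind (torusPt ρ θ) (torusPt (Function.update ρ i r) θ i)]
  congr 1; funext j
  by_cases hj : j = i
  · subst hj; simp
  · simp [hj, torusPt]

/-- Moving the radius of one coordinate, when the difference of the coordinate averages is a sum
of terms whose averages vanish. -/
lemma torusAvg_move {k : ℕ} {ι : Type*} {ρ : Fin k → ℝ} (hρ : ∀ i, 0 ≤ ρ i) (i : Fin k) {r : ℝ}
    (hr : 0 ≤ r) {f : (Fin k → ℂ) → ℂ} (hf : ContinuousOn f (torusSet ρ))
    (hf' : ContinuousOn f (torusSet (Function.update ρ i r)))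
    (s : Finset ι) (c : ι → (Fin k → ℂ) → ℂ) (hc : ∀ a ∈ s, ContinuousOn (c a) (torusSet ρ))
    (hc0 : ∀ a ∈ s, torusAvg ρ (c a) = 0)
    (h : ∀ x ∈ torusSet ρ, Real.circleAverage (fun z => f (Function.update x i z)) 0 (ρ i) =
      Real.circleAverage (fun z => f (Function.update x i z)) 0 r + ∑ a ∈ s, c a x) :
    torusAvg ρ f = torusAvg (Function.update ρ i r) f := by
  have hρ' : ∀ j, 0 ≤ Function.update ρ i r j := by
    intro j
    by_cases hj : j = i
    · subst hj; simpa
    · simpa [hj] using hρ j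
  have e2 : torusAvg (Function.update ρ i r) f =
      torusAvg ρ (fun x => Real.circleAverage (fun z => f (Function.update x i z)) 0 r) := by
    rw [torusAvg_fubini hρ' hf' i]
    simp only [Function.update_self]
    apply torusAvg_update_of_indep
    intro x z; simp
  have e3 : torusAvg ρ (fun x => ∑ a ∈ s, c a x) = 0 := by
    rw [torusAvg_sum hρ s hc]
    exact Finset.sum_eq_zero hc0
  have hfi : Integrable (fun θ => f (torusPt ρ θ)) := integrable_torus hρ hf
  rw [e2, torusAvg_fubini hρ hf i, ← sub_eq_zero]
  have key : ∀ θ, Real.circleAverage (fun z => f (Function.update (torusPt ρ θ) i z)) 0 r =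
      Real.circleAverage (fun z => f (Function.update (torusPt ρ θ) i z)) 0 (ρ i) -
        ∑ a ∈ s, c a (torusPt ρ θ) := by
    intro θ; rw [h _ (torusPt_mem hρ θ)]; ring
  have hI : Integrable fun θ =>
      Real.circleAverage (fun z => f (Function.update (torusPt ρ θ) i z)) 0 (ρ i) := by
    have hcont := continuous_comp_torusPt hρ hf
    have : (fun θ => Real.circleAverage (fun z => f (Function.update (torusPt ρ θ) i z)) 0 (ρ i)) =
        fun θ => ∫ s : UnitAddCircle, f (torusPt ρ (Function.update θ i s)) := by
      funext θ
      rw [← integral_circle_eq_circleAverage]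
      congr 1; funext s; congr 1; funext j
      by_cases hj : j = i
      · subst hj; simp [torusPt]
      · simp [torusPt, hj]
    rw [this]
    have hcc : Continuous fun p : (Fin k → UnitAddCircle) × UnitAddCircle =>
        f (torusPt ρ (Function.update p.1 i p.2)) :=
      hcont.comp (continuous_fst.update i continuous_snd)
    exact (hcc.integrable_of_hasCompactSupport (μ := volume.prod volume)
      (HasCompactSupport.of_compactSpace _)).integral_prod_left
  have hS : Integrable fun θ => ∑ a ∈ s, c a (torusPt ρ θ) :=
    integrable_finsetSum s fun a ha => integrable_torus hρ (hc a ha)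
  have e4 : torusAvg ρ (fun x => Real.circleAverage (fun z => f (Function.update x i z)) 0 r) =
      torusAvg ρ (fun x => Real.circleAverage (fun z => f (Function.update x i z)) 0 (ρ i)) -
        torusAvg ρ (fun x => ∑ a ∈ s, c a x) := by
    unfold torusAvg
    rw [← integral_sub hI hS]
    exact integral_congr_ae (Filter.Eventually.of_forall key)
  rw [e4, e3]
  ring

end

section

open MeasureTheory Filter Topology

lemma circleAverage_eq_of_differentiable {R : ℝ} (hR : 0 < R) {G : ℂ → ℂ}
    (hG : ∀ z, ‖z‖ ≤ R → DifferentiableAt ℂ G z) : Real.circleAverage G 0 R = G 0 := by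
  rw [Real.circleAverage_eq_circleIntegral hR.ne']
  have := Complex.circleIntegral_sub_inv_smul_of_differentiable_on_off_countable
    (c := 0) (w := 0) (R := R) (f := G) (s := ∅) Set.countable_empty (by simpa using hR)
    (fun z hz => (hG z (by simpa using hz)).continuousAt.continuousWithinAt)
    (fun z hz => hG z (by have := hz.1; simp at this; exact this.le))
  rw [this, smul_smul, inv_mul_cancel₀ (by simp [Real.pi_ne_zero]), one_smul]

lemma circleAverage_congr_norm {R : ℝ} {f g : ℂ → ℂ} (hR : 0 ≤ R)
    (h : ∀ z, ‖z‖ = R → f z = g z) : Real.circleAverage f 0 R = Real.circleAverage g 0 R := by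
  apply Real.circleAverage_congr_sphere
  intro z hz
  apply h
  rw [abs_of_nonneg hR] at hz
  simpa using hz

lemma circleAverage_eq_zero_of_eq_mul {R : ℝ} (hR : 0 < R) {f G : ℂ → ℂ}
    (hG : ∀ z, ‖z‖ ≤ R → DifferentiableAt ℂ G z) (h : ∀ z, ‖z‖ = R → f z = z * G z) :
    Real.circleAverage f 0 R = 0 := by
  rw [circleAverage_congr_norm hR.le h, circleAverage_eq_of_differentiable hR]
  · simp
  · intro z hz; exact differentiableAt_id.mul (hG z hz)

lemma circleIntegral_sub_inv_of_gt {R : ℝ} {a : ℂ} (ha : ‖a‖ < R) :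
    ∮ z in C(0, R), (z - a)⁻¹ = 2 * Real.pi * Complex.I :=
  circleIntegral.integral_sub_inv_of_mem_ball (by simpa using ha)

lemma circleIntegral_sub_inv_of_lt {r : ℝ} {a : ℂ} (hr : 0 < r) (ha : r < ‖a‖) :
    ∮ z in C(0, r), (z - a)⁻¹ = 0 := by
  apply Complex.circleIntegral_eq_zero_of_differentiable_on_off_countable hr.le Set.countable_empty
  · intro z hz
    have hz' : ‖z‖ ≤ r := by simpa using hz
    have : z - a ≠ 0 := by
      intro h; rw [sub_eq_zero] at h; rw [h] at hz'; linarith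
    exact ((continuousAt_id.sub continuousAt_const).inv₀ this).continuousWithinAt
  · intro z hz
    have hz' : ‖z‖ < r := by simpa using hz.1
    have : z - a ≠ 0 := by
      intro h; rw [sub_eq_zero] at h; rw [h] at hz'; linarith
    exact (differentiableAt_id.sub_const a).inv this

/-- The difference of two concentric circle averages is a sum over the simple poles in between. -/
lemma circleAverage_move {ι : Type*} {r R : ℝ} (hr : 0 < r) (hrR : r < R)
    (S : Finset ι) (a : ι → ℂ) (hinj : Set.InjOn a S) (hS : ∀ q ∈ S, r < ‖a q‖ ∧ ‖a q‖ < R)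
    (f : ℂ → ℂ) (hd : ∀ z, r ≤ ‖z‖ → ‖z‖ ≤ R → (∀ q ∈ S, z ≠ a q) → DifferentiableAt ℂ f z)
    (h : ι → ℂ → ℂ) (hh : ∀ q ∈ S, DifferentiableAt ℂ (h q) (a q))
    (hf : ∀ q ∈ S, ∀ᶠ z in 𝓝[≠] (a q), f z = h q z / (z - a q)) :
    Real.circleAverage f 0 R = Real.circleAverage f 0 r + ∑ q ∈ S, h q (a q) / a q := by
  classical
  have ha0 : ∀ q ∈ S, a q ≠ 0 := fun q hq h0 => by
    have := (hS q hq).1; rw [h0, norm_zero] at this; linarith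
  set res : ι → ℂ := fun q => h q (a q) / a q with hres
  set g : ℂ → ℂ := fun z => z⁻¹ * f z - ∑ q ∈ S, res q * (z - a q)⁻¹ with hg
  have hsphere : ∀ ρ, (∀ q ∈ S, ρ ≠ ‖a q‖) → ∀ z : ℂ, ‖z‖ = ρ → ∀ q ∈ S, z ≠ a q := by
    intro ρ hρ z hz q hq hzq
    exact hρ q hq (by rw [← hz, hzq])
  have hgd : ∀ z, r ≤ ‖z‖ → ‖z‖ ≤ R → (∀ q ∈ S, z ≠ a q) → DifferentiableAt ℂ g z := by
    intro z h1 h2 h3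
    have hz0 : z ≠ 0 := by intro h0; rw [h0, norm_zero] at h1; linarith
    refine ((differentiableAt_id.inv hz0).mul (hd z h1 h2 h3)).sub ?_
    refine DifferentiableAt.fun_sum fun q hq => ?_
    have hne : z - a q ≠ 0 := sub_ne_zero.2 (h3 q hq)
    have hsub : DifferentiableAt ℂ (fun w : ℂ => w - a q) z := by fun_prop
    exact (hsub.fun_inv hne).const_mul _
  have hlim : ∀ q ∈ S, ∃ L, Tendsto g (𝓝[≠] (a q)) (𝓝 L) := by
    intro q hq
    let φ : ℂ → ℂ := fun z => h q z / z
    have hφ : DifferentiableAt ℂ φ (a q) := (hh q hq).div differentiableAt_id (ha0 q hq)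
    have hsl := hasDerivAt_iff_tendsto_slope.1 hφ.hasDerivAt
    have hc : ContinuousAt (fun z => ∑ p ∈ S.erase q, res p * (z - a p)⁻¹) (a q) := by
      refine tendsto_finsetSum _ fun p hp => ?_
      have hne : a q - a p ≠ 0 := by
        rw [sub_ne_zero]; intro he
        exact (Finset.ne_of_mem_erase hp) (hinj (Finset.mem_of_mem_erase hp) hq he.symm)
      exact (continuousAt_const.mul ((continuousAt_id.sub continuousAt_const).inv₀ hne))
    refine ⟨_, (hsl.sub (hc.tendsto.mono_left nhdsWithin_le_nhds)).congr' ?_⟩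
    filter_upwards [hf q hq, self_mem_nhdsWithin,
      nhdsWithin_le_nhds (isOpen_ne.mem_nhds (ha0 q hq))] with z hz hne hz0
    have hne' : z - a q ≠ 0 := sub_ne_zero.2 hne
    have hz0' : z ≠ 0 := hz0
    simp only [hg]
    rw [hz, ← Finset.add_sum_erase S _ hq, slope_def_field]
    simp only [hres, φ]
    field_simp
    ring
  choose! L hL using hlim
  let G : ℂ → ℂ := fun z => if hz : ∃ q ∈ S, z = a q then L hz.choose else g z
  have hGq : ∀ q ∈ S, G (a q) = L q := by
    intro q hq
    have hz : ∃ q' ∈ S, a q = a q' := ⟨q, hq, rfl⟩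
    have : hz.choose = q := (hinj hq hz.choose_spec.1 hz.choose_spec.2).symm
    simp only [G, dif_pos hz, this]
  have hGg : ∀ z, (∀ q ∈ S, z ≠ a q) → G z = g z := by
    intro z hz
    have : ¬ ∃ q ∈ S, z = a q := by rintro ⟨q, hq, he⟩; exact hz q hq he
    simp only [G, dif_neg this]
  have hfin : (a '' (S : Set ι)).Finite := S.finite_toSet.image a
  have hev : ∀ z, ∀ᶠ w in 𝓝[≠] z, G w = g w := by
    intro z
    have : ∀ᶠ w in 𝓝[≠] z, w ∉ a '' (S : Set ι) \ {z} := by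
      have hcl : IsClosed (a '' (S : Set ι) \ {z}) := (hfin.subset Set.sdiff_subset).isClosed
      exact nhdsWithin_le_nhds (hcl.isOpen_compl.mem_nhds (by simp))
    filter_upwards [this, self_mem_nhdsWithin] with w hw hwz
    apply hGg
    intro q hq he
    exact hw ⟨⟨q, hq, he.symm⟩, hwz⟩
  have hcont : ∀ z, r ≤ ‖z‖ → ‖z‖ ≤ R → ContinuousAt G z := by
    intro z h1 h2
    rw [continuousAt_iff_punctured_nhds]
    by_cases hz : ∀ q ∈ S, z ≠ a q
    · rw [hGg z hz]
      exact ((hgd z h1 h2 hz).continuousAt.tendsto.mono_left nhdsWithin_le_nhds).congr'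
        ((hev z).mono fun w hw => hw.symm)
    · push Not at hz
      obtain ⟨q, hq, rfl⟩ := hz
      rw [hGq q hq]
      exact (hL q hq).congr' ((hev _).mono fun w hw => hw.symm)
  have hdiff : ∀ z, r ≤ ‖z‖ → ‖z‖ ≤ R → (∀ q ∈ S, z ≠ a q) → DifferentiableAt ℂ G z := by
    intro z h1 h2 hz
    refine (hgd z h1 h2 hz).congr_of_eventuallyEq ?_
    have := (hev z)
    rw [eventually_nhdsWithin_iff] at this
    filter_upwards [this] with w hw
    by_cases hwz : w = z
    · rw [hwz, hGg z hz]
    · exact hw hwz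
  have key := Complex.circleIntegral_eq_of_differentiable_on_annulus_off_countable (c := 0) hr hrR.le
    (f := G) (s := a '' (S : Set ι)) hfin.countable
    (fun z hz => (hcont z (by simpa using hz.2) (by simpa using hz.1)).continuousWithinAt)
    (fun z hz => hdiff z (by have := hz.1.2; simp at this; exact this.le)
      (by have := hz.1.1; simp at this; exact this.le)
      (fun q hq he => hz.2 ⟨q, hq, he.symm⟩))
  have hsp : ∀ ρ, 0 < ρ → r ≤ ρ → ρ ≤ R → (∀ q ∈ S, ρ ≠ ‖a q‖) →
      ∮ z in C(0, ρ), G z = (∮ z in C(0, ρ), (z - 0)⁻¹ • f z) -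
        ∑ q ∈ S, res q * ∮ z in C(0, ρ), (z - a q)⁻¹ := by
    intro ρ hρ h1 h2 h3
    have hs := hsphere ρ h3
    have hI1 : CircleIntegrable (fun z => (z - 0)⁻¹ • f z) 0 ρ := by
      apply ContinuousOn.circleIntegrable hρ.le
      intro z hz
      have hz' : ‖z‖ = ρ := by simpa using hz
      have hz0 : z - 0 ≠ 0 := by intro h0; rw [sub_zero] at h0; rw [h0, norm_zero] at hz'; linarith
      exact (((continuousAt_id.sub continuousAt_const).inv₀ hz0).smul
        (hd z (by linarith) (by linarith) (hs z hz')).continuousAt).continuousWithinAt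
    have hI2 : ∀ q ∈ S, CircleIntegrable (fun z => res q * (z - a q)⁻¹) 0 ρ := by
      intro q hq
      apply ContinuousOn.circleIntegrable hρ.le
      intro z hz
      have hz' : ‖z‖ = ρ := by simpa using hz
      exact (continuousAt_const.mul ((continuousAt_id.sub continuousAt_const).inv₀
        (sub_ne_zero.2 (hs z hz' q hq)))).continuousWithinAt
    have hI3 : CircleIntegrable (fun z => ∑ q ∈ S, res q * (z - a q)⁻¹) 0 ρ :=
      CircleIntegrable.fun_sum S hI2
    rw [circleIntegral.integral_congr hρ.le (g := fun z => (z - 0)⁻¹ • f z -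
      ∑ q ∈ S, res q * (z - a q)⁻¹), circleIntegral.integral_sub hI1 hI3,
      circleIntegral.integral_fun_sum hI2]
    · simp_rw [circleIntegral.integral_const_mul]
    · intro z hz
      have hz' : ‖z‖ = ρ := by simpa using hz
      simp only [hGg z (hs z hz'), hg, sub_zero, smul_eq_mul]
  rw [hsp R (hr.trans hrR) hrR.le le_rfl (fun q hq => (hS q hq).2.ne'),
    hsp r hr le_rfl hrR.le (fun q hq => (hS q hq).1.ne)] at key
  rw [Real.circleAverage_eq_circleIntegral (hr.trans hrR).ne',
    Real.circleAverage_eq_circleIntegral hr.ne']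
  have e1 : ∑ q ∈ S, res q * ∮ z in C(0, R), (z - a q)⁻¹ =
      (2 * Real.pi * Complex.I) * ∑ q ∈ S, res q := by
    rw [Finset.mul_sum]
    refine Finset.sum_congr rfl fun q hq => ?_
    rw [circleIntegral_sub_inv_of_gt (hS q hq).2]; ring
  have e2 : ∑ q ∈ S, res q * ∮ z in C(0, r), (z - a q)⁻¹ = 0 := by
    refine Finset.sum_eq_zero fun q hq => ?_
    rw [circleIntegral_sub_inv_of_lt hr (hS q hq).1, mul_zero]
  rw [e1, e2, sub_zero, sub_eq_iff_eq_add] at key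
  rw [key, smul_add, ← hres]
  congr 1
  rw [smul_eq_mul, ← mul_assoc, inv_mul_cancel₀ (by simp [Real.pi_ne_zero]), one_mul]

end

section

/-- The determinant with rows `1, a, s, a s, s², a s², …`. -/
noncomputable def doubleVdm {k : ℕ} (a s : Fin k → ℂ) : ℂ :=
  Matrix.det (Matrix.of fun i m : Fin k => a i ^ ((m : ℕ) % 2) * s i ^ ((m : ℕ) / 2))

lemma doubleVdm_perm {k : ℕ} (a s : Fin k → ℂ) (σ : Equiv.Perm (Fin k)) :
    doubleVdm (a ∘ σ) (s ∘ σ) = (Equiv.Perm.sign σ : ℂ) * doubleVdm a s := by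
  unfold doubleVdm
  rw [← Matrix.det_permute]
  rfl

lemma det_two_sparse_rows {k : ℕ} (N : Matrix (Fin (k + 2)) (Fin (k + 2)) ℂ)
    (h0 : ∀ m : Fin k, N 0 m.succ.succ = 0) (h1 : ∀ m : Fin k, N 1 m.succ.succ = 0) :
    N.det = (N 0 0 * N 1 1 - N 0 1 * N 1 0) *
      (N.submatrix (fun l : Fin k => l.succ.succ) (fun l : Fin k => l.succ.succ)).det := by
  have hA : ∀ j : Fin (k + 1), N 1 ((1 : Fin (k + 2)).succAbove j) * (-1) ^ (j : ℕ) *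
      ((N.submatrix Fin.succ ((1 : Fin (k + 2)).succAbove)).submatrix Fin.succ j.succAbove).det =
      if j = 0 then N 1 0 *
      (N.submatrix (fun l : Fin k => l.succ.succ) (fun l : Fin k => l.succ.succ)).det else 0 := by
    intro j
    refine Fin.cases ?_ (fun j => ?_) j
    · simp
      left
      congr 1
    · have : (1 : Fin (k + 2)).succAbove j.succ = j.succ.succ := by
        rw [show (1 : Fin (k + 2)) = Fin.succ 0 from rfl, Fin.succ_succAbove_succ]; simp
      rw [this, h1]; simp
  have hB : ∀ j : Fin (k + 1), N 1 j.succ * (-1) ^ (j : ℕ) *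
      ((N.submatrix Fin.succ Fin.succ).submatrix Fin.succ j.succAbove).det =
      if j = 0 then N 1 1 *
      (N.submatrix (fun l : Fin k => l.succ.succ) (fun l : Fin k => l.succ.succ)).det else 0 := by
    intro j
    refine Fin.cases ?_ (fun j => ?_) j
    · simp
      left
      congr 1
    · rw [h1]; simp
  have eA : (N.submatrix Fin.succ ((1 : Fin (k + 2)).succAbove)).det = N 1 0 *
      (N.submatrix (fun l : Fin k => l.succ.succ) (fun l : Fin k => l.succ.succ)).det := by
    rw [Matrix.det_succ_row_zero, Finset.sum_congr rfl (g := fun j => if j = 0 then N 1 0 *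
      (N.submatrix (fun l : Fin k => l.succ.succ) (fun l : Fin k => l.succ.succ)).det else 0)]
    · simp
    · intro j _
      rw [← hA j]
      simp [mul_comm]
  have eB : (N.submatrix Fin.succ Fin.succ).det = N 1 1 *
      (N.submatrix (fun l : Fin k => l.succ.succ) (fun l : Fin k => l.succ.succ)).det := by
    rw [Matrix.det_succ_row_zero, Finset.sum_congr rfl (g := fun j => if j = 0 then N 1 1 *
      (N.submatrix (fun l : Fin k => l.succ.succ) (fun l : Fin k => l.succ.succ)).det else 0)]
    · simp
    · intro j _
      rw [← hB j]
      simp [mul_comm]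
  rw [Matrix.det_succ_row_zero, Fin.sum_univ_succ, Fin.sum_univ_succ]
  have : ∀ j : Fin k, (-1 : ℂ) ^ ((j.succ.succ : Fin (k + 2)) : ℕ) * N 0 j.succ.succ *
      (N.submatrix Fin.succ (j.succ.succ.succAbove)).det = 0 := by
    intro j; rw [h0]; ring
  rw [Finset.sum_eq_zero fun j _ => this j]
  have e1 : (Fin.succ 0 : Fin (k + 2)) = 1 := rfl
  rw [e1, eA, Fin.succAbove_zero, eB]
  simp
  ring

/-- Column operations in `doubleVdm` clearing most of the first row. -/
lemma doubleVdm_eq_det {k : ℕ} (a s : Fin (k + 2) → ℂ) :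
    doubleVdm a s = (Matrix.of fun i : Fin (k + 2) => (Fin.cons 1 (Fin.cons (a i) fun m : Fin k =>
      (s i - s 0) * (a i ^ ((m : ℕ) % 2) * s i ^ ((m : ℕ) / 2))) : Fin (k + 2) → ℂ)).det := by
  unfold doubleVdm
  set M : Matrix (Fin (k + 2)) (Fin (k + 2)) ℂ :=
    Matrix.of fun i m => a i ^ ((m : ℕ) % 2) * s i ^ ((m : ℕ) / 2) with hM
  let V : Matrix (Fin (k + 2)) (Fin (k + 2)) ℂ :=
    Matrix.of fun j m => if j = m then 1 else if (j : ℕ) + 2 = m then - s 0 else 0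
  have hV : V.det = 1 := by
    rw [Matrix.det_of_isUpperTriangular]
    · simp [V]
    · intro i j hij
      have hij' : j < i := hij
      have h1 : i ≠ j := hij'.ne'
      have h2 : ¬ ((i : ℕ) + 2 = j) := by have : (j : ℕ) < i := hij'; omega
      simp [V, h1, h2]
  have hMV0 : ∀ i, (M * V) i 0 = 1 := by
    intro i
    rw [Matrix.mul_apply, Finset.sum_eq_single 0]
    · simp [V, M]
    · intro j _ hj; simp [V, hj]
    · simp
  have hMV1 : ∀ i, (M * V) i 1 = a i := by
    intro i
    rw [Matrix.mul_apply, Finset.sum_eq_single 1]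
    · simp [V, M]
    · intro j _ hj; simp [V, hj]
    · simp
  have hMV : ∀ i (m : Fin k), (M * V) i m.succ.succ =
      (s i - s 0) * (a i ^ ((m : ℕ) % 2) * s i ^ ((m : ℕ) / 2)) := by
    intro i m
    have hne : m.castSucc.castSucc ≠ m.succ.succ := by
      intro h; have := congrArg Fin.val h; simp at this; omega
    rw [Matrix.mul_apply, ← Finset.sum_subset (Finset.subset_univ {m.succ.succ, m.castSucc.castSucc}),
      Finset.sum_pair hne.symm]
    · have e1 : ((m : ℕ) + 1 + 1) % 2 = (m : ℕ) % 2 := by omega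
      have e2 : ((m : ℕ) + 1 + 1) / 2 = (m : ℕ) / 2 + 1 := by omega
      simp [V, M, hne, e1, e2]
      ring
    · intro j _ hj
      simp only [Finset.mem_insert, Finset.mem_singleton, not_or] at hj
      have h2 : ¬ ((j : ℕ) + 2 = (m.succ.succ : Fin (k + 2))) := by
        intro h; apply hj.2; ext; simpa using h
      simp only [V, Matrix.of_apply, hj.1, h2, if_false, mul_zero]
  rw [show M.det = (M * V).det by rw [Matrix.det_mul, hV, mul_one]]
  congr 1
  ext i m
  refine Fin.cases ?_ (fun m => Fin.cases ?_ (fun m => ?_) m) m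
  · rw [hMV0]; rfl
  · rw [Fin.succ_zero_eq_one, hMV1]; rfl
  · rw [hMV]; rfl

lemma doubleVdm_of_eq {k : ℕ} (a s : Fin (k + 2) → ℂ) (h : s 0 = s 1) :
    doubleVdm a s = (a 1 - a 0) * (∏ l : Fin k, (s l.succ.succ - s 0)) *
      doubleVdm (fun l : Fin k => a l.succ.succ) (fun l : Fin k => s l.succ.succ) := by
  rw [doubleVdm_eq_det, det_two_sparse_rows]
  · have : (Matrix.of fun i m : Fin k => (s i.succ.succ - s 0) * (Matrix.of fun (i m : Fin k) =>
        a i.succ.succ ^ ((m : ℕ) % 2) * s i.succ.succ ^ ((m : ℕ) / 2)) i m).det =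
        (∏ l : Fin k, (s l.succ.succ - s 0)) *
          doubleVdm (fun l : Fin k => a l.succ.succ) (fun l : Fin k => s l.succ.succ) :=
      Matrix.det_mul_column _ _
    rw [mul_assoc, ← this]
    congr 1
    change 1 * a 1 - a 0 * 1 = _
    ring
  · intro m
    change (s 0 - s 0) * _ = 0
    ring
  · intro m
    change (s 1 - s 0) * _ = 0
    rw [h]; ring

lemma exists_perm_zero_one {k : ℕ} {i j : Fin (k + 2)} (hij : i ≠ j) :
    ∃ σ : Equiv.Perm (Fin (k + 2)), σ 0 = i ∧ σ 1 = j := by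
  refine ⟨(Equiv.swap 1 (Equiv.swap 0 i j)).trans (Equiv.swap 0 i), ?_, ?_⟩
  · have h1 : (0 : Fin (k + 2)) ≠ 1 := by simp
    have h2 : (0 : Fin (k + 2)) ≠ Equiv.swap 0 i j := by
      intro h
      apply hij
      have := congrArg (Equiv.swap 0 i) h
      simpa using this
    simp [Equiv.swap_apply_of_ne_of_ne h1 h2]
  · simp

lemma prod_univ_erase_perm {k : ℕ} {i j : Fin (k + 2)}
    (σ : Equiv.Perm (Fin (k + 2))) (h0 : σ 0 = i) (h1 : σ 1 = j) (f : Fin (k + 2) → ℂ) :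
    ∏ l ∈ (Finset.univ.erase i).erase j, f l = ∏ l : Fin k, f (σ l.succ.succ) := by
  symm
  refine Finset.prod_bij (fun l _ => σ l.succ.succ) ?_ ?_ ?_ ?_
  · intro l _
    rw [← h0, ← h1]
    simp only [Finset.mem_erase, ne_eq, EmbeddingLike.apply_eq_iff_eq, Finset.mem_univ, and_true]
    constructor
    · intro h; have := congrArg Fin.val h; simp at this
    · exact Fin.succ_ne_zero _
  · intro l _ l' _ h; simpa using h
  · intro m hm
    simp only [Finset.mem_erase, Finset.mem_univ, and_true] at hm
    obtain ⟨m', rfl⟩ := σ.surjective m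
    have a1 : m' ≠ 1 := by rintro rfl; exact hm.1 h1
    have a0 : m' ≠ 0 := by rintro rfl; exact hm.2 h0
    obtain ⟨l, rfl⟩ := Fin.exists_succ_eq.2 a0
    have : l ≠ 0 := by rintro rfl; exact a1 rfl
    obtain ⟨l', rfl⟩ := Fin.exists_succ_eq.2 this
    exact ⟨l', Finset.mem_univ _, rfl⟩
  · intro l _; rfl

/-- When `s i = s j`, the determinant factors, with a cofactor independent of the
coordinates `i` and `j`. -/
lemma exists_doubleVdm_factor {k : ℕ} {i j : Fin k} (hij : i ≠ j) :
    ∃ c : (Fin k → ℂ) → (Fin k → ℂ) → ℂ,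
      (∀ a s, s i = s j → doubleVdm a s =
        c a s * ((a j - a i) * ∏ l ∈ (Finset.univ.erase i).erase j, (s l - s i))) ∧
      ∀ a s a' s', (∀ l, l ≠ i → l ≠ j → a l = a' l ∧ s l = s' l) → c a s = c a' s' := by
  obtain ⟨k, rfl⟩ : ∃ k', k = k' + 2 := by
    have h1 := i.2
    have h2 := j.2
    have : (i : ℕ) ≠ j := fun h => hij (Fin.ext h)
    exact ⟨k - 2, by omega⟩
  obtain ⟨σ, h0, h1⟩ := exists_perm_zero_one hij
  have hne : ∀ l : Fin k, σ l.succ.succ ≠ i ∧ σ l.succ.succ ≠ j := by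
    intro l
    rw [← h0, ← h1]
    simp only [ne_eq, EmbeddingLike.apply_eq_iff_eq]
    exact ⟨Fin.succ_ne_zero _, fun h => by have := congrArg Fin.val h; simp at this⟩
  refine ⟨fun a s => (Equiv.Perm.sign σ : ℂ) * doubleVdm (fun l : Fin k => a (σ l.succ.succ))
    (fun l : Fin k => s (σ l.succ.succ)), ?_, ?_⟩
  · intro a s hs
    have h := doubleVdm_perm a s σ
    have hsq : (Equiv.Perm.sign σ : ℂ) * (Equiv.Perm.sign σ : ℂ) = 1 := by
      rcases Int.units_eq_one_or (Equiv.Perm.sign σ) with h | h <;> simp [h]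
    rw [doubleVdm_of_eq (a ∘ σ) (s ∘ σ) (by simp [h0, h1, hs])] at h
    rw [prod_univ_erase_perm σ h0 h1]
    simp only [Function.comp, h0, h1] at h
    linear_combination (-(Equiv.Perm.sign σ : ℂ)) * h - doubleVdm a s * hsq
  · intro a s a' s' h
    have e1 : (fun l : Fin k => a (σ l.succ.succ)) = fun l : Fin k => a' (σ l.succ.succ) := by
      funext l; exact (h _ (hne l).1 (hne l).2).1
    have e2 : (fun l : Fin k => s (σ l.succ.succ)) = fun l : Fin k => s' (σ l.succ.succ) := by
      funext l; exact (h _ (hne l).1 (hne l).2).2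
    simp only [e1, e2]

end

section

open Finset

/-- The product of `F a b` over the pairs `a < b` in `s`. -/
noncomputable def pairProd {ι : Type*} [LinearOrder ι] (s : Finset ι) (F : ι → ι → ℂ) : ℂ :=
  ∏ a ∈ s, ∏ b ∈ s, if a < b then F a b else 1

/-- The factor of `pairProd` corresponding to an unordered pair. -/
noncomputable def pairFactor {ι : Type*} [LinearOrder ι] (F : ι → ι → ℂ) (a b : ι) : ℂ :=
  if a < b then F a b else F b a

lemma pairProd_insert {ι : Type*} [LinearOrder ι] {s : Finset ι} {i : ι} (hi : i ∉ s)
    (F : ι → ι → ℂ) :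
    pairProd (insert i s) F = (∏ l ∈ s, pairFactor F l i) * pairProd s F := by
  unfold pairProd
  rw [prod_insert hi, prod_insert hi]
  have : ∀ a ∈ s, (∏ b ∈ insert i s, if a < b then F a b else 1) =
      (if a < i then F a i else 1) * ∏ b ∈ s, if a < b then F a b else 1 := by
    intro a _
    rw [prod_insert hi]
  rw [prod_congr rfl this, prod_mul_distrib, ← mul_assoc]
  congr 1
  rw [if_neg (lt_irrefl i), one_mul, ← prod_mul_distrib]
  refine prod_congr rfl fun l hl => ?_
  have hne : l ≠ i := fun h => hi (h ▸ hl)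
  unfold pairFactor
  rcases lt_or_gt_of_ne hne with h | h
  · simp [h, h.not_gt]
  · simp [h, h.not_gt]

lemma pairProd_erase {ι : Type*} [LinearOrder ι] {s : Finset ι} {i : ι} (hi : i ∈ s)
    (F : ι → ι → ℂ) :
    pairProd s F = (∏ l ∈ s.erase i, pairFactor F l i) * pairProd (s.erase i) F := by
  conv_lhs => rw [← insert_erase hi]
  exact pairProd_insert (notMem_erase i s) F

lemma pairProd_split {k : ℕ} {i j : Fin k} (hij : i < j) (F : Fin k → Fin k → ℂ) :
    pairProd univ F = F i j * (∏ l ∈ (univ.erase i).erase j, pairFactor F l i * pairFactor F l j) *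
      pairProd ((univ.erase i).erase j) F := by
  have hj : j ∈ univ.erase i := mem_erase.2 ⟨hij.ne', mem_univ _⟩
  rw [pairProd_erase (mem_univ i), pairProd_erase hj, ← mul_prod_erase _ _ hj, prod_mul_distrib]
  have : pairFactor F j i = F i j := by simp [pairFactor, hij.not_gt]
  rw [this]
  ring

lemma pairProd_congr {ι : Type*} [LinearOrder ι] {s : Finset ι} {F G : ι → ι → ℂ}
    (h : ∀ a ∈ s, ∀ b ∈ s, a < b → F a b = G a b) : pairProd s F = pairProd s G := by
  unfold pairProd
  refine prod_congr rfl fun a ha => prod_congr rfl fun b hb => ?_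
  split_ifs with hab
  · exact h a ha b hb hab
  · rfl

lemma pairProd_mul {ι : Type*} [LinearOrder ι] (s : Finset ι) (F G : ι → ι → ℂ) :
    pairProd s (fun a b => F a b * G a b) = pairProd s F * pairProd s G := by
  unfold pairProd
  rw [← prod_mul_distrib]
  refine prod_congr rfl fun a _ => ?_
  rw [← prod_mul_distrib]
  refine prod_congr rfl fun b _ => ?_
  split_ifs <;> simp

/-- If `F a b` is symmetric on an adjacent pair, the product is invariant under its swap. -/
lemma pairProd_swap {k : ℕ} {i j : Fin k} (hij : (i : ℕ) + 1 = j) (F : Fin k → Fin k → ℂ) (c : ℂ)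
    (hc : F (Equiv.swap i j i) (Equiv.swap i j j) = c * F i j) :
    pairProd univ (fun a b => F (Equiv.swap i j a) (Equiv.swap i j b)) =
      c * pairProd univ F := by
  have hlt : i < j := by rw [Fin.lt_def]; omega
  rw [pairProd_split hlt, pairProd_split hlt F, hc]
  have hl : ∀ l ∈ (univ.erase i).erase j, Equiv.swap i j l = l := by
    intro l hl
    simp only [mem_erase, mem_univ, and_true] at hl
    exact Equiv.swap_apply_of_ne_of_ne hl.2 hl.1
  have e1 : ∀ l ∈ (univ.erase i).erase j,
      pairFactor (fun a b => F (Equiv.swap i j a) (Equiv.swap i j b)) l i *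
        pairFactor (fun a b => F (Equiv.swap i j a) (Equiv.swap i j b)) l j =
      pairFactor F l i * pairFactor F l j := by
    intro l h
    have h' := h
    simp only [mem_erase, mem_univ, and_true] at h'
    simp only [pairFactor, hl l h, Equiv.swap_apply_left, Equiv.swap_apply_right]
    by_cases h1 : l < i
    · have h2 : l < j := h1.trans hlt
      simp [h1, h2, mul_comm]
    · have h2 : ¬ l < j := by
        intro h2
        have a1 : (l : ℕ) ≠ i := fun h => h'.2 (Fin.ext h)
        rw [Fin.lt_def] at h1 h2
        omega
      simp [h1, h2, mul_comm]
  have e2 : pairProd ((univ.erase i).erase j) (fun a b => F (Equiv.swap i j a) (Equiv.swap i j b)) =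
      pairProd ((univ.erase i).erase j) F :=
    pairProd_congr fun a ha b hb _ => by rw [hl a ha, hl b hb]
  rw [prod_congr rfl e1, e2]
  ring

/-- Joint complex differentiability at all points of the closed polydisc of radius `1/8`. -/
def SmallHol {k : ℕ} (f : (Fin k → ℂ) → ℂ) : Prop :=
  ∀ x : Fin k → ℂ, (∀ i, ‖x i‖ ≤ 1 / 8) → DifferentiableAt ℂ f x

lemma SmallHol.mul {k : ℕ} {f g : (Fin k → ℂ) → ℂ} (hf : SmallHol f) (hg : SmallHol g) :
    SmallHol fun x => f x * g x := fun x hx => (hf x hx).mul (hg x hx)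

lemma SmallHol.sub {k : ℕ} {f g : (Fin k → ℂ) → ℂ} (hf : SmallHol f) (hg : SmallHol g) :
    SmallHol fun x => f x - g x := fun x hx => (hf x hx).sub (hg x hx)

lemma SmallHol.prod {k : ℕ} {ι : Type*} (s : Finset ι) {f : ι → (Fin k → ℂ) → ℂ}
    (hf : ∀ a ∈ s, SmallHol (f a)) : SmallHol fun x => ∏ a ∈ s, f a x := fun x hx => by
  classical
  induction s using Finset.induction_on with
  | empty => simp
  | insert a s ha ih =>
    simp only [prod_insert ha]
    exact (hf a (mem_insert_self a s) x hx).mul (ih fun b hb => hf b (mem_insert_of_mem hb))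

lemma SmallHol.sum {k : ℕ} {ι : Type*} (s : Finset ι) {f : ι → (Fin k → ℂ) → ℂ}
    (hf : ∀ a ∈ s, SmallHol (f a)) : SmallHol fun x => ∑ a ∈ s, f a x := fun x hx =>
  DifferentiableAt.fun_sum fun a ha => hf a ha x hx

lemma SmallHol.const {k : ℕ} (c : ℂ) : SmallHol fun _ : Fin k → ℂ => c := fun _ _ =>
  differentiableAt_const c

lemma SmallHol.coord {k : ℕ} {g : ℂ → ℂ} (hg : ∀ z, ‖z‖ ≤ 1 / 8 → DifferentiableAt ℂ g z)
    (i : Fin k) : SmallHol fun x => g (x i) := fun x hx =>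
  (hg _ (hx i)).comp x (differentiableAt_apply i x)

lemma differentiableAt_update {k : ℕ} {f : (Fin k → ℂ) → ℂ} {x : Fin k → ℂ} {i : Fin k} {z : ℂ}
    (hf : DifferentiableAt ℂ f (Function.update x i z)) :
    DifferentiableAt ℂ (fun w => f (Function.update x i w)) z :=
  DifferentiableAt.comp z hf (hasFDerivAt_update x z).differentiableAt

lemma SmallHol.continuousOn {k : ℕ} {f : (Fin k → ℂ) → ℂ} (hf : SmallHol f) {ρ : Fin k → ℝ}
    (hρ : ∀ i, ρ i ≤ 1 / 8) : ContinuousOn f (torusSet ρ) := fun x hx =>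
  (hf x fun i => (hx i).trans_le (hρ i)).continuousAt.continuousWithinAt

lemma norm_update_le {k : ℕ} {x : Fin k → ℂ} {i : Fin k} {z : ℂ} (hx : ∀ j, ‖x j‖ ≤ 1 / 8)
    (hz : ‖z‖ ≤ 1 / 8) (j : Fin k) : ‖Function.update x i z j‖ ≤ 1 / 8 := by
  by_cases hj : j = i
  · subst hj; simpa using hz
  · simpa [hj] using hx j

lemma ne_zero_of_mem_torusSet {k : ℕ} {ρ : Fin k → ℝ} (hρ : ∀ i, 0 < ρ i) {x : Fin k → ℂ}
    (hx : x ∈ torusSet ρ) (i : Fin k) : x i ≠ 0 := by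
  intro h
  have := hx i
  rw [h, norm_zero] at this
  exact (hρ i).ne this

/-- The mean value property on small tori. -/
lemma torusAvg_smallHol {k : ℕ} {ρ : Fin k → ℝ} (hρ : ∀ i, 0 < ρ i) (hρ' : ∀ i, ρ i ≤ 1 / 8)
    {f : (Fin k → ℂ) → ℂ} (hf : SmallHol f) : torusAvg ρ f = f 0 := by
  classical
  have key : ∀ s : Finset (Fin k), torusAvg ρ f = torusAvg (fun i => if i ∈ s then 0 else ρ i) f := by
    intro s
    induction s using Finset.induction_on with
    | empty => simp
    | insert i s hi ih =>
      rw [ih]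
      set τ : Fin k → ℝ := fun i => if i ∈ s then 0 else ρ i with hτ
      have h1 : (fun j => if j ∈ insert i s then 0 else ρ j) = Function.update τ i 0 := by
        funext j
        by_cases hj : j = i
        · subst hj; simp
        · simp [hj, hτ]
      have hτ8 : ∀ j, τ j ≤ 1 / 8 := by
        intro j; simp only [hτ]; split_ifs
        · norm_num
        · exact hρ' j
      have hτ0 : ∀ j, 0 ≤ τ j := by
        intro j; simp only [hτ]; split_ifs
        · exact le_rfl
        · exact (hρ j).le
      have hτi : τ i = ρ i := by simp [hτ, hi]
      rw [h1]
      refine torusAvg_move hτ0 i le_rfl (hf.continuousOn hτ8) (hf.continuousOn ?_)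
        (∅ : Finset ℕ) (fun _ _ => 0) (by simp) (by simp) ?_
      · intro j
        by_cases hj : j = i
        · subst hj; simp
        · simpa [hj] using hτ8 j
      · intro x hx
        rw [circleAverage_eq_of_differentiable (by rw [hτi]; exact hρ i)]
        · simp
        · intro z hz
          exact differentiableAt_update (hf _ (norm_update_le (fun j => (hx j).trans_le (hτ8 j))
            (hz.trans (hτ8 i))))
  rw [key univ]
  have : ∀ x ∈ torusSet (fun i : Fin k => if i ∈ univ then (0 : ℝ) else ρ i),
      f x = (fun _ => f 0) x := by
    intro x hx
    have : x = 0 := by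
      funext i
      have := hx i
      simpa using this
    rw [this]
  rw [torusAvg_congr (by simp) this, torusAvg_const]

/-- A Laurent monomial with a positive exponent times a holomorphic function averages to zero. -/
lemma torusAvg_monomial_eq_zero {k : ℕ} {ρ : Fin k → ℝ} (hρ : ∀ i, 0 < ρ i)
    (hρ' : ∀ i, ρ i ≤ 1 / 8) {H : (Fin k → ℂ) → ℂ} (hH : SmallHol H) (e : Fin k → ℤ) {i : Fin k}
    (hi : 0 < e i) : torusAvg ρ (fun x => (∏ j, x j ^ e j) * H x) = 0 := by
  apply torusAvg_eq_zero_of_coord (fun i => (hρ i).le) _ i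
  · intro x hx
    apply circleAverage_eq_zero_of_eq_mul (hρ i)
      (G := fun z => z ^ (e i - 1) * (∏ j ∈ univ.erase i, x j ^ e j) * H (Function.update x i z))
    · intro z hz
      refine DifferentiableAt.mul (DifferentiableAt.mul ?_ (differentiableAt_const _)) ?_
      · exact differentiableAt_zpow.2 (Or.inr (by omega))
      · exact differentiableAt_update (hH _ (norm_update_le (fun j => (hx j).trans_le (hρ' j))
          (hz.trans (hρ' i))))
    · intro z hz
      have hz0 : z ≠ 0 := by
        intro h; rw [h, norm_zero] at hz; exact (hρ i).ne hz
      rw [← mul_prod_erase univ _ (mem_univ i)]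
      have : ∏ j ∈ univ.erase i, Function.update x i z j ^ e j = ∏ j ∈ univ.erase i, x j ^ e j := by
        refine prod_congr rfl fun j hj => ?_
        rw [Function.update_of_ne (ne_of_mem_erase hj)]
      rw [this, Function.update_self, zpow_sub_one₀ hz0]
      field_simp
  · intro x hx
    refine (ContinuousAt.mul ?_ ?_).continuousWithinAt
    · refine tendsto_finsetProd _ fun j _ => ?_
      exact ((continuous_apply j).continuousAt).zpow₀ _ (Or.inl (ne_zero_of_mem_torusSet hρ hx j))
    · exact (hH x fun i => (hx i).trans_le (hρ' i)).continuousAt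

/-- The Möbius coordinate `z / (1 + z)`. -/
noncomputable def vCoord (z : ℂ) : ℂ := z / (1 + z)

/-- The coordinate `(1 + z)² / z`, invariant under `z ↦ z⁻¹`. -/
noncomputable def lamCoord (z : ℂ) : ℂ := (1 + z) ^ 2 / z

lemma one_add_ne_zero_of_small {z : ℂ} (hz : ‖z‖ ≤ 1 / 8) : 1 + z ≠ 0 := by
  intro h
  have : z = -1 := by linear_combination h
  rw [this] at hz
  norm_num at hz

lemma lamCoord_mul_vCoord {z : ℂ} (hz : z ≠ 0) (h1 : 1 + z ≠ 0) :
    lamCoord z * vCoord z = 1 + z := by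
  unfold lamCoord vCoord; field_simp

/-- The two-variable polynomial antisymmetrised away by the swap of neighbouring coordinates. -/
noncomputable def nullPoly (δ β : ℕ) (e l : ℂ) : ℂ :=
  (1 + e) * vCoord e ^ (β + 1 - δ) * ((1 + l) * vCoord l ^ β) +
    if δ = 0 then (vCoord e * vCoord l) ^ β else 0

/-- The hypotheses on the determinant entries `φ` and the pair interaction `P` under which
averages over small tori satisfy the recursion of interlacing chains. -/
structure IsKernel (δ : ℕ) (φ G : ℕ → ℂ → ℂ) (P : ℂ → ℂ → ℂ) : Prop where
  phi_eq : ∀ m z, z ≠ 0 → ‖z‖ ≤ 1 / 8 → φ m z = z ^ (-(m : ℤ)) * G m z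
  diff : ∀ m z, ‖z‖ ≤ 1 / 8 → DifferentiableAt ℂ (G m) z
  at_zero : ∀ m, G m 0 = 1
  pair_diff : ∀ p : ℂ × ℂ, ‖p.1‖ ≤ 1 / 8 → ‖p.2‖ ≤ 1 / 8 →
    DifferentiableAt ℂ (fun p : ℂ × ℂ => P p.1 p.2) p
  pair_zero : P 0 0 = 1
  pair_ne_zero : ∀ p q, ‖p‖ ≤ 1 / 8 → ‖q‖ ≤ 1 / 8 → P p q ≠ 0
  symm : ∀ β p q, ‖p‖ ≤ 1 / 8 → ‖q‖ ≤ 1 / 8 →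
    P p q * nullPoly δ β p q = P q p * nullPoly δ β q p

/-- The antisymmetric-type kernel built from `φ` and `P`. -/
noncomputable def kernelBase {k : ℕ} (φ : ℕ → ℂ → ℂ) (P : ℂ → ℂ → ℂ) (N : ℕ) (x : Fin k → ℂ) : ℂ :=
  (Matrix.of fun m i : Fin k => φ m (x i)).det * (∏ i, (1 / x i - x i) * lamCoord (x i) ^ N) *
    pairProd univ fun i j => P (x j) (x i)

lemma SmallHol.pair {k : ℕ} {P : ℂ → ℂ → ℂ}
    (hP : ∀ p : ℂ × ℂ, ‖p.1‖ ≤ 1 / 8 → ‖p.2‖ ≤ 1 / 8 →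
      DifferentiableAt ℂ (fun p : ℂ × ℂ => P p.1 p.2) p) (i j : Fin k) :
    SmallHol fun x : Fin k → ℂ => P (x i) (x j) := fun x hx =>
  DifferentiableAt.comp (g := fun p : ℂ × ℂ => P p.1 p.2) (f := fun x : Fin k → ℂ => (x i, x j)) x
    (hP (x i, x j) (hx i) (hx j))
    ((differentiableAt_apply i x).prodMk (differentiableAt_apply j x))

lemma SmallHol.pairProd {k : ℕ} {P : ℂ → ℂ → ℂ}
    (hP : ∀ p : ℂ × ℂ, ‖p.1‖ ≤ 1 / 8 → ‖p.2‖ ≤ 1 / 8 →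
      DifferentiableAt ℂ (fun p : ℂ × ℂ => P p.1 p.2) p) :
    SmallHol fun x : Fin k → ℂ => pairProd univ fun i j => P (x j) (x i) := by
  unfold _root_.pairProd
  refine SmallHol.prod _ fun i _ => SmallHol.prod _ fun j _ => ?_
  split_ifs
  · exact SmallHol.pair hP j i
  · exact SmallHol.const 1

lemma SmallHol.pow {k : ℕ} {f : (Fin k → ℂ) → ℂ} (hf : SmallHol f) (n : ℕ) :
    SmallHol fun x => f x ^ n := fun x hx => (hf x hx).pow n

lemma smallHol_one_add {k : ℕ} (i : Fin k) : SmallHol fun x : Fin k → ℂ => 1 + x i :=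
  SmallHol.coord (g := fun z => 1 + z) (fun z _ => by fun_prop) i

lemma smallHol_vCoord {k : ℕ} (i : Fin k) : SmallHol fun x : Fin k → ℂ => vCoord (x i) :=
  SmallHol.coord (fun z hz => by
    unfold vCoord
    exact differentiableAt_id.div (by fun_prop) (one_add_ne_zero_of_small hz)) i

namespace IsKernel

variable {δ : ℕ} {φ G : ℕ → ℂ → ℂ} {P : ℂ → ℂ → ℂ}

/-- The holomorphic factor of the `σ`-term of the kernel. -/
noncomputable def hol {k : ℕ} (G : ℕ → ℂ → ℂ) (P : ℂ → ℂ → ℂ) (N : ℕ)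
    (σ : Equiv.Perm (Fin k)) (x : Fin k → ℂ) : ℂ :=
  (∏ i, (G (σ i) (x i) * (1 - x i ^ 2) * (1 + x i) ^ (2 * N))) *
    pairProd univ fun i j => P (x j) (x i)

lemma smallHol_hol (h : IsKernel δ φ G P) {k : ℕ} (N : ℕ) (σ : Equiv.Perm (Fin k)) :
    SmallHol (hol G P N σ) := by
  refine SmallHol.mul (SmallHol.prod _ fun i _ => ?_) (SmallHol.pairProd h.pair_diff)
  refine SmallHol.mul (SmallHol.mul ?_ ?_) ((smallHol_one_add i).pow _)
  · exact SmallHol.coord (h.diff _) i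
  · exact SmallHol.coord (g := fun z => 1 - z ^ 2) (fun z _ => by fun_prop) i

lemma hol_zero (h : IsKernel δ φ G P) {k : ℕ} (N : ℕ) (σ : Equiv.Perm (Fin k)) :
    hol G P N σ 0 = 1 := by
  simp [hol, h.at_zero, h.pair_zero, _root_.pairProd]

lemma kernelBase_eq (h : IsKernel δ φ G P) {k : ℕ} (N : ℕ) {x : Fin k → ℂ}
    (hx0 : ∀ i, x i ≠ 0) (hx : ∀ i, ‖x i‖ ≤ 1 / 8) :
    kernelBase φ P N x = ∑ σ : Equiv.Perm (Fin k), ((Equiv.Perm.sign σ : ℤ) : ℂ) *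
      ((∏ i, x i ^ (-(N : ℤ) - 1 - (σ i : ℕ))) * hol G P N σ x) := by
  unfold kernelBase hol
  rw [Matrix.det_apply', sum_mul, sum_mul]
  refine sum_congr rfl fun σ _ => ?_
  rw [mul_assoc, mul_assoc]
  congr 1
  rw [← mul_assoc, ← mul_assoc, ← prod_mul_distrib, ← prod_mul_distrib]
  congr 1
  refine prod_congr rfl fun i _ => ?_
  simp only [Matrix.of_apply]
  rw [h.phi_eq _ _ (hx0 i) (hx i), zpow_sub₀ (hx0 i), zpow_sub₀ (hx0 i), zpow_neg, zpow_neg,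
    zpow_natCast, zpow_natCast, zpow_one]
  have := hx0 i
  unfold lamCoord
  rw [div_pow, ← pow_mul]
  field_simp

variable {k : ℕ} {r : ℝ}

/-- The weighted average attached to a kernel. -/
noncomputable def avg (φ : ℕ → ℂ → ℂ) (P : ℂ → ℂ → ℂ) (N : ℕ) (r : ℝ) (g : (Fin k → ℂ) → ℂ) : ℂ :=
  torusAvg (fun _ => r) fun x => kernelBase φ P N x * g x

lemma continuousOn_kernelBase (h : IsKernel δ φ G P) (N : ℕ) {ρ : Fin k → ℝ} (hr : ∀ i, 0 < ρ i)
    (hr' : ∀ i, ρ i ≤ 1 / 8) : ContinuousOn (kernelBase φ P N) (torusSet ρ) := by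
  refine ContinuousOn.congr (f := fun x => ∑ σ : Equiv.Perm (Fin k),
    ((Equiv.Perm.sign σ : ℤ) : ℂ) * ((∏ i, x i ^ (-(N : ℤ) - 1 - (σ i : ℕ))) * hol G P N σ x)) ?_ ?_
  · refine continuousOn_finsetSum _ fun σ _ => continuousOn_const.mul (ContinuousOn.mul ?_ ?_)
    · refine continuousOn_finsetProd _ fun i _ => ?_
      intro x hx
      exact (((continuous_apply i).continuousAt).zpow₀ _
        (Or.inl (ne_zero_of_mem_torusSet hr hx i))).continuousWithinAt
    · exact (h.smallHol_hol N σ).continuousOn hr'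
  · intro x hx
    exact h.kernelBase_eq N (fun i => ne_zero_of_mem_torusSet hr hx i) fun i => (hx i).trans_le (hr' i)

lemma continuousOn_mul (h : IsKernel δ φ G P) (N : ℕ) (hr : 0 < r)
    (hr' : r ≤ 1 / 8) {g : (Fin k → ℂ) → ℂ} (hg : SmallHol g) :
    ContinuousOn (fun x => kernelBase φ P N x * g x) (torusSet fun _ : Fin k => r) :=
  (h.continuousOn_kernelBase N (fun _ => hr) fun _ => hr').mul (hg.continuousOn fun _ => hr')

lemma avg_add (h : IsKernel δ φ G P) (N : ℕ) (hr : 0 < r) (hr' : r ≤ 1 / 8)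
    {f g : (Fin k → ℂ) → ℂ} (hf : SmallHol f) (hg : SmallHol g) :
    avg φ P N r (fun x => f x + g x) = avg φ P N r f + avg φ P N r g := by
  unfold avg
  rw [← torusAvg_add (fun _ => hr.le) (h.continuousOn_mul N hr hr' hf)
    (h.continuousOn_mul N hr hr' hg)]
  simp only [mul_add]

lemma avg_sub (h : IsKernel δ φ G P) (N : ℕ) (hr : 0 < r) (hr' : r ≤ 1 / 8)
    {f g : (Fin k → ℂ) → ℂ} (hf : SmallHol f) (hg : SmallHol g) :
    avg φ P N r (fun x => f x - g x) = avg φ P N r f - avg φ P N r g := by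
  unfold avg
  rw [← torusAvg_sub (fun _ => hr.le) (h.continuousOn_mul N hr hr' hf)
    (h.continuousOn_mul N hr hr' hg)]
  simp only [mul_sub]

lemma avg_congr (N : ℕ) (hr : 0 < r) (hr' : r ≤ 1 / 8) {f g : (Fin k → ℂ) → ℂ}
    (hfg : ∀ x, (∀ i, x i ≠ 0) → (∀ i, ‖x i‖ ≤ 1 / 8) → f x = g x) :
    avg φ P N r f = avg φ P N r g :=
  torusAvg_congr (fun _ => hr.le) fun x hx => by
    rw [hfg x (fun i => ne_zero_of_mem_torusSet (fun _ => hr) hx i) fun i => (hx i).trans_le hr']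

lemma avg_expand (h : IsKernel δ φ G P) (N : ℕ) (hr : 0 < r) (hr' : r ≤ 1 / 8)
    {g : (Fin k → ℂ) → ℂ} (hg : SmallHol g) (b : Fin k → ℕ) :
    avg φ P N r (fun x => (∏ i, vCoord (x i) ^ b i) * g x) =
      ∑ σ : Equiv.Perm (Fin k), ((Equiv.Perm.sign σ : ℤ) : ℂ) *
        torusAvg (fun _ => r) fun x => (∏ i, x i ^ ((b i : ℤ) - N - 1 - (σ i : ℕ))) *
          (hol G P N σ x * ((∏ i, (1 + x i)⁻¹ ^ b i) * g x)) := by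
  have hH : SmallHol fun x : Fin k → ℂ => (∏ i, (1 + x i)⁻¹ ^ b i) * g x := by
    refine SmallHol.mul (SmallHol.prod _ fun i _ => SmallHol.pow ?_ _) hg
    exact SmallHol.coord (g := fun z => (1 + z)⁻¹) (fun z hz => DifferentiableAt.inv (by fun_prop)
      (one_add_ne_zero_of_small hz)) i
  simp only [← torusAvg_const_mul]
  rw [← torusAvg_sum (fun _ => hr.le)]
  · refine torusAvg_congr (fun _ => hr.le) fun x hx => ?_
    have hx0 : ∀ i, x i ≠ 0 := ne_zero_of_mem_torusSet (fun _ => hr) hx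
    rw [h.kernelBase_eq N hx0 fun i => (hx i).trans_le hr', sum_mul]
    refine sum_congr rfl fun σ _ => ?_
    have : ∏ i, x i ^ ((b i : ℤ) - N - 1 - (σ i : ℕ)) =
        (∏ i, x i ^ (-(N : ℤ) - 1 - (σ i : ℕ))) * ∏ i, x i ^ b i := by
      rw [← prod_mul_distrib]
      refine prod_congr rfl fun i _ => ?_
      rw [← zpow_natCast, ← zpow_add₀ (hx0 i)]
      congr 1; ring
    have h2 : ∏ i, vCoord (x i) ^ b i = (∏ i, x i ^ b i) * ∏ i, (1 + x i)⁻¹ ^ b i := by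
      rw [← prod_mul_distrib]
      refine prod_congr rfl fun i _ => ?_
      rw [vCoord, div_eq_mul_inv, mul_pow]
    dsimp only
    rw [this, h2]
    ring
  · intro σ _
    refine continuousOn_const.mul (ContinuousOn.mul ?_
      (((h.smallHol_hol N σ).mul hH).continuousOn fun _ => hr'))
    refine continuousOn_finsetProd _ fun i _ => ?_
    intro x hx
    exact (((continuous_apply i).continuousAt).zpow₀ _
      (Or.inl (ne_zero_of_mem_torusSet (fun _ => hr) hx i))).continuousWithinAt

lemma smallHol_inv_prod (b : Fin k → ℕ) : SmallHol fun x : Fin k → ℂ => ∏ i, (1 + x i)⁻¹ ^ b i :=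
  SmallHol.prod _ fun i _ => SmallHol.pow (SmallHol.coord (g := fun z => (1 + z)⁻¹)
    (fun z hz => DifferentiableAt.inv (by fun_prop) (one_add_ne_zero_of_small hz)) i) _

/-- A large power of one `v` kills the average. -/
lemma avg_eq_zero_of_large (h : IsKernel δ φ G P) (N : ℕ) (hr : 0 < r) (hr' : r ≤ 1 / 8)
    {g : (Fin k → ℂ) → ℂ} (hg : SmallHol g) {i : Fin k} {B : ℕ} (hB : N + k ≤ B) :
    avg φ P N r (fun x => vCoord (x i) ^ (B + 1) * g x) = 0 := by
  have e : (fun x : Fin k → ℂ => vCoord (x i) ^ (B + 1) * g x) =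
      fun x => (∏ j, vCoord (x j) ^ (if j = i then B + 1 else 0)) * g x := by
    funext x
    rw [Finset.prod_eq_single i]
    · simp
    · intro j _ hj; simp [hj]
    · simp
  rw [e, h.avg_expand N hr hr' hg]
  refine sum_eq_zero fun σ _ => ?_
  rw [torusAvg_monomial_eq_zero (fun _ => hr) (fun _ => hr')
    ((h.smallHol_hol N σ).mul ((smallHol_inv_prod _).mul hg)) _ (i := i), mul_zero]
  have := (σ i).isLt
  simp only [if_true]
  push_cast
  omega

/-- The initial condition: averages of strictly decreasing exponents without `lam` weight. -/
lemma avg_init (h : IsKernel δ φ G P) (hr : 0 < r) (hr' : r ≤ 1 / 8) {b : Fin k → ℕ}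
    (hb : StrictAnti b) (hb1 : ∀ i, 1 ≤ b i) :
    avg φ P 0 r (fun x => ∏ i, vCoord (x i) ^ b i) =
      if ∀ i : Fin k, b i = k - i then ((Equiv.Perm.sign (Fin.revPerm (n := k)) : ℤ) : ℂ) else 0 := by
  have e : (fun x : Fin k → ℂ => ∏ i, vCoord (x i) ^ b i) =
      fun x => (∏ i, vCoord (x i) ^ b i) * 1 := by simp
  rw [e, h.avg_expand 0 hr hr' (SmallHol.const 1)]
  have hmin : ∀ i : Fin k, k - i ≤ b i := by
    intro i
    have key : ∀ d, ∀ i : Fin k, (i : ℕ) + d + 1 = k → d + 1 ≤ b i := by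
      intro d
      induction d with
      | zero => intro i _; exact hb1 i
      | succ d ih =>
        intro i hi
        have h1 := ih ⟨i + 1, by omega⟩ (by simp; omega)
        have h2 : b ⟨i + 1, by omega⟩ < b i := hb (by rw [Fin.lt_def]; simp)
        omega
    have := key (k - 1 - i) i (by omega)
    omega
  have hval : ∀ σ : Equiv.Perm (Fin k), torusAvg (fun _ => r) (fun x =>
      (∏ i, x i ^ ((b i : ℤ) - (0 : ℕ) - 1 - (σ i : ℕ))) *
        (hol G P 0 σ x * ((∏ i, (1 + x i)⁻¹ ^ b i) * 1))) =
      if ∀ i, b i = σ i + 1 then 1 else 0 := by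
    intro σ
    have hH := (h.smallHol_hol 0 σ).mul ((smallHol_inv_prod b).mul (SmallHol.const 1))
    by_cases hp : ∃ i, (0 : ℤ) < (b i : ℤ) - (0 : ℕ) - 1 - (σ i : ℕ)
    · obtain ⟨i, hi⟩ := hp
      rw [torusAvg_monomial_eq_zero (fun _ => hr) (fun _ => hr') hH _ hi, if_neg]
      intro hall
      have := hall i
      omega
    · push Not at hp
      have hsum : ∑ i : Fin k, ((b i : ℤ) - (0 : ℕ) - 1 - (σ i : ℕ)) =
          ∑ i : Fin k, ((b i : ℤ) - (k - (i : ℕ))) := by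
        have e1 : ∑ i : Fin k, ((σ i : ℕ) : ℤ) = ∑ i : Fin k, (((Fin.revPerm i : Fin k) : ℕ) : ℤ) := by
          rw [Equiv.sum_comp σ fun i : Fin k => ((i : ℕ) : ℤ),
            Equiv.sum_comp Fin.revPerm fun i : Fin k => ((i : ℕ) : ℤ)]
        rw [sum_sub_distrib, e1, ← sum_sub_distrib]
        refine sum_congr rfl fun i _ => ?_
        have := i.isLt
        simp only [Fin.revPerm_apply, Fin.val_rev]
        push_cast [Nat.cast_sub (show (i : ℕ) + 1 ≤ k by omega)]
        ring
      have hz : ∀ i, (b i : ℤ) - (0 : ℕ) - 1 - (σ i : ℕ) = 0 := by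
        have h1 : ∑ i : Fin k, ((b i : ℤ) - (0 : ℕ) - 1 - (σ i : ℕ)) = 0 := by
          apply le_antisymm (sum_nonpos fun i _ => hp i)
          rw [hsum]
          exact sum_nonneg fun i _ => by have := hmin i; have := i.isLt; omega
        exact fun i => (sum_eq_zero_iff_of_nonpos fun i _ => hp i).1 h1 i (mem_univ i)
      have hz' : ∀ i, b i = σ i + 1 := fun i => by have := hz i; omega
      rw [if_pos hz']
      have e2 : (fun x : Fin k → ℂ => (∏ i, x i ^ ((b i : ℤ) - (0 : ℕ) - 1 - (σ i : ℕ))) *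
          (hol G P 0 σ x * ((∏ i, (1 + x i)⁻¹ ^ b i) * 1))) =
          fun x => hol G P 0 σ x * ((∏ i, (1 + x i)⁻¹ ^ b i) * 1) := by
        funext x
        rw [prod_eq_one fun i _ => by rw [hz i, zpow_zero], one_mul]
      rw [e2, torusAvg_smallHol (fun _ => hr) (fun _ => hr') hH, h.hol_zero]
      simp
  simp only [hval]
  by_cases hm : ∀ i : Fin k, b i = k - i
  · rw [if_pos hm, sum_eq_single (Fin.revPerm (n := k))]
    · rw [if_pos, mul_one]
      intro i
      rw [hm i, Fin.revPerm_apply, Fin.val_rev]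
      have := i.isLt
      omega
    · intro σ _ hσ
      rw [if_neg, mul_zero]
      intro hall
      apply hσ
      ext i
      have h1 := hall i
      rw [hm i] at h1
      rw [Fin.revPerm_apply, Fin.val_rev]
      have := i.isLt
      omega
    · simp
  · rw [if_neg hm]
    refine sum_eq_zero fun σ _ => ?_
    rw [if_neg, mul_zero]
    intro hall
    apply hm
    have hs : ∑ i : Fin k, (b i : ℤ) = ∑ i : Fin k, ((k : ℤ) - (i : ℕ)) := by
      have e1 : ∑ i : Fin k, ((σ i : ℕ) : ℤ) = ∑ i : Fin k, (((Fin.revPerm i : Fin k) : ℕ) : ℤ) := by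
        rw [Equiv.sum_comp σ fun i : Fin k => ((i : ℕ) : ℤ),
          Equiv.sum_comp Fin.revPerm fun i : Fin k => ((i : ℕ) : ℤ)]
      have : ∑ i : Fin k, (b i : ℤ) = ∑ i : Fin k, (((σ i : ℕ) : ℤ) + 1) :=
        sum_congr rfl fun i _ => by rw [hall i]; push_cast; ring
      rw [this, sum_add_distrib, e1, ← sum_add_distrib]
      refine sum_congr rfl fun i _ => ?_
      have := i.isLt
      simp only [Fin.revPerm_apply, Fin.val_rev]
      push_cast [Nat.cast_sub (show (i : ℕ) + 1 ≤ k by omega)]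
      ring
    have h2 := (sum_eq_sum_iff_of_le (s := univ) (f := fun i : Fin k => (k : ℤ) - (i : ℕ))
      (g := fun i => (b i : ℤ)) fun i _ => by have := hmin i; have := i.isLt; omega).1 hs.symm
    intro i
    have := h2 i (mem_univ i)
    have := i.isLt
    omega

/-- Antisymmetry under the swap of neighbouring coordinates kills the average. -/
lemma avg_null (h : IsKernel δ φ G P) (N : ℕ) (hr : 0 < r) (hr' : r ≤ 1 / 8)
    {i j : Fin k} (hij : (i : ℕ) + 1 = j) (β : ℕ) {g : (Fin k → ℂ) → ℂ}
    (hg : ∀ x, g (x ∘ Equiv.swap i j) = g x) :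
    avg φ P N r (fun x => nullPoly δ β (x j) (x i) * g x) = 0 := by
  have hne : i ≠ j := by intro h; rw [h] at hij; omega
  unfold avg
  set f : (Fin k → ℂ) → ℂ := fun x => kernelBase φ P N x * (nullPoly δ β (x j) (x i) * g x)
  have h1 : torusAvg (fun _ => r) f = torusAvg (fun _ => r) fun x => f (x ∘ Equiv.swap i j) :=
    torusAvg_perm (fun _ => r) (Equiv.swap i j) f
  have h2 : torusAvg (fun _ => r) (fun x => f (x ∘ Equiv.swap i j)) =
      torusAvg (fun _ => r) fun x => (-1) * f x := by
    refine torusAvg_congr (fun _ => hr.le) fun x hx => ?_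
    have hs : ∀ l, ‖x l‖ ≤ 1 / 8 := fun l => (hx l).trans_le hr'
    simp only [f]
    rw [hg]
    have e1 : (Matrix.of fun m l : Fin k => φ m ((x ∘ Equiv.swap i j) l)).det =
        -(Matrix.of fun m l : Fin k => φ m (x l)).det := by
      have := Matrix.det_permute' (Equiv.swap i j) (Matrix.of fun m l : Fin k => φ m (x l))
      rw [Equiv.Perm.sign_swap hne] at this
      simpa [Matrix.submatrix, Function.comp_def] using this
    have e2 : ∏ l, (1 / (x ∘ Equiv.swap i j) l - (x ∘ Equiv.swap i j) l) *
        lamCoord ((x ∘ Equiv.swap i j) l) ^ N = ∏ l, (1 / x l - x l) * lamCoord (x l) ^ N :=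
      Equiv.prod_comp (Equiv.swap i j) fun l => (1 / x l - x l) * lamCoord (x l) ^ N
    have e3 := pairProd_swap hij (fun a b => P (x b) (x a)) (P (x i) (x j) / P (x j) (x i)) (by
      simp only [Equiv.swap_apply_left, Equiv.swap_apply_right]
      rw [div_mul_cancel₀ _ (h.pair_ne_zero _ _ (hs j) (hs i))])
    have e4 := h.symm β (x j) (x i) (hs j) (hs i)
    have e5 : P (x i) (x j) / P (x j) (x i) * nullPoly δ β (x i) (x j) = nullPoly δ β (x j) (x i) := by
      rw [div_mul_eq_mul_div, ← e4, mul_div_cancel_left₀ _ (h.pair_ne_zero _ _ (hs j) (hs i))]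
    unfold kernelBase
    rw [e1, e2]
    simp only [Function.comp_apply, Equiv.swap_apply_left, Equiv.swap_apply_right]
    rw [e3]
    linear_combination (-((Matrix.of fun m l : Fin k => φ m (x l)).det *
      (∏ l, (1 / x l - x l) * lamCoord (x l) ^ N) * (pairProd univ fun a b => P (x b) (x a)) * g x)) * e5
  rw [torusAvg_const_mul] at h2
  rw [h2] at h1
  have : (2 : ℂ) * torusAvg (fun _ => r) f = 0 := by linear_combination h1
  simpa using this

end IsKernel

/-- One step of the interlacing chains: `c` interlaces with `b`, with gap parameter `δ`. -/
def Step (δ : ℕ) {k : ℕ} (b c : Fin k → ℕ) : Prop :=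
  (∀ m, b m ≤ c m + 1) ∧ ∀ m m' : Fin k, (m' : ℕ) + 1 = m → c m + 1 + δ ≤ b m' ∧ c m < c m'

lemma step_snoc {δ B j : ℕ} (b : ℕ → ℕ) (c : Fin j → Fin (B + 1)) (t : Fin (B + 1)) :
    Step δ (fun i : Fin (j + 1) => b i)
      (fun i => ((Fin.snoc c t : Fin (j + 1) → Fin (B + 1)) i : ℕ)) ↔
    Step δ (fun i : Fin j => b i) (fun i => (c i : ℕ)) ∧ b j ≤ t + 1 ∧
      ∀ m : Fin j, (m : ℕ) + 1 = j → (t : ℕ) + 1 + δ ≤ b m ∧ (t : ℕ) < c m := by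
  unfold Step
  constructor
  · rintro ⟨h1, h2⟩
    refine ⟨⟨fun m => ?_, fun m m' hm => ?_⟩, ?_, fun m hm => ?_⟩
    · simpa using h1 m.castSucc
    · simpa using h2 m.castSucc m'.castSucc (by simpa using hm)
    · simpa using h1 (Fin.last j)
    · simpa using h2 (Fin.last j) m.castSucc (by simpa using hm)
  · rintro ⟨⟨h1, h2⟩, h3, h4⟩
    refine ⟨fun m => ?_, fun m m' hm => ?_⟩
    · refine Fin.lastCases ?_ (fun m => ?_) m
      · simpa using h3
      · simpa using h1 m
    · have hm' : (m' : ℕ) < j := by have := m.isLt; omega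
      obtain ⟨m', rfl⟩ : ∃ l : Fin j, m' = l.castSucc := ⟨⟨m', hm'⟩, rfl⟩
      revert hm
      refine Fin.lastCases (fun hm => ?_) (fun m hm => ?_) m
      · simpa using h4 m' (by simpa using hm)
      · simpa using h2 m m' (by simpa using hm)

open Classical in
/-- The generating function of the first `j` entries of the successors of `b`. -/
noncomputable def stepSum (δ B : ℕ) (b : ℕ → ℕ) (w : ℕ → ℂ) (j : ℕ) : ℂ :=
  ∑ c : Fin j → Fin (B + 1), if Step δ (fun i : Fin j => b i) (fun i => (c i : ℕ)) then
    ∏ i : Fin j, w i ^ (c i : ℕ) else 0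

lemma stepSum_zero (δ B : ℕ) (b : ℕ → ℕ) (w : ℕ → ℂ) : stepSum δ B b w 0 = 1 := by
  unfold stepSum
  simp [Step]

lemma sum_snoc {α : Type*} [Fintype α] {j : ℕ} (f : (Fin (j + 1) → α) → ℂ) :
    ∑ c, f c = ∑ c : Fin j → α, ∑ t, f (Fin.snoc c t) := by
  rw [← (Fin.snocEquiv fun _ : Fin (j + 1) => α).sum_comp, Fintype.sum_prod_type, sum_comm]
  rfl

open Classical in
lemma stepSum_succ_aux (δ B : ℕ) (b : ℕ → ℕ) (w : ℕ → ℂ) (j : ℕ) :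
    stepSum δ B b w (j + 1) = ∑ c : Fin j → Fin (B + 1),
      if Step δ (fun i : Fin j => b i) (fun i => (c i : ℕ)) then
        (∏ i : Fin j, w i ^ (c i : ℕ)) * ∑ t : Fin (B + 1),
          if b j ≤ t + 1 ∧ ∀ m : Fin j, (m : ℕ) + 1 = j → (t : ℕ) + 1 + δ ≤ b m ∧ (t : ℕ) < c m then
            w j ^ (t : ℕ) else 0 else 0 := by
  unfold stepSum
  rw [sum_snoc]
  refine sum_congr rfl fun c _ => ?_
  by_cases hc : Step δ (fun i : Fin j => b i) (fun i => (c i : ℕ))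
  · rw [if_pos hc, mul_sum]
    refine sum_congr rfl fun t _ => ?_
    rw [Fin.prod_univ_castSucc]
    simp only [step_snoc, hc, true_and, Fin.snoc_castSucc, Fin.snoc_last, Fin.val_castSucc,
      Fin.val_last, mul_ite, mul_zero]
  · rw [if_neg hc]
    refine sum_eq_zero fun t _ => ?_
    rw [if_neg]
    rw [step_snoc]
    exact fun h => hc h.1

lemma geom_Ico (w : ℂ) {m n : ℕ} (hmn : m ≤ n) :
    (1 - w) * ∑ t ∈ Ico m n, w ^ t = w ^ m - w ^ n := by
  have := geom_sum_Ico_mul w hmn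
  linear_combination -this

lemma sum_fin_ite (B : ℕ) (f : ℕ → ℂ) (p : ℕ → Prop) [DecidablePred p] :
    (∑ t : Fin (B + 1), if p t then f t else 0) = ∑ t ∈ (range (B + 1)).filter p, f t := by
  rw [sum_filter, sum_range fun t => if p t then f t else 0]

lemma stepSum_one (δ B : ℕ) (b : ℕ → ℕ) (w : ℕ → ℂ) (hb : b 0 ≤ B) :
    (1 - w 0) * stepSum δ B b w 1 = w 0 ^ (b 0 - 1) - w 0 ^ (B + 1) := by
  classical
  rw [stepSum_succ_aux, Fintype.sum_unique, if_pos (by simp [Step])]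
  simp only [IsEmpty.forall_iff, and_true]
  rw [sum_fin_ite B (fun t => w 0 ^ t) fun t => b 0 ≤ t + 1]
  have e : (range (B + 1)).filter (fun t => b 0 ≤ t + 1) = Ico (b 0 - 1) (B + 1) := by
    ext t; simp only [mem_filter, mem_range, mem_Ico]; omega
  rw [e, univ_eq_empty, prod_empty, one_mul, geom_Ico _ (by omega)]

open Classical in
lemma stepSum_forced (δ B : ℕ) (b : ℕ → ℕ) (w : ℕ → ℂ) (j : ℕ) (hδ : δ = 0) (hB : b j ≤ B)
    (h1 : 1 ≤ b j) (hb : ∀ m, m + 1 = j → b j < b m) :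
    (∑ c : Fin (j + 1) → Fin (B + 1),
      if Step δ (fun i : Fin (j + 1) => b i) (fun i => (c i : ℕ)) ∧ (c (Fin.last j) : ℕ) + 1 = b j then
        ∏ i : Fin (j + 1), w i ^ (c i : ℕ) else 0) = w j ^ (b j - 1) * stepSum δ B b w j := by
  subst hδ
  unfold stepSum
  rw [sum_snoc, mul_sum]
  refine sum_congr rfl fun c _ => ?_
  rw [sum_eq_single (⟨b j - 1, by omega⟩ : Fin (B + 1))]
  · rw [Fin.prod_univ_castSucc]
    simp only [step_snoc, Fin.snoc_castSucc, Fin.snoc_last, Fin.val_castSucc, Fin.val_last]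
    have : (Step 0 (fun i : Fin j => b i) (fun i => (c i : ℕ)) ∧ b j ≤ b j - 1 + 1 ∧
        ∀ m : Fin j, (m : ℕ) + 1 = j → b j - 1 + 1 + 0 ≤ b m ∧ b j - 1 < c m) ∧
        b j - 1 + 1 = b j ↔ Step 0 (fun i : Fin j => b i) (fun i => (c i : ℕ)) := by
      constructor
      · exact fun h => h.1.1
      · intro h
        refine ⟨⟨h, by omega, fun m hm => ?_⟩, by omega⟩
        have h2 := h.1 m
        have h3 := hb m hm
        simp only at h2
        omega
    simp only [this]
    split_ifs
    · ring
    · ring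
  · intro t _ ht
    rw [if_neg]
    rintro ⟨-, h⟩
    simp only [Fin.snoc_last] at h
    exact ht (Fin.ext (by simp; omega))
  · simp

lemma stepSum_succ_succ (δ B : ℕ) (b : ℕ → ℕ) (w : ℕ → ℂ) (j : ℕ) (hδ : δ ≤ 1) (hB : b j ≤ B)
    (h1 : 1 ≤ b (j + 1)) (hb : b (j + 1) < b j) (hb' : ∀ m, m + 1 = j → b j < b m) :
    (1 - w (j + 1)) * stepSum δ B b w (j + 2) =
      (w (j + 1) ^ (b (j + 1) - 1) - w (j + 1) ^ (b j - δ)) * stepSum δ B b w (j + 1) -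
        (1 - w (j + 1)) * ((if δ = 0 then (w (j + 1) * w j) ^ (b j - 1) else 0) *
          stepSum δ B b w j) := by
  classical
  have inner : ∀ c : Fin (j + 1) → Fin (B + 1),
      Step δ (fun i : Fin (j + 1) => b i) (fun i => (c i : ℕ)) →
      (∑ t : Fin (B + 1), if b (j + 1) ≤ t + 1 ∧ ∀ m : Fin (j + 1), (m : ℕ) + 1 = j + 1 →
        (t : ℕ) + 1 + δ ≤ b m ∧ (t : ℕ) < c m then w (j + 1) ^ (t : ℕ) else 0) =
      (∑ t ∈ Ico (b (j + 1) - 1) (b j - δ), w (j + 1) ^ t) -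
        if δ = 0 ∧ (c (Fin.last j) : ℕ) + 1 = b j then w (j + 1) ^ (b j - 1) else 0 := by
    intro c hc
    have hc' := hc.1 (Fin.last j)
    simp only [Fin.val_last] at hc'
    have : ∀ t : Fin (B + 1), (b (j + 1) ≤ (t : ℕ) + 1 ∧ ∀ m : Fin (j + 1), (m : ℕ) + 1 = j + 1 →
        (t : ℕ) + 1 + δ ≤ b m ∧ (t : ℕ) < c m) ↔
        (b (j + 1) ≤ (t : ℕ) + 1 ∧ (t : ℕ) + 1 + δ ≤ b j ∧ (t : ℕ) < c (Fin.last j)) := by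
      intro t
      constructor
      · rintro ⟨h1, h2⟩; exact ⟨h1, by simpa using h2 (Fin.last j) rfl⟩
      · rintro ⟨h1, h2⟩
        refine ⟨h1, fun m hm => ?_⟩
        have : m = Fin.last j := Fin.ext (by simpa using hm)
        subst this
        simpa using h2
    simp only [this]
    rw [sum_fin_ite B (fun t => w (j + 1) ^ t)
      fun t => b (j + 1) ≤ t + 1 ∧ t + 1 + δ ≤ b j ∧ t < c (Fin.last j)]
    split_ifs with h
    · have e : Ico (b (j + 1) - 1) (b j - δ) = insert (b j - 1) ((range (B + 1)).filter
          fun t => b (j + 1) ≤ t + 1 ∧ t + 1 + δ ≤ b j ∧ t < c (Fin.last j)) := by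
        ext t; simp only [mem_filter, mem_range, mem_Ico, mem_insert]; omega
      rw [e, sum_insert]
      · ring
      · simp only [mem_filter, mem_range]; omega
    · rw [sub_zero]
      refine sum_congr ?_ fun _ _ => rfl
      ext t; simp only [mem_filter, mem_range, mem_Ico]; omega
  have main : stepSum δ B b w (j + 2) =
      (∑ t ∈ Ico (b (j + 1) - 1) (b j - δ), w (j + 1) ^ t) * stepSum δ B b w (j + 1) -
        (if δ = 0 then (w (j + 1) * w j) ^ (b j - 1) else 0) * stepSum δ B b w j := by
    rw [stepSum_succ_aux]
    have e1 : (if δ = 0 then (w (j + 1) * w j) ^ (b j - 1) else 0) * stepSum δ B b w j =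
        ∑ c : Fin (j + 1) → Fin (B + 1),
          if Step δ (fun i : Fin (j + 1) => b i) (fun i => (c i : ℕ)) then
            (∏ i : Fin (j + 1), w i ^ (c i : ℕ)) * (if δ = 0 ∧ (c (Fin.last j) : ℕ) + 1 = b j then
              w (j + 1) ^ (b j - 1) else 0) else 0 := by
      by_cases hδ0 : δ = 0
      · rw [if_pos hδ0, mul_pow, mul_assoc, ← stepSum_forced δ B b w j hδ0 hB (by omega) hb', mul_sum]
        refine sum_congr rfl fun c _ => ?_
        by_cases h1 : Step δ (fun i : Fin (j + 1) => b i) (fun i => (c i : ℕ))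
        · by_cases h2 : (c (Fin.last j) : ℕ) + 1 = b j
          · simp [h2, hδ0, mul_comm]
          · simp [h2]
        · simp [h1]
      · simp [hδ0]
    rw [e1]
    unfold stepSum
    rw [mul_sum, ← sum_sub_distrib]
    refine sum_congr rfl fun c _ => ?_
    by_cases hc : Step δ (fun i : Fin (j + 1) => b i) (fun i => (c i : ℕ))
    · rw [if_pos hc, if_pos hc, if_pos hc, inner c hc]
      ring
    · simp [hc]
  rw [main, mul_sub, ← mul_assoc, geom_Ico _ (by omega)]

namespace IsKernel

variable {δ : ℕ} {φ G : ℕ → ℂ → ℂ} {P : ℂ → ℂ → ℂ} {k : ℕ} {r : ℝ}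

/-- The `m`-th coordinate, extended by zero. -/
noncomputable def coordExt (x : Fin k → ℂ) (m : ℕ) : ℂ := if h : m < k then x ⟨m, h⟩ else 0

lemma coordExt_val (x : Fin k → ℂ) (i : Fin k) : coordExt x i = x i := by
  simp [coordExt]

lemma smallHol_vCoord_ext (m : ℕ) : SmallHol fun x : Fin k → ℂ => vCoord (coordExt x m) := by
  by_cases h : m < k
  · simpa [coordExt, h] using smallHol_vCoord (⟨m, h⟩ : Fin k)
  · simpa [coordExt, h] using SmallHol.const _

lemma smallHol_one_add_ext (m : ℕ) : SmallHol fun x : Fin k → ℂ => 1 + coordExt x m := by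
  by_cases h : m < k
  · simpa [coordExt, h] using smallHol_one_add (⟨m, h⟩ : Fin k)
  · simpa [coordExt, h] using SmallHol.const _

lemma smallHol_stepSum (B : ℕ) (b : ℕ → ℕ) (j : ℕ) :
    SmallHol fun x : Fin k → ℂ => stepSum δ B b (fun m => vCoord (coordExt x m)) j := by
  classical
  unfold stepSum
  refine SmallHol.sum _ fun c _ => ?_
  split_ifs
  · exact SmallHol.prod _ fun i _ => (smallHol_vCoord_ext _).pow _
  · exact SmallHol.const 0

lemma smallHol_prod_range (b : ℕ → ℕ) (j : ℕ) :
    SmallHol fun x : Fin k → ℂ =>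
      ∏ l ∈ range j, ((1 + coordExt x l) * vCoord (coordExt x l) ^ (b l - 1)) :=
  SmallHol.prod _ fun l _ => (smallHol_one_add_ext l).mul ((smallHol_vCoord_ext l).pow _)

lemma one_add_mul_one_sub {z : ℂ} (hz : ‖z‖ ≤ 1 / 8) : (1 + z) * (1 - vCoord z) = 1 := by
  have := one_add_ne_zero_of_small hz
  unfold vCoord
  field_simp
  ring

lemma norm_coordExt_le {x : Fin k → ℂ} (hx : ∀ i, ‖x i‖ ≤ 1 / 8) (m : ℕ) :
    ‖coordExt x m‖ ≤ 1 / 8 := by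
  unfold coordExt
  split_ifs with h
  · exact hx _
  · simp

lemma coordExt_congr {x x' : Fin k → ℂ} {j m : ℕ} (hm : j ≤ m)
    (h : ∀ i : Fin k, j ≤ (i : ℕ) → x i = x' i) : coordExt x m = coordExt x' m := by
  unfold coordExt
  split_ifs with h1
  · exact h ⟨m, h1⟩ hm
  · rfl

/-- Modulo null terms, the successor generating function is a product of geometric tails. -/
lemma avg_stepSum (h : IsKernel δ φ G P) (N B : ℕ) (hr : 0 < r) (hr' : r ≤ 1 / 8) (hδ : δ ≤ 1)
    (b : ℕ → ℕ) (hb : ∀ m, m + 1 < k → b (m + 1) < b m) (hb1 : ∀ m, m < k → 1 ≤ b m)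
    (hB : ∀ m, m < k → b m ≤ B) (hNB : N + k ≤ B) (j : ℕ) :
    j ≤ k → ∀ g : (Fin k → ℂ) → ℂ, SmallHol g →
      (∀ x x' : Fin k → ℂ, (∀ i : Fin k, j ≤ (i : ℕ) → x i = x' i) → g x = g x') →
      avg φ P N r (fun x => stepSum δ B b (fun m => vCoord (coordExt x m)) j * g x) =
      avg φ P N r (fun x =>
        (∏ l ∈ range j, ((1 + coordExt x l) * vCoord (coordExt x l) ^ (b l - 1))) * g x) := by
  induction j using Nat.twoStepInduction with
  | zero =>
    intro _ g _ _
    simp [stepSum_zero]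
  | one =>
    intro h1 g hg _
    have e : avg φ P N r (fun x => stepSum δ B b (fun m => vCoord (coordExt x m)) 1 * g x) =
        avg φ P N r (fun x => (∏ l ∈ range 1, ((1 + coordExt x l) *
          vCoord (coordExt x l) ^ (b l - 1))) * g x -
          vCoord (x ⟨0, h1⟩) ^ (B + 1) * ((1 + x ⟨0, h1⟩) * g x)) := by
      refine avg_congr N hr hr' fun x _ hx => ?_
      have h2 := stepSum_one δ B b (fun m => vCoord (coordExt x m)) (hB 0 h1)
      have h3 := one_add_mul_one_sub (norm_coordExt_le hx 0)
      have h4 : coordExt x 0 = x ⟨0, h1⟩ := coordExt_val x ⟨0, h1⟩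
      simp only [range_one, prod_singleton]
      rw [← h4]
      linear_combination (1 + coordExt x 0) * g x * h2 -
        stepSum δ B b (fun m => vCoord (coordExt x m)) 1 * g x * h3
    rw [e, h.avg_sub N hr hr' ((smallHol_prod_range b 1).mul hg)
      (((smallHol_vCoord _).pow _).mul ((smallHol_one_add _).mul hg)),
      h.avg_eq_zero_of_large N hr hr' ((smallHol_one_add _).mul hg) hNB, sub_zero]
  | more j ih0 ih1 =>
    intro hjk g hg hgi
    have hj : j < k := by omega
    have hj1 : j + 1 < k := by omega
    set a : ℕ → (Fin k → ℂ) → ℂ := fun l x =>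
      (1 + coordExt x l) * vCoord (coordExt x l) ^ (b l - 1) with ha
    set z : (Fin k → ℂ) → ℂ := fun x =>
      (1 + coordExt x (j + 1)) * vCoord (coordExt x (j + 1)) ^ (b j - δ) with hz
    set p : (Fin k → ℂ) → ℂ := fun x =>
      if δ = 0 then (vCoord (coordExt x (j + 1)) * vCoord (coordExt x j)) ^ (b j - 1) else 0 with hp
    have sa : ∀ l, SmallHol (a l) := fun l =>
      (smallHol_one_add_ext l).mul ((smallHol_vCoord_ext l).pow _)
    have sz : SmallHol z := (smallHol_one_add_ext _).mul ((smallHol_vCoord_ext _).pow _)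
    have sp : SmallHol p := by
      simp only [hp]
      split_ifs
      · exact ((smallHol_vCoord_ext _).mul (smallHol_vCoord_ext _)).pow _
      · exact SmallHol.const 0
    have sT := fun j => smallHol_stepSum (k := k) (δ := δ) B b j
    have sQ := fun j => smallHol_prod_range (k := k) b j
    have e : avg φ P N r (fun x => stepSum δ B b (fun m => vCoord (coordExt x m)) (j + 2) * g x) =
        avg φ P N r (fun x =>
          (stepSum δ B b (fun m => vCoord (coordExt x m)) (j + 1) * (a (j + 1) x * g x) -
          stepSum δ B b (fun m => vCoord (coordExt x m)) (j + 1) * (z x * g x)) -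
          stepSum δ B b (fun m => vCoord (coordExt x m)) j * (p x * g x)) := by
      refine avg_congr N hr hr' fun x _ hx => ?_
      have h2 := stepSum_succ_succ δ B b (fun m => vCoord (coordExt x m)) j hδ (hB j hj)
        (hb1 _ hj1) (hb _ hj1) fun m hm => by subst hm; exact hb m (by omega)
      have h3 := one_add_mul_one_sub (norm_coordExt_le hx (j + 1))
      simp only [ha, hz, hp]
      linear_combination (1 + coordExt x (j + 1)) * g x * h2 -
        (stepSum δ B b (fun m => vCoord (coordExt x m)) (j + 2) * g x +
        (if δ = 0 then (vCoord (coordExt x (j + 1)) * vCoord (coordExt x j)) ^ (b j - 1) else 0) *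
        stepSum δ B b (fun m => vCoord (coordExt x m)) j * g x) * h3
    have ig : ∀ {x x' : Fin k → ℂ}, (∀ i : Fin k, j + 1 ≤ (i : ℕ) → x i = x' i) → g x = g x' :=
      fun hxx => hgi _ _ fun i hi => hxx i (by omega)
    rw [e, h.avg_sub N hr hr' (((sT _).mul ((sa _).mul hg)).sub ((sT _).mul (sz.mul hg)))
      ((sT _).mul (sp.mul hg)), h.avg_sub N hr hr' ((sT _).mul ((sa _).mul hg))
      ((sT _).mul (sz.mul hg)),
      ih1 (by omega) _ ((sa _).mul hg) (fun x x' hxx => by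
        simp only [ha]; rw [coordExt_congr le_rfl hxx, ig hxx]),
      ih1 (by omega) _ (sz.mul hg) (fun x x' hxx => by
        simp only [hz]; rw [coordExt_congr le_rfl hxx, ig hxx]),
      ih0 (by omega) _ (sp.mul hg) (fun x x' hxx => by
        simp only [hp]
        rw [coordExt_congr (Nat.le_succ j) hxx, coordExt_congr le_rfl hxx,
          ig fun i hi => hxx i (by omega)])]
    have e0 : avg φ P N r (fun x => nullPoly δ (b j - 1) (x ⟨j + 1, hj1⟩) (x ⟨j, hj⟩) *
        ((∏ l ∈ range j, a l x) * g x)) = 0 := by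
      refine h.avg_null N hr hr' (i := ⟨j, hj⟩) (j := ⟨j + 1, hj1⟩) rfl _ fun x => ?_
      congr 1
      · refine prod_congr rfl fun l hl => ?_
        rw [mem_range] at hl
        have : coordExt (x ∘ Equiv.swap ⟨j, hj⟩ ⟨j + 1, hj1⟩) l = coordExt x l := by
          unfold coordExt
          have hlk : l < k := by omega
          rw [dif_pos hlk, dif_pos hlk, Function.comp_apply, Equiv.swap_apply_of_ne_of_ne]
          · intro h; simp only [Fin.mk.injEq] at h; omega
          · intro h; simp only [Fin.mk.injEq] at h; omega
        simp only [ha, this]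
      · refine hgi _ _ fun i hi => ?_
        rw [Function.comp_apply, Equiv.swap_apply_of_ne_of_ne]
        · intro h; rw [h] at hi; simp at hi
        · intro h; rw [h] at hi; simp at hi
    have e1 : avg φ P N r (fun x => (∏ l ∈ range (j + 1), a l x) * (z x * g x)) +
        avg φ P N r (fun x => (∏ l ∈ range j, a l x) * (p x * g x)) = 0 := by
      rw [← h.avg_add N hr hr' ((sQ _).mul (sz.mul hg)) ((sQ _).mul (sp.mul hg)), ← e0]
      refine avg_congr N hr hr' fun x _ _ => ?_
      have h4 : coordExt x j = x ⟨j, hj⟩ := coordExt_val x ⟨j, hj⟩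
      have h5 : coordExt x (j + 1) = x ⟨j + 1, hj1⟩ := coordExt_val x ⟨j + 1, hj1⟩
      have h6 : b j - 1 + 1 - δ = b j - δ := by have := hb1 j hj; omega
      rw [prod_range_succ]
      simp only [ha, hz, hp, nullPoly, ← h4, ← h5, h6]
      split_ifs <;> ring
    have e2 : (fun x => (∏ l ∈ range (j + 2), a l x) * g x) =
        fun x => (∏ l ∈ range (j + 1), a l x) * (a (j + 1) x * g x) := by
      funext x
      rw [prod_range_succ _ (j + 1)]
      ring
    rw [e2]
    linear_combination -e1

open Classical in
/-- The averages satisfy the recursion of interlacing chains. -/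
theorem avg_step (h : IsKernel δ φ G P) (N B : ℕ) (hr : 0 < r) (hr' : r ≤ 1 / 8) (hδ : δ ≤ 1)
    {b : Fin k → ℕ} (hb : StrictAnti b) (hb1 : ∀ m, 1 ≤ b m) (hB : ∀ m, b m ≤ B)
    (hNB : N + k ≤ B) :
    avg φ P (N + 1) r (fun x => ∏ i, vCoord (x i) ^ b i) =
      ∑ c : Fin k → Fin (B + 1), if Step δ b (fun i => (c i : ℕ)) then
        avg φ P N r (fun x => ∏ i, vCoord (x i) ^ (c i : ℕ)) else 0 := by
  set b' : ℕ → ℕ := fun m => if hm : m < k then b ⟨m, hm⟩ else 0 with hb'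
  have hbv : ∀ i : Fin k, b' i = b i := fun i => by simp [hb']
  have key := h.avg_stepSum N B hr hr' hδ b'
    (fun m hm => by
      simp only [hb', dif_pos hm, dif_pos (Nat.lt_of_succ_lt hm)]
      exact hb (by rw [Fin.lt_def]; simp))
    (fun m hm => by simp only [hb', dif_pos hm]; exact hb1 _)
    (fun m hm => by simp only [hb', dif_pos hm]; exact hB _) hNB k le_rfl (fun _ => 1)
    (SmallHol.const 1) (fun _ _ _ => rfl)
  have e1 : avg φ P (N + 1) r (fun x : Fin k → ℂ => ∏ i, vCoord (x i) ^ b i) =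
      avg φ P N r (fun x : Fin k → ℂ => (∏ l ∈ range k, ((1 + coordExt x l) *
        vCoord (coordExt x l) ^ (b' l - 1))) * 1) := by
    unfold avg
    refine torusAvg_congr (fun _ => hr.le) fun x hx => ?_
    dsimp only
    rw [prod_range fun l => (1 + coordExt x l) * vCoord (coordExt x l) ^ (b' l - 1)]
    simp only [coordExt_val, hbv]
    unfold kernelBase
    have : (∏ i, (1 / x i - x i) * lamCoord (x i) ^ (N + 1)) * ∏ i, vCoord (x i) ^ b i =
        (∏ i, (1 / x i - x i) * lamCoord (x i) ^ N) *
          ∏ i, ((1 + x i) * vCoord (x i) ^ (b i - 1)) := by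
      rw [← prod_mul_distrib, ← prod_mul_distrib]
      refine prod_congr rfl fun i _ => ?_
      rw [← lamCoord_mul_vCoord (ne_zero_of_mem_torusSet (fun _ => hr) hx i)
        (one_add_ne_zero_of_small ((hx i).trans_le hr'))]
      obtain ⟨m, hm⟩ : ∃ m, b i = m + 1 := ⟨b i - 1, by have := hb1 i; omega⟩
      rw [hm, Nat.add_sub_cancel]
      ring
    linear_combination ((Matrix.of fun m i : Fin k => φ m (x i)).det *
      pairProd univ fun i j => P (x j) (x i)) * this
  rw [e1, ← key]
  have e2 : (fun x : Fin k → ℂ => stepSum δ B b' (fun m => vCoord (coordExt x m)) k * 1) =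
      fun x => ∑ c : Fin k → Fin (B + 1), if Step δ b (fun i => (c i : ℕ)) then
        ∏ i, vCoord (x i) ^ (c i : ℕ) else 0 := by
    funext x
    unfold stepSum
    simp only [coordExt_val, hbv, mul_one]
  rw [e2]
  unfold avg
  simp only [mul_sum]
  rw [torusAvg_sum (fun _ => hr.le)]
  · refine sum_congr rfl fun c _ => ?_
    split_ifs
    · rfl
    · simp only [mul_zero, torusAvg_const]
  · intro c _
    refine h.continuousOn_mul N hr hr' ?_
    split_ifs
    · exact SmallHol.prod _ fun i _ => (smallHol_vCoord i).pow _
    · exact SmallHol.const 0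

end IsKernel

/-- Pairwise distinct nonzero absolute values. -/
def IsGeneric {k : ℕ} (e : Fin k → ℤ) : Prop :=
  (∀ i, e i ≠ 0) ∧ ∀ i j, i ≠ j → |e i| ≠ |e j|

/-- The radii `100 ^ e`. -/
noncomputable def rad {k : ℕ} (e : Fin k → ℤ) (i : Fin k) : ℝ := (100 : ℝ) ^ e i

lemma rad_pos {k : ℕ} (e : Fin k → ℤ) (i : Fin k) : 0 < rad e i := zpow_pos (by norm_num) _

lemma rad_update {k : ℕ} (e : Fin k → ℤ) (i : Fin k) (m : ℤ) :
    rad (Function.update e i m) = Function.update (rad e) i ((100 : ℝ) ^ m) := by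
  funext j
  by_cases hj : j = i
  · subst hj; simp [rad]
  · simp [rad, hj]

lemma zpow_100_step {a b : ℤ} (h : a < b) : (100 : ℝ) * 100 ^ a ≤ 100 ^ b := by
  rw [← zpow_one_add₀ (by norm_num)]
  exact zpow_le_zpow_right₀ (by norm_num) (by omega)

lemma zpow_100_pos (a : ℤ) : (0 : ℝ) < 100 ^ a := zpow_pos (by norm_num) _

/-- Three complex numbers of widely different sizes do not sum to zero. -/
lemma add_add_ne_zero_of_norm {u v w : ℂ} {a b c : ℤ} (hu : ‖u‖ = 100 ^ a) (hv : ‖v‖ = 100 ^ b)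
    (hw : ‖w‖ = 100 ^ c) (hab : a ≠ b) (hac : a ≠ c) (hbc : b ≠ c) : u + v + w ≠ 0 := by
  intro h
  have h1 : ‖u‖ ≤ ‖v‖ + ‖w‖ := by
    have : u = -(v + w) := by linear_combination h
    rw [this, norm_neg]; exact norm_add_le _ _
  have h2 : ‖v‖ ≤ ‖u‖ + ‖w‖ := by
    have : v = -(u + w) := by linear_combination h
    rw [this, norm_neg]; exact norm_add_le _ _
  have h3 : ‖w‖ ≤ ‖u‖ + ‖v‖ := by
    have : w = -(u + v) := by linear_combination h
    rw [this, norm_neg]; exact norm_add_le _ _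
  rw [hu, hv, hw] at h1 h2 h3
  have pa := zpow_100_pos a
  have pb := zpow_100_pos b
  have pc := zpow_100_pos c
  rcases lt_or_gt_of_ne hab with x1 | x1 <;> rcases lt_or_gt_of_ne hac with x2 | x2 <;>
    rcases lt_or_gt_of_ne hbc with x3 | x3 <;>
    · have y1 := zpow_100_step x1
      have y2 := zpow_100_step x2
      have y3 := zpow_100_step x3
      linarith

/-- The two denominators attached to an earlier coordinate `p` and a later coordinate `q`. -/
noncomputable def pairDen (τ : Bool) (p q : ℂ) : ℂ := if τ then 1 + p + q else 1 + p + p * q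

lemma pairDen_ne_zero {p q : ℂ} {a b : ℤ} (hp : ‖p‖ = 100 ^ a) (hq : ‖q‖ = 100 ^ b) (ha : a ≠ 0)
    (hb : b ≠ 0) (hab : |a| ≠ |b|) (τ : Bool) : pairDen τ p q ≠ 0 := by
  have h1 : ‖(1 : ℂ)‖ = (100 : ℝ) ^ (0 : ℤ) := by simp
  have hne : a ≠ b := fun h => hab (by rw [h])
  have hne' : a + b ≠ 0 := fun h => hab (by rw [show a = -b by omega, abs_neg])
  unfold pairDen
  split_ifs
  · exact add_add_ne_zero_of_norm h1 hp hq ha.symm hb.symm hne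
  · refine add_add_ne_zero_of_norm h1 hp (c := a + b) ?_ ha.symm (by omega) (by omega)
    rw [norm_mul, hp, hq, zpow_add₀ (by norm_num)]

/-- The product of a numerator with all the inverse pair denominators. -/
noncomputable def polarFun {k : ℕ} (F : (Fin k → ℂ) → ℂ) (x : Fin k → ℂ) : ℂ :=
  F x * pairProd univ fun a b => (pairDen true (x b) (x a))⁻¹ * (pairDen false (x b) (x a))⁻¹

/-- `polarFun` with the denominator of type `τ` of the pair `a < b` removed. -/
noncomputable def reducedFun {k : ℕ} (F : (Fin k → ℂ) → ℂ) (a₀ b₀ : Fin k) (τ : Bool)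
    (x : Fin k → ℂ) : ℂ :=
  F x * pairProd univ fun a b =>
    (if a = a₀ ∧ b = b₀ ∧ τ = true then 1 else (pairDen true (x b) (x a))⁻¹) *
    (if a = a₀ ∧ b = b₀ ∧ τ = false then 1 else (pairDen false (x b) (x a))⁻¹)

lemma pairProd_single {k : ℕ} {a₀ b₀ : Fin k} (h : a₀ < b₀) (c : ℂ) :
    pairProd univ (fun a b : Fin k => if a = a₀ ∧ b = b₀ then c else 1) = c := by
  unfold pairProd
  rw [prod_eq_single a₀, prod_eq_single b₀]
  · simp [h]
  · intro b _ hb; simp [hb]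
  · simp
  · intro a _ ha
    exact prod_eq_one fun b _ => by simp [ha]
  · simp

lemma polarFun_eq {k : ℕ} (F : (Fin k → ℂ) → ℂ) {a₀ b₀ : Fin k} (h : a₀ < b₀) (τ : Bool)
    (x : Fin k → ℂ) : polarFun F x = reducedFun F a₀ b₀ τ x / pairDen τ (x b₀) (x a₀) := by
  unfold polarFun reducedFun
  rw [div_eq_mul_inv, mul_assoc]
  congr 1
  conv_rhs => rw [← pairProd_single h (pairDen τ (x b₀) (x a₀))⁻¹]
  rw [← pairProd_mul]
  refine pairProd_congr fun a _ b _ _ => ?_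
  by_cases hab : a = a₀ ∧ b = b₀
  · obtain ⟨rfl, rfl⟩ := hab
    cases τ <;> simp [mul_comm]
  · have h1 : ¬ (a = a₀ ∧ b = b₀ ∧ τ = true) := fun h => hab ⟨h.1, h.2.1⟩
    have h2 : ¬ (a = a₀ ∧ b = b₀ ∧ τ = false) := fun h => hab ⟨h.1, h.2.1⟩
    rw [if_neg hab, if_neg h1, if_neg h2, mul_one]

lemma differentiableAt_prod {k : ℕ} {ι : Type*} (s : Finset ι) {f : ι → (Fin k → ℂ) → ℂ}
    {x : Fin k → ℂ} (hf : ∀ a ∈ s, DifferentiableAt ℂ (f a) x) :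
    DifferentiableAt ℂ (fun x => ∏ a ∈ s, f a x) x := by
  classical
  induction s using Finset.induction_on with
  | empty => simp
  | insert a s ha ih =>
    simp only [prod_insert ha]
    exact (hf a (mem_insert_self a s)).mul (ih fun b hb => hf b (mem_insert_of_mem hb))

lemma differentiableAt_pairProd {k : ℕ} {F : Fin k → Fin k → (Fin k → ℂ) → ℂ} {x : Fin k → ℂ}
    (hF : ∀ a b, a < b → DifferentiableAt ℂ (F a b) x) :
    DifferentiableAt ℂ (fun x => pairProd univ fun a b => F a b x) x := by
  unfold pairProd
  refine differentiableAt_prod _ fun a _ => differentiableAt_prod _ fun b _ => ?_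
  split_ifs with h
  · exact hF a b h
  · exact differentiableAt_const _

lemma differentiableAt_pairDen_inv {k : ℕ} {τ : Bool} {a b : Fin k} {x : Fin k → ℂ}
    (h : pairDen τ (x b) (x a) ≠ 0) :
    DifferentiableAt ℂ (fun x : Fin k → ℂ => (pairDen τ (x b) (x a))⁻¹) x := by
  refine DifferentiableAt.inv ?_ h
  unfold pairDen
  split_ifs <;> fun_prop

lemma differentiableAt_polarFun {k : ℕ} {F : (Fin k → ℂ) → ℂ} {x : Fin k → ℂ}
    (hF : DifferentiableAt ℂ F x) (h : ∀ a b, a < b → ∀ τ, pairDen τ (x b) (x a) ≠ 0) :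
    DifferentiableAt ℂ (polarFun F) x :=
  hF.mul (differentiableAt_pairProd fun a b hab =>
    (differentiableAt_pairDen_inv (h a b hab true)).mul
      (differentiableAt_pairDen_inv (h a b hab false)))

lemma differentiableAt_reducedFun {k : ℕ} {F : (Fin k → ℂ) → ℂ} {x : Fin k → ℂ} {a₀ b₀ : Fin k}
    {σ : Bool} (hF : DifferentiableAt ℂ F x)
    (h : ∀ a b, a < b → ∀ τ, ¬ (a = a₀ ∧ b = b₀ ∧ σ = τ) → pairDen τ (x b) (x a) ≠ 0) :
    DifferentiableAt ℂ (reducedFun F a₀ b₀ σ) x := by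
  refine hF.mul (differentiableAt_pairProd fun a b hab => DifferentiableAt.mul ?_ ?_)
  · split_ifs with h1
    · exact differentiableAt_const _
    · exact differentiableAt_pairDen_inv (h a b hab true h1)
  · split_ifs with h1
    · exact differentiableAt_const _
    · exact differentiableAt_pairDen_inv (h a b hab false h1)

/-- The values of a moving coordinate at which a pair denominator with a coordinate equal to `w`
vanishes. -/
noncomputable def pole (τ : Bool) (w : ℂ) : ℂ := if τ then -1 - w else -(1 + w)⁻¹

/-- The order of magnitude of a pole. -/
def poleExp (τ : Bool) (a : ℤ) : ℤ := if τ then max a 0 else -max a 0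

lemma norm_one_add {w : ℂ} {a : ℤ} (hw : ‖w‖ = 100 ^ a) (ha : a ≠ 0) :
    99 / 100 * (100 : ℝ) ^ max a 0 ≤ ‖1 + w‖ ∧ ‖1 + w‖ ≤ 101 / 100 * (100 : ℝ) ^ max a 0 := by
  have h1 : ‖1 + w‖ ≤ 1 + ‖w‖ := by simpa using norm_add_le 1 w
  have h2 : 1 - ‖w‖ ≤ ‖1 + w‖ := by simpa using norm_sub_norm_le 1 (-w)
  have h3 : ‖w‖ - 1 ≤ ‖1 + w‖ := by
    have := norm_sub_norm_le w (-1)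
    simpa [add_comm] using this
  rw [hw] at h1 h2 h3
  rcases lt_or_gt_of_ne ha with h | h
  · have := zpow_100_step h
    rw [max_eq_right h.le, zpow_zero] at *
    constructor <;> linarith
  · have := zpow_100_step h
    rw [zpow_zero] at this
    rw [max_eq_left h.le]
    constructor <;> linarith

lemma one_add_ne_zero_of_norm {w : ℂ} {a : ℤ} (hw : ‖w‖ = 100 ^ a) (ha : a ≠ 0) : 1 + w ≠ 0 := by
  intro h
  have := (norm_one_add hw ha).1
  rw [h, norm_zero] at this
  have := zpow_100_pos (max a 0)
  linarith

lemma norm_pole {w : ℂ} {a : ℤ} (hw : ‖w‖ = 100 ^ a) (ha : a ≠ 0) (τ : Bool) :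
    9 / 10 * (100 : ℝ) ^ poleExp τ a ≤ ‖pole τ w‖ ∧
      ‖pole τ w‖ ≤ 11 / 10 * (100 : ℝ) ^ poleExp τ a := by
  have h := norm_one_add hw ha
  have hp := zpow_100_pos (max a 0)
  cases τ
  · simp only [pole, poleExp, Bool.false_eq_true, if_false, norm_neg, norm_inv, zpow_neg]
    have hpos : 0 < ‖1 + w‖ := lt_of_lt_of_le (by positivity) h.1
    constructor
    · rw [le_inv_comm₀ (by positivity) hpos, mul_inv, inv_inv]
      refine h.2.trans ?_
      gcongr; norm_num
    · rw [inv_le_comm₀ hpos (by positivity), mul_inv, inv_inv]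
      refine le_trans ?_ h.1
      gcongr; norm_num
  · simp only [pole, poleExp, if_true]
    rw [show -1 - w = -(1 + w) by ring, norm_neg]
    constructor <;> linarith [h.1, h.2]

lemma pairDen_eq_zero_left {τ : Bool} {z w : ℂ} (h : pairDen τ z w = 0) : z = pole τ w := by
  cases τ
  · simp only [pairDen, pole, Bool.false_eq_true, if_false] at *
    have h1 : 1 + w ≠ 0 := by
      intro h1
      have : (1 : ℂ) = 0 := by linear_combination h - z * h1
      exact one_ne_zero this
    field_simp
    linear_combination h
  · simp only [pairDen, pole, if_true] at *
    linear_combination h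

lemma pairDen_eq_zero_right {z w : ℂ} (h : pairDen true w z = 0) : z = pole true w := by
  simp only [pairDen, pole, if_true] at *
  linear_combination h

lemma pole_injective {w w' : ℂ} {a a' : ℤ} (hw : ‖w‖ = 100 ^ a) (hw' : ‖w'‖ = 100 ^ a')
    (ha : a ≠ 0) (ha' : a' ≠ 0) (haa : w = w' ∨ |a| ≠ |a'|) {τ τ' : Bool}
    (h : pole τ w = pole τ' w') : w = w' ∧ τ = τ' := by
  have h1 := one_add_ne_zero_of_norm hw ha
  have h1' := one_add_ne_zero_of_norm hw' ha'
  have key : ∀ {u u' : ℂ} {c c' : ℤ}, ‖u‖ = 100 ^ c → ‖u'‖ = 100 ^ c' → c ≠ 0 → c' ≠ 0 →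
      (u = u' ∨ |c| ≠ |c'|) → 1 + u' ≠ 0 → -1 - u = -(1 + u')⁻¹ → False := by
    intro u u' c c' hu hu' hc hc' hcc hne hE
    have hE' : u + u' + u * u' = 0 := by
      field_simp at hE
      linear_combination -hE
    rcases hcc with rfl | hcc
    · have hu0 : u ≠ 0 := by
        intro h0; rw [h0, norm_zero] at hu; exact (zpow_100_pos c).ne hu
      have h2 : u = -2 := by
        have : u * (u + 2) = 0 := by linear_combination hE'
        rcases mul_eq_zero.1 this with h | h
        · exact absurd h hu0
        · linear_combination h
      rw [h2] at hu
      norm_num at hu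
      rcases lt_or_gt_of_ne hc with h | h
      · have := zpow_100_step h
        rw [zpow_zero] at this; linarith
      · have := zpow_100_step h
        rw [zpow_zero] at this; linarith
    · refine add_add_ne_zero_of_norm hu hu' (c := c + c') ?_ ?_ (by omega) (by omega) hE'
      · rw [norm_mul, hu, hu', zpow_add₀ (by norm_num)]
      · intro h; exact hcc (by rw [h])
  cases τ <;> cases τ' <;> simp only [pole, Bool.false_eq_true, if_false, if_true] at h
  · refine ⟨?_, rfl⟩
    have := inv_injective (neg_injective h)
    linear_combination this
  · exact (key hw' hw ha' ha (haa.imp Eq.symm Ne.symm) h1 h.symm).elim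
  · exact (key hw hw' ha ha' haa h1' h).elim
  · exact ⟨by linear_combination -h, rfl⟩

end

section

open Finset Filter Topology

/-- The contribution of the pole of type `τ` created by the coordinate `l` when the coordinate `i`
moves. -/
noncomputable def poleTerm {k : ℕ} (F : (Fin k → ℂ) → ℂ) (i l : Fin k) (τ : Bool)
    (x : Fin k → ℂ) : ℂ :=
  reducedFun F (min i l) (max i l) τ (Function.update x i (pole τ (x l))) /
    (if τ then 1 else 1 + x l) / pole τ (x l)

/-- The poles crossed when the coordinate `i` moves from radius `100 ^ e i` to `100 ^ e₁`. -/
def crossed {k : ℕ} (e : Fin k → ℤ) (i : Fin k) (e₁ : ℤ) : Finset (Fin k × Bool) :=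
  univ.filter fun q => q.1 ≠ i ∧ (q.2 = false → q.1 < i) ∧ e₁ < poleExp q.2 (e q.1) ∧
    poleExp q.2 (e q.1) < e i

lemma poleExp_ne {k : ℕ} {e : Fin k → ℤ} (he : IsGeneric e) {i l : Fin k} (hl : l ≠ i) (τ : Bool) :
    poleExp τ (e l) ≠ e i := by
  have h1 := he.1 i
  have h2 := he.2 l i hl
  intro h
  apply h2
  cases τ
  · simp only [poleExp, Bool.false_eq_true, if_false] at h
    rcases max_cases (e l) 0 with ⟨h3, _⟩ | ⟨h3, _⟩
    · rw [← h, h3, abs_neg]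
    · omega
  · simp only [poleExp, if_true] at h
    rcases max_cases (e l) 0 with ⟨h3, _⟩ | ⟨h3, _⟩
    · rw [← h, h3]
    · omega

lemma exists_crossed {k : ℕ} {e : Fin k → ℤ} {i : Fin k} {e₁ : ℤ} (he : IsGeneric e)
    (he₁ : IsGeneric (Function.update e i e₁))
    (hout : ∀ l, i < l → e l < 0 ∧ e i + e l < 0) {x : Fin k → ℂ} (hx : x ∈ torusSet (rad e)) {z : ℂ}
    (hz₁ : (100 : ℝ) ^ e₁ ≤ ‖z‖ ∧ ‖z‖ ≤ 100 ^ e i)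
    {a b : Fin k} (hab : a < b) {τ : Bool}
    (h : pairDen τ (Function.update x i z b) (Function.update x i z a) = 0) :
    ∃ q ∈ crossed e i e₁, z = pole q.2 (x q.1) ∧ a = min i q.1 ∧ b = max i q.1 ∧ τ = q.2 := by
  have hx' : ∀ l, ‖x l‖ = 100 ^ e l := hx
  have mem : ∀ l : Fin k, l ≠ i → (τ = false → l < i) → z = pole τ (x l) →
      (l, τ) ∈ crossed e i e₁ := by
    intro l hl hτ hzp
    have hp := norm_pole (hx' l) (he.1 l) τ
    rw [← hzp] at hp
    have n1 := poleExp_ne he hl τ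
    have n2 := poleExp_ne he₁ hl τ
    simp only [Function.update_self, Function.update_of_ne hl] at n2
    simp only [crossed, mem_filter, mem_univ, true_and]
    refine ⟨hl, hτ, ?_, ?_⟩
    · by_contra hc
      have := zpow_100_step (lt_of_le_of_ne (not_lt.1 hc) n2)
      have := zpow_100_pos (poleExp τ (e l))
      linarith [hz₁.1]
    · by_contra hc
      have := zpow_100_step (lt_of_le_of_ne (not_lt.1 hc) n1.symm)
      have := zpow_100_pos (e i)
      linarith [hz₁.2]
  by_cases hbi : b = i
  · subst hbi
    rw [Function.update_self, Function.update_of_ne hab.ne] at h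
    have := pairDen_eq_zero_left h
    exact ⟨(a, τ), mem a hab.ne (fun _ => hab) this, this, (min_eq_right hab.le).symm,
      (max_eq_left hab.le).symm, rfl⟩
  · by_cases hai : a = i
    · subst hai
      rw [Function.update_self, Function.update_of_ne hbi] at h
      cases τ
      · exfalso
        obtain ⟨o1, o2⟩ := hout b hab
        have p1 := zpow_100_step o1
        have p2 := zpow_100_step o2
        rw [zpow_zero] at p1 p2
        simp only [pairDen, Bool.false_eq_true, if_false] at h
        have n1 : ‖x b * z‖ ≤ 1 / 100 := by
          rw [norm_mul, hx' b]
          have : (100 : ℝ) ^ e b * ‖z‖ ≤ 100 ^ e b * 100 ^ e a :=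
            mul_le_mul_of_nonneg_left hz₁.2 (zpow_100_pos _).le
          rw [← zpow_add₀ (by norm_num), add_comm] at this
          linarith
        have n2 : ‖x b‖ ≤ 1 / 100 := by rw [hx' b]; linarith
        have : (1 : ℂ) = -(x b + x b * z) := by linear_combination h
        have h3 : ‖(1 : ℂ)‖ ≤ 1 / 100 + 1 / 100 := by
          rw [this, norm_neg]
          exact (norm_add_le _ _).trans (add_le_add n2 n1)
        norm_num at h3
      · have := pairDen_eq_zero_right h
        exact ⟨(b, true), mem b hbi (by simp) this, this, (min_eq_left hab.le).symm,
          (max_eq_right hab.le).symm, rfl⟩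
    · exfalso
      rw [Function.update_of_ne hbi, Function.update_of_ne hai] at h
      exact pairDen_ne_zero (hx' b) (hx' a) (he.1 b) (he.1 a) (he.2 b a hab.ne') τ h

lemma polarFun_update_eq {k : ℕ} (F : (Fin k → ℂ) → ℂ) {i l : Fin k} (hl : l ≠ i) {τ : Bool}
    (hτ : τ = false → l < i) {x : Fin k → ℂ} (h1 : 1 + x l ≠ 0) (z : ℂ) :
    polarFun F (Function.update x i z) =
      reducedFun F (min i l) (max i l) τ (Function.update x i z) / (if τ then 1 else 1 + x l) /
        (z - pole τ (x l)) := by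
  rcases lt_or_gt_of_ne hl with h | h
  · rw [min_eq_right h.le, max_eq_left h.le, polarFun_eq F h τ, Function.update_self,
      Function.update_of_ne hl, div_div]
    congr 1
    cases τ <;> simp only [pairDen, pole, Bool.false_eq_true, if_false, if_true]
    · field_simp
      ring
    · ring
  · rw [min_eq_left h.le, max_eq_right h.le, polarFun_eq F h τ, Function.update_self,
      Function.update_of_ne hl, div_div]
    congr 1
    cases τ
    · exact absurd (hτ rfl) h.le.not_gt
    · simp only [pairDen, pole, if_true]
      ring

lemma crossed_norm_pole {k : ℕ} {e : Fin k → ℤ} {i : Fin k} {e₁ : ℤ} (he : IsGeneric e)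
    {x : Fin k → ℂ} (hx : x ∈ torusSet (rad e)) {q : Fin k × Bool} (hq : q ∈ crossed e i e₁) :
    100 ^ e₁ < ‖pole q.2 (x q.1)‖ ∧ ‖pole q.2 (x q.1)‖ < 100 ^ e i := by
  simp only [crossed, mem_filter, mem_univ, true_and] at hq
  have hp := norm_pole (hx q.1) (he.1 q.1) q.2
  have s1 := zpow_100_step hq.2.2.1
  have s2 := zpow_100_step hq.2.2.2
  have := zpow_100_pos (poleExp q.2 (e q.1))
  constructor <;> linarith

lemma crossed_pole_inj {k : ℕ} {e : Fin k → ℤ} (he : IsGeneric e)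
    {x : Fin k → ℂ} (hx : x ∈ torusSet (rad e)) {q q' : Fin k × Bool}
    (h : pole q.2 (x q.1) = pole q'.2 (x q'.1)) : q = q' := by
  have hqq : x q.1 = x q'.1 ∨ |e q.1| ≠ |e q'.1| := by
    by_cases hc : q.1 = q'.1
    · exact Or.inl (by rw [hc])
    · exact Or.inr (he.2 _ _ hc)
  obtain ⟨w1, w2⟩ := pole_injective (hx q.1) (hx q'.1) (he.1 _) (he.1 _) hqq h
  refine Prod.ext ?_ w2
  by_contra hc
  apply he.2 _ _ hc
  have := hx q.1
  rw [w1, hx q'.1] at this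
  have := zpow_right_injective₀ (by norm_num : (0:ℝ) < 100) (by norm_num) this
  exact congrArg abs this.symm

lemma crossed_pairDen_ne_zero {k : ℕ} {e : Fin k → ℤ} {i : Fin k} {e₁ : ℤ} (he : IsGeneric e)
    (he₁ : IsGeneric (Function.update e i e₁))
    (hout : ∀ l, i < l → e l < 0 ∧ e i + e l < 0) {x : Fin k → ℂ} (hx : x ∈ torusSet (rad e))
    {q : Fin k × Bool} (hq : q ∈ crossed e i e₁) (a b : Fin k) (hab : a < b) (σ : Bool)
    (hne : ¬ (a = min i q.1 ∧ b = max i q.1 ∧ q.2 = σ)) :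
    pairDen σ (Function.update x i (pole q.2 (x q.1)) b)
      (Function.update x i (pole q.2 (x q.1)) a) ≠ 0 := by
  intro h0
  obtain ⟨p1, p2⟩ := crossed_norm_pole he hx hq
  obtain ⟨q', hq', h1, h2, h3, h4⟩ := exists_crossed he he₁ hout hx ⟨p1.le, p2.le⟩ hab h0
  have := crossed_pole_inj he hx h1
  subst this
  exact hne ⟨h2, h3, h4.symm⟩

lemma differentiableAt_numerator {k : ℕ} {e : Fin k → ℤ} (he : IsGeneric e) {i : Fin k}
    {F : (Fin k → ℂ) → ℂ}
    (hF : ∀ x : Fin k → ℂ, (∀ l, x l ≠ 0) → (∀ l, l ≠ i → 1 + x l ≠ 0) → DifferentiableAt ℂ F x)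
    {x : Fin k → ℂ} (hx : x ∈ torusSet (rad e)) {z : ℂ} (hz : z ≠ 0) :
    DifferentiableAt ℂ F (Function.update x i z) := by
  apply hF
  · intro l
    by_cases hl : l = i
    · subst hl; rwa [Function.update_self]
    · rw [Function.update_of_ne hl]
      exact ne_zero_of_mem_torusSet (rad_pos e) hx l
  · intro l hl
    rw [Function.update_of_ne hl]
    exact one_add_ne_zero_of_norm (hx l) (he.1 l)

lemma crossed_differentiableAt_reducedFun {k : ℕ} {e : Fin k → ℤ} {i : Fin k} {e₁ : ℤ}
    (he : IsGeneric e) (he₁ : IsGeneric (Function.update e i e₁))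
    (hout : ∀ l, i < l → e l < 0 ∧ e i + e l < 0) {F : (Fin k → ℂ) → ℂ}
    (hF : ∀ x : Fin k → ℂ, (∀ l, x l ≠ 0) → (∀ l, l ≠ i → 1 + x l ≠ 0) → DifferentiableAt ℂ F x)
    {x : Fin k → ℂ} (hx : x ∈ torusSet (rad e)) {q : Fin k × Bool} (hq : q ∈ crossed e i e₁) :
    DifferentiableAt ℂ (reducedFun F (min i q.1) (max i q.1) q.2)
      (Function.update x i (pole q.2 (x q.1))) := by
  refine differentiableAt_reducedFun (differentiableAt_numerator he hF hx ?_)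
    (crossed_pairDen_ne_zero he he₁ hout hx hq)
  intro h
  have := (crossed_norm_pole he hx hq).1
  rw [h, norm_zero] at this
  linarith [zpow_100_pos e₁]

lemma continuousOn_poleTerm {k : ℕ} {e : Fin k → ℤ} {i : Fin k} {e₁ : ℤ} (he : IsGeneric e)
    (he₁ : IsGeneric (Function.update e i e₁))
    (hout : ∀ l, i < l → e l < 0 ∧ e i + e l < 0) {F : (Fin k → ℂ) → ℂ}
    (hF : ∀ x : Fin k → ℂ, (∀ l, x l ≠ 0) → (∀ l, l ≠ i → 1 + x l ≠ 0) → DifferentiableAt ℂ F x)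
    {q : Fin k × Bool} (hq : q ∈ crossed e i e₁) :
    ContinuousOn (poleTerm F i q.1 q.2) (torusSet (rad e)) := by
  intro x hx
  have hp := crossed_norm_pole he hx hq
  have hp0 : pole q.2 (x q.1) ≠ 0 := by
    intro h; rw [h, norm_zero] at hp; linarith [hp.1, zpow_100_pos e₁]
  refine DifferentiableAt.continuousAt (𝕜 := ℂ) ?_ |>.continuousWithinAt
  have hpd : DifferentiableAt ℂ (fun x : Fin k → ℂ => pole q.2 (x q.1)) x := by
    unfold pole
    split_ifs
    · fun_prop
    · have h1 : DifferentiableAt ℂ (fun x : Fin k → ℂ => 1 + x q.1) x := by fun_prop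
      exact (h1.inv (one_add_ne_zero_of_norm (hx q.1) (he.1 q.1))).neg
  change DifferentiableAt ℂ (fun x => poleTerm F i q.1 q.2 x) x
  unfold poleTerm
  have key : ∀ {f g h : (Fin k → ℂ) → ℂ}, DifferentiableAt ℂ f x → DifferentiableAt ℂ g x →
      DifferentiableAt ℂ h x → g x ≠ 0 → h x ≠ 0 →
      DifferentiableAt ℂ (fun x => f x / g x / h x) x :=
    fun hf hg hh h1 h2 => by
      simp only [div_eq_mul_inv]
      exact (hf.mul (hg.inv h1)).mul (hh.inv h2)
  refine key ?_ ?_ hpd ?_ hp0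
  · refine DifferentiableAt.comp x (crossed_differentiableAt_reducedFun he he₁ hout hF hx hq)
      (f := fun x : Fin k → ℂ => Function.update x i (pole q.2 (x q.1))) ?_
    rw [differentiableAt_pi]
    intro l
    by_cases hl : l = i
    · subst hl; simpa using hpd
    · simp only [Function.update_of_ne hl]; fun_prop
  · split_ifs
    · fun_prop
    · fun_prop
  · split_ifs
    · exact one_ne_zero
    · exact one_add_ne_zero_of_norm (hx q.1) (he.1 q.1)

/-- A coordinate can be moved inwards when the contributions of all crossed poles average to
zero. -/
theorem torusAvg_polarFun_move {k : ℕ} {e : Fin k → ℤ} {i : Fin k} {e₁ : ℤ} (he : IsGeneric e)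
    (he₁ : IsGeneric (Function.update e i e₁)) (hlt : e₁ < e i)
    (hout : ∀ l, i < l → e l < 0 ∧ e i + e l < 0) {F : (Fin k → ℂ) → ℂ}
    (hF : ∀ x : Fin k → ℂ, (∀ l, x l ≠ 0) → (∀ l, l ≠ i → 1 + x l ≠ 0) → DifferentiableAt ℂ F x)
    (hres : ∀ l τ, (l, τ) ∈ crossed e i e₁ → torusAvg (rad e) (poleTerm F i l τ) = 0) :
    torusAvg (rad e) (polarFun F) = torusAvg (rad (Function.update e i e₁)) (polarFun F) := by
  have hr : (0 : ℝ) < 100 ^ e₁ := zpow_100_pos _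
  have hR : (100 : ℝ) * 100 ^ e₁ ≤ 100 ^ e i := zpow_100_step hlt
  have hρ := fun l => (rad_pos e l).le
  have hdiff : ∀ x ∈ torusSet (rad e), ∀ z : ℂ, 100 ^ e₁ ≤ ‖z‖ → ‖z‖ ≤ 100 ^ e i →
      (∀ q ∈ crossed e i e₁, z ≠ pole q.2 (x q.1)) →
      DifferentiableAt ℂ (polarFun F) (Function.update x i z) := by
    intro x hx z hz1 hz2 hz
    refine differentiableAt_polarFun (differentiableAt_numerator he hF hx ?_) ?_
    · intro h; rw [h, norm_zero] at hz1; linarith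
    · intro a b hab τ h0
      obtain ⟨q', hq', h1, -⟩ := exists_crossed he he₁ hout hx ⟨hz1, hz2⟩ hab h0
      exact hz q' hq' h1
  have hone : ∀ x ∈ torusSet (rad e), ∀ l, 1 + x l ≠ 0 := fun x hx l =>
    one_add_ne_zero_of_norm (hx l) (he.1 l)
  have hcont : ∀ e' : Fin k → ℤ, IsGeneric e' → (∀ x ∈ torusSet (rad e'), DifferentiableAt ℂ F x) →
      ContinuousOn (polarFun F) (torusSet (rad e')) := by
    intro e' he' hF' x hx
    refine (differentiableAt_polarFun (hF' x hx) ?_).continuousAt.continuousWithinAt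
    intro a b hab τ
    exact pairDen_ne_zero (hx b) (hx a) (he'.1 b) (he'.1 a) (he'.2 b a hab.ne') τ
  have hFe : ∀ e' : Fin k → ℤ, IsGeneric e' → ∀ x ∈ torusSet (rad e'), DifferentiableAt ℂ F x :=
    fun e' he' x hx => hF x (ne_zero_of_mem_torusSet (rad_pos e') hx) fun l _ =>
      one_add_ne_zero_of_norm (hx l) (he'.1 l)
  rw [rad_update]
  refine torusAvg_move hρ i hr.le (hcont e he (hFe e he)) ?_ (crossed e i e₁)
    (fun q => poleTerm F i q.1 q.2) (fun q hq => continuousOn_poleTerm he he₁ hout hF hq)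
    (fun q hq => hres q.1 q.2 hq) ?_
  · rw [← rad_update]
    exact hcont _ he₁ (hFe _ he₁)
  · intro x hx
    have hmem : ∀ q ∈ crossed e i e₁, q.1 ≠ i ∧ (q.2 = false → q.1 < i) := by
      intro q hq
      simp only [crossed, mem_filter, mem_univ, true_and] at hq
      exact ⟨hq.1, hq.2.1⟩
    have := circleAverage_move (r := (100 : ℝ) ^ e₁) (R := 100 ^ e i) hr (by linarith)
      (crossed e i e₁) (fun q => pole q.2 (x q.1)) (fun q _ q' _ h => crossed_pole_inj he hx h)
      (fun q hq => crossed_norm_pole he hx hq)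
      (fun z => polarFun F (Function.update x i z)) ?_
      (fun q z => reducedFun F (min i q.1) (max i q.1) q.2 (Function.update x i z) /
        (if q.2 then 1 else 1 + x q.1)) ?_ ?_
    · exact this
    · intro z h1 h2 h3
      exact differentiableAt_update (hdiff x hx z h1 h2 h3)
    · intro q hq
      exact (differentiableAt_update
        (crossed_differentiableAt_reducedFun he he₁ hout hF hx hq)).div_const _
    · intro q hq
      obtain ⟨m1, m2⟩ := hmem q hq
      exact Eventually.of_forall fun z => polarFun_update_eq F m1 m2 (hone x hx q.1) z

end

section

open Finset

/-- The coordinate invariant under the order six group generated by `x ↦ 1 / x` and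
`x ↦ -1 - x`. -/
noncomputable def sCoord (z : ℂ) : ℂ := lamCoord z ^ 2 - 3 * lamCoord z - 1 / lamCoord z

lemma sCoord_sub {u t : ℂ} (hu : u ≠ 0) (ht : t ≠ 0) (hu1 : 1 + u ≠ 0) (ht1 : 1 + t ≠ 0) :
    sCoord u - sCoord t = (u - t) * (u * t - 1) * (1 + u + u * t) * (1 + u + t) * (t + u + t * u) *
      (1 + t + t * u) / (u ^ 2 * t ^ 2 * (1 + t) ^ 2 * (1 + u) ^ 2) := by
  unfold sCoord lamCoord
  field_simp
  ring

/-- The factor `λ ^ N v ^ b (1 / x - x)` of the integrand. -/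
noncomputable def weight (N : ℕ) (b : ℕ) (z : ℂ) : ℂ :=
  z ^ ((b : ℤ) - N - 1) * (1 - z ^ 2) * (1 + z) ^ (2 * (N : ℤ) - b)

lemma weight_eq (N b : ℕ) {z : ℂ} (hz : z ≠ 0) (hz1 : 1 + z ≠ 0) :
    weight N b z = (1 / z - z) * lamCoord z ^ N * vCoord z ^ b := by
  unfold weight lamCoord vCoord
  rw [div_pow, div_pow, zpow_sub₀ hz, zpow_sub₀ hz, zpow_sub₀ hz1, zpow_one, zpow_natCast,
    zpow_natCast, zpow_natCast, zpow_mul, zpow_ofNat, zpow_natCast]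
  field_simp

/-- The numerator of the integrand, with the poles at `x = -1` cleared. -/
noncomputable def hNum {k : ℕ} (N : ℕ) (b : Fin k → ℕ) (x : Fin k → ℂ) : ℂ :=
  Matrix.det (Matrix.of fun i m : Fin k => (1 + x i) ^ (2 * ((k - 1) / 2) - 2 * ((m : ℕ) / 2)) *
      lamCoord (x i) ^ ((m : ℕ) % 2) *
      ((1 + x i) ^ 6 / x i ^ 2 - 3 * (1 + x i) ^ 4 / x i - x i) ^ ((m : ℕ) / 2)) *
    ∏ i, (x i ^ ((b i : ℤ) - N - 1) * (1 - x i ^ 2) *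
      (1 + x i) ^ (2 * (N : ℤ) - b i + (2 * (k - 1) - 2 * ((k - 1) / 2) : ℕ)))

lemma pairProd_mul_self {k : ℕ} (g : Fin k → ℂ) :
    pairProd univ (fun a b => g a * g b) = ∏ i, g i ^ (k - 1) := by
  rw [pairProd_mul]
  unfold pairProd
  rw [prod_comm (f := fun a b => if a < b then g b else 1), ← prod_mul_distrib]
  refine prod_congr rfl fun i _ => ?_
  simp only [prod_ite, prod_const, one_pow, mul_one]
  rw [← pow_add]
  congr 1
  have h1 : (univ.filter fun b : Fin k => i < b) = Ioi i := by ext; simp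
  have h2 : (univ.filter fun b : Fin k => b < i) = Iio i := by ext; simp
  rw [h1, h2, Fin.card_Ioi, Fin.card_Iio]
  omega

lemma hNum_eq {k : ℕ} (N : ℕ) (b : Fin k → ℕ) {x : Fin k → ℂ} (hx : ∀ i, x i ≠ 0)
    (hx1 : ∀ i, 1 + x i ≠ 0) :
    hNum N b x = doubleVdm (fun i => lamCoord (x i)) (fun i => sCoord (x i)) *
      (∏ i, weight N (b i) (x i)) * pairProd univ fun a b => (1 + x a) ^ 2 * (1 + x b) ^ 2 := by
  have h1 : (Matrix.of fun i m : Fin k =>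
      (1 + x i) ^ (2 * ((k - 1) / 2) - 2 * ((m : ℕ) / 2)) * lamCoord (x i) ^ ((m : ℕ) % 2) *
      ((1 + x i) ^ 6 / x i ^ 2 - 3 * (1 + x i) ^ 4 / x i - x i) ^ ((m : ℕ) / 2)) =
      Matrix.of fun i m : Fin k => (1 + x i) ^ (2 * ((k - 1) / 2)) *
        (Matrix.of fun i m : Fin k => lamCoord (x i) ^ ((m : ℕ) % 2) *
          sCoord (x i) ^ ((m : ℕ) / 2)) i m := by
    ext i m
    simp only [Matrix.of_apply]
    have h2 : (1 + x i) ^ 6 / x i ^ 2 - 3 * (1 + x i) ^ 4 / x i - x i =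
        (1 + x i) ^ 2 * sCoord (x i) := by
      have := hx i
      have := hx1 i
      unfold sCoord lamCoord
      field_simp
    have h3 : (m : ℕ) / 2 ≤ (k - 1) / 2 := Nat.div_le_div_right (by omega)
    rw [h2, mul_pow, ← pow_mul]
    have h4 : (1 + x i) ^ (2 * ((k - 1) / 2)) = (1 + x i) ^ (2 * ((k - 1) / 2) - 2 * ((m : ℕ) / 2)) *
        (1 + x i) ^ (2 * ((m : ℕ) / 2)) := by
      rw [← pow_add]; congr 1; omega
    rw [h4]
    ring
  unfold hNum
  rw [h1, Matrix.det_mul_column, pairProd_mul_self fun i => (1 + x i) ^ 2]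
  change (_ * doubleVdm _ _) * _ = _
  rw [mul_comm (∏ i, (1 + x i) ^ (2 * ((k - 1) / 2))) _, mul_assoc, mul_assoc, ← prod_mul_distrib,
    ← prod_mul_distrib]
  congr 1
  refine prod_congr rfl fun i _ => ?_
  unfold weight
  rw [← pow_mul, zpow_add₀ (hx1 i), zpow_natCast]
  have h5 : (1 + x i) ^ (2 * (k - 1)) = (1 + x i) ^ (2 * ((k - 1) / 2)) *
      (1 + x i) ^ (2 * (k - 1) - 2 * ((k - 1) / 2)) := by
    rw [← pow_add]; congr 1; omega
  rw [h5]
  ring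

/-- The polynomial left over from the coordinate `u` at a pole. -/
noncomputable def leftover {k : ℕ} (a c : Fin k) (τ : Bool) (l : Fin k) (u t : ℂ) : ℂ :=
  if τ then
    -((if l < a then 1 + u + u * t else 1 + t + t * u) *
      (if c < l then t + u + t * u else u * t - 1))
  else if c < l then (u - t) * (u * t - 1)
    else -((u * t - 1) * (if l < a then 1 + u + u * t else 1 + t + t * u))

lemma leftover_differentiable {k : ℕ} (a c : Fin k) (τ : Bool) (l : Fin k) (u : ℂ) :
    Differentiable ℂ (leftover a c τ l u) := by
  unfold leftover
  split_ifs <;> fun_prop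

/-- The pair factor of the kernel with the denominator of type `τ` of the pair `a < c` removed. -/
noncomputable def pairKer {k : ℕ} (a c : Fin k) (τ : Bool) (x : Fin k → ℂ) (p q : Fin k) : ℂ :=
  (1 + x p) ^ 2 * (1 + x q) ^ 2 *
    ((if p = a ∧ q = c ∧ τ = true then 1 else (pairDen true (x q) (x p))⁻¹) *
      (if p = a ∧ q = c ∧ τ = false then 1 else (pairDen false (x q) (x p))⁻¹))

lemma reduced_leftover_true {t u w A B C D z : ℂ} (hw : w = -1 - t) (ht : t ≠ 0)
    (ht1 : 1 + t ≠ 0) (hu : u ≠ 0) (hu1 : 1 + u ≠ 0) (hA : A ≠ 0) (hB : B ≠ 0) (hC : C ≠ 0)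
    (hD : D ≠ 0) (h : (u - t) * (u * t - 1) * (1 + u + u * t) * (1 + u + t) * (t + u + t * u) *
      (1 + t + t * u) = z * (A * B * (C * D))) :
    (u - t) * (u * t - 1) * (1 + u + u * t) * (1 + u + t) * (t + u + t * u) *
      (1 + t + t * u) / (u ^ 2 * t ^ 2 * (1 + t) ^ 2 * (1 + u) ^ 2) *
      ((1 + u) ^ 2 * (1 + t) ^ 2 * (A⁻¹ * B⁻¹) * ((1 + u) ^ 2 * (1 + w) ^ 2 * (C⁻¹ * D⁻¹))) =
      (1 + u) ^ 2 / u ^ 2 * z := by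
  rw [h, hw]
  field_simp
  ring

lemma reduced_leftover_false {t u w A B C D z : ℂ} (hw : w = -(1 + t)⁻¹) (ht : t ≠ 0)
    (ht1 : 1 + t ≠ 0) (hu : u ≠ 0) (hu1 : 1 + u ≠ 0) (hA : A ≠ 0) (hB : B ≠ 0) (hC : C ≠ 0)
    (hD : D ≠ 0) (h : (u - t) * (u * t - 1) * (1 + u + u * t) * (1 + u + t) * (t + u + t * u) *
      (1 + t + t * u) = z * (1 + t) ^ 2 * (A * B * (C * D))) :
    (u - t) * (u * t - 1) * (1 + u + u * t) * (1 + u + t) * (t + u + t * u) *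
      (1 + t + t * u) / (u ^ 2 * t ^ 2 * (1 + t) ^ 2 * (1 + u) ^ 2) *
      ((1 + u) ^ 2 * (1 + t) ^ 2 * (A⁻¹ * B⁻¹) * ((1 + u) ^ 2 * (1 + w) ^ 2 * (C⁻¹ * D⁻¹))) =
      (1 + u) ^ 2 / u ^ 2 * z := by
  rw [h, hw]
  field_simp
  ring

lemma pairFactor_leftover {k : ℕ} {a c l : Fin k} (hac : a < c) (hla : l ≠ a) (hlc : l ≠ c)
    {τ : Bool} {x : Fin k → ℂ} (hx : ∀ i, x i ≠ 0) (hx1 : ∀ i, 1 + x i ≠ 0)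
    (hden : ∀ p q, p < q → ∀ σ, ¬ (p = a ∧ q = c ∧ τ = σ) → pairDen σ (x q) (x p) ≠ 0)
    (hp : x c = pole τ (x a)) :
    (sCoord (x l) - sCoord (x a)) *
      (pairFactor (pairKer a c τ x) l a * pairFactor (pairKer a c τ x) l c) =
    (1 + x l) ^ 2 / x l ^ 2 * leftover a c τ l (x l) (x a) := by
  have ha := hx a
  have hl := hx l
  have ha1 := hx1 a
  have hl1 := hx1 l
  have hc := hx c
  have D1 : ∀ σ, pairDen σ (x (max l a)) (x (min l a)) ≠ 0 := fun σ =>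
    hden _ _ (by rcases lt_or_gt_of_ne hla with h | h <;> simp [h.le, h]) σ (by
      rintro ⟨h1, h2, -⟩
      rcases lt_or_gt_of_ne hla with h | h
      · rw [max_eq_right h.le] at h2; exact hac.ne h2
      · rw [max_eq_left h.le] at h2; exact hlc h2)
  have D2 : ∀ σ, pairDen σ (x (max l c)) (x (min l c)) ≠ 0 := fun σ =>
    hden _ _ (by rcases lt_or_gt_of_ne hlc with h | h <;> simp [h.le, h]) σ (by
      rintro ⟨h1, h2, -⟩
      rcases lt_or_gt_of_ne hlc with h | h
      · rw [min_eq_left h.le] at h1; exact hla h1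
      · rw [min_eq_right h.le] at h1; exact hac.ne' h1)
  have D1t := D1 true
  have D1f := D1 false
  have D2t := D2 true
  have D2f := D2 false
  rw [sCoord_sub hl ha hl1 ha1]
  generalize ht : x a = t at *
  generalize hu : x l = u at *
  have hF : ∀ m, m ≠ l → pairFactor (pairKer a c τ x) l m =
      if l < m then pairKer a c τ x l m else pairKer a c τ x m l := fun m _ => rfl
  rw [hF a hla.symm, hF c hlc.symm]
  unfold pairKer
  simp only [hla, hlc, hac.ne, hac.ne', false_and, and_false, if_false, ht, hu]
  rcases lt_or_gt_of_ne hla with h1 | h1 <;> rcases lt_or_gt_of_ne hlc with h2 | h2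
  · rw [max_eq_right h1.le, min_eq_left h1.le, ht, hu] at D1t D1f
    rw [max_eq_right h2.le, min_eq_left h2.le, hu] at D2t D2f
    rw [if_pos h1, if_pos h2]
    unfold leftover
    simp only [if_pos h1, if_neg h2.not_gt]
    cases τ
    · simp only [pole, Bool.false_eq_true, if_false] at hp ⊢
      have := reduced_leftover_false hp ha ha1 hl hl1 D1t D1f D2t D2f
        (z := -((u * t - 1) * (1 + u + u * t))) (by
        simp only [pairDen, if_true, Bool.false_eq_true, if_false, hp]; field_simp; ring)
      linear_combination this
    · simp only [pole, if_true] at hp ⊢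
      have := reduced_leftover_true hp ha ha1 hl hl1 D1t D1f D2t D2f
        (z := -((1 + u + u * t) * (u * t - 1))) (by
        simp only [pairDen, if_true, Bool.false_eq_true, if_false, hp]; ring)
      linear_combination this
  · exact absurd (h1.trans hac) h2.not_gt
  · rw [max_eq_left h1.le, min_eq_right h1.le, ht, hu] at D1t D1f
    rw [max_eq_right h2.le, min_eq_left h2.le, hu] at D2t D2f
    rw [if_neg h1.not_gt, if_pos h2]
    unfold leftover
    simp only [if_neg h1.not_gt, if_neg h2.not_gt]
    cases τ
    · simp only [pole, Bool.false_eq_true, if_false] at hp ⊢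
      have := reduced_leftover_false hp ha ha1 hl hl1 D1t D1f D2t D2f
        (z := -((u * t - 1) * (1 + t + t * u))) (by
        simp only [pairDen, if_true, Bool.false_eq_true, if_false, hp]; field_simp; ring)
      linear_combination this
    · simp only [pole, if_true] at hp ⊢
      have := reduced_leftover_true hp ha ha1 hl hl1 D1t D1f D2t D2f
        (z := -((1 + t + t * u) * (u * t - 1))) (by
        simp only [pairDen, if_true, Bool.false_eq_true, if_false, hp]; ring)
      linear_combination this
  · rw [max_eq_left h1.le, min_eq_right h1.le, ht, hu] at D1t D1f
    rw [max_eq_left h2.le, min_eq_right h2.le, hu] at D2t D2f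
    rw [if_neg h1.not_gt, if_neg h2.not_gt]
    unfold leftover
    simp only [if_neg h1.not_gt, if_pos h2]
    cases τ
    · simp only [pole, Bool.false_eq_true, if_false] at hp ⊢
      have := reduced_leftover_false hp ha ha1 hl hl1 D1t D1f D2t D2f
        (z := (u - t) * (u * t - 1)) (by
        simp only [pairDen, if_true, Bool.false_eq_true, if_false, hp]; field_simp; ring)
      linear_combination this
    · simp only [pole, if_true] at hp ⊢
      have := reduced_leftover_true hp ha ha1 hl hl1 D1t D1f D2t D2f
        (z := -((1 + t + t * u) * (t + u + t * u))) (by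
        simp only [pairDen, if_true, Bool.false_eq_true, if_false, hp]; ring)
      linear_combination this

/-- The value at a pole of the factors of the integrand attached to the colliding pair. -/
noncomputable def mainTerm (N ba bc : ℕ) (τ : Bool) (t : ℂ) : ℂ :=
  (1 - t) * ((1 + t) ^ 3 + t ^ 3) * t ^ ((N : ℤ) + ba - bc) *
    (1 + t) ^ (if τ then (N : ℤ) - ba + bc + 1 else (N : ℤ) - ba)

lemma mainTerm_true {N ba bc : ℕ} {t w : ℂ} (ht : t ≠ 0) (ht1 : 1 + t ≠ 0)
    (hD : pairDen false w t ≠ 0) (hw : w = pole true t) :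
    (lamCoord w - lamCoord t) * (weight N ba t * weight N bc w) *
      ((1 + t) ^ 2 * (1 + w) ^ 2 * (pairDen false w t)⁻¹) =
    -((-1) ^ ((bc : ℤ) - N - 1) * (-1) ^ (2 * (N : ℤ) - bc)) * mainTerm N ba bc true t := by
  have hD' : pairDen false w t = -(t * (2 + t)) := by
    simp only [pairDen, hw, pole, if_true, Bool.false_eq_true, if_false]; ring
  rw [hD'] at hD ⊢
  have h2 : 2 + t ≠ 0 := fun h => hD (by rw [h]; ring)
  have hw' : w = (-1) * (1 + t) := by rw [hw]; simp only [pole, if_true]; ring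
  have hw1 : 1 + w = (-1) * t := by rw [hw']; ring
  unfold mainTerm weight lamCoord
  rw [hw1, hw', mul_zpow, mul_zpow, if_pos rfl,
    show (N : ℤ) + ba - bc = ((ba : ℤ) - N - 1) + (2 * (N : ℤ) - bc) + 1 by ring,
    show (N : ℤ) - ba + bc + 1 = (2 * (N : ℤ) - ba) + ((bc : ℤ) - N - 1) + 2 by ring,
    zpow_add₀ ht, zpow_add₀ ht, zpow_add₀ ht1, zpow_add₀ ht1, zpow_one, zpow_ofNat]
  generalize t ^ ((ba : ℤ) - N - 1) = T1
  generalize t ^ (2 * (N : ℤ) - bc) = T2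
  generalize (1 + t) ^ (2 * (N : ℤ) - ba) = Y1
  generalize (1 + t) ^ ((bc : ℤ) - N - 1) = Y2
  generalize (-1 : ℂ) ^ ((bc : ℤ) - N - 1) = E1
  generalize (-1 : ℂ) ^ (2 * (N : ℤ) - bc) = E2
  field_simp
  ring

lemma mainTerm_false {N ba bc : ℕ} {t w : ℂ} (ht : t ≠ 0) (ht1 : 1 + t ≠ 0)
    (hD : pairDen true w t ≠ 0) (hw : w = pole false t) :
    (lamCoord w - lamCoord t) * (weight N ba t * weight N bc w) *
      ((1 + t) ^ 2 * (1 + w) ^ 2 * (pairDen true w t)⁻¹) =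
    -((-1) ^ ((bc : ℤ) - N - 1)) * mainTerm N ba bc false t := by
  have hD' : pairDen true w t = t * (2 + t) / (1 + t) := by
    simp only [pairDen, hw, pole, if_true, Bool.false_eq_true, if_false]; field_simp; ring
  rw [hD'] at hD ⊢
  have h2 : 2 + t ≠ 0 := fun h => hD (by rw [h]; ring)
  have hw' : w = (-1) * (1 + t)⁻¹ := by
    rw [hw]; simp only [pole, Bool.false_eq_true, if_false]; ring
  have hw1 : 1 + w = t * (1 + t)⁻¹ := by rw [hw']; field_simp; ring
  unfold mainTerm weight lamCoord
  rw [hw1, hw', mul_zpow, mul_zpow, if_neg (by simp),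
    show (N : ℤ) + ba - bc = ((ba : ℤ) - N - 1) + (2 * (N : ℤ) - bc) + 1 by ring,
    show (N : ℤ) - ba = (2 * (N : ℤ) - ba) + -((bc : ℤ) - N - 1) + -(2 * (N : ℤ) - bc) + -1 by ring,
    zpow_add₀ ht, zpow_add₀ ht, zpow_add₀ ht1, zpow_add₀ ht1, zpow_add₀ ht1, zpow_one, zpow_neg_one,
    inv_zpow', inv_zpow']
  generalize t ^ ((ba : ℤ) - N - 1) = T1
  generalize t ^ (2 * (N : ℤ) - bc) = T2
  generalize (1 + t) ^ (2 * (N : ℤ) - ba) = Y1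
  generalize (1 + t) ^ (-((bc : ℤ) - N - 1)) = Y2
  generalize (1 + t) ^ (-(2 * (N : ℤ) - bc)) = Y3
  generalize (-1 : ℂ) ^ ((bc : ℤ) - N - 1) = E1
  field_simp
  ring

/-- At a pole the reduced integrand is, as a function of the later coordinate of the colliding
pair, an explicit product. -/
lemma exists_reducedFun_hNum {k : ℕ} (N : ℕ) (b : Fin k → ℕ) {a c : Fin k} (hac : a < c)
    (τ : Bool) :
    ∃ κ : (Fin k → ℂ) → ℂ, (∀ x x' : Fin k → ℂ, (∀ l, l ≠ a → l ≠ c → x l = x' l) → κ x = κ x') ∧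
      ∀ x : Fin k → ℂ, (∀ i, x i ≠ 0) → (∀ i, 1 + x i ≠ 0) →
        (∀ p q, p < q → ∀ σ, ¬ (p = a ∧ q = c ∧ τ = σ) → pairDen σ (x q) (x p) ≠ 0) →
        x c = pole τ (x a) →
        reducedFun (hNum N b) a c τ x = κ x * (mainTerm N (b a) (b c) τ (x a) *
          ∏ l ∈ (univ.erase a).erase c, leftover a c τ l (x l) (x a)) := by
  obtain ⟨C, hC, hC'⟩ := exists_doubleVdm_factor hac.ne
  refine ⟨fun x => C (fun i => lamCoord (x i)) (fun i => sCoord (x i)) *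
    (if τ then -((-1) ^ ((b c : ℤ) - N - 1) * (-1) ^ (2 * (N : ℤ) - b c))
      else -((-1) ^ ((b c : ℤ) - N - 1))) *
    (∏ l ∈ (univ.erase a).erase c, weight N (b l) (x l) * ((1 + x l) ^ 2 / x l ^ 2)) *
    pairProd ((univ.erase a).erase c) fun p q => (1 + x p) ^ 2 * (1 + x q) ^ 2 *
      ((pairDen true (x q) (x p))⁻¹ * (pairDen false (x q) (x p))⁻¹), ?_, ?_⟩
  · intro x x' h
    have hE : ∀ l ∈ (univ.erase a).erase c, x l = x' l := fun l hl =>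
      h l (mem_erase.1 (mem_erase.1 hl).2).1 (mem_erase.1 hl).1
    dsimp only
    congr 1
    · congr 1
      · congr 1
        exact hC' _ _ _ _ fun l h1 h2 => by rw [h l h1 h2]; exact ⟨rfl, rfl⟩
      · exact prod_congr rfl fun l hl => by rw [hE l hl]
    · exact pairProd_congr fun p hp q hq _ => by rw [hE p hp, hE q hq]
  · intro x hx hx1 hden hp
    have hs : sCoord (x a) = sCoord (x c) := by
      have := sCoord_sub (hx c) (hx a) (hx1 c) (hx1 a)
      have h0 : (1 + x c + x c * x a) * (1 + x c + x a) = 0 := by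
        rw [hp]
        cases τ
        · have := hx1 a
          simp only [pole, Bool.false_eq_true, if_false]
          field_simp
          ring
        · simp only [pole, if_true]; ring
      rw [show (x c - x a) * (x c * x a - 1) * (1 + x c + x c * x a) * (1 + x c + x a) *
        (x a + x c + x a * x c) * (1 + x a + x a * x c) = ((1 + x c + x c * x a) * (1 + x c + x a)) *
        ((x c - x a) * (x c * x a - 1) * (x a + x c + x a * x c) * (1 + x a + x a * x c)) by ring,
        h0, zero_mul, zero_div] at this
      linear_combination -this
    have hmem : c ∈ univ.erase a := mem_erase.2 ⟨hac.ne', mem_univ _⟩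
    unfold reducedFun
    rw [hNum_eq N b hx hx1, hC _ _ hs, mul_assoc _ (pairProd _ _) (pairProd _ _), ← pairProd_mul,
      ← mul_prod_erase univ _ (mem_univ a), ← mul_prod_erase (univ.erase a) _ hmem]
    change _ * pairProd univ (pairKer a c τ x) = _
    rw [pairProd_split hac]
    have hrest : pairProd ((univ.erase a).erase c) (pairKer a c τ x) =
        pairProd ((univ.erase a).erase c) fun p q => (1 + x p) ^ 2 * (1 + x q) ^ 2 *
      ((pairDen true (x q) (x p))⁻¹ * (pairDen false (x q) (x p))⁻¹) := by
      refine pairProd_congr fun p hp q hq _ => ?_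
      have : p ≠ a := (mem_erase.1 (mem_erase.1 hp).2).1
      simp [pairKer, this]
    have hmid : (∏ l ∈ (univ.erase a).erase c, (sCoord (x l) - sCoord (x a))) *
        (∏ l ∈ (univ.erase a).erase c,
          pairFactor (pairKer a c τ x) l a * pairFactor (pairKer a c τ x) l c) =
        (∏ l ∈ (univ.erase a).erase c, (1 + x l) ^ 2 / x l ^ 2) *
        ∏ l ∈ (univ.erase a).erase c, leftover a c τ l (x l) (x a) := by
      rw [← prod_mul_distrib, ← prod_mul_distrib]
      exact prod_congr rfl fun l hl => pairFactor_leftover hac (mem_erase.1 (mem_erase.1 hl).2).1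
        (mem_erase.1 hl).1 hx hx1 hden hp
    have hmain : (lamCoord (x c) - lamCoord (x a)) *
        (weight N (b a) (x a) * weight N (b c) (x c)) * pairKer a c τ x a c =
        (if τ then -((-1) ^ ((b c : ℤ) - N - 1) * (-1) ^ (2 * (N : ℤ) - b c))
          else -((-1) ^ ((b c : ℤ) - N - 1))) * mainTerm N (b a) (b c) τ (x a) := by
      cases τ
      · have := mainTerm_false (N := N) (ba := b a) (bc := b c) (hx a) (hx1 a)
          (hden a c hac true (by simp)) hp
        simpa [pairKer] using this
      · have := mainTerm_true (N := N) (ba := b a) (bc := b c) (hx a) (hx1 a)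
          (hden a c hac false (by simp)) hp
        simpa [pairKer] using this
    beta_reduce
    rw [hrest, prod_mul_distrib (f := fun l => weight N (b l) (x l))]
    linear_combination
      (C (fun i => lamCoord (x i)) (fun i => sCoord (x i)) *
        (∏ l ∈ (univ.erase a).erase c, weight N (b l) (x l)) *
        pairProd ((univ.erase a).erase c) (fun p q => (1 + x p) ^ 2 * (1 + x q) ^ 2 *
          ((pairDen true (x q) (x p))⁻¹ * (pairDen false (x q) (x p))⁻¹))) *
      ((∏ l ∈ (univ.erase a).erase c, (sCoord (x l) - sCoord (x a))) *
        (∏ l ∈ (univ.erase a).erase c,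
          pairFactor (pairKer a c τ x) l a * pairFactor (pairKer a c τ x) l c) * hmain +
       (if τ then -((-1) ^ ((b c : ℤ) - N - 1) * (-1) ^ (2 * (N : ℤ) - b c))
          else -((-1) ^ ((b c : ℤ) - N - 1))) * mainTerm N (b a) (b c) τ (x a) * hmid)

lemma differentiableAt_zpow_coord {k : ℕ} {g : ℂ → ℂ} (hg : Differentiable ℂ g) {x : Fin k → ℂ}
    {i : Fin k} {m : ℤ} (h : g (x i) ≠ 0 ∨ 0 ≤ m) :
    DifferentiableAt ℂ (fun x : Fin k → ℂ => g (x i) ^ m) x :=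
  DifferentiableAt.comp x (f := fun x : Fin k → ℂ => x i) (g := fun z => g z ^ m)
    ((hg _).zpow h) (by fun_prop)

lemma differentiableAt_det {k n : ℕ} {M : (Fin k → ℂ) → Matrix (Fin n) (Fin n) ℂ} {x : Fin k → ℂ}
    (h : ∀ i j, DifferentiableAt ℂ (fun x => M x i j) x) :
    DifferentiableAt ℂ (fun x => (M x).det) x := by
  simp only [Matrix.det_apply']
  refine DifferentiableAt.fun_sum fun σ _ => ?_
  exact (differentiableAt_const _).mul (differentiableAt_prod _ fun j _ => h _ _)

lemma differentiableAt_hNum_of_or {k : ℕ} (N : ℕ) (b : Fin k → ℕ)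
    {x : Fin k → ℂ} (hx : ∀ l, x l ≠ 0) (hx1 : ∀ l, 1 + x l ≠ 0 ∨ b l ≤ 2 * N) :
    DifferentiableAt ℂ (hNum N b) x := by
  have hdiv : ∀ l, DifferentiableAt ℂ (fun x : Fin k → ℂ => (x l)⁻¹) x := fun l =>
    DifferentiableAt.inv (by fun_prop) (hx l)
  have hlam : ∀ l, DifferentiableAt ℂ (fun x : Fin k → ℂ => lamCoord (x l)) x := fun l => by
    unfold lamCoord
    simp only [div_eq_mul_inv]
    exact DifferentiableAt.mul (by fun_prop) (hdiv l)
  refine DifferentiableAt.mul (differentiableAt_det fun l m => ?_)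
    (differentiableAt_prod _ fun l _ => ?_)
  · simp only [Matrix.of_apply, div_eq_mul_inv, ← inv_pow]
    refine DifferentiableAt.mul (DifferentiableAt.mul (by fun_prop) ((hlam l).pow _))
      (DifferentiableAt.pow (DifferentiableAt.sub (DifferentiableAt.sub ?_ ?_) (by fun_prop)) _)
    · exact DifferentiableAt.mul (by fun_prop) ((hdiv l).pow 2)
    · exact DifferentiableAt.mul (by fun_prop) (hdiv l)
  · refine DifferentiableAt.mul (DifferentiableAt.mul ?_ (by fun_prop)) ?_
    · exact differentiableAt_zpow_coord differentiable_id (Or.inl (hx l))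
    · refine differentiableAt_zpow_coord (g := fun z => 1 + z) (by fun_prop) ?_
      exact (hx1 l).imp_right fun h => by omega

lemma differentiableAt_hNum {k : ℕ} (N : ℕ) (b : Fin k → ℕ) {i : Fin k} (hi : b i ≤ 2 * N)
    {x : Fin k → ℂ} (hx : ∀ l, x l ≠ 0) (hx1 : ∀ l, l ≠ i → 1 + x l ≠ 0) :
    DifferentiableAt ℂ (hNum N b) x := by
  refine differentiableAt_hNum_of_or N b hx fun l => ?_
  by_cases hl : l = i
  · subst hl; exact Or.inr hi
  · exact Or.inl (hx1 l hl)

lemma crossed_mem_facts {k : ℕ} {e : Fin k → ℤ} {i l : Fin k} {e₁ : ℤ} {τ : Bool}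
    (he : IsGeneric e) (hq : (l, τ) ∈ crossed e i e₁) {x : Fin k → ℂ} (hx : x ∈ torusSet (rad e)) :
    x l ≠ 0 ∧ 1 + x l ≠ 0 ∧ pole τ (x l) ≠ 0 ∧ 1 + pole τ (x l) ≠ 0 := by
  have hnp := crossed_norm_pole he hx hq
  have hz1 : 1 + x l ≠ 0 := one_add_ne_zero_of_norm (hx l) (he.1 l)
  have hz0 : x l ≠ 0 := ne_zero_of_mem_torusSet (rad_pos e) hx l
  refine ⟨hz0, hz1, ?_, ?_⟩
  · intro h; rw [h, norm_zero] at hnp; linarith [hnp.1, zpow_100_pos e₁]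
  · cases τ
    · simp only [pole, Bool.false_eq_true, if_false]
      intro h
      apply hz0
      field_simp at h
      linear_combination h
    · simp only [pole, if_true]
      intro h
      apply hz0
      linear_combination -h

lemma exists_poleTerm_hNum {k : ℕ} {e : Fin k → ℤ} {i l : Fin k} {e₁ : ℤ} {τ : Bool}
    (he : IsGeneric e) (he₁ : IsGeneric (Function.update e i e₁))
    (hout : ∀ l, i < l → e l < 0 ∧ e i + e l < 0) (N : ℕ) (b : Fin k → ℕ)
    (hq : (l, τ) ∈ crossed e i e₁) {a c : Fin k} (hac : a < c)
    (hmin : min i l = a) (hmax : max i l = c) (hset : ∀ m, m ≠ a → m ≠ c → m ≠ l ∧ m ≠ i) :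
    ∃ κ : (Fin k → ℂ) → ℂ, (∀ x x' : Fin k → ℂ, (∀ m, m ≠ l → m ≠ i → x m = x' m) → κ x = κ x') ∧
      ∀ x ∈ torusSet (rad e), ∀ X, X = Function.update x i (pole τ (x l)) →
        X c = pole τ (X a) → poleTerm (hNum N b) i l τ x =
          κ x * (mainTerm N (b a) (b c) τ (X a) *
            ∏ m ∈ (univ.erase a).erase c, leftover a c τ m (x m) (X a)) /
            (if τ then 1 else 1 + x l) / pole τ (x l) := by
  obtain ⟨κ, hκ, hred⟩ := exists_reducedFun_hNum N b hac τ
  refine ⟨κ, fun x x' h => hκ _ _ fun m h1 h2 => h m (hset m h1 h2).1 (hset m h1 h2).2,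
    fun x hx X hX hXc => ?_⟩
  obtain ⟨hz0, hz1, hp0, hp1⟩ := crossed_mem_facts he hq hx
  have hXm : ∀ m, m ≠ i → X m = x m := fun m hm => by rw [hX, Function.update_of_ne hm]
  have hXi : X i = pole τ (x l) := by rw [hX, Function.update_self]
  have h0 : ∀ j, X j ≠ 0 := fun j => by
    by_cases hj : j = i
    · rw [hj, hXi]; exact hp0
    · rw [hXm j hj]; exact ne_zero_of_mem_torusSet (rad_pos e) hx j
  have h1 : ∀ j, 1 + X j ≠ 0 := fun j => by
    by_cases hj : j = i
    · rw [hj, hXi]; exact hp1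
    · rw [hXm j hj]; exact one_add_ne_zero_of_norm (hx j) (he.1 j)
  have hden := crossed_pairDen_ne_zero he he₁ hout hx hq
  rw [← hX, hmin, hmax] at hden
  have := hred X h0 h1 hden hXc
  rw [poleTerm, ← hX, hmin, hmax, this, hκ X x fun m h1 h2 => hXm m (hset m h1 h2).2]
  congr 4
  exact prod_congr rfl fun m hm => by
    rw [hXm m (hset m (mem_erase.1 (mem_erase.1 hm).2).1 (mem_erase.1 hm).1).2]

lemma torusAvg_poleTerm_hNum_of_lt {k : ℕ} {e : Fin k → ℤ} {i : Fin k} {e₁ : ℤ} (he : IsGeneric e)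
    (he₁ : IsGeneric (Function.update e i e₁))
    (hout : ∀ l, i < l → e l < 0 ∧ e i + e l < 0) {N : ℕ} {b : Fin k → ℕ} (hb : StrictAnti b)
    (hi : b i ≤ N) {l : Fin k} {τ : Bool} (h : l < i) (hl : e l < 0 ∨ b l ≤ N)
    (hq : (l, τ) ∈ crossed e i e₁) : torusAvg (rad e) (poleTerm (hNum N b) i l τ) = 0 := by
  refine torusAvg_eq_zero_of_coord (fun j => (rad_pos e j).le)
    (continuousOn_poleTerm (q := (l, _)) he he₁ hout
      (fun x h1 h2 => differentiableAt_hNum N b (by omega) h1 h2) hq) l fun x hx => ?_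
  obtain ⟨κ, hκ, hT⟩ := exists_poleTerm_hNum he he₁ hout N b hq h (min_eq_right h.le)
    (max_eq_left h.le) fun m h1 h2 => ⟨h1, h2⟩
  have hd := hb h
  refine circleAverage_eq_zero_of_eq_mul (rad_pos e l) (G := fun z => -(κ x *
    ((1 - z) * ((1 + z) ^ 3 + z ^ 3) * z ^ ((N : ℤ) + b l - b i - 1) *
      (1 + z) ^ (if τ then (N : ℤ) - b l + b i else (N : ℤ) - b l) *
      ∏ m ∈ (univ.erase l).erase i, leftover l i τ m (x m) z))) ?_ ?_
  · intro z hz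
    have h1 : 1 + z ≠ 0 ∨ (0 : ℤ) ≤ if τ then (N : ℤ) - b l + b i else (N : ℤ) - b l := by
      rcases hl with h1 | h1
      · left
        intro h0
        have h2 : ‖z‖ = 1 := by rw [show z = -1 by linear_combination h0]; simp
        have := zpow_100_step h1
        rw [h2] at hz
        unfold rad at hz
        rw [zpow_zero] at this
        linarith
      · right
        split_ifs <;> omega
    refine (DifferentiableAt.mul (differentiableAt_const _) (DifferentiableAt.mul
      (DifferentiableAt.mul (DifferentiableAt.mul (by fun_prop) ?_) ?_) ?_)).neg
    · exact differentiableAt_id.zpow (Or.inr (by omega))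
    · exact DifferentiableAt.zpow (f := fun z : ℂ => 1 + z) (by fun_prop) h1
    · exact DifferentiableAt.fun_finsetProd fun m _ => leftover_differentiable _ _ _ _ _ z
  · intro z hz
    have hxz : Function.update x l z ∈ torusSet (rad e) := by
      simpa using update_mem_torusSet (i := l) hx hz
    obtain ⟨hz0, hz1, hp0, -⟩ := crossed_mem_facts he hq hxz
    have := hT _ hxz _ rfl
    rw [hκ _ x fun m h1 h2 => Function.update_of_ne h1 _ _, Function.update_self,
      Function.update_of_ne h.ne, Function.update_self] at this
    simp only [Function.update_self] at hz0 hz1 hp0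
    rw [this rfl]
    have hprod : ∏ m ∈ (univ.erase l).erase i, leftover l i τ m (Function.update x l z m) z =
        ∏ m ∈ (univ.erase l).erase i, leftover l i τ m (x m) z :=
      prod_congr rfl fun m hm => by
        rw [Function.update_of_ne (mem_erase.1 (mem_erase.1 hm).2).1]
    rw [hprod]
    generalize ∏ m ∈ (univ.erase l).erase i, leftover l i τ m (x m) z = Q
    unfold mainTerm
    have e1 : z ^ ((N : ℤ) + b l - b i) = z ^ ((N : ℤ) + b l - b i - 1) * z := by
      rw [← zpow_add_one₀ hz0]; congr 1; ring
    rw [e1]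
    cases τ
    · simp only [Bool.false_eq_true, if_false, pole] at hp0 ⊢
      field_simp
    · simp only [if_true, pole] at hp0 ⊢
      have e2 : -1 - z = -(1 + z) := by ring
      rw [zpow_add_one₀ hz1, e2]
      field_simp

lemma torusAvg_poleTerm_hNum_of_gt {k : ℕ} {e : Fin k → ℤ} {i : Fin k} {e₁ : ℤ} (he : IsGeneric e)
    (he₁ : IsGeneric (Function.update e i e₁))
    (hout : ∀ l, i < l → e l < 0 ∧ e i + e l < 0) {N : ℕ} {b : Fin k → ℕ} (hb : StrictAnti b)
    (hi : b i ≤ N) {l : Fin k} {τ : Bool} (h : i < l)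
    (hq : (l, τ) ∈ crossed e i e₁) : torusAvg (rad e) (poleTerm (hNum N b) i l τ) = 0 := by
  have hτ : τ = true := by
    simp only [crossed, mem_filter, mem_univ, true_and] at hq
    cases τ
    · exact absurd (hq.2.1 rfl) h.not_gt
    · rfl
  subst hτ
  refine torusAvg_eq_zero_of_coord (fun j => (rad_pos e j).le)
    (continuousOn_poleTerm (q := (l, _)) he he₁ hout
      (fun x h1 h2 => differentiableAt_hNum N b (by omega) h1 h2) hq) l fun x hx => ?_
  obtain ⟨κ, hκ, hT⟩ := exists_poleTerm_hNum he he₁ hout N b hq h (min_eq_left h.le)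
    (max_eq_right h.le) fun m h1 h2 => ⟨h2, h1⟩
  have hd := hb h
  refine circleAverage_eq_zero_of_eq_mul (rad_pos e l) (G := fun z => -(κ x *
    ((2 + z) * ((-z) ^ 3 + (-1 - z) ^ 3) * (-1 - z) ^ ((N : ℤ) + b i - b l - 1) *
      (-z) ^ ((N : ℤ) - b i + b l) *
      ∏ m ∈ (univ.erase i).erase l, leftover i l true m (x m) (-1 - z)))) ?_ ?_
  · intro z hz
    refine (DifferentiableAt.mul (differentiableAt_const _) (DifferentiableAt.mul
      (DifferentiableAt.mul (DifferentiableAt.mul (by fun_prop) ?_) ?_) ?_)).neg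
    · exact DifferentiableAt.zpow (f := fun z : ℂ => -1 - z) (by fun_prop) (Or.inr (by omega))
    · exact DifferentiableAt.zpow (f := fun z : ℂ => -z) (by fun_prop) (Or.inr (by omega))
    · refine DifferentiableAt.fun_finsetProd fun m _ => ?_
      exact (leftover_differentiable i l true m (x m)).comp (g := leftover i l true m (x m))
        (f := fun z : ℂ => -1 - z) (by fun_prop) z
  · intro z hz
    have hxz : Function.update x l z ∈ torusSet (rad e) := by
      simpa using update_mem_torusSet (i := l) hx hz
    obtain ⟨hz0, hz1, hp0, -⟩ := crossed_mem_facts he hq hxz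
    have := hT _ hxz _ rfl
    rw [hκ _ x fun m h1 h2 => Function.update_of_ne h1 _ _, Function.update_self,
      Function.update_self, Function.update_of_ne h.ne', Function.update_self] at this
    simp only [Function.update_self] at hz0 hz1 hp0
    rw [this (by simp [pole])]
    have hprod : ∏ m ∈ (univ.erase i).erase l,
        leftover i l true m (Function.update x l z m) (pole true z) =
        ∏ m ∈ (univ.erase i).erase l, leftover i l true m (x m) (-1 - z) :=
      prod_congr rfl fun m hm => by
        rw [Function.update_of_ne (mem_erase.1 hm).1]
        simp [pole]
    rw [hprod]
    generalize ∏ m ∈ (univ.erase i).erase l, leftover i l true m (x m) (-1 - z) = Q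
    simp only [pole, if_true, mainTerm] at hp0 ⊢
    have e1 : (-1 - z) ^ ((N : ℤ) + b i - b l) =
        (-1 - z) ^ ((N : ℤ) + b i - b l - 1) * (-1 - z) := by
      rw [← zpow_add_one₀ hp0]; congr 1; ring
    have e3 : 1 + (-1 - z) = -z := by ring
    rw [e1, e3, zpow_add_one₀ (neg_ne_zero.2 hz0)]
    field_simp
    ring

lemma torusAvg_poleTerm_hNum {k : ℕ} {e : Fin k → ℤ} {i : Fin k} {e₁ : ℤ} (he : IsGeneric e)
    (he₁ : IsGeneric (Function.update e i e₁))
    (hout : ∀ l, i < l → e l < 0 ∧ e i + e l < 0) {N : ℕ} {b : Fin k → ℕ} (hb : StrictAnti b)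
    (hi : b i ≤ N) (hl : ∀ l, l < i → e l < 0 ∨ b l ≤ N) {l : Fin k} {τ : Bool}
    (hq : (l, τ) ∈ crossed e i e₁) : torusAvg (rad e) (poleTerm (hNum N b) i l τ) = 0 := by
  have hmem : l ≠ i := by
    simp only [crossed, mem_filter, mem_univ, true_and] at hq
    exact hq.1
  rcases lt_or_gt_of_ne hmem with h | h
  · exact torusAvg_poleTerm_hNum_of_lt he he₁ hout hb hi h (hl l h) hq
  · exact torusAvg_poleTerm_hNum_of_gt he he₁ hout hb hi h hq

lemma circleAverage_eq_of_differentiable_punctured {f : ℂ → ℂ} {B r R : ℝ} (hr : 0 < r) (hR : 0 < R)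
    (hrB : r ≤ B) (hRB : R ≤ B) (hf : ∀ z, z ≠ 0 → ‖z‖ ≤ B → DifferentiableAt ℂ f z) :
    Real.circleAverage f 0 r = Real.circleAverage f 0 R := by
  wlog h : r ≤ R generalizing r R
  · exact (this hR hr hRB hrB (le_of_not_ge h)).symm
  rcases h.eq_or_lt with h | h
  · rw [h]
  · have := circleAverage_move hr h (∅ : Finset ℕ) (fun _ => 0) (by simp) (by simp) f
      (fun z hz hz' _ => hf z (norm_pos_iff.1 (hr.trans_le hz)) (hz'.trans hRB))
      (fun _ _ => 0) (by simp) (by simp)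
    simpa using this.symm

lemma torusAvg_eq_of_differentiable {k : ℕ} {f : (Fin k → ℂ) → ℂ} {B : ℝ}
    (hf : ∀ x : Fin k → ℂ, (∀ i, x i ≠ 0) → (∀ i, ‖x i‖ ≤ B) → DifferentiableAt ℂ f x)
    {ρ ρ' : Fin k → ℝ} (hρ : ∀ i, 0 < ρ i) (hρB : ∀ i, ρ i ≤ B) (hρ' : ∀ i, 0 < ρ' i)
    (hρB' : ∀ i, ρ' i ≤ B) : torusAvg ρ f = torusAvg ρ' f := by
  classical
  have hcont : ∀ ρ : Fin k → ℝ, (∀ i, 0 < ρ i) → (∀ i, ρ i ≤ B) → ContinuousOn f (torusSet ρ) :=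
    fun ρ h0 hB x hx => (hf x (ne_zero_of_mem_torusSet h0 hx)
      fun i => (hx i).trans_le (hB i)).continuousAt.continuousWithinAt
  have key : ∀ s : Finset (Fin k), torusAvg ρ f = torusAvg (fun i => if i ∈ s then ρ' i else ρ i) f := by
    intro s
    induction s using Finset.induction_on with
    | empty => simp
    | insert a s ha ih =>
      rw [ih]
      set ρ₁ : Fin k → ℝ := fun i => if i ∈ s then ρ' i else ρ i with hρ₁
      have h0 : ∀ i, 0 < ρ₁ i := fun i => by simp only [hρ₁]; split_ifs; exacts [hρ' i, hρ i]
      have hB : ∀ i, ρ₁ i ≤ B := fun i => by simp only [hρ₁]; split_ifs; exacts [hρB' i, hρB i]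
      have e1 : (fun i => if i ∈ insert a s then ρ' i else ρ i) = Function.update ρ₁ a (ρ' a) := by
        ext i
        by_cases hi : i = a
        · subst hi; simp
        · simp [hi, hρ₁]
      have h0' : ∀ i, 0 < Function.update ρ₁ a (ρ' a) i := fun i => by
        rw [← e1]; dsimp only; split_ifs; exacts [hρ' i, hρ i]
      have hB' : ∀ i, Function.update ρ₁ a (ρ' a) i ≤ B := fun i => by
        rw [← e1]; dsimp only; split_ifs; exacts [hρB' i, hρB i]
      rw [e1]
      refine torusAvg_move (fun i => (h0 i).le) a (hρ' a).le (hcont _ h0 hB) (hcont _ h0' hB')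
        (∅ : Finset ℕ) (fun _ _ => 0) (by simp) (by simp) fun x hx => ?_
      rw [sum_empty, add_zero]
      refine circleAverage_eq_of_differentiable_punctured (h0 a) (hρ' a) (hB a) (hρB' a)
        fun z hz hzB => differentiableAt_update (hf _ (fun i => ?_) fun i => ?_)
      · by_cases hi : i = a
        · subst hi; simpa using hz
        · simpa [hi] using ne_zero_of_mem_torusSet h0 hx i
      · by_cases hi : i = a
        · subst hi; simpa using hzB
        · simpa [hi] using (hx i).trans_le (hB i)
  have := key univ
  simpa using this

/-- The determinant entries of the kernel counting Gog trapezoids. -/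
noncomputable def gogEntry (m : ℕ) (z : ℂ) : ℂ := lamCoord z ^ (m % 2) * sCoord z ^ (m / 2)

/-- The pair interaction of the kernel counting Gog trapezoids. -/
noncomputable def gogPair (p q : ℂ) : ℂ :=
  (1 + p) ^ 2 * (1 + q) ^ 2 / (pairDen true p q * pairDen false p q)

lemma pairDen_ne_zero_of_small {p q : ℂ} (hp : ‖p‖ ≤ 1 / 8) (hq : ‖q‖ ≤ 1 / 8) (τ : Bool) :
    pairDen τ p q ≠ 0 := by
  intro h
  cases τ
  · have h1 : (1 : ℂ) = -(p + p * q) := by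
      simp only [pairDen, Bool.false_eq_true, if_false] at h
      linear_combination h
    have h2 : (1 : ℝ) ≤ ‖p‖ + ‖p‖ * ‖q‖ := by
      rw [← norm_mul, ← norm_one (α := ℂ), h1, norm_neg]; exact norm_add_le _ _
    nlinarith [norm_nonneg p, norm_nonneg q]
  · have h1 : (1 : ℂ) = -(p + q) := by
      simp only [pairDen, if_true] at h
      linear_combination h
    have h2 : (1 : ℝ) ≤ ‖p‖ + ‖q‖ := by
      rw [← norm_one (α := ℂ), h1, norm_neg]; exact norm_add_le _ _
    linarith

lemma isKernel_gog : IsKernel 0 gogEntry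
    (fun m z => (1 + z) ^ (2 * (m % 2)) *
      ((1 + z) ^ 4 - 3 * z * (1 + z) ^ 2 - z ^ 3 / (1 + z) ^ 2) ^ (m / 2)) gogPair where
  phi_eq m z hz hz8 := by
    have h1 := one_add_ne_zero_of_small hz8
    have e1 : sCoord z = ((1 + z) ^ 4 - 3 * z * (1 + z) ^ 2 - z ^ 3 / (1 + z) ^ 2) / z ^ 2 := by
      unfold sCoord lamCoord
      field_simp
    have e2 : z ^ (-(m : ℤ)) = (z ^ (m % 2) * (z ^ 2) ^ (m / 2))⁻¹ := by
      rw [zpow_neg, zpow_natCast, ← pow_mul, ← pow_add, Nat.mod_add_div]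
    rw [gogEntry, e1, e2, lamCoord, div_pow, div_pow, ← pow_mul]
    field_simp
  diff m z hz := by
    have h1 := one_add_ne_zero_of_small hz
    have h2 : DifferentiableAt ℂ (fun z : ℂ => (1 + z) ^ 4 - 3 * z * (1 + z) ^ 2 -
        z ^ 3 / (1 + z) ^ 2) z :=
      DifferentiableAt.sub (by fun_prop) (DifferentiableAt.div (by fun_prop) (by fun_prop)
        (pow_ne_zero _ h1))
    exact DifferentiableAt.mul (by fun_prop) (h2.pow _)
  at_zero m := by norm_num
  pair_diff p hp hq := by
    have h0 := mul_ne_zero (pairDen_ne_zero_of_small hp hq true)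
      (pairDen_ne_zero_of_small hp hq false)
    simp only [gogPair, pairDen, if_true, Bool.false_eq_true, if_false] at h0 ⊢
    simp only [div_eq_mul_inv]
    exact DifferentiableAt.mul (by fun_prop) (DifferentiableAt.inv (by fun_prop) h0)
  pair_zero := by simp [gogPair, pairDen]
  pair_ne_zero p q hp hq := by
    refine div_ne_zero (mul_ne_zero ?_ ?_) (mul_ne_zero (pairDen_ne_zero_of_small hp hq true)
      (pairDen_ne_zero_of_small hp hq false))
    · exact pow_ne_zero _ (one_add_ne_zero_of_small hp)
    · exact pow_ne_zero _ (one_add_ne_zero_of_small hq)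
  symm β p q hp hq := by
    have h1 := one_add_ne_zero_of_small hp
    have h2 := one_add_ne_zero_of_small hq
    have e : ∀ p q : ℂ, 1 + p ≠ 0 → 1 + q ≠ 0 →
        nullPoly 0 β p q = (vCoord p * vCoord q) ^ β * pairDen false p q := by
      intro p q h1 h2
      simp only [nullPoly, pairDen, Bool.false_eq_true, if_false, if_true, vCoord, tsub_zero]
      rw [mul_pow, pow_succ]
      field_simp
      ring
    have d1 := pairDen_ne_zero_of_small hp hq true
    have d2 := pairDen_ne_zero_of_small hq hp true
    have d3 := pairDen_ne_zero_of_small hp hq false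
    have d4 := pairDen_ne_zero_of_small hq hp false
    have d5 : pairDen true q p = pairDen true p q := by simp [pairDen]; ring
    rw [e p q h1 h2, e q p h2 h1, gogPair, gogPair, d5]
    field_simp

lemma kernelBase_gog_mul {k : ℕ} (N : ℕ) (b : Fin k → ℕ) {x : Fin k → ℂ} (hx : ∀ i, x i ≠ 0)
    (hx1 : ∀ i, 1 + x i ≠ 0) :
    kernelBase gogEntry gogPair N x * ∏ i, vCoord (x i) ^ b i = polarFun (hNum N b) x := by
  have h1 : (Matrix.of fun m i : Fin k => gogEntry m (x i)).det =
      doubleVdm (fun i => lamCoord (x i)) (fun i => sCoord (x i)) := by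
    rw [doubleVdm, ← Matrix.det_transpose]
    rfl
  have h2 : (∏ i, weight N (b i) (x i)) = (∏ i, (1 / x i - x i) * lamCoord (x i) ^ N) *
      ∏ i, vCoord (x i) ^ b i := by
    rw [← prod_mul_distrib]
    exact prod_congr rfl fun i _ => weight_eq N (b i) (hx i) (hx1 i)
  have h3 : (pairProd univ fun i j => gogPair (x j) (x i)) =
      (pairProd univ fun a b => (1 + x a) ^ 2 * (1 + x b) ^ 2) *
      pairProd univ fun a b => (pairDen true (x b) (x a))⁻¹ * (pairDen false (x b) (x a))⁻¹ := by
    rw [← pairProd_mul]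
    refine pairProd_congr fun a _ b _ _ => ?_
    rw [gogPair, div_eq_mul_inv, mul_inv, mul_comm ((1 + x b) ^ 2)]
  rw [kernelBase, polarFun, hNum_eq N b hx hx1, h1, h2, h3]
  ring

/-- The average over a small torus counting Gog-type chains from `b`. -/
noncomputable def gogAvg {k : ℕ} (N : ℕ) (b : Fin k → ℕ) : ℂ :=
  IsKernel.avg gogEntry gogPair N (1 / 8) fun x => ∏ i, vCoord (x i) ^ b i

lemma rad_le_of_neg {k : ℕ} {e : Fin k → ℤ} {i : Fin k} (h : e i < 0) : rad e i ≤ 1 / 8 := by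
  have := zpow_100_step h
  rw [zpow_zero] at this
  unfold rad
  linarith

lemma torusAvg_hNum_of_neg {k : ℕ} (N : ℕ) (b : Fin k → ℕ) {e : Fin k → ℤ}
    (hneg : ∀ i, e i < 0) : torusAvg (rad e) (polarFun (hNum N b)) = gogAvg N b := by
  have h1 : torusAvg (rad e) (polarFun (hNum N b)) =
      torusAvg (fun _ => 1 / 8) (polarFun (hNum N b)) := by
    refine torusAvg_eq_of_differentiable (B := 1 / 8) (fun x hx hx8 => ?_) (rad_pos e)
      (fun i => rad_le_of_neg (hneg i)) (fun _ => by norm_num) fun _ => le_rfl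
    refine differentiableAt_polarFun ?_ fun a c _ τ => pairDen_ne_zero_of_small (hx8 c) (hx8 a) τ
    have hx1 : ∀ l, 1 + x l ≠ 0 := fun l => one_add_ne_zero_of_small (hx8 l)
    exact differentiableAt_hNum_of_or N b hx fun l => Or.inl (hx1 l)
  rw [h1, gogAvg, IsKernel.avg]
  refine (torusAvg_congr (fun _ => by norm_num) fun x hx => ?_).symm
  exact kernelBase_gog_mul N b (ne_zero_of_mem_torusSet (fun _ => by norm_num) hx)
    fun i => one_add_ne_zero_of_small (hx i).le

lemma hNum_move {k : ℕ} {e : Fin k → ℤ} {i : Fin k} {e₁ : ℤ} (he : IsGeneric e)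
    (he₁ : IsGeneric (Function.update e i e₁)) (hlt : e₁ < e i)
    (hout : ∀ l, i < l → e l < 0 ∧ e i + e l < 0) {N : ℕ} {b : Fin k → ℕ} (hb : StrictAnti b)
    (hi : b i ≤ N) (hl : ∀ l, l < i → e l < 0 ∨ b l ≤ N) :
    torusAvg (rad e) (polarFun (hNum N b)) =
      torusAvg (rad (Function.update e i e₁)) (polarFun (hNum N b)) :=
  torusAvg_polarFun_move he he₁ hlt hout
    (fun x h1 h2 => differentiableAt_hNum N b (by omega) h1 h2)
    fun _ _ hq => torusAvg_poleTerm_hNum he he₁ hout hb hi hl hq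

/-- Coordinates of index at least `k - m` moved to the small radii `100 ^ (-(M + 1 + i))`. -/
def shrink {k : ℕ} (e : Fin k → ℤ) (M m : ℕ) (i : Fin k) : ℤ :=
  if k ≤ i + m then -((M : ℤ) + 1 + i) else e i

lemma isGeneric_shrink {k : ℕ} {e : Fin k → ℤ} (he : IsGeneric e) {M : ℕ} (hM : ∀ i, |e i| ≤ M)
    (m : ℕ) : IsGeneric (shrink e M m) := by
  refine ⟨fun i => ?_, fun i j hij => ?_⟩
  · unfold shrink
    split_ifs
    · omega
    · exact he.1 i
  · have h1 := he.2 i j hij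
    have h2 := hM i
    have h3 := hM j
    have h4 : (i : ℕ) ≠ j := fun h => hij (Fin.ext h)
    unfold shrink
    split_ifs
    · rw [abs_neg, abs_neg, abs_of_pos (by omega), abs_of_pos (by omega)]; omega
    · rw [abs_neg, abs_of_pos (by omega)]; omega
    · rw [abs_neg, abs_of_pos (by omega : (0 : ℤ) < M + 1 + j)]; omega
    · exact h1

lemma shrink_succ {k : ℕ} (e : Fin k → ℤ) (M : ℕ) {m : ℕ} {i : Fin k} (h : (i : ℕ) + (m + 1) = k) :
    shrink e M (m + 1) = Function.update (shrink e M m) i (-((M : ℤ) + 1 + i)) := by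
  funext j
  by_cases hj : j = i
  · subst hj; simp [shrink, h]
  · have : (i : ℕ) ≠ j := fun h => hj (Fin.ext h.symm)
    rw [Function.update_of_ne hj]
    unfold shrink
    split_ifs <;> first | rfl | omega

lemma torusAvg_hNum_shrink {k : ℕ} {e : Fin k → ℤ} (he : IsGeneric e) {N : ℕ} {b : Fin k → ℕ}
    (hb : StrictAnti b) (hbN : ∀ i, b i ≤ N) {M : ℕ} (hM : ∀ i, |e i| ≤ M) {m : ℕ} (hm : m ≤ k) :
    torusAvg (rad e) (polarFun (hNum N b)) = torusAvg (rad (shrink e M m)) (polarFun (hNum N b)) := by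
  induction m with
  | zero =>
    congr 2
    funext i
    have := i.2
    simp [shrink, this]
  | succ m ih =>
    rw [ih (by omega)]
    obtain ⟨i, hi⟩ : ∃ i : Fin k, (i : ℕ) + (m + 1) = k :=
      ⟨⟨k - (m + 1), by omega⟩, by simp only; omega⟩
    have hei : shrink e M m i = e i := by rw [shrink, if_neg (by omega)]
    have h1 := abs_le.1 (hM i)
    rw [shrink_succ e M hi]
    refine hNum_move (isGeneric_shrink he hM m) ?_ (by rw [hei]; omega) (fun l hl => ?_) hb (hbN i)
      fun l _ => Or.inr (hbN l)
    · rw [← shrink_succ e M hi]; exact isGeneric_shrink he hM (m + 1)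
    · rw [Fin.lt_def] at hl
      rw [hei, shrink, if_pos (by omega)]
      omega

lemma torusAvg_hNum_of_isGeneric {k : ℕ} {e : Fin k → ℤ} (he : IsGeneric e) {N : ℕ}
    {b : Fin k → ℕ} (hb : StrictAnti b) (hbN : ∀ i, b i ≤ N) :
    torusAvg (rad e) (polarFun (hNum N b)) = gogAvg N b := by
  have hM : ∀ i, |e i| ≤ ((∑ i, (e i).natAbs : ℕ) : ℤ) := fun i => by
    have := single_le_sum (f := fun i => (e i).natAbs) (fun _ _ => Nat.zero_le _) (mem_univ i)
    rw [← Int.natCast_natAbs]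
    exact_mod_cast this
  rw [torusAvg_hNum_shrink he hb hbN hM le_rfl]
  refine torusAvg_hNum_of_neg N b fun i => ?_
  rw [shrink, if_pos (by omega)]
  omega

lemma gogPair_inv {p q : ℂ} (hp : p ≠ 0) : gogPair p⁻¹ q = gogPair p q := by
  have h1 : pairDen true p⁻¹ q * pairDen false p⁻¹ q =
      pairDen true p q * pairDen false p q / p ^ 2 := by
    simp only [pairDen, if_true, Bool.false_eq_true, if_false]
    field_simp
    ring
  have h2 : (1 + p⁻¹) ^ 2 = (1 + p) ^ 2 / p ^ 2 := by field_simp; ring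
  rw [gogPair, gogPair, h1, h2]
  field_simp

lemma lamCoord_inv (z : ℂ) : lamCoord z⁻¹ = lamCoord z := by
  by_cases h : z = 0
  · simp [h]
  · unfold lamCoord
    field_simp
    ring

lemma sCoord_inv (z : ℂ) : sCoord z⁻¹ = sCoord z := by
  rw [sCoord, lamCoord_inv, sCoord]

lemma isGeneric_update_neg {k : ℕ} {e : Fin k → ℤ} (he : IsGeneric e) (i : Fin k) :
    IsGeneric (Function.update e i (-e i)) := by
  have h : ∀ j, |Function.update e i (-e i) j| = |e j| := fun j => by
    by_cases hj : j = i
    · subst hj; simp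
    · rw [Function.update_of_ne hj]
  refine ⟨fun j hj => he.1 j ?_, fun j l hjl => by rw [h, h]; exact he.2 j l hjl⟩
  rw [← abs_eq_zero, ← h j, hj, abs_zero]

lemma flipPt_single_rad {k : ℕ} (e : Fin k → ℤ) (i : Fin k) :
    flipPt (fun j => decide (j = i)) (rad e) = rad (Function.update e i (-e i)) := by
  funext j
  by_cases hj : j = i
  · subst hj; simp [flipPt, rad]
  · simp [flipPt, rad, hj]

lemma polarFun_hNum_flip_last {k : ℕ} (N : ℕ) {b : Fin k → ℕ} {i : Fin k} (hi : ∀ j, j ≤ i)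
    (hb : b i = 0) {x : Fin k → ℂ} (hx : ∀ j, x j ≠ 0) (hx1 : ∀ j, 1 + x j ≠ 0) :
    polarFun (hNum N b) (flipPt (fun j => decide (j = i)) x) = -polarFun (hNum N b) x := by
  set X := flipPt (fun j => decide (j = i)) x with hX
  have hXi : X i = (x i)⁻¹ := by simp [hX, flipPt]
  have hXj : ∀ j, j ≠ i → X j = x j := fun j hj => by simp [hX, flipPt, hj]
  have h0 : ∀ j, X j ≠ 0 := fun j => by
    by_cases hj : j = i
    · rw [hj, hXi]; exact inv_ne_zero (hx i)
    · rw [hXj j hj]; exact hx j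
  have h1 : ∀ j, 1 + X j ≠ 0 := fun j => by
    by_cases hj : j = i
    · rw [hj, hXi]
      intro h
      apply hx1 i
      have h0 := hx i
      field_simp at h
      linear_combination h
    · rw [hXj j hj]; exact hx1 j
  have hlam : ∀ j, lamCoord (X j) = lamCoord (x j) := fun j => by
    by_cases hj : j = i
    · rw [hj, hXi, lamCoord_inv]
    · rw [hXj j hj]
  have hs : ∀ j, sCoord (X j) = sCoord (x j) := fun j => by
    by_cases hj : j = i
    · rw [hj, hXi, sCoord_inv]
    · rw [hXj j hj]
  rw [← kernelBase_gog_mul N b h0 h1, ← kernelBase_gog_mul N b hx hx1, kernelBase, kernelBase]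
  have e1 : (Matrix.of fun m j : Fin k => gogEntry m (X j)) =
      Matrix.of fun m j : Fin k => gogEntry m (x j) := by
    ext m j
    simp only [Matrix.of_apply, gogEntry, hlam, hs]
  have e2 : (pairProd univ fun a c => gogPair (X c) (X a)) =
      pairProd univ fun a c => gogPair (x c) (x a) := by
    refine pairProd_congr fun a _ c _ hac => ?_
    have ha : a ≠ i := fun h => by rw [h] at hac; exact absurd (hi c) hac.not_ge
    rw [hXj a ha]
    by_cases hc : c = i
    · rw [hc, hXi, gogPair_inv (hx i)]
    · rw [hXj c hc]
  have e3 : (∏ j, (1 / X j - X j) * lamCoord (X j) ^ N) =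
      -∏ j, (1 / x j - x j) * lamCoord (x j) ^ N := by
    rw [← mul_prod_erase univ _ (mem_univ i), ← mul_prod_erase univ (fun j => (1 / x j - x j) *
      lamCoord (x j) ^ N) (mem_univ i), hXi, lamCoord_inv]
    have : ∏ j ∈ univ.erase i, (1 / X j - X j) * lamCoord (X j) ^ N =
        ∏ j ∈ univ.erase i, (1 / x j - x j) * lamCoord (x j) ^ N :=
      prod_congr rfl fun j hj => by rw [hXj j (mem_erase.1 hj).1]
    rw [this]
    have h2 : 1 / (x i)⁻¹ - (x i)⁻¹ = -(1 / x i - x i) := by simp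
    rw [h2]
    ring
  have e4 : ∏ j, vCoord (X j) ^ b j = ∏ j, vCoord (x j) ^ b j := by
    refine prod_congr rfl fun j _ => ?_
    by_cases hj : j = i
    · rw [hj, hb, pow_zero, pow_zero]
    · rw [hXj j hj]
  rw [e1, e2, e3, e4]
  ring

lemma gogAvg_eq_zero_of_wall {k : ℕ} (N : ℕ) {b : Fin k → ℕ} (hb : StrictAnti b) {i : Fin k}
    (hi : ∀ j, j ≤ i) (hbi : b i = 0) : gogAvg N b = 0 := by
  set e : Fin k → ℤ := fun j => if j = i then (k : ℤ) + 1 else -((j : ℤ) + 1) with he_def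
  have hei : e i = k + 1 := by simp [he_def]
  have hej : ∀ j, j ≠ i → e j = -((j : ℤ) + 1) := fun j hj => by simp [he_def, hj]
  have he : IsGeneric e := by
    have habs : ∀ j, |e j| = if j = i then (k : ℤ) + 1 else (j : ℤ) + 1 := fun j => by
      by_cases hj : j = i
      · rw [hj, hei, if_pos rfl, abs_of_pos (by omega)]
      · rw [hej j hj, if_neg hj, abs_neg, abs_of_pos (by omega)]
    refine ⟨fun j hj => ?_, fun j l hjl h => ?_⟩
    · have := habs j
      rw [hj, abs_zero] at this
      split_ifs at this <;> omega
    · rw [habs, habs] at h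
      have hj := j.2
      have hl := l.2
      split_ifs at h with h1 h2 h2
      · exact hjl (h1.trans h2.symm)
      · omega
      · omega
      · exact hjl (Fin.ext (by omega))
  have he₁ := isGeneric_update_neg he i
  have hneg : ∀ j, Function.update e i (-e i) j < 0 := fun j => by
    by_cases hj : j = i
    · rw [hj, Function.update_self, hei]; omega
    · rw [Function.update_of_ne hj, hej j hj]; omega
  have h1 := hNum_move (N := N) (b := b) he he₁ (by rw [hei]; omega)
    (fun l hl => absurd (hi l) hl.not_ge) hb (by omega)
    fun l hl => Or.inl (by rw [hej l hl.ne]; omega)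
  have h2 : torusAvg (rad (Function.update e i (-e i))) (polarFun (hNum N b)) =
      -torusAvg (rad e) (polarFun (hNum N b)) := by
    rw [← flipPt_single_rad, torusAvg_flip, neg_eq_neg_one_mul, ← torusAvg_const_mul]
    refine torusAvg_congr (fun j => (rad_pos e j).le) fun x hx => ?_
    rw [polarFun_hNum_flip_last N hi hbi (ne_zero_of_mem_torusSet (rad_pos e) hx)
      fun j => one_add_ne_zero_of_norm (hx j) (he.1 j)]
    ring
  rw [← torusAvg_hNum_of_neg N b hneg]
  rw [h1] at h2
  exact self_eq_neg.1 h2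

/-- The Vandermonde determinant. -/
noncomputable def vdm {k : ℕ} (s : Fin k → ℂ) : ℂ := (Matrix.vandermonde s).det

lemma vdm_perm {k : ℕ} (s : Fin k → ℂ) (σ : Equiv.Perm (Fin k)) :
    vdm (s ∘ σ) = (Equiv.Perm.sign σ : ℂ) * vdm s := by
  unfold vdm
  rw [← Matrix.det_permute]
  rfl

lemma vdm_cons {k : ℕ} (z : ℂ) (s : Fin k → ℂ) :
    vdm (Fin.cons z s : Fin (k + 1) → ℂ) = (∏ j, (s j - z)) * vdm s := by
  unfold vdm
  rw [Matrix.det_vandermonde, Matrix.det_vandermonde, Fin.prod_univ_succ, Fin.prod_Ioi_zero]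
  simp [Fin.prod_Ioi_succ]

lemma cons_succAbove_comp_cycleRange {k : ℕ} {α : Type*} (x : Fin (k + 1) → α) (c : Fin (k + 1)) :
    (Fin.cons (x c) (x ∘ c.succAbove) : Fin (k + 1) → α) ∘ c.cycleRange = x := by
  rw [Fin.cons_comp_cycleRange]
  exact Fin.insertNth_self_removeNth c x

lemma sign_cycleRange_cast {k : ℕ} (c : Fin k) :
    ((Equiv.Perm.sign c.cycleRange : ℤ) : ℂ) = (-1) ^ (c : ℕ) := by
  rw [Fin.sign_cycleRange]; push_cast; simp

lemma vdm_succAbove {k : ℕ} (s : Fin (k + 1) → ℂ) (c : Fin (k + 1)) :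
    vdm s = (-1) ^ (c : ℕ) * (∏ j, (s (c.succAbove j) - s c)) * vdm (s ∘ c.succAbove) := by
  conv_lhs => rw [← cons_succAbove_comp_cycleRange s c, vdm_perm, sign_cycleRange_cast, vdm_cons]
  simp [mul_assoc]

lemma vdm_ne_zero {k : ℕ} {s : Fin k → ℂ} (h : Function.Injective s) : vdm s ≠ 0 :=
  Matrix.det_vandermonde_ne_zero_iff.2 h

lemma prod_erase_eq_prod_succAbove {k : ℕ} (c : Fin (k + 1)) (f : Fin (k + 1) → ℂ) :
    ∏ j ∈ univ.erase c, f j = ∏ j, f (c.succAbove j) := by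
  have : univ.erase c = univ.image c.succAbove := by
    rw [Fin.image_succAbove_univ]; ext; simp
  rw [this, prod_image]
  exact fun _ _ _ _ h => Fin.succAbove_right_injective h

/-- The sum of the values of `R(z)/z` divided by the derivative of the nodal polynomial. -/
lemma sum_div_nodal_eq {k : ℕ} {l : Fin (k + 1) → ℂ} (hl : Function.Injective l)
    (h0 : ∀ i, l i ≠ 0) {R : Polynomial ℂ} (hR : R.natDegree ≤ k) :
    (∏ i, l i) * ∑ c, R.eval (l c) / (l c * ∏ j, (l (c.succAbove j) - l c)) = R.eval 0 := by
  have hd : R.degree < ((univ : Finset (Fin (k + 1))).card : WithBot ℕ) := by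
    rw [card_univ, Fintype.card_fin]
    exact lt_of_le_of_lt (Polynomial.degree_le_of_natDegree_le hR) (by exact_mod_cast k.lt_succ_self)
  have h := Lagrange.eq_interpolate (v := l) (hl.injOn) hd
  conv_rhs => rw [h]
  rw [Lagrange.interpolate_apply, Polynomial.eval_finsetSum, mul_sum]
  refine sum_congr rfl fun c _ => ?_
  rw [Polynomial.eval_mul, Polynomial.eval_C, Lagrange.basis, Polynomial.eval_prod,
    prod_erase_eq_prod_succAbove, Fin.prod_univ_succAbove _ c]
  have hne : ∀ j, l (c.succAbove j) - l c ≠ 0 := fun j =>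
    sub_ne_zero.2 fun e => Fin.succAbove_ne c j (hl e)
  have e : ∀ j, Polynomial.eval 0 (Lagrange.basisDivisor (l c) (l (c.succAbove j))) =
      l (c.succAbove j) / (l (c.succAbove j) - l c) := by
    intro j
    have h2 : l c - l (c.succAbove j) ≠ 0 := by
      intro h; exact hne j (by linear_combination -h)
    simp only [Lagrange.basisDivisor, Polynomial.eval_mul, Polynomial.eval_C, Polynomial.eval_sub,
      Polynomial.eval_X]
    field_simp [hne j]
    ring
  simp_rw [e, prod_div_distrib]
  have h3 : ∏ j, (l (c.succAbove j) - l c) ≠ 0 := prod_ne_zero_iff.2 fun j _ => hne j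
  field_simp [h0 c]

lemma exists_powerDifference (n p : ℕ) (h : n ≤ 2 * p + 1) :
    ∃ W : Polynomial ℂ, W.natDegree ≤ p ∧ W.eval 0 = (if n = 2 * p + 1 then (-1) ^ p else 0) ∧
      ∀ v : ℂ, v ≠ 0 → v ≠ 1 → (1 / (v * (1 - v))) ^ p * (v ^ n - (1 - v) ^ n) =
        (v - (1 - v)) * W.eval (1 / (v * (1 - v))) := by
  induction n using Nat.strong_induction_on generalizing p with
  | _ n ih =>
  match n with
  | 0 => exact ⟨0, by simp, by simp, by simp⟩
  | 1 =>
    refine ⟨Polynomial.X ^ p, by simp, ?_, fun v _ _ => by simp; ring⟩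
    rcases p with _ | p <;> simp
  | n + 2 =>
    obtain ⟨q, rfl⟩ : ∃ q, p = q + 1 := ⟨p - 1, by omega⟩
    obtain ⟨W1, d1, e1, h1⟩ := ih (n + 1) (by omega) (q + 1) (by omega)
    obtain ⟨W0, d0, e0, h0⟩ := ih n (by omega) q (by omega)
    refine ⟨W1 - W0, ?_, ?_, fun v hv hv1 => ?_⟩
    · exact (Polynomial.natDegree_sub_le _ _).trans (max_le d1 (d0.trans (by omega)))
    · rw [Polynomial.eval_sub, e1, e0]
      have : ¬ (n + 1 = 2 * (q + 1) + 1) := by omega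
      have h3 : (n + 2 = 2 * (q + 1) + 1) ↔ n = 2 * q + 1 := by omega
      simp only [this, h3, if_false]
      split_ifs <;> ring
    · have hv' : 1 - v ≠ 0 := sub_ne_zero.2 (Ne.symm hv1)
      have e : (1 / (v * (1 - v))) ^ (q + 1) * (v * (1 - v)) = (1 / (v * (1 - v))) ^ q := by
        rw [pow_succ]; field_simp
      rw [Polynomial.eval_sub, mul_sub (v - (1 - v)), ← h1 v hv hv1, ← h0 v hv hv1, ← e]
      ring

/-- The cubic function through which `sCoord` factors. -/
noncomputable def cubicCoord (t : ℂ) : ℂ := t ^ 2 - 3 * t - 1 / t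

lemma sCoord_eq (z : ℂ) : sCoord z = cubicCoord (lamCoord z) := rfl

lemma exists_doubleVdm_cons {k : ℕ} {l : Fin (k + 1) → ℂ} (hl : Function.Injective l)
    (h0 : ∀ i, l i ≠ 0) :
    ∃ T : Polynomial ℂ, 2 * T.natDegree ≤ k + 1 ∧
      T.coeff 0 = doubleVdm l (cubicCoord ∘ l) ∧
      ∀ ν : ℂ, ν ≠ 0 → doubleVdm (Fin.cons ν l : Fin (k + 2) → ℂ)
        (Fin.cons (cubicCoord ν) (cubicCoord ∘ l)) = T.eval ν⁻¹ * ∏ i, (l i - ν) := by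
  classical
  let M : Fin (k + 2) → ℂ := fun m =>
    (Matrix.of fun (i j : Fin (k + 1)) => l i ^ ((m.succAbove j : ℕ) % 2) *
      cubicCoord (l i) ^ ((m.succAbove j : ℕ) / 2)).det
  set h := (k + 1) / 2 with hh
  let B : ℕ → Polynomial ℂ := fun m => Polynomial.X ^ (h - m / 2 + m % 2) *
    (Polynomial.X ^ 3 - 3 * Polynomial.X ^ 2 - 1) ^ (m / 2)
  let Q : Polynomial ℂ := ∑ m : Fin (k + 2), Polynomial.C ((-1) ^ (m : ℕ) * M m) * B m
  have hD : ∀ ν, doubleVdm (Fin.cons ν l : Fin (k + 2) → ℂ)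
      (Fin.cons (cubicCoord ν) (cubicCoord ∘ l)) =
      ∑ m : Fin (k + 2), (-1) ^ (m : ℕ) * (ν ^ ((m : ℕ) % 2) * cubicCoord ν ^ ((m : ℕ) / 2)) * M m := by
    intro ν
    unfold doubleVdm
    rw [Matrix.det_succ_row_zero]
    rfl
  have hQ : ∀ ν, ν ≠ 0 → Q.eval ν = ν ^ h * doubleVdm (Fin.cons ν l : Fin (k + 2) → ℂ)
      (Fin.cons (cubicCoord ν) (cubicCoord ∘ l)) := by
    intro ν hν
    rw [hD, Polynomial.eval_finsetSum, mul_sum]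
    refine sum_congr rfl fun m _ => ?_
    have hm : (m : ℕ) / 2 ≤ h := by have := m.2; omega
    have e1 : ν ^ h = ν ^ (h - (m : ℕ) / 2) * ν ^ ((m : ℕ) / 2) := by
      rw [← pow_add]; congr 1; omega
    have e2 : cubicCoord ν ^ ((m : ℕ) / 2) * ν ^ ((m : ℕ) / 2) =
        (ν ^ 3 - 3 * ν ^ 2 - 1) ^ ((m : ℕ) / 2) := by
      rw [← mul_pow]; congr 1; unfold cubicCoord; field_simp
    simp only [B, Polynomial.eval_mul, Polynomial.eval_C, Polynomial.eval_pow, Polynomial.eval_X,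
      Polynomial.eval_sub, Polynomial.eval_one, Polynomial.eval_ofNat]
    rw [e1, ← e2, pow_add]
    ring
  have hcub : (Polynomial.X ^ 3 - 3 * Polynomial.X ^ 2 - 1 : Polynomial ℂ).natDegree ≤ 3 := by
    compute_degree
  have hcubm : (Polynomial.X ^ 3 - 3 * Polynomial.X ^ 2 - 1 : Polynomial ℂ).Monic := by
    monicity!
  have hBdeg : ∀ m, m ≤ k + 1 → (B m).natDegree ≤ h + m := by
    intro m hm
    refine Polynomial.natDegree_mul_le.trans ?_
    rw [Polynomial.natDegree_X_pow]
    have := Polynomial.natDegree_pow_le_of_le (m / 2) hcub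
    omega
  have hBm : (B (k + 1)).coeff (h + (k + 1)) = 1 := by
    have hmon : (B (k + 1)).Monic := (Polynomial.monic_X_pow _).mul (hcubm.pow _)
    have hdeg : (B (k + 1)).natDegree = h + (k + 1) := by
      have : (Polynomial.X ^ 3 - 3 * Polynomial.X ^ 2 - 1 : Polynomial ℂ).natDegree = 3 := by
        compute_degree!
      rw [(Polynomial.monic_X_pow _).natDegree_mul (hcubm.pow _), Polynomial.natDegree_X_pow,
        hcubm.natDegree_pow, this]
      omega
    rw [← hdeg]; exact hmon
  have hQdeg : Q.natDegree ≤ h + (k + 1) := by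
    refine Polynomial.natDegree_sum_le_of_forall_le _ _ fun m _ => ?_
    refine (Polynomial.natDegree_C_mul_le _ _).trans ((hBdeg m (by omega)).trans (by omega))
  have hQc : Q.coeff (h + (k + 1)) = (-1) ^ (k + 1) * doubleVdm l (cubicCoord ∘ l) := by
    simp only [Q, Polynomial.finsetSum_coeff, Polynomial.coeff_C_mul]
    rw [Fin.sum_univ_castSucc, sum_eq_zero, zero_add]
    · simp only [Fin.val_last, hBm, mul_one]
      congr 1
      simp only [M, Fin.succAbove_last]
      rfl
    · intro m _
      rw [Polynomial.coeff_eq_zero_of_natDegree_lt, mul_zero]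
      refine lt_of_le_of_lt (hBdeg _ (by simp)) ?_
      have := m.2
      simp
      omega
  let N : Polynomial ℂ := ∏ i, (Polynomial.X - Polynomial.C (l i))
  have hNm : N.Monic := Polynomial.monic_prod_of_monic _ _ fun i _ => Polynomial.monic_X_sub_C _
  have hNd : N.natDegree = k + 1 := by
    simp only [N]
    rw [Polynomial.natDegree_prod_of_monic _ _ fun i _ => Polynomial.monic_X_sub_C _]
    simp
  obtain ⟨S, hS⟩ : N ∣ Q := by
    refine prod_dvd_of_coprime ((Polynomial.pairwise_coprime_X_sub_C hl).set_pairwise _) fun i _ => ?_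
    rw [Polynomial.dvd_iff_isRoot, Polynomial.IsRoot, hQ _ (h0 i)]
    apply mul_eq_zero_of_right
    refine Matrix.det_zero_of_row_eq (Fin.succ_ne_zero i).symm ?_
    ext m
    simp
  have hSd : S.natDegree ≤ h := by
    by_cases hS0 : S = 0
    · simp [hS0]
    · rw [hS, hNm.natDegree_mul' hS0, hNd] at hQdeg
      omega
  have hSc : S.coeff h = (-1) ^ (k + 1) * doubleVdm l (cubicCoord ∘ l) := by
    rw [← hQc, hS, add_comm h, Polynomial.coeff_mul_add_eq_of_natDegree_le hNd.le hSd]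
    have : N.coeff (k + 1) = 1 := by rw [← hNd]; exact hNm
    rw [this, one_mul]
  refine ⟨Polynomial.C ((-1) ^ (k + 1)) * Polynomial.reflect h S, ?_, ?_, fun ν hν => ?_⟩
  · have := (Polynomial.natDegree_C_mul_le ((-1 : ℂ) ^ (k + 1)) (Polynomial.reflect h S)).trans
      (Polynomial.natDegree_reflect_le)
    have h2 := max_le (le_refl h) hSd
    omega
  · rw [Polynomial.coeff_C_mul, Polynomial.coeff_reflect]
    rw [show (Polynomial.revAt h) 0 = h by simp [Polynomial.revAt_le], hSc, ← mul_assoc, ← mul_pow]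
    simp
  · have e := hQ ν hν
    let _ := invertibleOfNonzero hν
    have e2 := Polynomial.eval₂_reflect_mul_pow (RingHom.id ℂ) ν h S hSd
    rw [invOf_eq_inv, Polynomial.eval₂_id, Polynomial.eval₂_id] at e2
    rw [hS, Polynomial.eval_mul, ← e2] at e
    have e3 : N.eval ν = (-1) ^ (k + 1) * ∏ i, (l i - ν) := by
      simp only [N, Polynomial.eval_prod, Polynomial.eval_sub, Polynomial.eval_X, Polynomial.eval_C]
      rw [show ((-1 : ℂ)) ^ (k + 1) = ∏ _i : Fin (k + 1), (-1 : ℂ) by simp, ← prod_mul_distrib]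
      exact prod_congr rfl fun _ _ => by ring
    rw [e3] at e
    have hp : ν ^ h ≠ 0 := pow_ne_zero _ hν
    apply mul_left_cancel₀ hp
    rw [← e, Polynomial.eval_mul, Polynomial.eval_C]
    ring

/-- `lamCoord` as a function of `vCoord`. -/
noncomputable def lamOfV (v : ℂ) : ℂ := 1 / (v * (1 - v))

/-- The second root `ν` of `cubicCoord ν = cubicCoord (lamOfV v)`. -/
noncomputable def nuOfV (v : ℂ) : ℂ := -v ^ 2 / (1 - v)

lemma lamOfV_one_sub (v : ℂ) : lamOfV (1 - v) = lamOfV v := by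
  unfold lamOfV; congr 1; ring

lemma cubicCoord_sub {a v : ℂ} (ha : a ≠ 0) (h0 : v ≠ 0) (h1 : v ≠ 1) :
    (cubicCoord a - cubicCoord (lamOfV v)) * a =
      (a - lamOfV v) * (a - nuOfV v) * (a - nuOfV (1 - v)) := by
  have h1' : 1 - v ≠ 0 := sub_ne_zero.2 h1.symm
  unfold cubicCoord lamOfV nuOfV
  rw [show 1 - (1 - v) = v by ring]
  field_simp
  ring

lemma nuOfV_ne_zero {v : ℂ} (h0 : v ≠ 0) (h1 : v ≠ 1) : nuOfV v ≠ 0 := by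
  have h1' : 1 - v ≠ 0 := sub_ne_zero.2 h1.symm
  unfold nuOfV
  exact div_ne_zero (neg_ne_zero.2 (pow_ne_zero _ h0)) h1'

lemma lamOfV_ne_zero {v : ℂ} (h0 : v ≠ 0) (h1 : v ≠ 1) : lamOfV v ≠ 0 := by
  have h1' : 1 - v ≠ 0 := sub_ne_zero.2 h1.symm
  unfold lamOfV
  exact one_div_ne_zero (mul_ne_zero h0 h1')

lemma cubicCoord_nuOfV {v : ℂ} (h0 : v ≠ 0) (h1 : v ≠ 1) :
    cubicCoord (nuOfV v) = cubicCoord (lamOfV v) := by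
  have h := cubicCoord_sub (nuOfV_ne_zero h0 h1) h0 h1
  rw [sub_self, mul_zero, zero_mul, mul_eq_zero] at h
  exact sub_eq_zero.1 (h.resolve_right (nuOfV_ne_zero h0 h1))

lemma lamOfV_ne_nuOfV {v : ℂ} (h0 : v ≠ 0) (h1 : v ≠ 1) (h : v ^ 3 ≠ -1) :
    lamOfV v - nuOfV v ≠ 0 := by
  have h1' : 1 - v ≠ 0 := sub_ne_zero.2 h1.symm
  have : (lamOfV v - nuOfV v) * (v * (1 - v)) = 1 + v ^ 3 := by
    unfold lamOfV nuOfV; field_simp; ring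
  intro h2
  rw [h2, zero_mul] at this
  exact h (by linear_combination -this)

lemma doubleVdm_cons_succAbove {k : ℕ} (z w : ℂ) (a s : Fin (k + 1) → ℂ) (c : Fin (k + 1)) :
    doubleVdm (Fin.cons z a : Fin (k + 2) → ℂ) (Fin.cons w s) =
      (-1) ^ (c : ℕ) * doubleVdm
        (Fin.cons z (Fin.cons (a c) (a ∘ c.succAbove) : Fin (k + 1) → ℂ) : Fin (k + 2) → ℂ)
        (Fin.cons w (Fin.cons (s c) (s ∘ c.succAbove) : Fin (k + 1) → ℂ)) := by
  have e : ∀ (z : ℂ) (a : Fin (k + 1) → ℂ), (Fin.cons z a : Fin (k + 2) → ℂ) =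
      (Fin.cons z (Fin.cons (a c) (a ∘ c.succAbove) : Fin (k + 1) → ℂ) : Fin (k + 2) → ℂ) ∘
        Equiv.Perm.decomposeFin.symm (0, c.cycleRange) := by
    intro z a
    funext i
    refine Fin.cases ?_ (fun i => ?_) i
    · simp
    · have := congrFun (cons_succAbove_comp_cycleRange a c) i
      simp only [Function.comp_apply] at this
      simp [this]
  rw [e z a, e w s, doubleVdm_perm, Equiv.Perm.decomposeFin.symm_sign]
  simp only [if_true, one_mul, sign_cycleRange_cast]

lemma doubleVdm_rest_mul_prod {k : ℕ} {l : Fin (k + 1) → ℂ} (h0 : ∀ i, l i ≠ 0)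
    (hs : Function.Injective (cubicCoord ∘ l)) {c : Fin (k + 1)} {w : ℂ} (hw0 : w ≠ 0) (hw1 : w ≠ 1)
    (hw3 : w ^ 3 ≠ -1) (hc : l c = lamOfV w) {t : ℂ}
    (ht : doubleVdm (Fin.cons (nuOfV w) l : Fin (k + 2) → ℂ)
        (Fin.cons (cubicCoord (nuOfV w)) (cubicCoord ∘ l)) = t * ∏ i, (l i - nuOfV w)) :
    (-1) ^ (c : ℕ) * doubleVdm (l ∘ c.succAbove) (cubicCoord ∘ l ∘ c.succAbove) *
      ∏ j, (l (c.succAbove j) - nuOfV (1 - w)) =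
      t * ((∏ j, l (c.succAbove j)) / ∏ j, (l (c.succAbove j) - l c)) := by
  have hd : doubleVdm (Fin.cons (nuOfV w) l : Fin (k + 2) → ℂ)
        (Fin.cons (cubicCoord (nuOfV w)) (cubicCoord ∘ l)) =
      (-1) ^ (c : ℕ) * ((l c - nuOfV w) *
        (∏ j, (cubicCoord (l (c.succAbove j)) - cubicCoord (l c))) *
        doubleVdm (l ∘ c.succAbove) (cubicCoord ∘ l ∘ c.succAbove)) := by
    rw [doubleVdm_cons_succAbove _ _ _ _ c, doubleVdm_of_eq]
    · rw [cubicCoord_nuOfV hw0 hw1, ← hc]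
      rfl
    · rw [cubicCoord_nuOfV hw0 hw1, ← hc]; rfl
  have hsix : (∏ j, (cubicCoord (l (c.succAbove j)) - cubicCoord (l c))) * ∏ j, l (c.succAbove j) =
      (∏ j, (l (c.succAbove j) - l c)) * (∏ j, (l (c.succAbove j) - nuOfV w)) *
        ∏ j, (l (c.succAbove j) - nuOfV (1 - w)) := by
    simp_rw [← prod_mul_distrib]
    refine prod_congr rfl fun j _ => ?_
    rw [hc]
    exact cubicCoord_sub (h0 _) hw0 hw1
  have hsne : ∏ j, (cubicCoord (l (c.succAbove j)) - cubicCoord (l c)) ≠ 0 :=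
    prod_ne_zero_iff.2 fun j _ => sub_ne_zero.2 fun e => Fin.succAbove_ne c j (hs e)
  have hlne : ∏ j, l (c.succAbove j) ≠ 0 := prod_ne_zero_iff.2 fun j _ => h0 _
  have hprod := mul_ne_zero hsne hlne
  rw [hsix] at hprod
  have n1 := left_ne_zero_of_mul hprod
  have n2 := left_ne_zero_of_mul n1
  have n3 := right_ne_zero_of_mul n1
  have n4 : l c - nuOfV w ≠ 0 := by rw [hc]; exact lamOfV_ne_nuOfV hw0 hw1 hw3
  rw [hd, Fin.prod_univ_succAbove _ c] at ht
  rw [← mul_div_assoc, eq_div_iff n2]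
  apply mul_left_cancel₀ (mul_ne_zero n4 n3)
  linear_combination (∏ j, l (c.succAbove j)) * ht - ((-1) ^ (c : ℕ) * (l c - nuOfV w) *
    doubleVdm (l ∘ c.succAbove) (cubicCoord ∘ l ∘ c.succAbove)) * hsix

/-- The identity that removes one coordinate from `doubleVdm`. -/
lemma sum_peel {k : ℕ} {v : Fin (k + 1) → ℂ} (h0 : ∀ i, v i ≠ 0) (h1 : ∀ i, v i ≠ 1)
    (h2 : ∀ i, v i - (1 - v i) ≠ 0) (h3 : ∀ i, v i ^ 3 ≠ -1) (h4 : ∀ i, (1 - v i) ^ 3 ≠ -1)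
    (hs : Function.Injective (cubicCoord ∘ lamOfV ∘ v)) :
    ∑ c : Fin (k + 1), (-1) ^ (c : ℕ) * lamOfV (v c) ^ k *
      doubleVdm (lamOfV ∘ v ∘ c.succAbove) (cubicCoord ∘ lamOfV ∘ v ∘ c.succAbove) *
      (v c ^ (2 * k + 1) * ∏ j, (lamOfV (v (c.succAbove j)) - nuOfV (1 - v c)) -
        (1 - v c) ^ (2 * k + 1) * ∏ j, (lamOfV (v (c.succAbove j)) - nuOfV (v c))) /
      (v c - (1 - v c)) = (-1) ^ k * doubleVdm (lamOfV ∘ v) (cubicCoord ∘ lamOfV ∘ v) := by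
  set l := lamOfV ∘ v with hl
  have hl0 : ∀ i, l i ≠ 0 := fun i => lamOfV_ne_zero (h0 i) (h1 i)
  have hli : Function.Injective l := fun a b h => hs (by simp [h])
  obtain ⟨T, hTd, hT0, hT⟩ := exists_doubleVdm_cons hli hl0
  choose! W hWd hW0 hW using exists_powerDifference
  let R : Polynomial ℂ := ∑ m ∈ range (T.natDegree + 1),
    Polynomial.C ((-1) ^ m * T.coeff m) * W (2 * k + 1 - 3 * m) (k - m)
  have hb : ∀ m ∈ range (T.natDegree + 1), m ≤ k ∧ 3 * m ≤ 2 * k + 1 := by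
    intro m hm; rw [mem_range] at hm; omega
  have hRd : R.natDegree ≤ k := by
    refine Polynomial.natDegree_sum_le_of_forall_le _ _ fun m hm => ?_
    exact (Polynomial.natDegree_C_mul_le _ _).trans
      ((hWd _ _ (by have := hb m hm; omega)).trans (by omega))
  have hR0 : R.eval 0 = (-1) ^ k * doubleVdm l (cubicCoord ∘ l) := by
    rw [Polynomial.eval_finsetSum, sum_eq_single 0]
    · rw [Polynomial.eval_mul, hW0 _ _ (by omega), Polynomial.eval_C, hT0]
      simp [mul_comm]
    · intro m hm hm0
      rw [Polynomial.eval_mul, hW0 _ _ (by have := hb m hm; omega), if_neg, mul_zero]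
      have := hb m hm; omega
    · simp
  have key : ∀ w : ℂ, w ≠ 0 → w ≠ 1 →
      lamOfV w ^ k * (w ^ (2 * k + 1) * T.eval (nuOfV w)⁻¹ -
        (1 - w) ^ (2 * k + 1) * T.eval (nuOfV (1 - w))⁻¹) =
      (w - (1 - w)) * R.eval (lamOfV w) := by
    intro w hw0 hw1
    have hw1' : 1 - w ≠ 0 := sub_ne_zero.2 hw1.symm
    simp only [R]
    rw [Polynomial.eval_finsetSum, Polynomial.eval_eq_sum_range, Polynomial.eval_eq_sum_range,
      mul_sum, mul_sum, mul_sum, ← sum_sub_distrib, mul_sum]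
    refine sum_congr rfl fun m hm => ?_
    obtain ⟨hm1, hm2⟩ := hb m hm
    have hw := hW (2 * k + 1 - 3 * m) (k - m) (by omega) w hw0 hw1
    rw [Polynomial.eval_mul, Polynomial.eval_C, mul_left_comm (w - (1 - w))]
    unfold lamOfV
    rw [← hw]
    have a1 : ∀ u : ℂ, u ≠ 0 → u ≠ 1 →
        (1 / (u * (1 - u))) ^ k * (u ^ (2 * k + 1) * (T.coeff m * (nuOfV u)⁻¹ ^ m)) =
        (-1) ^ m * T.coeff m * ((1 / (u * (1 - u))) ^ (k - m) * u ^ (2 * k + 1 - 3 * m)) := by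
      intro u hu0 hu1
      have hu1' : 1 - u ≠ 0 := sub_ne_zero.2 hu1.symm
      have e1 : (1 / (u * (1 - u))) ^ k =
          (1 / (u * (1 - u))) ^ (k - m) * (1 / (u * (1 - u))) ^ m := by
        rw [← pow_add]; congr 1; omega
      have e2 : u ^ (2 * k + 1) = u ^ (2 * k + 1 - 3 * m) * (u ^ 3) ^ m := by
        rw [← pow_mul, ← pow_add]; congr 1; omega
      have e3 : (1 / (u * (1 - u))) ^ m * (u ^ 3) ^ m * (nuOfV u)⁻¹ ^ m = (-1) ^ m := by
        rw [← mul_pow, ← mul_pow]; congr 1; unfold nuOfV; field_simp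
      rw [e1, e2]
      linear_combination ((1 / (u * (1 - u))) ^ (k - m) * u ^ (2 * k + 1 - 3 * m) * T.coeff m) * e3
    have b1 := a1 w hw0 hw1
    have b2 := a1 (1 - w) hw1' (by intro h; apply hw0; linear_combination -h)
    rw [show (1 - w) * (1 - (1 - w)) = w * (1 - w) by ring] at b2
    rw [mul_sub (α := ℂ), b1, b2]
    ring
  rw [← hR0, ← sum_div_nodal_eq hli hl0 hRd, mul_sum]
  refine sum_congr rfl fun c _ => ?_
  have hx1 := doubleVdm_rest_mul_prod hl0 hs (c := c) (h0 c) (h1 c) (h3 c) rfl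
    (hT _ (nuOfV_ne_zero (h0 c) (h1 c)))
  have hv1 : 1 - v c ≠ 0 := sub_ne_zero.2 (h1 c).symm
  have hv2 : 1 - v c ≠ 1 := by intro h; apply h0 c; linear_combination -h
  have hx2 := doubleVdm_rest_mul_prod hl0 hs (c := c) hv1 hv2 (h4 c)
    (lamOfV_one_sub _).symm (hT _ (nuOfV_ne_zero hv1 hv2))
  rw [sub_sub_cancel] at hx2
  have hk := key (v c) (h0 c) (h1 c)
  have hne : ∏ j, (l (c.succAbove j) - l c) ≠ 0 :=
    prod_ne_zero_iff.2 fun j _ => sub_ne_zero.2 fun e => Fin.succAbove_ne c j (hli e)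
  have hlc : l c = lamOfV (v c) := rfl
  rw [Fin.prod_univ_succAbove _ c, div_eq_iff (h2 c)]
  have e : l c * (∏ j, l (c.succAbove j)) * (Polynomial.eval (l c) R /
      (l c * ∏ j, (l (c.succAbove j) - l c))) * (v c - (1 - v c)) =
      ((v c - (1 - v c)) * R.eval (lamOfV (v c))) *
        ((∏ j, l (c.succAbove j)) / ∏ j, (l (c.succAbove j) - l c)) := by
    rw [← hlc]
    field_simp [hl0 c]
  rw [e, ← hk]
  change (-1) ^ (c : ℕ) * l c ^ k *
    doubleVdm (l ∘ c.succAbove) (cubicCoord ∘ l ∘ c.succAbove) *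
    (v c ^ (2 * k + 1) * ∏ j, (l (c.succAbove j) - nuOfV (1 - v c)) -
    (1 - v c) ^ (2 * k + 1) * ∏ j, (l (c.succAbove j) - nuOfV (v c))) = _
  rw [← hlc]
  linear_combination (l c ^ k * v c ^ (2 * k + 1)) * hx1 -
    (l c ^ k * (1 - v c) ^ (2 * k + 1)) * hx2

/-- The alternating sum of `F` over the permutations of the coordinates. -/
noncomputable def permSum {k : ℕ} (F : (Fin k → ℂ) → ℂ) (x : Fin k → ℂ) : ℂ :=
  ∑ σ : Equiv.Perm (Fin k), (Equiv.Perm.sign σ : ℂ) * F (x ∘ σ)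

/-- The sign of a family of coordinate inversions. -/
def flipSign {k : ℕ} (ε : Fin k → Bool) : ℂ := ∏ i, if ε i then -1 else 1

/-- The alternating sum of `F` over the inversions of the coordinates. -/
noncomputable def flipSum {k : ℕ} (F : (Fin k → ℂ) → ℂ) (x : Fin k → ℂ) : ℂ :=
  ∑ ε : Fin k → Bool, flipSign ε * F (flipPt ε x)

lemma permSum_bijective {k : ℕ} : Function.Bijective
    (fun p : Fin (k + 1) × Equiv.Perm (Fin k) =>
      (Equiv.Perm.decomposeFin.symm (0, p.2)).trans p.1.cycleRange.symm) := by
  rw [Fintype.bijective_iff_injective_and_card]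
  constructor
  · rintro ⟨c, τ⟩ ⟨c', τ'⟩ h
    have h0 := congrFun (congrArg DFunLike.coe h) 0
    simp [Fin.cycleRange_symm_zero] at h0
    subst h0
    have h1 : (Equiv.Perm.decomposeFin.symm (0, τ)) = Equiv.Perm.decomposeFin.symm (0, τ') := by
      ext i
      have h2 := congrFun (congrArg DFunLike.coe h) i
      simp only [Equiv.trans_apply, EmbeddingLike.apply_eq_iff_eq] at h2
      rw [h2]
    have := Equiv.Perm.decomposeFin.symm.injective h1
    simp at this
    simp [this]
  · simp [Fintype.card_perm, Nat.factorial_succ]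

lemma permSum_succ {k : ℕ} (F : (Fin (k + 1) → ℂ) → ℂ) (x : Fin (k + 1) → ℂ) :
    permSum F x = ∑ c : Fin (k + 1), (-1) ^ (c : ℕ) *
      permSum (fun w => F (Fin.cons (x c) w)) (x ∘ c.succAbove) := by
  unfold permSum
  rw [← Function.Bijective.sum_comp permSum_bijective, Fintype.sum_prod_type]
  refine sum_congr rfl fun c _ => ?_
  rw [mul_sum]
  refine sum_congr rfl fun τ _ => ?_
  have e : x ∘ ((Equiv.Perm.decomposeFin.symm (0, τ)).trans c.cycleRange.symm) =
      Fin.cons (x c) ((x ∘ c.succAbove) ∘ τ) := by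
    funext i
    refine Fin.cases ?_ (fun i => ?_) i
    · simp [Fin.cycleRange_symm_zero]
    · simp [Fin.cycleRange_symm_succ]
  rw [e, Equiv.Perm.sign_trans, Equiv.Perm.decomposeFin.symm_sign, Equiv.Perm.sign_symm]
  simp only [if_true, one_mul, Units.val_mul, Int.cast_mul, sign_cycleRange_cast]
  ring

lemma flipSum_succ {k : ℕ} (F : (Fin (k + 1) → ℂ) → ℂ) (x : Fin (k + 1) → ℂ) (c : Fin (k + 1)) :
    flipSum F x = flipSum (fun w => F (c.insertNth (x c) w)) (x ∘ c.succAbove) -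
      flipSum (fun w => F (c.insertNth (x c)⁻¹ w)) (x ∘ c.succAbove) := by
  unfold flipSum
  rw [← (Fin.insertNthEquiv (fun _ => Bool) c).sum_comp, Fintype.sum_prod_type,
    Fintype.sum_bool, sub_eq_add_neg, ← sum_neg_distrib, add_comm]
  have e : ∀ (η : Bool) (ε : Fin k → Bool),
      flipPt (c.insertNth η ε : Fin (k + 1) → Bool) x =
        c.insertNth (if η then (x c)⁻¹ else x c) (flipPt ε (x ∘ c.succAbove)) := by
    intro η ε
    funext i
    refine Fin.succAboveCases c ?_ (fun i => ?_) i
    · simp [flipPt]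
    · simp [flipPt]
  have e2 : ∀ (η : Bool) (ε : Fin k → Bool),
      flipSign (c.insertNth η ε : Fin (k + 1) → Bool) = (if η then -1 else 1) * flipSign ε := by
    intro η ε
    simp [flipSign, Fin.prod_univ_succAbove _ c]
  congr 1 <;> refine sum_congr rfl fun ε _ => ?_
  · change flipSign (c.insertNth false ε : Fin (k + 1) → Bool) *
      F (flipPt (c.insertNth false ε : Fin (k + 1) → Bool) x) = _
    simp [e, e2]
  · change flipSign (c.insertNth true ε : Fin (k + 1) → Bool) *
      F (flipPt (c.insertNth true ε : Fin (k + 1) → Bool) x) = _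
    simp [e, e2]

lemma flipSum_sum {k : ℕ} {ι : Type*} (s : Finset ι) (c : ι → ℂ) (F : ι → (Fin k → ℂ) → ℂ)
    (x : Fin k → ℂ) :
    flipSum (fun x => ∑ i ∈ s, c i * F i x) x = ∑ i ∈ s, c i * flipSum (F i) x := by
  unfold flipSum
  simp_rw [mul_sum]
  rw [sum_comm]
  exact sum_congr rfl fun i _ => sum_congr rfl fun ε _ => by ring

/-- The alternating sum of `F` over the signed permutations of the coordinates. -/
noncomputable def weylSum {k : ℕ} (F : (Fin k → ℂ) → ℂ) : (Fin k → ℂ) → ℂ := flipSum (permSum F)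

lemma weylSum_succ {k : ℕ} (F : (Fin (k + 1) → ℂ) → ℂ) (x : Fin (k + 1) → ℂ) :
    weylSum F x = ∑ c : Fin (k + 1), (-1) ^ (c : ℕ) *
      (weylSum (fun w => F (Fin.cons (x c) w)) (x ∘ c.succAbove) -
        weylSum (fun w => F (Fin.cons (x c)⁻¹ w)) (x ∘ c.succAbove)) := by
  have e : permSum F = fun x => ∑ c : Fin (k + 1), (-1) ^ (c : ℕ) *
      permSum (fun w => F (Fin.cons (x c) w)) (x ∘ c.succAbove) := by
    funext x; exact permSum_succ F x
  unfold weylSum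
  rw [e, flipSum_sum univ (fun c : Fin (k + 1) => (-1) ^ (c : ℕ))
    (fun c x => permSum (fun w => F (Fin.cons (x c) w)) (x ∘ c.succAbove))]
  refine sum_congr rfl fun c _ => ?_
  rw [flipSum_succ _ x c]
  have e3 : ∀ (z : ℂ) (w : Fin k → ℂ), (c.insertNth z w : Fin (k + 1) → ℂ) ∘ c.succAbove = w := by
    intro z w; funext i; simp
  simp only [Fin.insertNth_apply_same, e3]

lemma weylSum_mul_left {k : ℕ} (h F : (Fin k → ℂ) → ℂ) (x : Fin k → ℂ)
    (hh : ∀ ε (σ : Equiv.Perm (Fin k)), h (flipPt ε x ∘ σ) = h x) :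
    weylSum (fun w => h w * F w) x = h x * weylSum F x := by
  unfold weylSum flipSum permSum
  simp_rw [mul_sum, hh]
  exact sum_congr rfl fun ε _ => sum_congr rfl fun σ _ => by ring

/-- The points where all the denominators of the symmetrization identities are nonzero. -/
structure IsGeneralPoint {k : ℕ} (x : Fin k → ℂ) : Prop where
  ne_zero : ∀ i, x i ≠ 0
  one_add : ∀ i, 1 + x i ≠ 0
  sq : ∀ i, x i ^ 2 ≠ 1
  cube : ∀ i, vCoord (x i) ^ 3 ≠ -1 ∧ (1 - vCoord (x i)) ^ 3 ≠ -1
  inj : Function.Injective (sCoord ∘ x)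

lemma IsGeneralPoint.succAbove {k : ℕ} {x : Fin (k + 1) → ℂ} (h : IsGeneralPoint x) (c : Fin (k + 1)) :
    IsGeneralPoint (x ∘ c.succAbove) :=
  ⟨fun _ => h.ne_zero _, fun _ => h.one_add _, fun _ => h.sq _, fun _ => h.cube _,
    fun _ _ e => Fin.succAbove_right_injective (h.inj e)⟩

lemma vCoord_inv {z : ℂ} (h0 : z ≠ 0) (h1 : 1 + z ≠ 0) : vCoord z⁻¹ = 1 - vCoord z := by
  have h2 : z + 1 ≠ 0 := by rwa [add_comm]
  unfold vCoord; field_simp; ring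

lemma lamOfV_vCoord {z : ℂ} (h0 : z ≠ 0) (h1 : 1 + z ≠ 0) : lamOfV (vCoord z) = lamCoord z := by
  unfold lamOfV vCoord lamCoord; field_simp; ring

lemma sub_inv_eq {z : ℂ} (h0 : z ≠ 0) (h1 : 1 + z ≠ 0) :
    z - z⁻¹ = lamCoord z * (vCoord z - (1 - vCoord z)) := by
  unfold vCoord lamCoord; field_simp; ring

/-- The function whose signed symmetrization is evaluated in `weylSum_gogTerm`. -/
noncomputable def gogTerm : (k : ℕ) → (Fin k → ℂ) → ℂ
  | 0, _ => 1
  | k + 1, x => (∏ j : Fin k, 1 / (lamCoord (x j.succ) - nuOfV (vCoord (x 0)))) *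
      (vCoord (x 0) ^ (2 * k + 1) * gogTerm k (Fin.tail x))

lemma weylSum_gogTerm_succ {k : ℕ} {x : Fin (k + 1) → ℂ} (hx : IsGeneralPoint x) :
    weylSum (gogTerm (k + 1)) x = ∑ c : Fin (k + 1), (-1) ^ (c : ℕ) *
      (vCoord (x c) ^ (2 * k + 1) /
        (∏ j, (lamCoord (x (c.succAbove j)) - nuOfV (vCoord (x c)))) -
      (1 - vCoord (x c)) ^ (2 * k + 1) /
        (∏ j, (lamCoord (x (c.succAbove j)) - nuOfV (1 - vCoord (x c))))) *
      weylSum (gogTerm k) (x ∘ c.succAbove) := by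
  rw [weylSum_succ]
  refine sum_congr rfl fun c _ => ?_
  have key : ∀ z : ℂ, weylSum (fun w => gogTerm (k + 1) (Fin.cons z w)) (x ∘ c.succAbove) =
      vCoord z ^ (2 * k + 1) / (∏ j, (lamCoord (x (c.succAbove j)) - nuOfV (vCoord z))) *
        weylSum (gogTerm k) (x ∘ c.succAbove) := by
    intro z
    have e : (fun w : Fin k → ℂ => gogTerm (k + 1) (Fin.cons z w)) = fun w =>
        (vCoord z ^ (2 * k + 1) * ∏ j : Fin k, 1 / (lamCoord (w j) - nuOfV (vCoord z))) *
          gogTerm k w := by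
      funext w
      simp only [gogTerm, Fin.cons_succ, Fin.cons_zero, Fin.tail_cons]
      ring
    rw [e, weylSum_mul_left (fun w => vCoord z ^ (2 * k + 1) *
      ∏ j : Fin k, 1 / (lamCoord (w j) - nuOfV (vCoord z)))]
    · simp [div_eq_mul_inv]
    · intro ε σ
      congr 1
      have : ∀ j, lamCoord (flipPt ε (x ∘ c.succAbove) j) = lamCoord ((x ∘ c.succAbove) j) := by
        intro j
        unfold flipPt
        split_ifs
        · exact lamCoord_inv _
        · rfl
      simp only [Function.comp_apply] at this ⊢
      simp only [this]
      exact Equiv.prod_comp σ (fun j => 1 / (lamCoord (x (c.succAbove j)) - nuOfV (vCoord z)))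
  rw [key, key, vCoord_inv (hx.ne_zero c) (hx.one_add c)]
  ring

lemma peel_step_algebra {p q N N' κ X D V W S A L lam d σ : ℂ} {k : ℕ} (hσ : σ ≠ 0) (hlam : lam ≠ 0)
    (hd : d ≠ 0) (hS : S ≠ 0) (hL : L ≠ 0) (hW : W ≠ 0) (h : S * L = A * N * N') :
    σ * (p / N - q / N') * (κ * X * D * V / (W * L ^ k)) =
      κ * (lam * d * X) * (σ * A * V) / ((σ * S * W) * (lam ^ (k + 1) * L ^ (k + 1))) *
        (σ * lam ^ k * D * (p * N' - q * N) / d) := by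
  have h1 := mul_ne_zero hS hL
  rw [h] at h1
  have hN' := right_ne_zero_of_mul h1
  have hN := right_ne_zero_of_mul (left_ne_zero_of_mul h1)
  have hS' : S = A * N * N' / L := by rw [← h]; field_simp
  have hA := left_ne_zero_of_mul (left_ne_zero_of_mul h1)
  rw [hS']
  field_simp
  ring

lemma weylSum_gogTerm (k : ℕ) : ∃ κ : ℂ, (κ = 1 ∨ κ = -1) ∧ ∀ x : Fin k → ℂ, IsGeneralPoint x →
    weylSum (gogTerm k) x = κ * (∏ i, (x i - (x i)⁻¹)) *
      doubleVdm (lamCoord ∘ x) (sCoord ∘ x) * vdm (lamCoord ∘ x) /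
        (vdm (sCoord ∘ x) * ∏ i, lamCoord (x i) ^ k) := by
  induction k with
  | zero =>
    refine ⟨1, Or.inl rfl, fun x _ => ?_⟩
    simp [weylSum, flipSum, permSum, gogTerm, flipSign, doubleVdm, vdm]
  | succ k ih =>
    obtain ⟨κ, hκ, h⟩ := ih
    refine ⟨κ * (-1) ^ k, ?_, fun x hx => ?_⟩
    · rcases hκ with rfl | rfl <;> rcases neg_one_pow_eq_or ℂ k with e | e <;> simp [e]
    have hv0 : ∀ i, vCoord (x i) ≠ 0 := fun i => div_ne_zero (hx.ne_zero i) (hx.one_add i)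
    have hv1' : ∀ i, 1 - vCoord (x i) ≠ 0 := fun i => by
      have := hx.one_add i
      unfold vCoord; field_simp; simpa using this
    have hv1 : ∀ i, vCoord (x i) ≠ 1 := fun i => (sub_ne_zero.1 (hv1' i)).symm
    have hv2 : ∀ i, vCoord (x i) - (1 - vCoord (x i)) ≠ 0 := by
      intro i hi
      have := sub_inv_eq (hx.ne_zero i) (hx.one_add i)
      rw [hi, mul_zero] at this
      apply hx.sq i
      have h0 := hx.ne_zero i
      field_simp at this
      linear_combination this
    have hL : ∀ i, lamOfV (vCoord (x i)) = lamCoord (x i) :=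
      fun i => lamOfV_vCoord (hx.ne_zero i) (hx.one_add i)
    have hL0 : ∀ i, lamCoord (x i) ≠ 0 := fun i => by rw [← hL]; exact lamOfV_ne_zero (hv0 i) (hv1 i)
    have eL : lamOfV ∘ (vCoord ∘ x) = lamCoord ∘ x := funext hL
    have eS : cubicCoord ∘ lamOfV ∘ (vCoord ∘ x) = sCoord ∘ x := by rw [eL]; rfl
    have hp := sum_peel (v := vCoord ∘ x) hv0 hv1 hv2 (fun i => (hx.cube i).1)
      (fun i => (hx.cube i).2) (by rw [eS]; exact hx.inj)
    rw [eS, eL] at hp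
    rw [weylSum_gogTerm_succ hx]
    have hrhs : κ * (-1) ^ k * (∏ i, (x i - (x i)⁻¹)) *
        doubleVdm (lamCoord ∘ x) (sCoord ∘ x) * vdm (lamCoord ∘ x) /
        (vdm (sCoord ∘ x) * ∏ i, lamCoord (x i) ^ (k + 1)) =
        κ * (∏ i, (x i - (x i)⁻¹)) * vdm (lamCoord ∘ x) /
        (vdm (sCoord ∘ x) * ∏ i, lamCoord (x i) ^ (k + 1)) *
        ((-1) ^ k * doubleVdm (lamCoord ∘ x) (sCoord ∘ x)) := by ring
    rw [hrhs, ← hp, mul_sum]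
    refine sum_congr rfl fun c _ => ?_
    rw [h _ (hx.succAbove c)]
    have hlam : ∀ j, lamOfV ((vCoord ∘ x) j) = lamCoord (x j) := hL
    have e1 : (lamOfV ∘ (vCoord ∘ x) ∘ c.succAbove) = lamCoord ∘ x ∘ c.succAbove :=
      funext fun j => hL _
    rw [e1]
    simp only [hlam]
    rw [vdm_succAbove (lamCoord ∘ x) c, vdm_succAbove (sCoord ∘ x) c,
      Fin.prod_univ_succAbove (fun i => x i - (x i)⁻¹) c,
      Fin.prod_univ_succAbove (fun i => lamCoord (x i) ^ (k + 1)) c,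
      sub_inv_eq (hx.ne_zero c) (hx.one_add c), prod_pow, prod_pow]
    have hsix : (∏ j, (sCoord (x (c.succAbove j)) - sCoord (x c))) *
        ∏ j, lamCoord (x (c.succAbove j)) =
        (∏ j, (lamCoord (x (c.succAbove j)) - lamCoord (x c))) *
        (∏ j, (lamCoord (x (c.succAbove j)) - nuOfV (vCoord (x c)))) *
        ∏ j, (lamCoord (x (c.succAbove j)) - nuOfV (1 - vCoord (x c))) := by
      simp_rw [← prod_mul_distrib]
      refine prod_congr rfl fun j _ => ?_
      rw [sCoord_eq, sCoord_eq, ← hL c]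
      exact cubicCoord_sub (hL0 _) (hv0 c) (hv1 c)
    have hsne : ∏ j, (sCoord (x (c.succAbove j)) - sCoord (x c)) ≠ 0 :=
      prod_ne_zero_iff.2 fun j _ => sub_ne_zero.2 fun e => Fin.succAbove_ne c j (hx.inj e)
    have hlne : ∏ j, lamCoord (x (c.succAbove j)) ≠ 0 := prod_ne_zero_iff.2 fun j _ => hL0 _
    have hW : vdm (sCoord ∘ x ∘ c.succAbove) ≠ 0 := vdm_ne_zero (hx.succAbove c).inj
    have hc0 := hL0 c
    have hd := hv2 c
    have hsg : ((-1 : ℂ)) ^ (c : ℕ) ≠ 0 := pow_ne_zero _ (by norm_num)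
    exact peel_step_algebra hsg hc0 hd hsne hlne hW hsix

lemma isGeneric_comp_perm {k : ℕ} {e : Fin k → ℤ} (he : IsGeneric e) (σ : Equiv.Perm (Fin k)) :
    IsGeneric (e ∘ σ) :=
  ⟨fun i => he.1 (σ i), fun _ _ hij => he.2 _ _ fun h => hij (σ.injective h)⟩

lemma isGeneric_flip {k : ℕ} {e : Fin k → ℤ} (he : IsGeneric e) (ε : Fin k → Bool) :
    IsGeneric fun i => if ε i then -e i else e i := by
  have h : ∀ i, |if ε i then -e i else e i| = |e i| := fun i => by split_ifs <;> simp
  refine ⟨fun i hi => he.1 i ?_, fun i j hij => by rw [h, h]; exact he.2 i j hij⟩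
  exact abs_eq_zero.1 ((h i).symm.trans (abs_eq_zero.2 hi))

lemma flipPt_rad {k : ℕ} (e : Fin k → ℤ) (ε : Fin k → Bool) :
    flipPt ε (rad e) = rad fun i => if ε i then -e i else e i := by
  funext i
  by_cases h : ε i <;> simp [flipPt, rad, h]

lemma flipPt_mem_torusSet {k : ℕ} {e : Fin k → ℤ} (ε : Fin k → Bool) {x : Fin k → ℂ}
    (hx : x ∈ torusSet (rad e)) :
    flipPt ε x ∈ torusSet (rad fun i => if ε i then -e i else e i) := by
  intro i
  have := hx i
  by_cases h : ε i <;> simp_all [flipPt, rad]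

lemma torusAvg_weyl {k : ℕ} {e : Fin k → ℤ} (he : IsGeneric e) {K g : (Fin k → ℂ) → ℂ} {A : ℂ}
    (hc : ∀ e : Fin k → ℤ, IsGeneric e → ContinuousOn (fun x => K x * g x) (torusSet (rad e)))
    (hA : ∀ e : Fin k → ℤ, IsGeneric e → torusAvg (rad e) (fun x => K x * g x) = A)
    (hK : ∀ x : Fin k → ℂ, (∀ i, x i ≠ 0) → ∀ ε (σ : Equiv.Perm (Fin k)),
      K (flipPt ε x ∘ σ) = flipSign ε * (Equiv.Perm.sign σ : ℂ) * K x) :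
    torusAvg (rad e) (fun x => K x * weylSum g x) = 2 ^ k * k.factorial * A := by
  have hgen : ∀ (ε : Fin k → Bool) (σ : Equiv.Perm (Fin k)),
      IsGeneric ((fun i => if ε i then -e i else e i) ∘ σ) := fun ε σ =>
    isGeneric_comp_perm (isGeneric_flip he ε) σ
  have h1 : torusAvg (rad e) (fun x => K x * weylSum g x) = torusAvg (rad e) (fun x =>
      ∑ p : (Fin k → Bool) × Equiv.Perm (Fin k),
        (K (flipPt p.1 x ∘ p.2) * g (flipPt p.1 x ∘ p.2))) := by
    refine torusAvg_congr (fun i => (rad_pos e i).le) fun x hx => ?_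
    rw [Fintype.sum_prod_type]
    simp_rw [hK x (ne_zero_of_mem_torusSet (rad_pos e) hx), weylSum, flipSum, permSum, mul_sum]
    exact sum_congr rfl fun ε _ => sum_congr rfl fun σ _ => by ring
  rw [h1, torusAvg_sum (fun i => (rad_pos e i).le)]
  · have h2 : ∀ p ∈ (univ : Finset ((Fin k → Bool) × Equiv.Perm (Fin k))), torusAvg (rad e)
        (fun x => K (flipPt p.1 x ∘ p.2) * g (flipPt p.1 x ∘ p.2)) = A := fun p _ => by
      rw [← hA _ (hgen p.1 p.2)]
      have : rad ((fun i => if p.1 i then -e i else e i) ∘ p.2) = flipPt p.1 (rad e) ∘ p.2 := by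
        rw [flipPt_rad]; rfl
      rw [this, torusAvg_perm, torusAvg_flip]
    rw [sum_congr rfl h2]
    simp [Fintype.card_perm]
  · intro p _
    refine (hc _ (hgen p.1 p.2)).comp (f := fun x : Fin k → ℂ => flipPt p.1 x ∘ p.2) ?_ ?_
    · refine continuousOn_pi.2 fun i => ?_
      simp only [flipPt, Function.comp_apply]
      by_cases h : p.1 (p.2 i)
      · simp only [h, if_true]
        exact (continuous_apply _).continuousOn.inv₀ fun x hx =>
          ne_zero_of_mem_torusSet (rad_pos e) hx _
      · simp only [h, Bool.false_eq_true, if_false]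
        exact (continuous_apply _).continuousOn
    · intro x hx i
      exact flipPt_mem_torusSet p.1 hx (p.2 i)

lemma prod_comp_perm {k : ℕ} (f : ℂ → ℂ) (x : Fin k → ℂ) (σ : Equiv.Perm (Fin k)) :
    ∏ i, f ((x ∘ σ) i) = ∏ i, f (x i) :=
  Equiv.prod_comp σ fun i => f (x i)

lemma prod_flipPt_of_odd {k : ℕ} (f : ℂ → ℂ) (hf : ∀ z, f z⁻¹ = -f z) (ε : Fin k → Bool)
    (x : Fin k → ℂ) : ∏ i, f (flipPt ε x i) = flipSign ε * ∏ i, f (x i) := by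
  rw [flipSign, ← prod_mul_distrib]
  refine prod_congr rfl fun i _ => ?_
  by_cases h : ε i <;> simp [flipPt, h, hf]

lemma comp_flipPt_of_even {k : ℕ} (f : ℂ → ℂ) (hf : ∀ z, f z⁻¹ = f z) (ε : Fin k → Bool)
    (x : Fin k → ℂ) : f ∘ flipPt ε x = f ∘ x := by
  funext i
  by_cases h : ε i <;> simp [flipPt, h, hf]

lemma norm_mem_ne_one {z : ℂ} {a : ℤ} (hz : ‖z‖ = 100 ^ a) (ha : a ≠ 0) : ‖z‖ ≠ 1 := by
  rw [hz]
  exact fun h => ha (zpow_right_injective₀ (a := (100 : ℝ)) (by norm_num) (by norm_num)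
    (h.trans (zpow_zero _).symm))

lemma cubic_ne_zero_of_norm {z : ℂ} {a : ℤ} (hz : ‖z‖ = 100 ^ a) (ha : a ≠ 0) :
    2 * z ^ 3 + 3 * z ^ 2 + 3 * z + 1 ≠ 0 := by
  have hz' : 100 ≤ ‖z‖ ∨ ‖z‖ ≤ 1 / 100 := by
    rw [hz]
    rcases lt_or_gt_of_ne ha with h | h
    · right; have := zpow_100_step h; rw [zpow_zero] at this; linarith
    · left; have := zpow_100_step h; rw [zpow_zero] at this; linarith
  intro h
  have n0 := norm_nonneg z
  rcases hz' with h1 | h1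
  · have e : 2 * z ^ 3 = -(3 * z ^ 2 + 3 * z + 1) := by linear_combination h
    have := congrArg norm e
    rw [norm_neg] at this
    have h2 : ‖3 * z ^ 2 + 3 * z + 1‖ ≤ 3 * ‖z‖ ^ 2 + 3 * ‖z‖ + 1 := by
      refine (norm_add₃_le).trans (le_of_eq ?_); simp
    rw [← this] at h2
    simp only [norm_mul, norm_pow, RCLike.norm_ofNat] at h2
    nlinarith [mul_nonneg n0 n0, mul_nonneg (mul_nonneg n0 n0) (sub_nonneg.2 h1)]
  · have e : (1 : ℂ) = -(2 * z ^ 3 + 3 * z ^ 2 + 3 * z) := by linear_combination h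
    have := congrArg norm e
    rw [norm_neg, norm_one] at this
    have h2 : ‖2 * z ^ 3 + 3 * z ^ 2 + 3 * z‖ ≤ 2 * ‖z‖ ^ 3 + 3 * ‖z‖ ^ 2 + 3 * ‖z‖ := by
      refine (norm_add₃_le).trans (le_of_eq ?_); simp
    rw [← this] at h2
    have h3 : ‖z‖ ^ 2 ≤ 1 / 100 := by nlinarith
    have h4 : ‖z‖ ^ 3 ≤ 1 / 100 := by nlinarith
    linarith

lemma isGeneralPoint_of_mem {k : ℕ} {e : Fin k → ℤ} (he : IsGeneric e) {x : Fin k → ℂ}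
    (hx : x ∈ torusSet (rad e)) : IsGeneralPoint x := by
  have hx0 : ∀ i, x i ≠ 0 := ne_zero_of_mem_torusSet (rad_pos e) hx
  have hx1 : ∀ i, 1 + x i ≠ 0 := fun i => one_add_ne_zero_of_norm (hx i) (he.1 i)
  have hxc : ∀ i, 2 * x i ^ 3 + 3 * x i ^ 2 + 3 * x i + 1 ≠ 0 := fun i =>
    cubic_ne_zero_of_norm (hx i) (he.1 i)
  have hinv : ∀ i, ‖(x i)⁻¹‖ = 100 ^ (-e i) := fun i => by
    rw [norm_inv, hx i, rad, zpow_neg]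
  have hcc : ∀ z : ℂ, z ≠ 0 → 1 + z ≠ 0 → 2 * z ^ 3 + 3 * z ^ 2 + 3 * z + 1 ≠ 0 →
      vCoord z ^ 3 ≠ -1 := fun z _ h1 hc h => by
    unfold vCoord at h
    field_simp at h
    exact hc (by linear_combination h)
  refine ⟨hx0, hx1, fun i h => ?_, fun i => ⟨hcc _ (hx0 i) (hx1 i) (hxc i), ?_⟩, fun i j hij => ?_⟩
  · refine norm_mem_ne_one (hx i) (he.1 i) ?_
    have := congrArg norm h
    rw [norm_pow, norm_one] at this
    exact (pow_eq_one_iff_of_nonneg (norm_nonneg _) two_ne_zero).1 this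
  · rw [← vCoord_inv (hx0 i) (hx1 i)]
    exact hcc _ (inv_ne_zero (hx0 i)) (one_add_ne_zero_of_norm (hinv i) (neg_ne_zero.2 (he.1 i)))
      (cubic_ne_zero_of_norm (hinv i) (neg_ne_zero.2 (he.1 i)))
  · by_contra hne
    have h1 := sCoord_sub (hx0 i) (hx0 j) (hx1 i) (hx1 j)
    have h2 := he.2 i j hne
    have h0 := hx0 i
    have h0' := hx0 j
    rw [show sCoord (x i) = sCoord (x j) from hij, sub_self, eq_comm, div_eq_zero_iff] at h1
    have hd : x i ^ 2 * x j ^ 2 * (1 + x j) ^ 2 * (1 + x i) ^ 2 ≠ 0 := by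
      simp [hx0, hx1]
    have f1 : x i - x j ≠ 0 := fun h => h2 (by
      have := congrArg norm (sub_eq_zero.1 h)
      rw [hx i, hx j, rad, rad] at this
      rw [zpow_right_injective₀ (a := (100 : ℝ)) (by norm_num) (by norm_num) this])
    have f2 : x i * x j - 1 ≠ 0 := fun h => h2 (by
      have := congrArg norm (sub_eq_zero.1 h)
      rw [norm_mul, hx i, hx j, rad, rad, norm_one, ← zpow_add₀ (by norm_num)] at this
      have := zpow_right_injective₀ (a := (100 : ℝ)) (by norm_num) (by norm_num)
        (this.trans (zpow_zero _).symm)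
      rw [show e i = -e j by omega, abs_neg])
    have f3 := pairDen_ne_zero (hx i) (hx j) (he.1 i) (he.1 j) h2 false
    have f4 := pairDen_ne_zero (hx i) (hx j) (he.1 i) (he.1 j) h2 true
    have f6 := pairDen_ne_zero (hx j) (hx i) (he.1 j) (he.1 i) h2.symm false
    have f5 := pairDen_ne_zero (hinv i) (hinv j) (neg_ne_zero.2 (he.1 i)) (neg_ne_zero.2 (he.1 j))
      (by rwa [abs_neg, abs_neg]) true
    simp only [pairDen, if_true, Bool.false_eq_true, if_false] at f3 f4 f5 f6
    have f5' : x j + x i + x j * x i ≠ 0 := fun h => f5 (by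
      field_simp; linear_combination h)
    rcases h1 with h1 | h1
    · simp [f1, f2, f3, f4, f5', f6] at h1
    · exact hd h1

lemma pairProd_univ_succ {k : ℕ} (F : Fin (k + 1) → Fin (k + 1) → ℂ) :
    pairProd univ F = (∏ j : Fin k, F 0 j.succ) *
      pairProd univ fun a b : Fin k => F a.succ b.succ := by
  unfold pairProd
  rw [Fin.prod_univ_succ, Fin.prod_univ_succ, if_neg (lt_irrefl _), one_mul]
  refine congrArg₂ (· * ·) (prod_congr rfl fun j _ => if_pos (Fin.succ_pos j))
    (prod_congr rfl fun a _ => ?_)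
  rw [Fin.prod_univ_succ, if_neg (Fin.not_lt_zero _), one_mul]
  simp_rw [Fin.succ_lt_succ_iff]

lemma gogPair_eq {p q : ℂ} (hp : p ≠ 0) (hq1 : 1 + q ≠ 0) :
    gogPair p q = lamCoord p * (1 + q) / (lamCoord p - nuOfV (vCoord q)) := by
  have h1 : pairDen true p q * pairDen false p q =
      p * (1 + q) * (lamCoord p - nuOfV (vCoord q)) := by
    have hv : 1 - vCoord q = 1 / (1 + q) := by unfold vCoord; field_simp; ring
    unfold nuOfV
    rw [hv]
    simp only [pairDen, lamCoord, vCoord, if_true, Bool.false_eq_true, if_false]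
    field_simp
    ring
  rw [gogPair, h1, lamCoord]
  generalize (1 + p) ^ 2 / p - nuOfV (vCoord q) = c
  by_cases hc : c = 0
  · simp [hc]
  · field_simp

lemma pairProd_gogPair_mul {k : ℕ} {x : Fin k → ℂ} (hx : ∀ i, x i ≠ 0) (hx1 : ∀ i, 1 + x i ≠ 0) :
    (pairProd univ fun i j => gogPair (x j) (x i)) * (∏ i, vCoord (x i) ^ (k - (i : ℕ))) *
      (∏ i, lamCoord (x i)) = (∏ i, lamCoord (x i)) ^ k * gogTerm k x := by
  induction k with
  | zero => simp [pairProd, gogTerm]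
  | succ k ih =>
    have h := ih (x := Fin.tail x) (fun i => hx _) (fun i => hx1 _)
    simp only [Fin.tail] at h
    rw [pairProd_univ_succ, Fin.prod_univ_succ, Fin.prod_univ_succ, gogTerm]
    simp only [Fin.val_zero, Fin.val_succ, Nat.add_sub_add_right, Nat.sub_zero]
    rw [prod_congr rfl fun (j : Fin k) _ => gogPair_eq (hx j.succ) (hx1 0)]
    simp only [prod_div_distrib, prod_mul_distrib, prod_const, card_univ, Fintype.card_fin, one_pow]
    have hv : lamCoord (x 0) * vCoord (x 0) = 1 + x 0 := by
      have h0 := hx 0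
      have h1 := hx1 0
      unfold lamCoord vCoord; field_simp
    rw [← hv]
    generalize (pairProd univ fun i j => gogPair (x (Fin.succ j)) (x (Fin.succ i))) = A at *
    generalize (∏ i : Fin k, vCoord (x i.succ) ^ (k - (i : ℕ))) = V at *
    generalize (∏ j : Fin k, (lamCoord (x j.succ) - nuOfV (vCoord (x 0)))) = N at *
    generalize (∏ j : Fin k, lamCoord (x j.succ)) = L at *
    generalize gogTerm k _ = g at *
    calc _ = L * (lamCoord (x 0) * vCoord (x 0)) ^ k / N * vCoord (x 0) ^ (k + 1) *
          lamCoord (x 0) * (A * V * L) := by ring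
      _ = _ := by rw [h]; ring

/-- The common `W`-symmetric integrand of the two enumerations. -/
noncomputable def commonIntegrand {k : ℕ} (n : ℕ) (x : Fin k → ℂ) : ℂ :=
  doubleVdm (lamCoord ∘ x) (sCoord ∘ x) ^ 2 * vdm (lamCoord ∘ x) / vdm (sCoord ∘ x) *
    ((∏ i, (1 / x i - x i)) * (∏ i, (x i - (x i)⁻¹)) * ∏ i, lamCoord (x i) ^ (n - 1))

lemma gogAvg_eq_commonIntegrand (k : ℕ) (hk : 1 ≤ k) : ∃ κ : ℂ, (κ = 1 ∨ κ = -1) ∧ ∀ n, k ≤ n →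
    ∀ e : Fin k → ℤ, IsGeneric e →
      2 ^ k * k.factorial * gogAvg n (fun i : Fin k => k - (i : ℕ)) =
        κ * torusAvg (rad e) (commonIntegrand n) := by
  obtain ⟨κ, hκ, hw⟩ := weylSum_gogTerm k
  refine ⟨κ, hκ, fun n hn e he => ?_⟩
  set b : Fin k → ℕ := fun i => k - (i : ℕ) with hb
  have hbs : StrictAnti b := fun i j hij => by
    have h1 := i.2
    have h2 := j.2
    simp only [hb]
    rw [Fin.lt_def] at hij
    omega
  set K : (Fin k → ℂ) → ℂ := fun x => doubleVdm (lamCoord ∘ x) (sCoord ∘ x) *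
    ((∏ i, (1 / x i - x i)) * ∏ i, lamCoord (x i) ^ (n + k - 1)) with hK
  have hlam : ∀ e : Fin k → ℤ, IsGeneric e → ∀ x ∈ torusSet (rad e), ∀ i, lamCoord (x i) ≠ 0 :=
    fun e he x hx i => div_ne_zero (pow_ne_zero _ ((isGeneralPoint_of_mem he hx).one_add i))
      ((isGeneralPoint_of_mem he hx).ne_zero i)
  have hKg : ∀ e : Fin k → ℤ, IsGeneric e → ∀ x ∈ torusSet (rad e),
      K x * gogTerm k x = polarFun (hNum n b) x := fun e he x hx => by
    have hg := isGeneralPoint_of_mem he hx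
    rw [← kernelBase_gog_mul n b hg.ne_zero hg.one_add]
    have h1 : (Matrix.of fun m i : Fin k => gogEntry m (x i)).det =
        doubleVdm (lamCoord ∘ x) (sCoord ∘ x) := by
      rw [doubleVdm, ← Matrix.det_transpose]
      rfl
    have hL : ∏ i, lamCoord (x i) ≠ 0 := prod_ne_zero_iff.2 fun i _ => hlam e he x hx i
    have h2 := pairProd_gogPair_mul hg.ne_zero hg.one_add
    rw [kernelBase, h1, prod_mul_distrib]
    simp only [hK, prod_pow]
    rw [show n + k - 1 = n + (k - 1) by omega, pow_add]
    have h3 : (∏ i, lamCoord (x i)) ^ k = (∏ i, lamCoord (x i)) ^ (k - 1) * ∏ i, lamCoord (x i) := by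
      rw [← pow_succ]; congr 1; omega
    rw [h3] at h2
    have h4 := mul_right_cancel₀ hL (h2.trans (mul_right_comm _ _ _))
    simp only [hb] at *
    linear_combination (-doubleVdm (lamCoord ∘ x) (sCoord ∘ x) * (∏ i, (1 / x i - x i)) *
      (∏ i, lamCoord (x i)) ^ n) * h4
  have hKe : ∀ x : Fin k → ℂ, (∀ i, x i ≠ 0) → ∀ ε (σ : Equiv.Perm (Fin k)),
      K (flipPt ε x ∘ σ) = flipSign ε * (Equiv.Perm.sign σ : ℂ) * K x := fun x _ ε σ => by
    simp only [hK]
    rw [← Function.comp_assoc, ← Function.comp_assoc, comp_flipPt_of_even _ lamCoord_inv,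
      comp_flipPt_of_even _ sCoord_inv, doubleVdm_perm,
      prod_comp_perm (fun z => 1 / z - z), prod_comp_perm (fun z => lamCoord z ^ (n + k - 1)),
      prod_flipPt_of_odd (fun z => 1 / z - z) (fun z => by simp)]
    have : ∏ i, lamCoord (flipPt ε x i) ^ (n + k - 1) = ∏ i, lamCoord (x i) ^ (n + k - 1) :=
      prod_congr rfl fun i _ => by
        rw [show lamCoord (flipPt ε x i) = lamCoord (x i) from
          congrFun (comp_flipPt_of_even _ lamCoord_inv ε x) i]
    rw [this]
    ring
  have hmain := torusAvg_weyl he (K := K) (g := gogTerm k) (A := gogAvg n b) (fun e he => ?_)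
    (fun e he => ?_) hKe
  · rw [← hmain, ← torusAvg_const_mul]
    refine torusAvg_congr (fun i => (rad_pos e i).le) fun x hx => ?_
    rw [hw x (isGeneralPoint_of_mem he hx)]
    simp only [hK, commonIntegrand, prod_pow]
    have hL : ∏ i, lamCoord (x i) ≠ 0 := prod_ne_zero_iff.2 fun i _ => hlam e he x hx i
    rw [show n + k - 1 = (n - 1) + k by omega, pow_add]
    field_simp
  · refine ContinuousOn.congr (f := polarFun (hNum n b)) (fun x hx => ?_) (hKg e he)
    have hg := isGeneralPoint_of_mem he hx
    exact (differentiableAt_polarFun (differentiableAt_hNum_of_or n b hg.ne_zero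
      fun l => Or.inl (hg.one_add l)) fun a c hac τ => pairDen_ne_zero (hx c) (hx a) (he.1 c)
      (he.1 a) (he.2 c a hac.ne') τ).continuousAt.continuousWithinAt
  · rw [← torusAvg_hNum_of_isGeneric he hbs (N := n) fun i => by simp only [hb]; omega]
    exact torusAvg_congr (fun i => (rad_pos e i).le) (hKg e he)

/-- The average counting the chains of Magog trapezoids. -/
noncomputable def magogAvg {k : ℕ} (N : ℕ) (b : Fin k → ℕ) : ℂ :=
  IsKernel.avg (fun m z => lamCoord z ^ m) (fun _ _ => 1) N (1 / 8) fun x => ∏ i, vCoord (x i) ^ b i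

lemma isKernel_magog : IsKernel 1 (fun m z => lamCoord z ^ m) (fun m z => (1 + z) ^ (2 * m))
    (fun _ _ => 1) where
  phi_eq m z hz _ := by
    unfold lamCoord
    rw [div_pow, ← pow_mul, zpow_neg, zpow_natCast]
    field_simp
  diff m z _ := by fun_prop
  at_zero m := by simp
  pair_diff p _ _ := by fun_prop
  pair_zero := rfl
  pair_ne_zero _ _ _ _ := one_ne_zero
  symm β p q _ _ := by
    simp only [nullPoly, Nat.add_sub_cancel, one_ne_zero, if_false]
    ring

lemma differentiableAt_lamCoord {z : ℂ} (hz : z ≠ 0) : DifferentiableAt ℂ lamCoord z := by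
  unfold lamCoord
  exact DifferentiableAt.div (by fun_prop) (by fun_prop) hz

lemma pairProd_one {ι : Type*} [LinearOrder ι] (s : Finset ι) :
    (pairProd s fun _ _ => (1 : ℂ)) = 1 := by simp [pairProd]

lemma kernelBase_magog {k : ℕ} (N : ℕ) (x : Fin k → ℂ) :
    kernelBase (fun m z => lamCoord z ^ m) (fun _ _ => 1) N x =
      vdm (lamCoord ∘ x) * ((∏ i, (1 / x i - x i)) * ∏ i, lamCoord (x i) ^ N) := by
  rw [kernelBase, pairProd_one, mul_one, prod_mul_distrib, vdm, ← Matrix.det_transpose]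
  rfl

lemma differentiableAt_vdm {k : ℕ} {f : (Fin k → ℂ) → Fin k → ℂ} {x : Fin k → ℂ}
    (hf : ∀ i, DifferentiableAt ℂ (fun x => f x i) x) : DifferentiableAt ℂ (fun x => vdm (f x)) x := by
  unfold vdm
  exact differentiableAt_det fun i m => (hf i).pow _

lemma differentiableAt_kernelBase_magog {k : ℕ} (N : ℕ) {x : Fin k → ℂ} (hx : ∀ i, x i ≠ 0) :
    DifferentiableAt ℂ (kernelBase (fun m z => lamCoord z ^ m) (fun _ _ => 1) N) x := by
  have hl : ∀ i, DifferentiableAt ℂ (fun x : Fin k → ℂ => lamCoord (x i)) x := fun i =>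
    DifferentiableAt.comp (g := lamCoord) (f := fun x : Fin k → ℂ => x i) x
      (differentiableAt_lamCoord (hx i)) (differentiableAt_apply i x)
  have e : kernelBase (fun m z => lamCoord z ^ m) (fun _ _ => 1) N = fun x : Fin k → ℂ =>
      vdm (lamCoord ∘ x) * ((∏ i, (1 / x i - x i)) * ∏ i, lamCoord (x i) ^ N) :=
    funext fun x => kernelBase_magog N x
  rw [e]
  refine DifferentiableAt.mul (differentiableAt_vdm hl) (DifferentiableAt.mul ?_ ?_)
  · refine differentiableAt_prod _ fun i _ => ?_
    have := (differentiableAt_apply (𝕜 := ℂ) i x).fun_inv (hx i)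
    simp only [one_div]
    exact this.sub (differentiableAt_apply i x)
  · exact differentiableAt_prod _ fun i _ => (hl i).pow _

lemma kernelBase_magog_flip {k : ℕ} (N : ℕ) (ε : Fin k → Bool) (x : Fin k → ℂ) :
    kernelBase (fun m z => lamCoord z ^ m) (fun _ _ => 1) N (flipPt ε x) =
      flipSign ε * kernelBase (fun m z => lamCoord z ^ m) (fun _ _ => 1) N x := by
  rw [kernelBase_magog, kernelBase_magog, comp_flipPt_of_even _ lamCoord_inv,
    prod_flipPt_of_odd (fun z => 1 / z - z) (fun z => by simp)]
  have : ∏ i, lamCoord (flipPt ε x i) ^ N = ∏ i, lamCoord (x i) ^ N :=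
    prod_congr rfl fun i _ => by
      rw [show lamCoord (flipPt ε x i) = lamCoord (x i) from
        congrFun (comp_flipPt_of_even _ lamCoord_inv ε x) i]
  rw [this]
  ring

lemma circleAverage_eq_zero_of_odd {h : ℂ → ℂ} {r : ℝ} (hr : 0 < r) (hr1 : r ≤ 1)
    (hd : ∀ z, z ≠ 0 → DifferentiableAt ℂ h z) (hodd : ∀ z, h z⁻¹ = -h z) :
    Real.circleAverage h 0 r = 0 := by
  rw [circleAverage_eq_of_differentiable_punctured hr one_pos hr1 le_rfl fun z hz _ => hd z hz]
  have h1 := Real.circleAverage_zero_one_congr_inv (f := h)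
  have h2 : Real.circleAverage (fun z => h z⁻¹) 0 1 = -Real.circleAverage h 0 1 := by
    have : (fun z => h z⁻¹) = fun z => (-1 : ℂ) • h z := funext fun z => by simp [hodd]
    rw [this, Real.circleAverage_fun_smul]
    simp
  rw [h2] at h1
  exact self_eq_neg.1 h1.symm

lemma flipPt_single_update {k : ℕ} (x : Fin k → ℂ) (i : Fin k) (z : ℂ) :
    Function.update x i z⁻¹ = flipPt (fun j => decide (j = i)) (Function.update x i z) := by
  funext j
  by_cases hj : j = i
  · subst hj; simp [flipPt]
  · simp [flipPt, hj]

lemma magogAvg_eq_zero_of_wall {k : ℕ} (N : ℕ) {b : Fin k → ℕ} {i : Fin k} (hb : b i = 0) :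
    magogAvg N b = 0 := by
  have hv : SmallHol fun x : Fin k → ℂ => ∏ i, vCoord (x i) ^ b i :=
    SmallHol.prod _ fun i _ => (smallHol_vCoord i).pow _
  refine torusAvg_eq_zero_of_coord (fun _ => by norm_num)
    (isKernel_magog.continuousOn_mul N (by norm_num) le_rfl hv) i fun x hx => ?_
  have hx0 := ne_zero_of_mem_torusSet (fun _ => by norm_num) hx
  have hc : ∀ z, ∏ j, vCoord (Function.update x i z j) ^ b j = ∏ j, vCoord (x j) ^ b j := fun z =>
    prod_congr rfl fun j _ => by
      by_cases hj : j = i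
      · rw [hj, hb, pow_zero, pow_zero]
      · rw [Function.update_of_ne hj]
  simp only [hc]
  refine circleAverage_eq_zero_of_odd (by norm_num) (by norm_num) (fun z hz => ?_) fun z => ?_
  · refine DifferentiableAt.mul_const (differentiableAt_update
      (f := kernelBase (fun m z => lamCoord z ^ m) (fun _ _ => 1) N)
      (differentiableAt_kernelBase_magog N fun j => ?_)) _
    by_cases hj : j = i
    · subst hj; simpa using hz
    · rw [Function.update_of_ne hj]; exact hx0 j
  · have : flipSign (fun j => decide (j = i)) = -1 := by
      simp only [flipSign, decide_eq_true_eq]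
      rw [prod_ite_eq' univ i]
      simp
    rw [flipPt_single_update, kernelBase_magog_flip, this]
    ring

/-- The product of the coordinates `vCoord (x m)` over `m ≤ l`. -/
noncomputable def prefixProd {k : ℕ} (x : Fin k → ℂ) (l : Fin k) : ℂ :=
  ∏ m ∈ univ.filter (· ≤ l), vCoord (x m)

/-- The strictly decreasing sequence with the gaps `d l + 1`. -/
def gapSum {k B : ℕ} (d : Fin k → Fin B) (m : Fin k) : ℕ :=
  ∑ l ∈ univ.filter (m ≤ ·), ((d l : ℕ) + 1)

lemma prod_pow_gapSum {k B : ℕ} (v : Fin k → ℂ) (d : Fin k → Fin B) :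
    ∏ m, v m ^ gapSum d m = ∏ l, (∏ m ∈ univ.filter (· ≤ l), v m) ^ ((d l : ℕ) + 1) := by
  simp only [gapSum, ← prod_pow_eq_pow_sum, prod_filter, ← prod_pow, ite_pow, one_pow]
  exact prod_comm

lemma norm_vCoord_le {z : ℂ} (hz : ‖z‖ ≤ 1 / 8) : ‖vCoord z‖ ≤ 1 / 7 := by
  have h1 : 7 / 8 ≤ ‖1 + z‖ := by
    have : 1 - ‖z‖ ≤ ‖1 + z‖ := by simpa using norm_sub_norm_le 1 (-z)
    linarith
  rw [vCoord, norm_div, div_le_iff₀ (by linarith)]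
  linarith

lemma one_sub_prefixProd_ne_zero {k : ℕ} {x : Fin k → ℂ} (hx : ∀ i, ‖x i‖ ≤ 1 / 8) (l : Fin k) :
    1 - prefixProd x l ≠ 0 := by
  have h1 : ‖prefixProd x l‖ ≤ 1 / 7 := by
    unfold prefixProd
    rw [← mul_prod_erase (univ.filter (· ≤ l)) _ (by simp : l ∈ univ.filter (· ≤ l)), norm_mul, norm_prod]
    have h2 : ∏ m ∈ (univ.filter (· ≤ l)).erase l, ‖vCoord (x m)‖ ≤ 1 :=
      prod_le_one (fun _ _ => norm_nonneg _) fun m _ => (norm_vCoord_le (hx m)).trans (by norm_num)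
    have h3 := norm_vCoord_le (hx l)
    nlinarith [norm_nonneg (vCoord (x l))]
  intro h
  rw [← sub_eq_zero.1 h, norm_one] at h1
  norm_num at h1

lemma smallHol_prefixProd {k : ℕ} (l : Fin k) : SmallHol fun x : Fin k → ℂ => prefixProd x l :=
  SmallHol.prod _ fun i _ => smallHol_vCoord i

lemma smallHol_prod_prefixProd_div {k : ℕ} :
    SmallHol fun x : Fin k → ℂ => ∏ l, prefixProd x l / (1 - prefixProd x l) := by
  refine SmallHol.prod _ fun l _ x hx => ?_
  have h := smallHol_prefixProd l x hx
  simp only [div_eq_mul_inv]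
  exact h.mul (((differentiableAt_const _).sub h).fun_inv (one_sub_prefixProd_ne_zero hx l))

lemma sum_prod_pow_gapSum {k B : ℕ} {x : Fin k → ℂ} (hx : ∀ i, ‖x i‖ ≤ 1 / 8) :
    ∑ d : Fin k → Fin B, ∏ i, vCoord (x i) ^ gapSum d i =
      (∏ l, prefixProd x l / (1 - prefixProd x l)) * ∏ l, (1 - prefixProd x l ^ B) := by
  simp only [prod_pow_gapSum]
  rw [← Fintype.prod_sum (f := fun (l : Fin k) (t : Fin B) =>
    (∏ m ∈ univ.filter (· ≤ l), vCoord (x m)) ^ ((t : ℕ) + 1)), ← prod_mul_distrib]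
  refine prod_congr rfl fun l _ => ?_
  have h1 := one_sub_prefixProd_ne_zero hx l
  change ∑ t : Fin B, prefixProd x l ^ ((t : ℕ) + 1) = _
  rw [Fin.sum_univ_eq_sum_range (fun t => prefixProd x l ^ (t + 1)) B]
  have h2 := mul_neg_geom_sum (prefixProd x l) B
  simp only [pow_succ, ← sum_mul]
  rw [div_mul_eq_mul_div, eq_div_iff h1]
  linear_combination prefixProd x l * h2

lemma sum_magogAvg_gapSum {k : ℕ} (hk : 1 ≤ k) {N B : ℕ} (hB : N + k ≤ B) :
    ∑ d : Fin k → Fin B, magogAvg N (gapSum d) =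
      IsKernel.avg (fun m z => lamCoord z ^ m) (fun _ _ => 1) N (1 / 8)
        fun x : Fin k → ℂ => ∏ l, prefixProd x l / (1 - prefixProd x l) := by
  set Q : (Fin k → ℂ) → ℂ := fun x => ∏ l, prefixProd x l / (1 - prefixProd x l) with hQ
  have hv : ∀ b : Fin k → ℕ, SmallHol fun x : Fin k → ℂ => ∏ i, vCoord (x i) ^ b i := fun b =>
    SmallHol.prod _ fun i _ => (smallHol_vCoord i).pow _
  have hr : (0 : ℝ) < 1 / 8 := by norm_num
  have h1 : ∑ d : Fin k → Fin B, magogAvg N (gapSum d) =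
      IsKernel.avg (fun m z => lamCoord z ^ m) (fun _ _ => 1) N (1 / 8)
        fun x : Fin k → ℂ => Q x * ∏ l, (1 - prefixProd x l ^ B) := by
    simp only [magogAvg, IsKernel.avg]
    rw [← torusAvg_sum (fun _ => hr.le) _ fun d _ =>
      isKernel_magog.continuousOn_mul N hr le_rfl (hv _)]
    refine torusAvg_congr (fun _ => hr.le) fun x hx => ?_
    rw [← mul_sum, sum_prod_pow_gapSum fun i => (hx i).le]
  have hpow : ∀ s : Finset (Fin k), SmallHol fun x : Fin k → ℂ => ∏ l ∈ s, (1 - prefixProd x l ^ B) :=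
    fun s => SmallHol.prod _ fun l _ => (SmallHol.const 1).sub ((smallHol_prefixProd l).pow B)
  have key : ∀ s : Finset (Fin k), IsKernel.avg (fun m z => lamCoord z ^ m) (fun _ _ => 1) N (1 / 8)
      (fun x : Fin k → ℂ => Q x * ∏ l ∈ s, (1 - prefixProd x l ^ B)) =
      IsKernel.avg (fun m z => lamCoord z ^ m) (fun _ _ => 1) N (1 / 8) Q := by
    intro s
    induction s using Finset.induction_on with
    | empty => simp
    | insert l s hl ih =>
      rw [← ih, ← sub_eq_zero, ← isKernel_magog.avg_sub N hr le_rfl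
        (smallHol_prod_prefixProd_div.mul (hpow _)) (smallHol_prod_prefixProd_div.mul (hpow _))]
      set i0 : Fin k := ⟨0, hk⟩
      have hi0 : ∀ l : Fin k, i0 ≤ l := fun l => Nat.zero_le _
      set R : Fin k → (Fin k → ℂ) → ℂ := fun l x =>
        ∏ m ∈ (univ.filter (· ≤ l)).erase i0, vCoord (x m) with hR
      have hRl : ∀ l x, prefixProd x l = vCoord (x i0) * R l x := fun l x =>
        (mul_prod_erase (univ.filter (· ≤ l)) (fun m => vCoord (x m))
          (mem_filter.2 ⟨mem_univ _, hi0 l⟩ : i0 ∈ univ.filter (· ≤ l))).symm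
      have hR' : ∀ l, SmallHol (R l) := fun l => SmallHol.prod _ fun i _ => smallHol_vCoord i
      have hrest : SmallHol fun x : Fin k → ℂ => ∏ l ∈ univ.erase i0, prefixProd x l /
          (1 - prefixProd x l) := by
        refine SmallHol.prod _ fun l _ x hx => ?_
        have h := smallHol_prefixProd l x hx
        simp only [div_eq_mul_inv]
        exact h.mul (((differentiableAt_const _).sub h).fun_inv (one_sub_prefixProd_ne_zero hx l))
      have hinv : SmallHol fun x : Fin k → ℂ => (1 - prefixProd x i0)⁻¹ := fun x hx =>
        ((differentiableAt_const _).sub (smallHol_prefixProd i0 x hx)).fun_inv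
          (one_sub_prefixProd_ne_zero hx i0)
      have hz := isKernel_magog.avg_eq_zero_of_large N hr le_rfl (k := k) (i := i0) (hB := hB)
        (g := fun x => R l x ^ B * (R i0 x * (1 - prefixProd x i0)⁻¹ *
          (∏ l ∈ univ.erase i0, prefixProd x l / (1 - prefixProd x l))) *
          ((-1) * ∏ l ∈ s, (1 - prefixProd x l ^ B)))
        ((((hR' l).pow B).mul (((hR' i0).mul hinv).mul hrest)).mul ((SmallHol.const (-1)).mul (hpow s)))
      rw [← hz]
      refine IsKernel.avg_congr N hr le_rfl fun x _ _ => ?_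
      rw [prod_insert hl, ← mul_prod_erase univ _ (mem_univ i0), div_eq_mul_inv,
        show prefixProd x i0 * (1 - prefixProd x i0)⁻¹ =
          vCoord (x i0) * R i0 x * (1 - prefixProd x i0)⁻¹ by rw [← hRl], hRl l]
      ring
  rw [h1, key univ]

/-- The product of `w / (1 - w)` over the products `w` of `vCoord` over final segments. -/
noncomputable def suffixTerm : (k : ℕ) → (Fin k → ℂ) → ℂ
  | 0, _ => 1
  | k + 1, x => (∏ i, vCoord (x i)) / (1 - ∏ i, vCoord (x i)) * suffixTerm k (Fin.tail x)

lemma suffixTerm_eq_prod {k : ℕ} (x : Fin k → ℂ) :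
    suffixTerm k x = ∏ l, (∏ m, if l ≤ m then vCoord (x m) else 1) /
      (1 - ∏ m, if l ≤ m then vCoord (x m) else 1) := by
  induction k with
  | zero => simp [suffixTerm]
  | succ k ih =>
    rw [suffixTerm, ih, Fin.prod_univ_succ (fun l => (∏ m, if l ≤ m then vCoord (x m) else 1) /
      (1 - ∏ m, if l ≤ m then vCoord (x m) else 1))]
    congr 1
    refine prod_congr rfl fun l _ => ?_
    rw [Fin.prod_univ_succ (fun m => if l.succ ≤ m then vCoord (x m) else 1)]
    simp [Fin.tail]

lemma prod_prefixProd_eq_suffixTerm {k : ℕ} (x : Fin k → ℂ) :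
    ∏ l, prefixProd x l / (1 - prefixProd x l) = suffixTerm k (x ∘ Fin.revPerm) := by
  have h : ∀ l, prefixProd x l =
      ∏ m, if Fin.revPerm l ≤ m then vCoord ((x ∘ Fin.revPerm) m) else 1 := fun l => by
    rw [prefixProd, prod_filter, ← Equiv.prod_comp Fin.revPerm]
    refine prod_congr rfl fun m _ => ?_
    have : Fin.revPerm m ≤ l ↔ Fin.revPerm l ≤ m := by
      simp only [Fin.revPerm_apply, Fin.le_def, Fin.val_rev]; omega
    simp only [this, Function.comp]
  rw [suffixTerm_eq_prod]
  simp only [h]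
  exact Equiv.prod_comp Fin.revPerm fun l =>
    (∏ m, if l ≤ m then vCoord ((x ∘ Fin.revPerm) m) else 1) /
      (1 - ∏ m, if l ≤ m then vCoord ((x ∘ Fin.revPerm) m) else 1)

lemma permSum_perm {k : ℕ} (F : (Fin k → ℂ) → ℂ) (x : Fin k → ℂ) (τ : Equiv.Perm (Fin k)) :
    permSum F (x ∘ τ) = (Equiv.Perm.sign τ : ℂ) * permSum F x := by
  unfold permSum
  rw [← Equiv.sum_comp (Equiv.mulLeft τ)
    (fun σ : Equiv.Perm (Fin k) => (Equiv.Perm.sign σ : ℂ) * F (x ∘ σ)), mul_sum]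
  refine sum_congr rfl fun σ _ => ?_
  have h : ((Equiv.Perm.sign τ : ℤ) : ℂ) * ((Equiv.Perm.sign τ : ℤ) : ℂ) = 1 := by
    rcases Int.units_eq_one_or (Equiv.Perm.sign τ) with h | h <;> simp [h]
  simp only [Equiv.coe_mulLeft, Equiv.Perm.sign_mul, Units.val_mul, Int.cast_mul]
  have e : (x ∘ τ) ∘ σ = x ∘ (τ * σ : Equiv.Perm (Fin k)) := rfl
  rw [e, ← mul_assoc, ← mul_assoc, h, one_mul]

lemma permSum_comp_perm {k : ℕ} (F : (Fin k → ℂ) → ℂ) (x : Fin k → ℂ) (τ : Equiv.Perm (Fin k)) :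
    permSum (fun x => F (x ∘ τ)) x = (Equiv.Perm.sign τ : ℂ) * permSum F x := by
  unfold permSum
  rw [← Equiv.sum_comp (Equiv.mulRight τ)
    (fun σ : Equiv.Perm (Fin k) => (Equiv.Perm.sign σ : ℂ) * F (x ∘ σ)), mul_sum]
  refine sum_congr rfl fun σ _ => ?_
  have h : ((Equiv.Perm.sign τ : ℤ) : ℂ) * ((Equiv.Perm.sign τ : ℤ) : ℂ) = 1 := by
    rcases Int.units_eq_one_or (Equiv.Perm.sign τ) with h | h <;> simp [h]
  simp only [Equiv.coe_mulRight, Equiv.Perm.sign_mul, Units.val_mul, Int.cast_mul]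
  have e : (x ∘ σ) ∘ τ = x ∘ (σ * τ : Equiv.Perm (Fin k)) := rfl
  rw [e]
  linear_combination -((Equiv.Perm.sign σ : ℂ) * F (x ∘ (σ * τ : Equiv.Perm (Fin k)))) * h

lemma permSum_eq_zero_of_not_injective {k : ℕ} (F : (Fin k → ℂ) → ℂ) {x : Fin k → ℂ}
    (hx : ¬ Function.Injective x) : permSum F x = 0 := by
  obtain ⟨i, j, hij, hne⟩ : ∃ i j, x i = x j ∧ i ≠ j := by
    simpa [Function.Injective] using hx
  have h := permSum_perm F x (Equiv.swap i j)
  have e : x ∘ Equiv.swap i j = x := by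
    funext m
    simp only [Function.comp, Equiv.swap_apply_def]
    split_ifs with h1 h2
    · rw [h1, hij]
    · rw [h2, hij]
    · rfl
  rw [e, Equiv.Perm.sign_swap hne] at h
  simp only [Units.val_neg, Units.val_one, Int.cast_neg, Int.cast_one, neg_mul, one_mul] at h
  exact self_eq_neg.1 h

/-- The coordinate in which the pair factors `1 + p + q` become differences. -/
noncomputable def halfSq (z : ℂ) : ℂ := (z + 1 / 2) ^ 2

lemma halfSq_sub (p q : ℂ) : halfSq p - halfSq q = (p - q) * (1 + p + q) := by
  unfold halfSq; ring

lemma vdm_eq_pairProd {k : ℕ} (s : Fin k → ℂ) :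
    vdm s = pairProd univ fun i j => s j - s i := by
  rw [vdm, Matrix.det_vandermonde, pairProd]
  refine prod_congr rfl fun i _ => ?_
  rw [← prod_filter]
  refine prod_congr ?_ fun _ _ => rfl
  ext j; simp

lemma vdm_halfSq {k : ℕ} (x : Fin k → ℂ) :
    vdm (halfSq ∘ x) = vdm x * pairProd univ fun i j => 1 + x j + x i := by
  rw [vdm_eq_pairProd, vdm_eq_pairProd, ← pairProd_mul]
  refine pairProd_congr fun i _ j _ _ => ?_
  simp only [Function.comp]
  exact halfSq_sub _ _

lemma sum_prod_one_add_div {k : ℕ} {x : Fin (k + 1) → ℂ} (hx : Function.Injective x)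
    (h0 : ∀ i, x i ≠ 0) (h2 : ∀ i, 1 + 2 * x i ≠ 0) :
    (∏ i, x i) * ∑ c, (∏ j, (1 + x (c.succAbove j) + x c)) /
      (x c * ∏ j, (x (c.succAbove j) - x c)) = (∏ i, (1 + x i)) - ∏ i, x i := by
  open Polynomial in
  set p : ℂ[X] := ∏ i, (X + C (1 + x i)) - ∏ i, (C (x i) - X) with hp
  have hdeg : p.natDegree ≤ k + 1 := by
    refine (natDegree_sub_le _ _).trans (max_le ?_ ?_)
    · refine (natDegree_prod_le _ _).trans ((sum_le_card_nsmul _ _ 1 fun i _ => ?_).trans (by simp))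
      rw [natDegree_X_add_C]
    · refine (natDegree_prod_le _ _).trans ((sum_le_card_nsmul _ _ 1 fun i _ => ?_).trans (by simp))
      exact (natDegree_sub_le _ _).trans (by simp)
  have hroot : p.IsRoot (-1 / 2) := by
    simp only [hp, IsRoot.def, eval_sub, eval_prod, eval_add, eval_X, eval_C]
    rw [sub_eq_zero]
    exact prod_congr rfl fun i _ => by ring
  obtain ⟨q, hq⟩ := dvd_iff_isRoot.2 hroot
  have hqdeg : q.natDegree ≤ k := by
    by_cases hq0 : q = 0
    · simp [hq0]
    rw [hq, natDegree_mul (X_sub_C_ne_zero _) hq0, natDegree_X_sub_C] at hdeg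
    omega
  have hev : ∀ z, (∏ i, (z + (1 + x i))) - ∏ i, (x i - z) = (z + 1 / 2) * q.eval z := fun z => by
    have := congrArg (eval z) hq
    simp only [hp, eval_sub, eval_prod, eval_add, eval_X, eval_C, eval_mul] at this
    rw [this]; ring
  have h := sum_div_nodal_eq hx h0 hqdeg
  have hc : ∀ c, q.eval (x c) = 2 * ∏ j, (1 + x (c.succAbove j) + x c) := fun c => by
    have h3 := hev (x c)
    rw [Fin.prod_univ_succAbove _ c, Fin.prod_univ_succAbove (fun i => x i - x c) c, sub_self,
      zero_mul, sub_zero] at h3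
    have h4 : ∏ j, (x c + (1 + x (c.succAbove j))) = ∏ j, (1 + x (c.succAbove j) + x c) :=
      prod_congr rfl fun j _ => by ring
    rw [h4] at h3
    refine mul_left_cancel₀ (h2 c) ?_
    linear_combination -2 * h3
  have h5 := hev 0
  simp only [zero_add, sub_zero] at h5
  rw [h5, ← h]
  simp only [hc, mul_div_assoc, ← mul_sum]
  ring

lemma permSum_suffixTerm {k : ℕ} {x : Fin k → ℂ} (hx : Function.Injective x)
    (h0 : ∀ i, x i ≠ 0) (hs : ∀ i, ‖x i‖ ≤ 1 / 8) :
    permSum (suffixTerm k) x = (∏ i, x i) * vdm x ^ 2 / vdm (halfSq ∘ x) := by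
  induction k with
  | zero => simp [permSum, suffixTerm, vdm]
  | succ k ih =>
    have hnorm : ∀ z w : ℂ, ‖z‖ ≤ 1 / 8 → ‖w‖ ≤ 1 / 8 → 1 + z + w ≠ 0 := fun z w hz hw h => by
      have h1 : (1 : ℂ) = -(z + w) := by linear_combination h
      have h2 := congrArg norm h1
      rw [norm_one, norm_neg] at h2
      linarith [norm_add_le z w]
    have hone : ∀ i, 1 + x i ≠ 0 := fun i => by simpa using hnorm (x i) 0 (hs i) (by simp)
    set V := ∏ i, vCoord (x i) with hV
    have hV1 : 1 - V ≠ 0 := by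
      have := one_sub_prefixProd_ne_zero hs (Fin.last k)
      rw [prefixProd, filter_true_of_mem fun m _ => Fin.le_last m] at this
      exact this
    have hsq : Function.Injective (halfSq ∘ x) := fun i j hij => by
      have h1 : halfSq (x i) - halfSq (x j) = 0 := sub_eq_zero.2 hij
      rw [halfSq_sub] at h1
      exact hx (sub_eq_zero.1 ((mul_eq_zero.1 h1).resolve_right (hnorm _ _ (hs i) (hs j))))
    have hvx := vdm_ne_zero hx
    have hvq := vdm_ne_zero hsq
    have hpx : ∏ i, x i ≠ 0 := prod_ne_zero_iff.2 fun i _ => h0 i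
    have hVe : V = (∏ i, x i) / ∏ i, (1 + x i) := by
      rw [hV, ← prod_div_distrib]; rfl
    have hp1 : ∏ i, (1 + x i) ≠ 0 := prod_ne_zero_iff.2 fun i _ => hone i
    have hterm : ∀ c : Fin (k + 1), (-1) ^ (c : ℕ) *
        permSum (fun w => suffixTerm (k + 1) (Fin.cons (x c) w)) (x ∘ c.succAbove) =
        V / (1 - V) * ((∏ i, x i) * vdm x ^ 2 / vdm (halfSq ∘ x)) *
          ((∏ j, (1 + x (c.succAbove j) + x c)) / (x c * ∏ j, (x (c.succAbove j) - x c))) := by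
      intro c
      have e1 : permSum (fun w => suffixTerm (k + 1) (Fin.cons (x c) w)) (x ∘ c.succAbove) =
          V / (1 - V) * permSum (suffixTerm k) (x ∘ c.succAbove) := by
        unfold permSum
        rw [mul_sum]
        refine sum_congr rfl fun σ _ => ?_
        have : ∏ i, vCoord ((Fin.cons (x c) ((x ∘ c.succAbove) ∘ σ) : Fin (k + 1) → ℂ) i) = V := by
          rw [hV, Fin.prod_univ_succ, Fin.prod_univ_succAbove _ c]
          simp only [Fin.cons_zero, Fin.cons_succ, Function.comp]
          rw [Equiv.prod_comp σ fun j => vCoord (x (c.succAbove j))]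
        change _ * (_ / (1 - _) * _) = _
        rw [this, Fin.tail_cons]
        ring
      rw [e1, ih (hx.comp Fin.succAbove_right_injective) (fun _ => h0 _) fun _ => hs _]
      have e2 := vdm_succAbove x c
      have e3 := vdm_succAbove (halfSq ∘ x) c
      simp only [Function.comp_apply, halfSq_sub, prod_mul_distrib] at e3
      rw [Function.comp_assoc] at e3
      have e4 : ∏ i, x i = x c * ∏ j, x (c.succAbove j) := Fin.prod_univ_succAbove _ c
      have hA : ∏ j, (x (c.succAbove j) - x c) ≠ 0 := fun h => by
        rw [h] at e2; simp at e2; exact hvx e2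
      have hB : ∏ j, (1 + x (c.succAbove j) + x c) ≠ 0 := fun h => by
        rw [h] at e3; simp at e3; exact hvq e3
      have hq : vdm (halfSq ∘ x ∘ c.succAbove) ≠ 0 := fun h => by
        rw [h] at e3; simp at e3; exact hvq e3
      rw [e2, e3, e4]
      simp only [Function.comp]
      have hxc := h0 c
      have hsg : ((-1 : ℂ) ^ (c : ℕ)) ^ 2 = 1 := by rw [← pow_mul, mul_comm, pow_mul]; simp
      have hs0 : ((-1 : ℂ) ^ (c : ℕ)) ≠ 0 := by simp
      change (-1) ^ (c : ℕ) * (V / (1 - V) * ((∏ j, x (c.succAbove j)) * vdm (x ∘ c.succAbove) ^ 2 /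
        vdm (halfSq ∘ x ∘ c.succAbove))) = _
      generalize (-1 : ℂ) ^ (c : ℕ) = σ at *
      change _ = V / (1 - V) * ((x c * ∏ j, x (c.succAbove j)) * (σ * _ * vdm (x ∘ c.succAbove)) ^ 2 /
        _) * _
      generalize hVV : V / (1 - V) = VV
      field_simp
    rw [permSum_succ, sum_congr rfl fun c _ => hterm c, ← mul_sum]
    have hfin := sum_prod_one_add_div hx h0 fun i => by
      have := hnorm (x i) (x i) (hs i) (hs i); rwa [add_assoc, ← two_mul] at this
    have hd : (∏ i, (1 + x i)) - ∏ i, x i ≠ 0 := fun h => hV1 (by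
      rw [hVe, ← sub_eq_zero.1 h, div_self hp1, sub_self])
    have e5 : V / (1 - V) * ((∏ i, (1 + x i)) - ∏ i, x i) = ∏ i, x i := by
      have : 1 - V = ((∏ i, (1 + x i)) - ∏ i, x i) / ∏ i, (1 + x i) := by rw [hVe]; field_simp
      rw [this, hVe]; field_simp
    calc _ = V / (1 - V) * (vdm x ^ 2 / vdm (halfSq ∘ x)) * ((∏ i, x i) *
          ∑ c, (∏ j, (1 + x (c.succAbove j) + x c)) / (x c * ∏ j, (x (c.succAbove j) - x c))) := by ring
      _ = (V / (1 - V) * ((∏ i, (1 + x i)) - ∏ i, x i)) * (vdm x ^ 2 / vdm (halfSq ∘ x)) := by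
          rw [hfin]; ring
      _ = _ := by rw [e5]; ring

/-- The numerator of the integrand summing over all Magog trapezoids. -/
noncomputable def magNum {k : ℕ} (N : ℕ) (x : Fin k → ℂ) : ℂ :=
  kernelBase (fun m z => lamCoord z ^ m) (fun _ _ => 1) N x * ((∏ i, x i) * vdm x) *
    pairProd univ fun a b => pairDen false (x b) (x a)

lemma differentiableAt_magNum {k : ℕ} (N : ℕ) {x : Fin k → ℂ} (hx : ∀ i, x i ≠ 0) :
    DifferentiableAt ℂ (magNum N) x := by
  refine DifferentiableAt.mul ((differentiableAt_kernelBase_magog N hx).mul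
    (DifferentiableAt.mul ?_ ?_)) (differentiableAt_pairProd fun a b _ => ?_)
  · exact differentiableAt_prod _ fun i _ => differentiableAt_apply i x
  · exact differentiableAt_vdm (f := fun x => x) fun i => differentiableAt_apply i x
  · simp only [pairDen, Bool.false_eq_true, if_false]
    fun_prop

lemma pairProd_eq_zero {k : ℕ} {F : Fin k → Fin k → ℂ} {a b : Fin k} (hab : a < b) (h : F a b = 0) :
    pairProd univ F = 0 :=
  prod_eq_zero (mem_univ a) (prod_eq_zero (mem_univ b) (by rw [if_pos hab, h]))

lemma pairProd_vdm_reduced {k : ℕ} {a c : Fin k} (hac : a < c) :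
    ∃ κ : (Fin k → ℂ) → ℂ, (∀ x x' : Fin k → ℂ, (∀ m, m ≠ a → m ≠ c → x m = x' m) → κ x = κ x') ∧
      ∀ x : Fin k → ℂ, 1 + x c + x a = 0 →
        (∀ m, m ≠ a → m ≠ c → 1 + x m + x a ≠ 0 ∧ 1 + x m + x c ≠ 0) →
        (pairProd univ fun i j => (x j - x i) * if i = a ∧ j = c then 1 else (1 + x j + x i)⁻¹) =
          κ x * (x c - x a) := by
  refine ⟨fun x => (∏ m ∈ (univ.erase a).erase c,
    ((if m < a then -1 else 1) * (if m < c then -1 else 1))) *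
    pairProd ((univ.erase a).erase c) fun i j =>
      (x j - x i) * if i = a ∧ j = c then 1 else (1 + x j + x i)⁻¹, fun x x' h => ?_, fun x hx hne => ?_⟩
  · simp only
    congr 1
    refine pairProd_congr fun i hi j hj _ => ?_
    rw [h i (mem_erase.1 (mem_erase.1 hi).2).1 (mem_erase.1 hi).1,
      h j (mem_erase.1 (mem_erase.1 hj).2).1 (mem_erase.1 hj).1]
  · rw [pairProd_split hac]
    simp only [and_self, if_true, mul_one]
    rw [mul_comm (x c - x a), mul_right_comm]
    congr 2
    refine prod_congr rfl fun m hm => ?_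
    have hmc := (mem_erase.1 hm).1
    have hma := (mem_erase.1 (mem_erase.1 hm).2).1
    obtain ⟨h1, h2⟩ := hne m hma hmc
    have e1 : 1 + x m + x a = x m - x c := by linear_combination hx
    have e2 : 1 + x m + x c = x m - x a := by linear_combination hx
    have e1' : 1 + x a + x m = x m - x c := by linear_combination hx
    have e2' : 1 + x c + x m = x m - x a := by linear_combination hx
    rw [e1] at h1
    rw [e2] at h2
    have h3 : ¬ (a = a ∧ m = c) := fun h => hmc h.2
    have h4 : ¬ (m = a ∧ c = c) := fun h => hma h.1
    have h5 : ¬ (m = a ∧ a = c) := fun h => hma h.1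
    have h6 : ¬ (c = a ∧ m = c) := fun h => hmc h.2
    unfold pairFactor
    beta_reduce
    rw [if_neg h3, if_neg h4, if_neg h5, if_neg h6, e1, e2, e1', e2']
    split_ifs <;> · field_simp <;> ring

lemma update_update_apply {k : ℕ} (x : Fin k → ℂ) {i l m : Fin k} (hmi : m ≠ i) (hml : m ≠ l)
    (z w : ℂ) : Function.update (Function.update x l z) i w m = x m := by
  rw [Function.update_of_ne hmi, Function.update_of_ne hml]

lemma prod_update_update {k : ℕ} (f : ℂ → ℂ) (x : Fin k → ℂ) {i l : Fin k} (hli : l ≠ i) (z w : ℂ) :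
    ∏ m, f (Function.update (Function.update x l z) i w m) =
      f w * f z * ∏ m ∈ (univ.erase i).erase l, f (x m) := by
  rw [← mul_prod_erase univ _ (mem_univ i),
    ← mul_prod_erase (univ.erase i) _ (mem_erase.2 ⟨hli, mem_univ l⟩), Function.update_self,
    Function.update_of_ne hli, Function.update_self, mul_assoc]
  congr 2
  refine prod_congr rfl fun m hm => ?_
  rw [update_update_apply x (mem_erase.1 (mem_erase.1 hm).2).1 (mem_erase.1 hm).1]

/-- The Vandermonde matrix of `lamCoord` along `x i = -1 - z`, `x l = z`, cleared of denominators. -/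
noncomputable def clearedVdm {k : ℕ} (x : Fin k → ℂ) (i l : Fin k) (z : ℂ) : ℂ :=
  (Matrix.of fun a m : Fin k => if a = i then (-z ^ 2) ^ (m : ℕ) * (1 + z) ^ (k - 1 - m) else
    if a = l then (1 + z) ^ (2 * (m : ℕ)) * z ^ (k - 1 - m) else lamCoord (x a) ^ (m : ℕ)).det

lemma differentiable_clearedVdm {k : ℕ} (x : Fin k → ℂ) (i l : Fin k) :
    Differentiable ℂ (clearedVdm x i l) := by
  unfold clearedVdm
  simp only [Matrix.det_apply, Matrix.of_apply]
  refine Differentiable.fun_sum fun σ _ => Differentiable.const_smul ?_ _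
  refine Differentiable.fun_finsetProd fun m _ => ?_
  split_ifs <;> fun_prop

lemma clearedVdm_eq {k : ℕ} (x : Fin k → ℂ) {i l : Fin k} (hli : l ≠ i) {z : ℂ} (hz : z ≠ 0)
    (hz1 : 1 + z ≠ 0) : clearedVdm x i l z = (z * (1 + z)) ^ (k - 1) *
      vdm (lamCoord ∘ Function.update (Function.update x l z) i (-1 - z)) := by
  set w : Fin k → ℂ := fun a => if a = i then (1 + z) ^ (k - 1) else if a = l then z ^ (k - 1) else 1
    with hw
  have h1 : ∏ a, w a = (z * (1 + z)) ^ (k - 1) := by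
    rw [← mul_prod_erase univ _ (mem_univ i),
      ← mul_prod_erase (univ.erase i) _ (mem_erase.2 ⟨hli, mem_univ l⟩), prod_eq_one]
    · simp only [hw, if_true, if_neg hli, mul_one]; rw [mul_pow, mul_comm]
    · intro m hm
      simp only [hw, if_neg (mem_erase.1 (mem_erase.1 hm).2).1, if_neg (mem_erase.1 hm).1]
  rw [← h1, vdm, ← Matrix.det_mul_column, clearedVdm]
  congr 1
  ext a m
  have hm : k - 1 = m + (k - 1 - m) := by have := m.2; omega
  simp only [Matrix.of_apply, Matrix.vandermonde_apply, hw, Function.comp]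
  by_cases hai : a = i
  · subst hai
    have : lamCoord (-1 - z) = -z ^ 2 / (1 + z) := by
      have h3 : -1 - z ≠ 0 := fun h => hz1 (by linear_combination -h)
      unfold lamCoord; field_simp; ring
    rw [if_pos rfl, if_pos rfl, Function.update_self, this, div_pow]
    conv_rhs => rw [hm, pow_add]
    field_simp
  · rw [if_neg hai, if_neg hai, Function.update_of_ne hai]
    by_cases hal : a = l
    · subst hal
      rw [if_pos rfl, if_pos rfl, Function.update_self, lamCoord, div_pow, ← pow_mul]
      conv_rhs => rw [hm, pow_add]
      field_simp
    · rw [if_neg hal, if_neg hal, Function.update_of_ne hal, one_mul]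

lemma torusAvg_poleTerm_magNum {k : ℕ} {e : Fin k → ℤ} {i : Fin k} {e₁ : ℤ} (he : IsGeneric e)
    (he₁ : IsGeneric (Function.update e i e₁))
    (hout : ∀ l, i < l → e l < 0 ∧ e i + e l < 0) {N : ℕ} (hN : k ≤ N + 1) {l : Fin k} {τ : Bool}
    (hq : (l, τ) ∈ crossed e i e₁) : torusAvg (rad e) (poleTerm (magNum N) i l τ) = 0 := by
  have hq' := hq
  simp only [crossed, mem_filter, mem_univ, true_and] at hq'
  have hli := hq'.1
  cases τ
  · refine torusAvg_zero (fun j => (rad_pos e j).le) fun x hx => ?_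
    have hlt := hq'.2.1 rfl
    have hz1 := (crossed_mem_facts he hq hx).2.1
    have : magNum N (Function.update x i (pole false (x l))) = 0 := by
      rw [magNum, pairProd_eq_zero hlt, mul_zero]
      rw [Function.update_self, Function.update_of_ne hlt.ne]
      simp only [pole, pairDen, Bool.false_eq_true, if_false]
      field_simp
      ring
    rw [poleTerm, reducedFun, this]
    simp
  obtain ⟨a, c, hac, hmin, hmax, hset⟩ : ∃ a c, a < c ∧ min i l = a ∧ max i l = c ∧
      (a = l ∧ c = i ∨ a = i ∧ c = l) := by
    rcases lt_or_gt_of_ne hli with h | h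
    · exact ⟨l, i, h, min_eq_right h.le, max_eq_left h.le, Or.inl ⟨rfl, rfl⟩⟩
    · exact ⟨i, l, h, min_eq_left h.le, max_eq_right h.le, Or.inr ⟨rfl, rfl⟩⟩
  obtain ⟨κ, hκ, hred⟩ := pairProd_vdm_reduced hac
  refine torusAvg_eq_zero_of_coord (fun j => (rad_pos e j).le)
    (continuousOn_poleTerm (q := (l, _)) he he₁ hout
      (fun x h1 _ => differentiableAt_magNum N h1) hq) l fun x hx => ?_
  set δ : ℂ := if a = l then -1 else 1 with hδ
  set Q : ℂ := κ x * δ * (∏ m ∈ (univ.erase i).erase l, (1 - x m ^ 2)) *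
    ∏ m ∈ (univ.erase i).erase l, lamCoord (x m) ^ N with hQ
  refine circleAverage_eq_zero_of_eq_mul (rad_pos e l) (G := fun z => Q *
    ((2 + z) * (1 - z) * (1 + 2 * z) * (-1) ^ N * (z * (1 + z)) ^ (N - (k - 1)) *
      clearedVdm x i l z)) ?_ ?_
  · intro z _
    have := differentiable_clearedVdm x i l z
    fun_prop
  · intro z hz
    have hxz : Function.update x l z ∈ torusSet (rad e) := by
      simpa using update_mem_torusSet (i := l) hx hz
    have hfacts := crossed_mem_facts he hq hxz
    have hden := crossed_pairDen_ne_zero he he₁ hout hxz hq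
    simp only [Function.update_self, hmin, hmax] at hfacts hden
    obtain ⟨hz0, hz1, hp0, -⟩ := hfacts
    set X : Fin k → ℂ := Function.update (Function.update x l z) i (-1 - z) with hX
    have hpole : pole true z = -1 - z := rfl
    rw [hpole] at hden hp0
    rw [← hX] at hden
    have hXi : X i = -1 - z := by rw [hX, Function.update_self]
    have hXl : X l = z := by rw [hX, Function.update_of_ne hli, Function.update_self]
    have h0 : ∀ m, X m ≠ 0 := fun m => by
      by_cases hm : m = i
      · rw [hm, hXi]; exact hp0
      · rw [hX, Function.update_of_ne hm]; exact ne_zero_of_mem_torusSet (rad_pos e) hxz m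
    have hsum : 1 + X c + X a = 0 := by
      rcases hset with ⟨rfl, rfl⟩ | ⟨rfl, rfl⟩ <;> rw [hXi, hXl] <;> ring
    have hdiff : X c - X a = δ * (1 + 2 * z) := by
      rcases hset with ⟨rfl, rfl⟩ | ⟨rfl, rfl⟩
      · rw [hXi, hXl, hδ, if_pos rfl]; ring
      · rw [hXi, hXl, hδ, if_neg (Ne.symm hli)]; ring
    have hκX : κ X = κ x := hκ _ _ fun m h1 h2 => by
      rcases hset with ⟨rfl, rfl⟩ | ⟨rfl, rfl⟩
      · exact update_update_apply x h2 h1 _ _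
      · exact update_update_apply x h1 h2 _ _
    have hne : ∀ m n, m ≠ n → ¬ (m = a ∧ n = c) → ¬ (m = c ∧ n = a) → 1 + X m + X n ≠ 0 := by
      intro m n hmn h1 h2
      rcases lt_or_gt_of_ne hmn with h | h
      · have := hden m n h true fun h => h1 ⟨h.1, h.2.1⟩
        simpa [pairDen, add_right_comm] using this
      · have := hden n m h true fun h => h2 ⟨h.2.1, h.1⟩
        simpa [pairDen] using this
    have hR := hred X hsum fun m h1 h2 => ⟨hne m a h1 (fun h => h1 h.1) fun h => h2 h.1,
      hne m c h2 (fun h => h1 h.1) fun h => h2 h.1⟩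
    have hredF : reducedFun (magNum N) a c true X =
        kernelBase (fun m z => lamCoord z ^ m) (fun _ _ => 1) N X * (∏ m, X m) *
          (κ X * (X c - X a)) := by
      rw [reducedFun, magNum, vdm_eq_pairProd, ← hR, mul_assoc _ (pairProd _ _) (pairProd _ _),
        ← pairProd_mul, mul_assoc, mul_assoc, mul_assoc, ← pairProd_mul]
      congr 2
      refine (pairProd_congr fun p _ q _ hpq => ?_)
      have h1 := hden p q hpq false (by simp)
      simp only [and_true, reduceCtorEq, and_false, if_false]
      have h2 : pairDen true (X q) (X p) = 1 + X q + X p := rfl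
      rw [h2]
      field_simp
    have hprod : (∏ m, (1 / X m - X m)) * ∏ m, X m = ∏ m, (1 - X m ^ 2) := by
      rw [← prod_mul_distrib]
      exact prod_congr rfl fun m _ => by have := h0 m; field_simp
    rw [poleTerm, Function.update_self, hpole, ← hX, hmin, hmax, hredF, kernelBase_magog, hκX, hdiff]
    have hcv := clearedVdm_eq x hli hz0 hz1
    rw [← hX] at hcv
    have hlam := prod_update_update (fun u => lamCoord u ^ N) x hli z (-1 - z)
    have hsq := prod_update_update (fun u => 1 - u ^ 2) x hli z (-1 - z)
    simp only [← hX] at hlam hsq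
    rw [hsq] at hprod
    have hll : lamCoord (-1 - z) ^ N * lamCoord z ^ N = (-1) ^ N * ((z * (1 + z)) ^ (N - (k - 1)) *
        (z * (1 + z)) ^ (k - 1)) := by
      rw [← pow_add, Nat.sub_add_cancel (by omega), ← mul_pow, ← mul_pow]
      congr 1
      unfold lamCoord; field_simp; ring
    rw [hcv, hlam, hll]
    simp only [if_true, div_one]
    rw [div_eq_iff hp0]
    simp only [hQ]
    generalize vdm (lamCoord ∘ X) = V
    generalize (∏ m ∈ (univ.erase i).erase l, lamCoord (x m) ^ N) = L at *
    linear_combination (V * ((-1) ^ N * ((z * (1 + z)) ^ (N - (k - 1)) *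
        (z * (1 + z)) ^ (k - 1)) * L) * (κ x * (δ * (1 + 2 * z)))) * hprod

lemma magNum_shrink {k : ℕ} {e : Fin k → ℤ} (he : IsGeneric e) {N : ℕ} (hN : k ≤ N + 1)
    {M : ℕ} (hM : ∀ i, |e i| ≤ M) {m : ℕ} (hm : m ≤ k) :
    torusAvg (rad e) (polarFun (magNum N)) = torusAvg (rad (shrink e M m)) (polarFun (magNum N)) := by
  induction m with
  | zero =>
    congr 2
    funext i
    have := i.2
    simp [shrink, this]
  | succ m ih =>
    rw [ih (by omega)]
    obtain ⟨i, hi⟩ : ∃ i : Fin k, (i : ℕ) + (m + 1) = k :=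
      ⟨⟨k - (m + 1), by omega⟩, by simp only; omega⟩
    have hei : shrink e M m i = e i := by rw [shrink, if_neg (by omega)]
    have h1 := abs_le.1 (hM i)
    rw [shrink_succ e M hi]
    have he₁ : IsGeneric (Function.update (shrink e M m) i (-((M : ℤ) + 1 + i))) := by
      rw [← shrink_succ e M hi]; exact isGeneric_shrink he hM (m + 1)
    have hout : ∀ l, i < l → shrink e M m l < 0 ∧ shrink e M m i + shrink e M m l < 0 := fun l hl => by
      rw [Fin.lt_def] at hl
      rw [hei, shrink, if_pos (by omega)]
      omega
    exact torusAvg_polarFun_move (isGeneric_shrink he hM m) he₁ (by rw [hei]; omega) hout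
      (fun x h _ => differentiableAt_magNum N h)
      fun l τ hq => torusAvg_poleTerm_magNum (isGeneric_shrink he hM m) he₁ hout hN hq

lemma torusAvg_magNum {k : ℕ} {e : Fin k → ℤ} (he : IsGeneric e) {N : ℕ} (hN : k ≤ N + 1) :
    torusAvg (rad e) (polarFun (magNum N)) = torusAvg (fun _ : Fin k => 1 / 8) (polarFun (magNum N)) := by
  obtain ⟨M, hM⟩ : ∃ M : ℕ, ∀ i, |e i| ≤ M :=
    ⟨∑ i, (e i).natAbs, fun i => by
      rw [Int.abs_eq_natAbs]
      exact_mod_cast single_le_sum (f := fun i => (e i).natAbs) (fun _ _ => Nat.zero_le _) (mem_univ i)⟩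
  rw [magNum_shrink he hN hM le_rfl]
  refine torusAvg_eq_of_differentiable (B := 1 / 8) (fun x hx hx8 => ?_) (rad_pos _)
    (fun i => rad_le_of_neg ?_) (fun _ => by norm_num) fun _ => le_rfl
  · exact differentiableAt_polarFun (differentiableAt_magNum N hx)
      fun a c _ τ => pairDen_ne_zero_of_small (hx8 c) (hx8 a) τ
  · rw [shrink, if_pos (by omega)]; omega

/-- The signed maximal minors of the matrix of `doubleVdm`. -/
noncomputable def doubleCofactor {k : ℕ} (a s : Fin (k + 1) → ℂ) (j : Fin (k + 1)) : ℂ :=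
  (-1) ^ (j : ℕ) * doubleVdm (a ∘ j.succAbove) (s ∘ j.succAbove)

lemma sum_doubleCofactor {k : ℕ} (a s : Fin (k + 1) → ℂ) (f : Fin (k + 1) → ℂ) :
    ∑ j, doubleCofactor a s j * f j = (Matrix.of fun i => (Fin.cons (f i) fun m : Fin k =>
      a i ^ ((m : ℕ) % 2) * s i ^ ((m : ℕ) / 2) : Fin (k + 1) → ℂ)).det := by
  rw [Matrix.det_succ_column_zero]
  refine sum_congr rfl fun j _ => ?_
  have : ((Matrix.of fun i => (Fin.cons (f i) fun m : Fin k =>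
      a i ^ ((m : ℕ) % 2) * s i ^ ((m : ℕ) / 2) : Fin (k + 1) → ℂ)).submatrix j.succAbove
        Fin.succ).det = doubleVdm (a ∘ j.succAbove) (s ∘ j.succAbove) := rfl
  rw [this, doubleCofactor, Matrix.of_apply, Fin.cons_zero]
  ring

lemma sum_doubleCofactor_pow {k : ℕ} (a s : Fin (k + 1) → ℂ) {m : ℕ} (hm : m < k) :
    ∑ j, doubleCofactor a s j * (a j ^ (m % 2) * s j ^ (m / 2)) = 0 := by
  rw [sum_doubleCofactor]
  refine Matrix.det_zero_of_column_eq (i := 0) (j := (⟨m, hm⟩ : Fin k).succ)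
    (Fin.succ_ne_zero _).symm fun i => ?_
  simp only [Matrix.of_apply, Fin.cons_zero, Fin.cons_succ]

lemma sum_doubleCofactor_last {p : ℕ} (a s : Fin (2 * p + 1) → ℂ) :
    ∑ j, doubleCofactor a s j * s j ^ p = doubleVdm a s := by
  rw [doubleVdm, Matrix.det_succ_column _ (Fin.last _)]
  refine sum_congr rfl fun j _ => ?_
  have h : ((Matrix.of fun i m : Fin (2 * p + 1) => a i ^ ((m : ℕ) % 2) * s i ^ ((m : ℕ) / 2)).submatrix
      j.succAbove (Fin.last _).succAbove).det = doubleVdm (a ∘ j.succAbove) (s ∘ j.succAbove) := by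
    rw [Fin.succAbove_last]; rfl
  rw [h, doubleCofactor, Matrix.of_apply, Fin.val_last, pow_add, pow_mul]
  have e1 : 2 * p % 2 = 0 := by omega
  have e2 : 2 * p / 2 = p := by omega
  rw [e1, e2]
  ring

lemma doubleVdm_cons_cons {k : ℕ} (a₀ s₀ : ℂ) (a s : Fin (k + 1) → ℂ) :
    doubleVdm (Fin.cons a₀ a : Fin (k + 2) → ℂ) (Fin.cons s₀ s) =
      ∑ j, doubleCofactor a s j * (a j - a₀) * ∏ l, (s (j.succAbove l) - s₀) := by
  have key : ∀ f : Fin (k + 1) → ℂ, (Matrix.of fun i => (Fin.cons (f i) fun m : Fin k =>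
      (s i - s₀) * (a i ^ ((m : ℕ) % 2) * s i ^ ((m : ℕ) / 2)) : Fin (k + 1) → ℂ)).det =
      ∑ j, doubleCofactor a s j * f j * ∏ l, (s (j.succAbove l) - s₀) := by
    intro f
    rw [Matrix.det_succ_column_zero]
    refine sum_congr rfl fun j _ => ?_
    have : ((Matrix.of fun i => (Fin.cons (f i) fun m : Fin k =>
        (s i - s₀) * (a i ^ ((m : ℕ) % 2) * s i ^ ((m : ℕ) / 2)) : Fin (k + 1) → ℂ)).submatrix
          j.succAbove Fin.succ).det =
        (∏ l, (s (j.succAbove l) - s₀)) * doubleVdm (a ∘ j.succAbove) (s ∘ j.succAbove) :=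
      Matrix.det_mul_column _ _
    rw [this, doubleCofactor, Matrix.of_apply, Fin.cons_zero]
    ring
  rw [doubleVdm_eq_det, Matrix.det_succ_row_zero, Fin.sum_univ_succ, Fin.sum_univ_succ,
    sum_eq_zero, add_zero]
  · have h0 : ((Matrix.of fun i : Fin (k + 2) => (Fin.cons 1 (Fin.cons
        ((Fin.cons a₀ a : Fin (k + 2) → ℂ) i) fun m : Fin k =>
        ((Fin.cons s₀ s : Fin (k + 2) → ℂ) i - (Fin.cons s₀ s : Fin (k + 2) → ℂ) 0) *
          ((Fin.cons a₀ a : Fin (k + 2) → ℂ) i ^ ((m : ℕ) % 2) *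
            (Fin.cons s₀ s : Fin (k + 2) → ℂ) i ^ ((m : ℕ) / 2))) : Fin (k + 2) → ℂ)).submatrix
          Fin.succ (Fin.succAbove 0)).det =
        ∑ j, doubleCofactor a s j * a j * ∏ l, (s (j.succAbove l) - s₀) := by
      rw [← key]; rfl
    have h1 : ((Matrix.of fun i : Fin (k + 2) => (Fin.cons 1 (Fin.cons
        ((Fin.cons a₀ a : Fin (k + 2) → ℂ) i) fun m : Fin k =>
        ((Fin.cons s₀ s : Fin (k + 2) → ℂ) i - (Fin.cons s₀ s : Fin (k + 2) → ℂ) 0) *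
          ((Fin.cons a₀ a : Fin (k + 2) → ℂ) i ^ ((m : ℕ) % 2) *
            (Fin.cons s₀ s : Fin (k + 2) → ℂ) i ^ ((m : ℕ) / 2))) : Fin (k + 2) → ℂ)).submatrix
          Fin.succ (Fin.succAbove (Fin.succ 0))).det =
        ∑ j, doubleCofactor a s j * 1 * ∏ l, (s (j.succAbove l) - s₀) := by
      rw [← key (fun _ => 1)]
      congr 1
      ext i m
      refine Fin.cases ?_ (fun m => ?_) m
      · simp
      · simp [Matrix.submatrix_apply]
    rw [h0, h1]
    simp only [Fin.val_zero, pow_zero, one_mul, Matrix.of_apply, Fin.cons_zero, Fin.cons_succ,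
      Fin.val_succ, zero_add, pow_one, mul_one, mul_sum, ← sum_add_distrib]
    refine sum_congr rfl fun j _ => ?_
    ring
  · intro m _
    simp

lemma sum_div_sub_nodal_eq {k : ℕ} {l : Fin (k + 1) → ℂ} (hl : Function.Injective l) {z : ℂ}
    (h0 : ∀ i, l i ≠ z) {R : Polynomial ℂ} (hR : R.natDegree ≤ k) :
    (∏ i, (l i - z)) * ∑ c, R.eval (l c) / ((l c - z) * ∏ j, (l (c.succAbove j) - l c)) =
      R.eval z := by
  have h := sum_div_nodal_eq (l := fun i => l i - z) (fun i j h => hl (sub_left_injective h))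
    (fun i => sub_ne_zero.2 (h0 i)) (R := R.comp (Polynomial.X + Polynomial.C z))
    (by rw [Polynomial.natDegree_comp, Polynomial.natDegree_X_add_C, mul_one]; exact hR)
  simpa using h

lemma sum_div_nodal_eq_coeff {p : ℕ} {l : Fin (2 * p + 1) → ℂ} (hl : Function.Injective l)
    {R : Polynomial ℂ} (hR : R.natDegree ≤ 2 * p) :
    ∑ c, R.eval (l c) / ∏ j, (l (c.succAbove j) - l c) = R.coeff (2 * p) := by
  have hd : R.degree < ((univ : Finset (Fin (2 * p + 1))).card : WithBot ℕ) := by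
    rw [card_univ, Fintype.card_fin]
    exact lt_of_le_of_lt (Polynomial.degree_le_of_natDegree_le hR)
      (by exact_mod_cast (2 * p).lt_succ_self)
  have h := Lagrange.coeff_eq_sum hl.injOn hd
  rw [card_univ, Fintype.card_fin, Nat.add_sub_cancel] at h
  rw [h]
  refine sum_congr rfl fun c _ => ?_
  rw [prod_erase_eq_prod_succAbove c fun j => l c - l j]
  congr 1
  have : ∀ j, l (c.succAbove j) - l c = -1 * (l c - l (c.succAbove j)) := fun j => by ring
  simp_rw [this, prod_mul_distrib]
  simp

lemma exists_interpolant {p : ℕ} {s : Fin (2 * p + 1) → ℂ} (hs : Function.Injective s)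
    (b : Fin (2 * p + 1) → ℂ) (hb : ∀ i < p, ∑ j, b j * s j ^ i = 0) :
    ∃ h : Polynomial ℂ, h.natDegree ≤ p ∧
      (∀ j, h.eval (s j) = b j * ∏ l, (s (j.succAbove l) - s j)) ∧ h.coeff p = ∑ j, b j * s j ^ p := by
  set r : Fin (2 * p + 1) → ℂ := fun j => b j * ∏ l, (s (j.succAbove l) - s j) with hr
  set h := Lagrange.interpolate univ s r with hh
  have heval : ∀ j, h.eval (s j) = r j := fun j =>
    Lagrange.eval_interpolate_at_node r hs.injOn (mem_univ j)
  have hne : ∀ j : Fin (2 * p + 1), ∏ l, (s (j.succAbove l) - s j) ≠ 0 := fun j =>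
    prod_ne_zero_iff.2 fun l _ => sub_ne_zero.2 fun e => Fin.succAbove_ne j l (hs e)
  have hdeg2 : h.natDegree ≤ 2 * p := by
    have := Lagrange.degree_interpolate_lt (s := univ) r hs.injOn
    rw [card_univ, Fintype.card_fin] at this
    by_cases h0 : h = 0
    · simp [h0]
    · rw [Polynomial.degree_eq_natDegree h0] at this
      exact Nat.lt_succ_iff.1 (by exact_mod_cast this)
  have hcoef : ∀ i, (h * Polynomial.X ^ i).natDegree ≤ 2 * p →
      ∑ j, b j * s j ^ i = (h * Polynomial.X ^ i).coeff (2 * p) := fun i hi => by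
    rw [← sum_div_nodal_eq_coeff hs hi]
    refine sum_congr rfl fun j _ => ?_
    rw [Polynomial.eval_mul, heval, Polynomial.eval_pow, Polynomial.eval_X, eq_div_iff (hne j)]
    simp only [hr]
    ring
  have hdeg : h.natDegree ≤ p := by
    by_contra! hlt
    have h0 : h ≠ 0 := by rintro h0; simp [h0] at hlt
    have e : (h * Polynomial.X ^ (2 * p - h.natDegree)).natDegree = 2 * p := by
      rw [Polynomial.natDegree_mul h0 (pow_ne_zero _ Polynomial.X_ne_zero),
        Polynomial.natDegree_X_pow]
      omega
    have h1 := hcoef _ e.le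
    rw [hb _ (by omega)] at h1
    have h2 := (h * Polynomial.X ^ (2 * p - h.natDegree)).coeff_natDegree
    rw [e, ← h1, eq_comm, Polynomial.leadingCoeff_eq_zero] at h2
    exact mul_ne_zero h0 (pow_ne_zero _ Polynomial.X_ne_zero) h2
  refine ⟨h, hdeg, heval, ?_⟩
  rw [hcoef p (Polynomial.natDegree_mul_le.trans (by rw [Polynomial.natDegree_X_pow]; omega)),
    two_mul, Polynomial.coeff_mul_X_pow]

lemma doubleVdm_sq_odd {p : ℕ} {a s : Fin (2 * p + 1) → ℂ} (hs : Function.Injective s) :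
    doubleVdm a s ^ 2 =
      ∑ j, doubleCofactor a s j ^ 2 * ∏ l, (s (j.succAbove l) - s j) := by
  obtain ⟨h, hd, he, hc⟩ := exists_interpolant hs (doubleCofactor a s) fun i hi => by
    have := sum_doubleCofactor_pow a s (m := 2 * i) (by omega)
    simpa using this
  rw [sum_doubleCofactor_last] at hc
  have e : ∀ j, doubleCofactor a s j ^ 2 * ∏ l, (s (j.succAbove l) - s j) =
      doubleCofactor a s j * h.eval (s j) := fun j => by rw [he]; ring
  simp_rw [e, Polynomial.eval_eq_sum_range' (Nat.lt_succ_of_le hd), mul_sum]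
  rw [sum_comm, sum_range_succ, sum_eq_zero, zero_add, hc]
  · simp_rw [mul_left_comm _ (doubleVdm a s), ← mul_sum]
    rw [sum_doubleCofactor_last, sq]
  · intro i hi
    have := sum_doubleCofactor_pow a s (m := 2 * i) (by have := mem_range.1 hi; omega)
    simp_rw [mul_left_comm _ (h.coeff i), ← mul_sum]
    rw [mul_eq_zero]; right
    simpa using this

lemma doubleVdm_sq_even {p : ℕ} (a₀ s₀ : ℂ) {a s : Fin (2 * p + 1) → ℂ} (hs : Function.Injective s)
    (h0 : ∀ j, s j ≠ s₀) :
    doubleVdm (Fin.cons a₀ a : Fin (2 * p + 2) → ℂ) (Fin.cons s₀ s) ^ 2 = (∏ j, (s j - s₀)) *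
      ∑ j, doubleCofactor a s j ^ 2 * (∏ l, (s (j.succAbove l) - s j)) *
        ((a j - a₀) ^ 2 / (s j - s₀)) := by
  obtain ⟨h, hd, he, -⟩ := exists_interpolant hs (fun j => doubleCofactor a s j * (a j - a₀))
    fun i hi => by
      have h1 := sum_doubleCofactor_pow a s (m := 2 * i) (by omega)
      have h2 := sum_doubleCofactor_pow a s (m := 2 * i + 1) (by omega)
      have e1 : (2 * i + 1) % 2 = 1 := by omega
      have e2 : (2 * i + 1) / 2 = i := by omega
      have e3 : 2 * i % 2 = 0 := by omega
      have e4 : 2 * i / 2 = i := by omega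
      rw [e1, e2] at h2
      rw [e3, e4] at h1
      have : ∀ j, doubleCofactor a s j * (a j - a₀) * s j ^ i =
          doubleCofactor a s j * (a j ^ 1 * s j ^ i) -
            a₀ * (doubleCofactor a s j * (a j ^ 0 * s j ^ i)) := fun j => by ring
      simp_rw [this]
      rw [sum_sub_distrib, ← mul_sum, h1, h2]
      ring
  have hne : ∀ j : Fin (2 * p + 1), ∏ l, (s (j.succAbove l) - s j) ≠ 0 := fun j =>
    prod_ne_zero_iff.2 fun l _ => sub_ne_zero.2 fun e => Fin.succAbove_ne j l (hs e)
  have hz : ∀ j, s j - s₀ ≠ 0 := fun j => sub_ne_zero.2 (h0 j)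
  have e1 : doubleVdm (Fin.cons a₀ a : Fin (2 * p + 2) → ℂ) (Fin.cons s₀ s) = h.eval s₀ := by
    rw [doubleVdm_cons_cons, ← sum_div_sub_nodal_eq hs h0 (hd.trans (by omega)), mul_sum]
    refine sum_congr rfl fun j _ => ?_
    rw [he, Fin.prod_univ_succAbove _ j]
    have := hne j
    have := hz j
    field_simp
  have e2 := sum_div_sub_nodal_eq hs h0 (R := h ^ 2)
    (Polynomial.natDegree_pow_le.trans (by omega))
  rw [e1, ← Polynomial.eval_pow, ← e2]
  congr 1
  refine sum_congr rfl fun j _ => ?_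
  rw [Polynomial.eval_pow, he]
  have := hne j
  have := hz j
  field_simp

/-- The square of `doubleVdm` divided by the Vandermonde determinant of its second argument. -/
noncomputable def sqRatio {k : ℕ} (a s : Fin k → ℂ) : ℂ := doubleVdm a s ^ 2 / vdm s

lemma doubleCofactor_sq_mul_div {k : ℕ} (a : Fin (k + 1) → ℂ) {s : Fin (k + 1) → ℂ}
    (hs : Function.Injective s) (j : Fin (k + 1)) :
    doubleCofactor a s j ^ 2 * (∏ l, (s (j.succAbove l) - s j)) / vdm s =
      (-1) ^ (j : ℕ) * sqRatio (a ∘ j.succAbove) (s ∘ j.succAbove) := by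
  have h1 : ∏ l, (s (j.succAbove l) - s j) ≠ 0 :=
    prod_ne_zero_iff.2 fun l _ => sub_ne_zero.2 fun e => Fin.succAbove_ne j l (hs e)
  have h2 : vdm (s ∘ j.succAbove) ≠ 0 := vdm_ne_zero (hs.comp Fin.succAbove_right_injective)
  rw [vdm_succAbove s j, doubleCofactor, sqRatio]
  rcases neg_one_pow_eq_or ℂ (j : ℕ) with h | h <;> rw [h] <;> field_simp

lemma sqRatio_odd {p : ℕ} (a : Fin (2 * p + 1) → ℂ) {s : Fin (2 * p + 1) → ℂ}
    (hs : Function.Injective s) :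
    sqRatio a s = ∑ j : Fin (2 * p + 1), (-1) ^ (j : ℕ) *
      sqRatio (a ∘ j.succAbove) (s ∘ j.succAbove) := by
  rw [sqRatio, doubleVdm_sq_odd hs, sum_div]
  exact sum_congr rfl fun j _ => doubleCofactor_sq_mul_div a hs j

lemma sqRatio_even {p : ℕ} (a : Fin (2 * p + 2) → ℂ) {s : Fin (2 * p + 2) → ℂ}
    (hs : Function.Injective s) :
    sqRatio a s = ∑ j : Fin (2 * p + 1), (-1) ^ (j : ℕ) *
      ((a j.succ - a 0) ^ 2 / (s j.succ - s 0)) *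
      sqRatio (a ∘ Fin.succ ∘ j.succAbove) (s ∘ Fin.succ ∘ j.succAbove) := by
  have hs' : Function.Injective (Fin.tail s) := hs.comp (Fin.succ_injective _)
  have hne : ∀ j, Fin.tail s j ≠ s 0 := fun j h => Fin.succ_ne_zero j (hs h)
  have h := doubleVdm_sq_even (a 0) (s 0) (a := Fin.tail a) hs' hne
  have hv := vdm_cons (s 0) (Fin.tail s)
  rw [Fin.cons_self_tail, Fin.cons_self_tail] at h
  rw [Fin.cons_self_tail] at hv
  have hP : ∏ j, (Fin.tail s j - s 0) ≠ 0 :=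
    prod_ne_zero_iff.2 fun j _ => sub_ne_zero.2 (hne j)
  rw [sqRatio, h, hv, mul_div_mul_left _ _ hP, sum_div]
  refine sum_congr rfl fun j _ => ?_
  rw [mul_div_right_comm, doubleCofactor_sq_mul_div _ hs']
  simp only [Fin.tail]
  rw [mul_right_comm]
  rfl

/-- The symmetrized generating function of the Magog side. -/
noncomputable def halfTerm {k : ℕ} (x : Fin k → ℂ) : ℂ :=
  (∏ i, x i) * vdm x ^ 2 / vdm (halfSq ∘ x)

lemma halfTerm_eq {k : ℕ} (x : Fin k → ℂ) :
    halfTerm x = (∏ i, x i) * sqRatio ((fun z => z + 1 / 2) ∘ x) (halfSq ∘ x) := by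
  have h1 : doubleVdm ((fun z => z + 1 / 2) ∘ x) (halfSq ∘ x) = vdm ((fun z => z + 1 / 2) ∘ x) := by
    unfold doubleVdm vdm
    congr 1
    ext i m
    simp only [Matrix.of_apply, Matrix.vandermonde_apply, Function.comp, halfSq]
    rw [← pow_mul, ← pow_add]
    congr 1
    omega
  have h2 : vdm ((fun z => z + 1 / 2) ∘ x) = vdm x := by
    rw [vdm_eq_pairProd, vdm_eq_pairProd]
    exact pairProd_congr fun i _ j _ _ => by simp
  rw [halfTerm, sqRatio, h1, h2, mul_div_assoc]

lemma halfTerm_odd {p : ℕ} {x : Fin (2 * p + 1) → ℂ} (hx : Function.Injective (halfSq ∘ x)) :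
    halfTerm x = ∑ j : Fin (2 * p + 1), (-1) ^ (j : ℕ) * (x j * halfTerm (x ∘ j.succAbove)) := by
  rw [halfTerm_eq, sqRatio_odd _ hx, mul_sum]
  refine sum_congr rfl fun j _ => ?_
  rw [halfTerm_eq, Fin.prod_univ_succAbove _ j]
  simp only [Function.comp_assoc]
  simp only [Function.comp_def]
  ring

lemma halfTerm_even {p : ℕ} {x : Fin (2 * p + 2) → ℂ} (hx : Function.Injective (halfSq ∘ x)) :
    halfTerm x = ∑ j : Fin (2 * p + 1), (-1) ^ (j : ℕ) *
      (x 0 * x j.succ * (x j.succ - x 0) / (1 + x j.succ + x 0) *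
        halfTerm (x ∘ Fin.succ ∘ j.succAbove)) := by
  rw [halfTerm_eq, sqRatio_even _ hx, mul_sum]
  refine sum_congr rfl fun j _ => ?_
  have h1 : halfSq (x j.succ) - halfSq (x 0) ≠ 0 :=
    sub_ne_zero.2 fun h => Fin.succ_ne_zero j (hx h)
  rw [halfSq_sub] at h1
  have h2 := left_ne_zero_of_mul h1
  have h3 := right_ne_zero_of_mul h1
  rw [halfTerm_eq, Fin.prod_univ_succ, Fin.prod_univ_succAbove _ j]
  simp only [Function.comp_assoc]
  simp only [Function.comp_def]
  rw [halfSq_sub]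
  field_simp
  ring

lemma flipSum_congr {k : ℕ} {F G : (Fin k → ℂ) → ℂ} {x : Fin k → ℂ}
    (h : ∀ ε, F (flipPt ε x) = G (flipPt ε x)) : flipSum F x = flipSum G x :=
  sum_congr rfl fun ε _ => by rw [h]

lemma flipSum_const_mul {k : ℕ} (c : ℂ) (F : (Fin k → ℂ) → ℂ) (x : Fin k → ℂ) :
    flipSum (fun x => c * F x) x = c * flipSum F x := by
  unfold flipSum
  rw [mul_sum]
  exact sum_congr rfl fun _ _ => by ring

lemma flipSum_coord_mul {k : ℕ} (f : ℂ → ℂ) (H : (Fin k → ℂ) → ℂ) (x : Fin (k + 1) → ℂ)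
    (c : Fin (k + 1)) : flipSum (fun x => f (x c) * H (x ∘ c.succAbove)) x =
      (f (x c) - f (x c)⁻¹) * flipSum H (x ∘ c.succAbove) := by
  have e : ∀ (z : ℂ) (w : Fin k → ℂ), (c.insertNth z w : Fin (k + 1) → ℂ) ∘ c.succAbove = w := by
    intro z w; funext i; simp
  rw [flipSum_succ _ x c]
  simp only [Fin.insertNth_apply_same, e]
  rw [flipSum_const_mul, flipSum_const_mul]
  ring

/-- The points whose coordinates are separated by `sCoord`. -/
structure IsSeparated {k : ℕ} (x : Fin k → ℂ) : Prop where
  ne_zero : ∀ i, x i ≠ 0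
  one_add : ∀ i, 1 + x i ≠ 0
  inj : Function.Injective (sCoord ∘ x)

lemma IsGeneralPoint.isSeparated {k : ℕ} {x : Fin k → ℂ} (h : IsGeneralPoint x) : IsSeparated x :=
  ⟨h.ne_zero, h.one_add, h.inj⟩

lemma IsSeparated.comp {k l : ℕ} {x : Fin k → ℂ} (h : IsSeparated x) {f : Fin l → Fin k}
    (hf : Function.Injective f) : IsSeparated (x ∘ f) :=
  ⟨fun _ => h.ne_zero _, fun _ => h.one_add _, h.inj.comp hf⟩

lemma IsSeparated.flipPt {k : ℕ} {x : Fin k → ℂ} (h : IsSeparated x) (ε : Fin k → Bool) :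
    IsSeparated (flipPt ε x) := by
  refine ⟨fun i => ?_, fun i => ?_, ?_⟩
  · simp only [_root_.flipPt]
    split_ifs
    · exact inv_ne_zero (h.ne_zero i)
    · exact h.ne_zero i
  · simp only [_root_.flipPt]
    split_ifs
    · have h0 := h.ne_zero i
      have : 1 + (x i)⁻¹ = (1 + x i) / x i := by field_simp; ring
      rw [this]
      exact div_ne_zero (h.one_add i) h0
    · exact h.one_add i
  · rw [comp_flipPt_of_even sCoord sCoord_inv]
    exact h.inj

lemma IsSeparated.halfSq {k : ℕ} {x : Fin k → ℂ} (h : IsSeparated x) :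
    Function.Injective (halfSq ∘ x) := by
  intro i j hij
  by_contra hne
  have h1 : sCoord (x i) - sCoord (x j) ≠ 0 := sub_ne_zero.2 fun e => hne (h.inj e)
  rw [sCoord_sub (h.ne_zero i) (h.ne_zero j) (h.one_add i) (h.one_add j)] at h1
  have h2 : (x i - x j) * (1 + x i + x j) = 0 := by
    rw [← halfSq_sub]; exact sub_eq_zero.2 hij
  apply h1
  rcases mul_eq_zero.1 h2 with h | h <;> rw [h] <;> ring

lemma flip_two_eq {p q : ℂ} (hp : p ≠ 0) (hq : q ≠ 0) (hp1 : 1 + p ≠ 0) (hq1 : 1 + q ≠ 0)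
    (h : sCoord q - sCoord p ≠ 0) :
    p * q * (q - p) / (1 + q + p) - p * q⁻¹ * (q⁻¹ - p) / (1 + q⁻¹ + p) -
      (p⁻¹ * q * (q - p⁻¹) / (1 + q + p⁻¹) - p⁻¹ * q⁻¹ * (q⁻¹ - p⁻¹) / (1 + q⁻¹ + p⁻¹)) =
    (p - p⁻¹) * (q - q⁻¹) * ((lamCoord q - lamCoord p) ^ 2 / (sCoord q - sCoord p)) := by
  rw [sCoord_sub hq hp hq1 hp1] at h ⊢
  simp only [ne_eq, div_eq_zero_iff, mul_eq_zero, not_or] at h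
  obtain ⟨⟨⟨⟨⟨⟨h1, h2⟩, h3⟩, h4⟩, h5⟩, h6⟩, -⟩ := h
  have e1 : 1 + q⁻¹ + p = (1 + q + q * p) / q := by field_simp; ring
  have e2 : 1 + q + p⁻¹ = (1 + p + p * q) / p := by field_simp; ring
  have e3 : 1 + q⁻¹ + p⁻¹ = (p + q + p * q) / (p * q) := by field_simp; ring
  have e4 : lamCoord q - lamCoord p = (q - p) * (q * p - 1) / (q * p) := by
    unfold lamCoord; field_simp; ring
  rw [e1, e2, e3, e4]
  obtain ⟨A, hA⟩ : ∃ A, A = 1 + p + p * q := ⟨_, rfl⟩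
  obtain ⟨B, hB⟩ : ∃ B, B = p + q + p * q := ⟨_, rfl⟩
  obtain ⟨C, hC⟩ : ∃ C, C = 1 + q + p := ⟨_, rfl⟩
  obtain ⟨D, hD⟩ : ∃ D, D = 1 + q + q * p := ⟨_, rfl⟩
  obtain ⟨E, hE⟩ : ∃ E, E = q - p := ⟨_, rfl⟩
  obtain ⟨F, hF⟩ : ∃ F, F = q * p - 1 := ⟨_, rfl⟩
  rw [← hA] at h6 ⊢
  rw [← hB] at h5 ⊢
  rw [← hC] at h4 ⊢
  rw [← hD] at h3 ⊢
  rw [← hE] at h1 ⊢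
  rw [← hF] at h2 ⊢
  field_simp
  subst hA hB hC hD hE hF
  ring

lemma flipSum_halfTerm_even (p : ℕ) {x : Fin (2 * p) → ℂ} (hx : IsSeparated x) :
    flipSum halfTerm x = (∏ i, (x i - (x i)⁻¹)) * sqRatio (lamCoord ∘ x) (sCoord ∘ x) := by
  induction p with
  | zero => simp [flipSum, flipSign, halfTerm, sqRatio, doubleVdm, vdm]
  | succ p ih =>
    change Fin (2 * p + 2) → ℂ at x
    have h1 : flipSum halfTerm x = flipSum (fun x : Fin (2 * p + 2) → ℂ =>
        ∑ j : Fin (2 * p + 1), (-1) ^ (j : ℕ) *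
        (x 0 * x j.succ * (x j.succ - x 0) / (1 + x j.succ + x 0) *
        halfTerm (x ∘ Fin.succ ∘ j.succAbove))) x :=
      flipSum_congr fun ε => halfTerm_even (hx.flipPt ε).halfSq
    rw [h1, flipSum_sum univ (fun j : Fin (2 * p + 1) => (-1) ^ (j : ℕ)) fun j x =>
      x 0 * x j.succ * (x j.succ - x 0) / (1 + x j.succ + x 0) *
        halfTerm (x ∘ Fin.succ ∘ j.succAbove), sqRatio_even _ hx.inj, mul_sum]
    refine sum_congr rfl fun j _ => ?_
    rw [flipSum_succ _ x 0]
    simp only [Fin.insertNth_zero', Fin.cons_zero, Fin.cons_succ, Fin.succAbove_zero]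
    have e : ∀ (z : ℂ) (w : Fin (2 * p + 1) → ℂ),
        (Fin.cons z w : Fin (2 * p + 2) → ℂ) ∘ Fin.succ ∘ j.succAbove = w ∘ j.succAbove :=
      fun z w => rfl
    have hs : sCoord (x j.succ) - sCoord (x 0) ≠ 0 :=
      sub_ne_zero.2 fun e => Fin.succ_ne_zero j (hx.inj e)
    simp only [e]
    rw [flipSum_coord_mul (fun z => x 0 * z * (z - x 0) / (1 + z + x 0)) halfTerm,
      flipSum_coord_mul (fun z => (x 0)⁻¹ * z * (z - (x 0)⁻¹) / (1 + z + (x 0)⁻¹)) halfTerm,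
      ← sub_mul]
    simp only [Function.comp_apply]
    rw [flip_two_eq (hx.ne_zero _) (hx.ne_zero _) (hx.one_add _) (hx.one_add _) hs,
      Function.comp_assoc,
      ih (hx.comp ((Fin.succ_injective _).comp Fin.succAbove_right_injective)),
      show ∏ i : Fin (2 * (p + 1)), (x i - (x i)⁻¹) = _ from
        Fin.prod_univ_succ (n := 2 * p + 1) fun i => x i - (x i)⁻¹, Fin.prod_univ_succAbove _ j]
    simp only [Function.comp_assoc]
    simp only [Function.comp_def]
    ring

lemma flipSum_halfTerm {k : ℕ} {x : Fin k → ℂ} (hx : IsSeparated x) :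
    flipSum halfTerm x = (∏ i, (x i - (x i)⁻¹)) * sqRatio (lamCoord ∘ x) (sCoord ∘ x) := by
  rcases Nat.even_or_odd' k with ⟨p, rfl | rfl⟩
  · exact flipSum_halfTerm_even p hx
  · have h1 : flipSum halfTerm x = flipSum (fun x : Fin (2 * p + 1) → ℂ =>
        ∑ j : Fin (2 * p + 1), (-1) ^ (j : ℕ) * (x j * halfTerm (x ∘ j.succAbove))) x :=
      flipSum_congr fun ε => halfTerm_odd (hx.flipPt ε).halfSq
    rw [h1, flipSum_sum univ (fun j : Fin (2 * p + 1) => (-1) ^ (j : ℕ)) fun j x =>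
      x j * halfTerm (x ∘ j.succAbove), sqRatio_odd _ hx.inj, mul_sum]
    refine sum_congr rfl fun j _ => ?_
    rw [flipSum_coord_mul (fun z => z) halfTerm,
      flipSum_halfTerm_even p (hx.comp Fin.succAbove_right_injective),
      Fin.prod_univ_succAbove _ j]
    simp only [Function.comp_assoc]
    simp only [Function.comp_def]
    ring

lemma polarFun_magNum {k : ℕ} (N : ℕ) {x : Fin k → ℂ}
    (hx : ∀ a b : Fin k, a < b → ∀ τ, pairDen τ (x b) (x a) ≠ 0) :
    polarFun (magNum N) x =
      kernelBase (fun m z => lamCoord z ^ m) (fun _ _ => 1) N x * halfTerm x := by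
  rw [polarFun, magNum, halfTerm, vdm_halfSq, pairProd_mul]
  have h1 : (pairProd univ fun a b => pairDen false (x b) (x a)) *
      (pairProd univ fun a b => (pairDen false (x b) (x a))⁻¹) = 1 := by
    rw [← pairProd_mul, ← pairProd_one (univ : Finset (Fin k))]
    exact pairProd_congr fun a _ b _ hab => mul_inv_cancel₀ (hx a b hab false)
  have h2 : (pairProd univ fun i j => 1 + x j + x i) *
      (pairProd univ fun a b => (pairDen true (x b) (x a))⁻¹) = 1 := by
    refine (pairProd_mul _ _ _).symm.trans (Eq.trans ?_ (pairProd_one (univ : Finset (Fin k))))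
    exact pairProd_congr fun a _ b _ hab => by
      have := hx a b hab true
      simp only [pairDen, if_true] at this ⊢
      exact mul_inv_cancel₀ this
  rw [eq_inv_of_mul_eq_one_right h2]
  generalize (pairProd univ fun a b => (pairDen false (x b) (x a))⁻¹) = D at *
  by_cases hv : vdm x = 0
  · simp [hv]
  · have := left_ne_zero_of_mul_eq_one h2
    field_simp
    linear_combination kernelBase (fun m z => lamCoord z ^ m) (fun _ _ => 1) N x * (∏ i, x i) * h1

lemma kernelBase_magog_perm {k : ℕ} (N : ℕ) (σ : Equiv.Perm (Fin k)) (x : Fin k → ℂ) :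
    kernelBase (fun m z => lamCoord z ^ m) (fun _ _ => 1) N (x ∘ σ) =
      (Equiv.Perm.sign σ : ℂ) * kernelBase (fun m z => lamCoord z ^ m) (fun _ _ => 1) N x := by
  rw [kernelBase_magog, kernelBase_magog, ← Function.comp_assoc, vdm_perm,
    prod_comp_perm (fun z => 1 / z - z), prod_comp_perm (fun z => lamCoord z ^ N)]
  ring

lemma halfTerm_perm {k : ℕ} (x : Fin k → ℂ) (σ : Equiv.Perm (Fin k)) :
    halfTerm (x ∘ σ) = (Equiv.Perm.sign σ : ℂ) * halfTerm x := by
  rw [halfTerm, halfTerm, ← Function.comp_assoc, vdm_perm, vdm_perm, prod_comp_perm (fun z => z)]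
  rcases Int.units_eq_one_or (Equiv.Perm.sign σ) with h | h <;> simp [h, div_neg]

lemma permSum_halfTerm {k : ℕ} (x : Fin k → ℂ) : permSum halfTerm x = k.factorial * halfTerm x := by
  have h : ∀ σ : Equiv.Perm (Fin k), (Equiv.Perm.sign σ : ℂ) * halfTerm (x ∘ σ) = halfTerm x :=
    fun σ => by
      rw [halfTerm_perm]
      rcases Int.units_eq_one_or (Equiv.Perm.sign σ) with h | h <;> simp [h]
  rw [permSum, sum_congr rfl fun σ _ => h σ]
  simp [Fintype.card_perm]

/-- Antisymmetrizing a factor of an otherwise antisymmetric integrand on a torus of equal radii. -/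
lemma torusAvg_permSum {k : ℕ} {r : ℝ} (hr : 0 ≤ r) {K g : (Fin k → ℂ) → ℂ}
    (hc : ContinuousOn (fun x => K x * g x) (torusSet fun _ : Fin k => r))
    (hK : ∀ (σ : Equiv.Perm (Fin k)) x, K (x ∘ σ) = (Equiv.Perm.sign σ : ℂ) * K x) :
    torusAvg (fun _ : Fin k => r) (fun x => K x * permSum g x) =
      k.factorial * torusAvg (fun _ : Fin k => r) fun x => K x * g x := by
  have h1 : (fun x => K x * permSum g x) = fun x =>
      ∑ σ : Equiv.Perm (Fin k), K (x ∘ σ) * g (x ∘ σ) := funext fun x => by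
    simp only [permSum, mul_sum, hK]
    exact sum_congr rfl fun σ _ => by ring
  rw [h1, torusAvg_sum fun _ => hr]
  · rw [sum_congr rfl fun σ _ => (torusAvg_perm (fun _ : Fin k => r) σ fun x => K x * g x).symm]
    simp [Fintype.card_perm, Function.comp_def]
  · exact fun σ _ => hc.comp (f := fun x : Fin k → ℂ => x ∘ σ)
      (continuousOn_pi.2 fun i => (continuous_apply (σ i)).continuousOn) fun x hx i => hx (σ i)

lemma permSum_prod_prefixProd {k : ℕ} {x : Fin k → ℂ} (h0 : ∀ i, x i ≠ 0)
    (hs : ∀ i, ‖x i‖ ≤ 1 / 8) :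
    permSum (fun x : Fin k → ℂ => ∏ l, prefixProd x l / (1 - prefixProd x l)) x =
      (Equiv.Perm.sign (Fin.revPerm (n := k)) : ℂ) * halfTerm x := by
  by_cases hx : Function.Injective x
  · rw [funext fun x : Fin k → ℂ => prod_prefixProd_eq_suffixTerm x, permSum_comp_perm,
      permSum_suffixTerm hx h0 hs, halfTerm]
  · rw [permSum_eq_zero_of_not_injective _ hx]
    have : vdm x = 0 := by
      rw [vdm, Matrix.det_vandermonde]
      obtain ⟨i, j, hij, hne⟩ : ∃ i j, x i = x j ∧ i ≠ j := by
        simpa [Function.Injective] using hx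
      rcases lt_or_gt_of_ne hne with h | h
      · exact prod_eq_zero (mem_univ i) (prod_eq_zero (mem_Ioi.2 h) (by rw [hij, sub_self]))
      · exact prod_eq_zero (mem_univ j) (prod_eq_zero (mem_Ioi.2 h) (by rw [hij, sub_self]))
    simp [halfTerm, this]

lemma factorial_mul_sum_magogAvg {k : ℕ} (hk : 1 ≤ k) {N B : ℕ} (hN : k ≤ N + 1) (hB : N + k ≤ B)
    {e : Fin k → ℤ} (he : IsGeneric e) :
    k.factorial * ∑ d : Fin k → Fin B, magogAvg N (gapSum d) =
      (Equiv.Perm.sign (Fin.revPerm (n := k)) : ℂ) * torusAvg (rad e) fun x =>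
        kernelBase (fun m z => lamCoord z ^ m) (fun _ _ => 1) N x * halfTerm x := by
  have h1 : torusAvg (rad e) (fun x =>
      kernelBase (fun m z => lamCoord z ^ m) (fun _ _ => 1) N x * halfTerm x) =
      torusAvg (fun _ : Fin k => 1 / 8) (polarFun (magNum N)) := by
    rw [← torusAvg_magNum he hN]
    exact torusAvg_congr (fun i => (rad_pos e i).le) fun x hx =>
      (polarFun_magNum N fun a c hac τ => pairDen_ne_zero (hx c) (hx a) (he.1 c) (he.1 a)
        (he.2 c a hac.ne') τ).symm
  rw [sum_magogAvg_gapSum hk hB, IsKernel.avg, ← torusAvg_permSum (by norm_num)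
    (isKernel_magog.continuousOn_mul N (by norm_num) le_rfl smallHol_prod_prefixProd_div)
    (kernelBase_magog_perm N), h1, ← torusAvg_const_mul]
  refine torusAvg_congr (fun _ => by norm_num) fun x hx => ?_
  rw [polarFun_magNum N fun a c _ τ => pairDen_ne_zero_of_small (hx c).le (hx a).le τ,
    permSum_prod_prefixProd (ne_zero_of_mem_torusSet (fun _ => by norm_num) hx)
      fun i => (hx i).le]
  ring

lemma sum_magogAvg_eq_commonIntegrand {k : ℕ} (hk : 1 ≤ k) {n B : ℕ} (hn : k ≤ n)
    (hB : n - 1 + k ≤ B) {e : Fin k → ℤ} (he : IsGeneric e) :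
    2 ^ k * k.factorial * ∑ d : Fin k → Fin B, magogAvg (n - 1) (gapSum d) =
      (Equiv.Perm.sign (Fin.revPerm (n := k)) : ℂ) * torusAvg (rad e) (commonIntegrand n) := by
  set N := n - 1 with hN
  have hNk : k ≤ N + 1 := by omega
  set K : (Fin k → ℂ) → ℂ := kernelBase (fun m z => lamCoord z ^ m) (fun _ _ => 1) N with hK
  set A : ℂ := torusAvg (fun _ : Fin k => 1 / 8) (polarFun (magNum N)) with hA
  have hpol : ∀ e : Fin k → ℤ, IsGeneric e → ∀ x ∈ torusSet (rad e),
      K x * halfTerm x = polarFun (magNum N) x := fun e he x hx =>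
    (polarFun_magNum N fun a c hac τ => pairDen_ne_zero (hx c) (hx a) (he.1 c) (he.1 a)
      (he.2 c a hac.ne') τ).symm
  have hAe : ∀ e : Fin k → ℤ, IsGeneric e → torusAvg (rad e) (fun x => K x * halfTerm x) = A :=
    fun e he => by
      rw [hA, ← torusAvg_magNum he hNk]
      exact torusAvg_congr (fun i => (rad_pos e i).le) (hpol e he)
  have hw := torusAvg_weyl he (K := K) (g := halfTerm) (A := A) (fun e he => ?_) hAe
    fun x _ ε σ => by rw [hK, kernelBase_magog_perm, kernelBase_magog_flip]; ring
  · have hf : (k.factorial : ℂ) ≠ 0 := by exact_mod_cast k.factorial_ne_zero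
    have h2 : torusAvg (rad e) (fun x => K x * weylSum halfTerm x) =
        k.factorial * torusAvg (rad e) (commonIntegrand n) := by
      rw [← torusAvg_const_mul]
      refine torusAvg_congr (fun i => (rad_pos e i).le) fun x hx => ?_
      rw [weylSum, funext (permSum_halfTerm (k := k)), flipSum_const_mul,
        flipSum_halfTerm (isGeneralPoint_of_mem he hx).isSeparated, hK, kernelBase_magog,
        commonIntegrand, sqRatio, prod_pow]
      ring
    rw [h2, mul_right_comm] at hw
    have h3 : torusAvg (rad e) (commonIntegrand n) = 2 ^ k * A :=
      mul_left_cancel₀ hf (by rw [hw]; ring)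
    rw [h3, mul_assoc, factorial_mul_sum_magogAvg hk hNk hB he, hAe e he]
    ring
  · refine ContinuousOn.congr (f := polarFun (magNum N)) (fun x hx => ?_) (hpol e he)
    exact (differentiableAt_polarFun (differentiableAt_magNum N
      (isGeneralPoint_of_mem he hx).ne_zero) fun a c hac τ => pairDen_ne_zero (hx c) (hx a)
      (he.1 c) (he.1 a) (he.2 c a hac.ne') τ).continuousAt.continuousWithinAt

/-- The analytic form of the equality of the Gog and Magog enumerations. -/
lemma gogAvg_eq_or_neg {k : ℕ} (hk : 1 ≤ k) {n B : ℕ} (hn : k ≤ n) (hB : n - 1 + k ≤ B) :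
    gogAvg n (fun i : Fin k => k - (i : ℕ)) = ∑ d : Fin k → Fin B, magogAvg (n - 1) (gapSum d) ∨
    gogAvg n (fun i : Fin k => k - (i : ℕ)) =
      -∑ d : Fin k → Fin B, magogAvg (n - 1) (gapSum d) := by
  obtain ⟨κ, hκ, h1⟩ := gogAvg_eq_commonIntegrand k hk
  have he : IsGeneric fun i : Fin k => (i : ℤ) + 1 := by
    refine ⟨fun i => by positivity, fun i j hij h => hij ?_⟩
    rw [abs_of_nonneg (by positivity), abs_of_nonneg (by positivity)] at h
    exact Fin.ext (by exact_mod_cast add_right_cancel h)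
  have h2 := h1 n hn _ he
  have h3 := sum_magogAvg_eq_commonIntegrand hk hn hB he
  have hf : (2 ^ k * k.factorial : ℂ) ≠ 0 :=
    mul_ne_zero (by norm_num) (by exact_mod_cast k.factorial_ne_zero)
  generalize torusAvg _ (commonIntegrand n) = T at h2 h3
  rcases hκ with rfl | rfl <;>
    rcases Int.units_eq_one_or (Equiv.Perm.sign (Fin.revPerm (n := k))) with hs | hs <;>
    simp only [hs, Units.val_one, Units.val_neg, Int.cast_one, Int.cast_neg] at h3
  · exact Or.inl (mul_left_cancel₀ hf (by rw [h2, h3]))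
  · exact Or.inr (mul_left_cancel₀ hf (by rw [h2, mul_neg, h3]; ring))
  · exact Or.inr (mul_left_cancel₀ hf (by rw [h2, mul_neg, h3]; ring))
  · exact Or.inl (mul_left_cancel₀ hf (by rw [h2, h3]))

lemma strictAnti_of_consecutive {k : ℕ} {c : Fin k → ℕ}
    (h : ∀ m m' : Fin k, (m' : ℕ) + 1 = m → c m < c m') : StrictAnti c := by
  cases k with
  | zero => exact fun i => i.elim0
  | succ k => exact Fin.strictAnti_iff_succ_lt.2 fun i => h i.succ i.castSucc (by simp)

/-- The chains of length `N` from `b` to the minimal row `(k, …, 2, 1)`. -/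
def chains (δ : ℕ) {k : ℕ} (N : ℕ) (b : Fin k → ℕ) : Set (ℕ → Fin k → ℕ) :=
  {C | C 0 = b ∧ (∀ t < N, Step δ (C t) (C (t + 1)) ∧ ∀ i, 1 ≤ C (t + 1) i) ∧
    (∀ i : Fin k, C N i = k - i) ∧ ∀ t, N < t → C t = 0}

variable {k δ N B : ℕ} {b : Fin k → ℕ} {C : ℕ → Fin k → ℕ}

lemma le_of_mem_chains (h : C ∈ chains δ N b) {t : ℕ} (ht : t ≤ N) (i : Fin k) :
    C t i ≤ k - i + (N - t) := by
  induction ht using Nat.decreasingInduction with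
  | of_succ t ht ih => have := (h.2.1 t ht).1.1 i; omega
  | self => simp [h.2.2.1 i]

lemma le_of_mem_chains' (h : C ∈ chains δ N b) (hB : N + k ≤ B) (t : ℕ) (i : Fin k) :
    C t i ≤ B := by
  rcases le_or_gt t N with ht | ht
  · have := le_of_mem_chains h ht i
    omega
  · simp [h.2.2.2 t ht]

lemma finite_setOf_bounded (N B : ℕ) :
    {C : ℕ → Fin k → ℕ | (∀ t i, C t i ≤ B) ∧ ∀ t, N < t → C t = 0}.Finite := by
  refine (Set.finite_range fun (F : Fin (N + 1) → Fin k → Fin (B + 1)) (t : ℕ) (i : Fin k) =>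
    if h : t < N + 1 then (F ⟨t, h⟩ i : ℕ) else 0).subset ?_
  rintro C ⟨h1, h2⟩
  refine ⟨fun t i => ⟨C t i, Nat.lt_succ_of_le (h1 t i)⟩, ?_⟩
  funext t i
  by_cases h : t < N + 1
  · simp [h]
  · simp [h, h2 t (by omega)]

lemma finite_chains (δ N : ℕ) (b : Fin k → ℕ) : (chains δ N b).Finite :=
  (finite_setOf_bounded N (N + k)).subset fun _ hC => ⟨le_of_mem_chains' hC le_rfl, hC.2.2.2⟩

lemma ncard_eq_sum_fiber {α : Type*} {S : Set α} (hS : S.Finite) (f : α → Fin k → ℕ)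
    (hf : ∀ a ∈ S, ∀ i, f a i ≤ B) :
    S.ncard = ∑ c : Fin k → Fin (B + 1), {a ∈ S | f a = fun i => (c i : ℕ)}.ncard := by
  classical
  rw [Set.ncard_eq_toFinset_card S hS, Finset.card_eq_sum_card_fiberwise
    (f := fun a i => Fin.ofNat (B + 1) (f a i)) (t := univ) fun _ _ => by simp]
  refine sum_congr rfl fun c _ => ?_
  rw [← Set.ncard_coe_finset]
  congr 1
  ext a
  simp only [coe_filter, Set.Finite.mem_toFinset, Set.mem_ofPred_eq]
  refine and_congr_right fun ha => ?_
  rw [funext_iff, funext_iff]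
  refine forall_congr' fun i => ?_
  rw [Fin.ext_iff, Fin.val_ofNat, Nat.mod_eq_of_lt (Nat.lt_succ_of_le (hf a ha i))]

lemma ncard_chains_zero (hb : ∀ i : Fin k, b i = k - i) : (chains δ 0 b).ncard = 1 := by
  rw [Set.ncard_eq_one]
  refine ⟨fun t => if t = 0 then b else 0, Set.eq_singleton_iff_unique_mem.2 ⟨?_, fun C hC => ?_⟩⟩
  · exact ⟨by simp, fun t ht => absurd ht (Nat.not_lt_zero _), fun i => by simpa using hb i,
      fun t ht => by simp [ht.ne']⟩
  · funext t
    rcases Nat.eq_zero_or_pos t with rfl | ht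
    · simpa using hC.1
    · simpa [ht.ne'] using hC.2.2.2 t ht

lemma ncard_chains_succ (c : Fin k → ℕ) (hc : Step δ b c) (hc1 : ∀ i, 1 ≤ c i) :
    {C ∈ chains δ (N + 1) b | C 1 = c}.ncard = (chains δ N c).ncard := by
  refine Set.ncard_congr (fun C _ t => C (t + 1)) ?_ ?_ ?_
  · rintro C ⟨⟨h0, h1, h2, h3⟩, h4⟩
    exact ⟨h4, fun t ht => h1 (t + 1) (by omega), h2, fun t ht => h3 (t + 1) (by omega)⟩
  · rintro C C' ⟨hC, -⟩ ⟨hC', -⟩ h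
    funext t
    cases t with
    | zero => rw [hC.1, hC'.1]
    | succ t => exact congrFun h t
  · rintro C ⟨h0, h1, h2, h3⟩
    refine ⟨fun t => t.casesOn b C, ⟨⟨rfl, fun t ht => ?_, h2, fun t ht => ?_⟩, h0⟩, rfl⟩
    · cases t with
      | zero => exact ⟨by simpa [h0] using hc, by simpa [h0] using hc1⟩
      | succ t => exact h1 t (by omega)
    · cases t with
      | zero => omega
      | succ t => exact h3 t (by omega)

/-- The averages of a kernel that vanishes on the wall count chains. -/
lemma IsKernel.avg_eq_ncard_chains {φ : ℕ → ℂ → ℂ} {G : ℕ → ℂ → ℂ} {P : ℂ → ℂ → ℂ}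
    (h : IsKernel δ φ G P) (hδ : δ ≤ 1)
    (hw : ∀ N (b : Fin k → ℕ), StrictAnti b → ∀ i : Fin k, (∀ j, j ≤ i) → b i = 0 →
      IsKernel.avg φ P N (1 / 8) (fun x => ∏ i, vCoord (x i) ^ b i) = 0)
    (hB : N + k ≤ B) (hb : StrictAnti b) (hb1 : ∀ i, 1 ≤ b i) (hbB : ∀ i, b i ≤ B) :
    IsKernel.avg φ P N (1 / 8) (fun x => ∏ i, vCoord (x i) ^ b i) =
      ((Equiv.Perm.sign (Fin.revPerm (n := k)) : ℤ) : ℂ) * (chains δ N b).ncard := by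
  induction N generalizing b with
  | zero =>
    rw [h.avg_init (by norm_num) le_rfl hb hb1]
    split_ifs with hmin
    · rw [ncard_chains_zero hmin]; simp
    · have : chains δ 0 b = ∅ := Set.eq_empty_of_forall_notMem fun C hC =>
        hmin fun i => by rw [← hC.2.2.1 i, hC.1]
      simp [this]
  | succ N ih =>
    rw [h.avg_step N B (by norm_num) le_rfl hδ hb hb1 hbB (by omega),
      ncard_eq_sum_fiber (finite_chains δ (N + 1) b) (fun C => C 1)
        fun C hC i => le_of_mem_chains' hC hB 1 i]
    push_cast
    rw [mul_sum]
    refine sum_congr rfl fun c _ => ?_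
    by_cases hs : Step δ b fun i => (c i : ℕ)
    · rw [if_pos hs]
      have hsa : StrictAnti fun i => (c i : ℕ) :=
        strictAnti_of_consecutive fun m m' hm => (hs.2 m m' hm).2
      by_cases hc1 : ∀ i, 1 ≤ (c i : ℕ)
      · rw [ncard_chains_succ _ hs hc1, ih (by omega) hsa hc1 fun i => Nat.le_of_lt_succ (c i).2]
      · have hempty : {C ∈ chains δ (N + 1) b | C 1 = fun i => (c i : ℕ)} = ∅ :=
          Set.eq_empty_of_forall_notMem fun C hC => hc1 fun i => by
            have := (hC.1.2.1 0 (by omega)).2 i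
            rwa [zero_add, hC.2] at this
        rw [hempty]
        push Not at hc1
        obtain ⟨i, hi⟩ := hc1
        cases k with
        | zero => exact i.elim0
        | succ k =>
          rw [hw N _ hsa (Fin.last k) Fin.le_last (by have := hsa.antitone (Fin.le_last i); omega)]
          simp
    · have hempty : {C ∈ chains δ (N + 1) b | C 1 = fun i => (c i : ℕ)} = ∅ :=
        Set.eq_empty_of_forall_notMem fun C hC => hs <| by
          have := (hC.1.2.1 0 (by omega)).1
          rwa [zero_add, hC.2, hC.1.1] at this
      rw [if_neg hs, hempty]
      simp

end

section

open Finset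

/-- The chains of the Magog trapezoids, with a free first row. -/
def freeChains (k N : ℕ) : Set (ℕ → Fin k → ℕ) :=
  {C | C ∈ chains 1 N (C 0) ∧ StrictAnti (C 0) ∧ ∀ i, 1 ≤ C 0 i}

lemma gapSum_eq {k B : ℕ} (d : Fin k → Fin B) (m : Fin k) :
    gapSum d m = d m + 1 + if h : (m : ℕ) + 1 < k then gapSum d ⟨m + 1, h⟩ else 0 := by
  have h1 : univ.filter (m ≤ ·) = insert m (univ.filter (m < ·)) := by
    ext l
    simp only [mem_filter, mem_univ, true_and, mem_insert]
    rw [le_iff_eq_or_lt, eq_comm]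
  rw [gapSum, h1, sum_insert (by simp)]
  congr 1
  split_ifs with h
  · rfl
  · refine sum_eq_zero fun l hl => absurd (mem_filter.1 hl).2 ?_
    rw [Fin.lt_def]
    omega

lemma gapSum_injective {k B : ℕ} : Function.Injective (gapSum : (Fin k → Fin B) → Fin k → ℕ) := by
  intro d d' h
  funext m
  have h1 := gapSum_eq d m
  rw [h, gapSum_eq d' m] at h1
  exact Fin.ext (by omega)

lemma one_le_gapSum {k B : ℕ} (d : Fin k → Fin B) (m : Fin k) : 1 ≤ gapSum d m := by
  rw [gapSum_eq]; omega

lemma strictAnti_gapSum {k B : ℕ} (d : Fin k → Fin B) : StrictAnti (gapSum d) :=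
  strictAnti_of_consecutive fun m m' h => by
    rw [gapSum_eq d m', dif_pos (by omega), show (⟨m' + 1, by omega⟩ : Fin k) = m from Fin.ext h]
    omega

lemma gapSum_le {k B : ℕ} (d : Fin k → Fin B) (m : Fin k) : gapSum d m ≤ k * B := by
  refine (sum_le_univ_sum_of_nonneg fun _ => Nat.zero_le _).trans ?_
  refine (sum_le_card_nsmul univ _ B fun l _ => (d l).2).trans ?_
  simp

lemma exists_gapSum_eq {k B : ℕ} {c : Fin k → ℕ} (hc : StrictAnti c) (hc1 : ∀ i, 1 ≤ c i)
    (hB : ∀ i, c i ≤ B) : ∃ d : Fin k → Fin B, gapSum d = c := by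
  have hlt : ∀ m : Fin k, c m - 1 - (if h : (m : ℕ) + 1 < k then c ⟨m + 1, h⟩ else 0) < B :=
    fun m => by have := hc1 m; have := hB m; omega
  refine ⟨fun m => ⟨_, hlt m⟩, funext fun m => ?_⟩
  induction h : k - m generalizing m with
  | zero => omega
  | succ j ih =>
    rw [gapSum_eq]
    have := hc1 m
    by_cases hm : (m : ℕ) + 1 < k
    · have h1 : c ⟨m + 1, hm⟩ < c m := hc (by rw [Fin.lt_def]; simp)
      have h2 := ih ⟨m + 1, hm⟩ (by simp only; omega)
      simp only [dif_pos hm]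
      rw [h2]
      omega
    · simp only [dif_neg hm]
      omega

lemma finite_freeChains (k N : ℕ) : (freeChains k N).Finite :=
  (finite_setOf_bounded N (N + k)).subset
    fun _ hC => ⟨le_of_mem_chains' hC.1 le_rfl, hC.1.2.2.2⟩

lemma sum_ncard_chains_gapSum {k : ℕ} (hk : 1 ≤ k) {N B : ℕ} (hB : N + k ≤ B) :
    ∑ d : Fin k → Fin B, (chains 1 N (gapSum d)).ncard = (freeChains k N).ncard := by
  have hBk : B ≤ k * B := Nat.le_mul_of_pos_left _ hk
  rw [ncard_eq_sum_fiber (B := k * B) (finite_freeChains k N) (fun C => C 0) fun C hC i =>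
    le_of_mem_chains' hC.1 (hB.trans hBk) 0 i]
  refine sum_of_injOn (fun d i => ⟨gapSum d i, Nat.lt_succ_of_le (gapSum_le d i)⟩) ?_
    (fun _ _ => mem_coe.2 (mem_univ _)) (fun c _ hc => ?_) fun d _ => ?_
  · intro d _ d' _ h
    exact gapSum_injective (funext fun i => Fin.mk.inj (congrFun h i))
  · rw [Set.ncard_eq_zero ((finite_freeChains k N).subset fun _ h => h.1)]
    refine Set.eq_empty_of_forall_notMem fun C hC => hc ?_
    obtain ⟨d, hd⟩ := exists_gapSum_eq hC.1.2.1 hC.1.2.2 (le_of_mem_chains' hC.1.1 hB 0)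
    exact ⟨d, mem_coe.2 (mem_univ _), funext fun i => Fin.ext (by simp [hd, hC.2])⟩
  · congr 1
    ext C
    refine ⟨fun h => ⟨⟨by rwa [h.1], h.1 ▸ strictAnti_gapSum d, h.1 ▸ one_le_gapSum d⟩, h.1⟩, ?_⟩
    rintro ⟨h, h0⟩
    have := h.1
    rwa [h0] at this

/-- The two families of chains are equinumerous. -/
lemma ncard_chains_eq_ncard_freeChains {k n : ℕ} (hk : 1 ≤ k) (hn : k ≤ n) :
    (chains 0 n fun i : Fin k => k - (i : ℕ)).ncard = (freeChains k (n - 1)).ncard := by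
  have hs : ((Equiv.Perm.sign (Fin.revPerm (n := k)) : ℤ) : ℂ) ≠ 0 := by
    exact_mod_cast (Equiv.Perm.sign (Fin.revPerm (n := k))).ne_zero
  have hg : gogAvg n (fun i : Fin k => k - (i : ℕ)) = _ :=
    isKernel_gog.avg_eq_ncard_chains (B := n + k) (Nat.zero_le 1)
      (fun N b hb i hi hbi => gogAvg_eq_zero_of_wall N hb hi hbi) le_rfl
      (fun i j h => by have := j.2; rw [Fin.lt_def] at h; change k - (j : ℕ) < k - i; omega)
      (fun i => by omega) (fun i => by omega)
  have hm : ∀ d : Fin k → Fin (n + k), magogAvg (n - 1) (gapSum d) = _ := fun d =>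
    isKernel_magog.avg_eq_ncard_chains (B := k * (n + k)) le_rfl
      (fun N b _ i _ hbi => magogAvg_eq_zero_of_wall N hbi)
      ((by omega : n - 1 + k ≤ n + k).trans (Nat.le_mul_of_pos_left _ hk))
      (strictAnti_gapSum d) (one_le_gapSum d) (gapSum_le d)
  have h := gogAvg_eq_or_neg hk hn (B := n + k) (by omega)
  rw [hg, sum_congr rfl fun d _ => hm d, ← mul_sum, ← mul_neg, mul_right_inj' hs,
    mul_right_inj' hs, ← Nat.cast_sum, sum_ncard_chains_gapSum hk (by omega)] at h
  rcases h with h | h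
  · exact_mod_cast h
  · have h2 : (chains 0 n fun i : Fin k => k - (i : ℕ)).ncard + (freeChains k (n - 1)).ncard = 0 := by
      have := eq_neg_iff_add_eq_zero.1 h
      exact_mod_cast this
    omega

end

section

lemma mem_chains_iff {k δ N : ℕ} {b : Fin k → ℕ} {D : ℕ → ℕ → ℕ} :
    (fun t (i : Fin k) => D t i) ∈ chains δ N b ↔ (∀ i : Fin k, D 0 i = b i) ∧
      (∀ t < N, (∀ m < k, D t m ≤ D (t + 1) m + 1) ∧ (∀ m < k, 1 ≤ D (t + 1) m) ∧
        ∀ m, m + 1 < k → D (t + 1) (m + 1) + 1 + δ ≤ D t m ∧ D (t + 1) (m + 1) < D (t + 1) m) ∧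
      (∀ m < k, D N m = k - m) ∧ ∀ t, N < t → ∀ m < k, D t m = 0 := by
  constructor
  · rintro ⟨h0, h1, h2, h3⟩
    exact ⟨fun i => congrFun h0 i, fun t ht => ⟨fun m hm => (h1 t ht).1.1 ⟨m, hm⟩,
      fun m hm => (h1 t ht).2 ⟨m, hm⟩,
      fun m hm => (h1 t ht).1.2 ⟨m + 1, hm⟩ ⟨m, Nat.lt_of_succ_lt hm⟩ rfl⟩,
      fun m hm => h2 ⟨m, hm⟩, fun t ht m hm => congrFun (h3 t ht) ⟨m, hm⟩⟩
  · rintro ⟨h0, h1, h2, h3⟩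
    refine ⟨funext h0, fun t ht => ⟨⟨fun m => (h1 t ht).1 m m.2, fun m m' h => ?_⟩,
      fun i => (h1 t ht).2.1 i i.2⟩, fun i => h2 i i.2, fun t ht => funext fun i => h3 t ht i i.2⟩
    have := (h1 t ht).2.2 m' (h ▸ m.2)
    rwa [h] at this

lemma exists_nat_extension {k : ℕ} (C : ℕ → Fin k → ℕ) :
    ∃ D : ℕ → ℕ → ℕ, C = fun t (i : Fin k) => D t i :=
  ⟨fun t m => if h : m < k then C t ⟨m, h⟩ else 0, by funext t i; simp⟩

lemma IsGog.le_apply {n : ℕ} {Y : ℕ → ℕ → ℤ} (h : IsGog n Y) {i : ℕ} (hi : i ≤ n) (j : ℕ) :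
    j + 1 ≤ i → (j : ℤ) + 1 ≤ Y i (j + 1) := by
  induction j with
  | zero => intro hj; simpa using h.1.1 i 1 le_rfl hj hi
  | succ j ih =>
    intro hj
    have h1 := ih (by omega)
    have h2 := h.2.1 i (j + 1) (by omega) hj hi
    push_cast
    omega

/-- The entry of row `t` at distance `m` from the right boundary, relative to its largest
possible position; beyond the left boundary the minimal value is used. -/
def gogDepth (X : ℕ → ℕ → ℤ) (t m : ℕ) : ℤ := if m < t then X t (t - m) - t else -m

/-- The rows of the chain of a right Gog trapezoid. -/
def gogRow (n k : ℕ) (X : ℕ → ℕ → ℤ) (t m : ℕ) : ℕ :=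
  if t ≤ n then (gogDepth X t m + k).toNat else 0

section gogDepth

variable {n : ℕ} {Y : ℕ → ℕ → ℤ}

lemma IsGog.le_gogDepth (h : IsGog n Y) {t : ℕ} (ht : t ≤ n) (m : ℕ) :
    -(m : ℤ) ≤ gogDepth Y t m := by
  unfold gogDepth
  split_ifs with hm
  · obtain ⟨j, rfl⟩ := Nat.exists_eq_add_of_lt hm
    have := h.le_apply ht j (by omega)
    rw [show m + j + 1 - m = j + 1 by omega]
    push_cast
    omega
  · exact le_rfl

lemma IsGog.gogDepth_succ (h : IsGog n Y) {t : ℕ} (ht : t < n) (m : ℕ) :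
    gogDepth Y t m ≤ gogDepth Y (t + 1) m + 1 := by
  by_cases hm : m < t
  · have := (h.1.2 t (t - m) (by omega) (by omega) ht).2
    rw [gogDepth, gogDepth, if_pos hm, if_pos (by omega), show t + 1 - m = t - m + 1 by omega]
    push_cast
    omega
  · have := h.le_gogDepth (t := t + 1) ht m
    rw [gogDepth, if_neg hm]
    omega

lemma IsGog.gogDepth_succ_succ (h : IsGog n Y) {t : ℕ} (ht : t < n) (m : ℕ) :
    gogDepth Y (t + 1) (m + 1) + 1 ≤ gogDepth Y t m := by
  by_cases hm : m < t
  · have := (h.1.2 t (t - m) (by omega) (by omega) ht).1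
    rw [gogDepth, gogDepth, if_pos hm, if_pos (by omega), Nat.add_sub_add_right]
    push_cast
    omega
  · rw [gogDepth, gogDepth, if_neg hm, if_neg (by omega)]
    push_cast
    omega

lemma IsGog.gogDepth_lt (h : IsGog n Y) {t : ℕ} (ht : t ≤ n) (m : ℕ) :
    gogDepth Y t (m + 1) < gogDepth Y t m := by
  by_cases hm : m + 1 < t
  · have := h.2.1 t (t - (m + 1)) (by omega) (by omega) ht
    rw [show t - (m + 1) + 1 = t - m by omega] at this
    rw [gogDepth, gogDepth, if_pos hm, if_pos (by omega)]
    omega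
  · have := h.le_gogDepth ht m
    rw [gogDepth, if_neg hm]
    push_cast
    omega

lemma IsGog.gogDepth_top (h : IsGog n Y) (m : ℕ) : gogDepth Y n m = -m := by
  unfold gogDepth
  split_ifs with hm
  · rw [h.2.2 (n - m) (by omega) (by omega)]
    omega
  · rfl

end gogDepth

lemma gogRow_congr {n k : ℕ} {X Y : ℕ → ℕ → ℤ} (h : ∀ i j, RightIdx n k i j → X i j = Y i j)
    (t : ℕ) {m : ℕ} (hm : m < k) : gogRow n k X t m = gogRow n k Y t m := by
  unfold gogRow gogDepth
  split_ifs with ht hmt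
  · rw [h t (t - m) ⟨by omega, by omega, ht, by omega⟩]
  · rfl
  · rfl

lemma gogRow_mem_chains {n k : ℕ} {X : ℕ → ℕ → ℤ} (hX : X ∈ RightGogTrapezoids n k) :
    (fun t (i : Fin k) => gogRow n k X t i) ∈ chains 0 n fun i : Fin k => k - (i : ℕ) := by
  obtain ⟨⟨Y, hY, hXY⟩, -⟩ := hX
  rw [show (fun t (i : Fin k) => gogRow n k X t i) = fun t (i : Fin k) => gogRow n k Y t i from
    funext fun t => funext fun i => gogRow_congr hXY t i.2, mem_chains_iff]
  refine ⟨fun i => ?_, fun t ht => ⟨fun m hm => ?_, fun m hm => ?_, fun m hm => ?_⟩,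
    fun m hm => ?_, fun t ht m hm => ?_⟩
  · simp only [gogRow, gogDepth, Nat.zero_le, if_true, Nat.not_lt_zero, if_false]
    omega
  · have := hY.gogDepth_succ ht m
    rw [gogRow, gogRow, if_pos ht.le, if_pos (Nat.succ_le_of_lt ht)]
    omega
  · have := hY.le_gogDepth (t := t + 1) ht m
    rw [gogRow, if_pos (Nat.succ_le_of_lt ht)]
    omega
  · have h1 := hY.gogDepth_succ_succ ht m
    have h2 := hY.gogDepth_lt (t := t + 1) ht m
    have h3 := hY.le_gogDepth (t := t + 1) ht (m + 1)
    rw [gogRow, gogRow, gogRow, if_pos ht.le, if_pos (Nat.succ_le_of_lt ht),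
      if_pos (Nat.succ_le_of_lt ht)]
    push_cast at h3
    omega
  · rw [gogRow, if_pos le_rfl, hY.gogDepth_top]
    omega
  · rw [gogRow, if_neg (by omega)]

lemma gogRow_injOn {n k : ℕ} {X X' : ℕ → ℕ → ℤ} (hX : X ∈ RightGogTrapezoids n k)
    (hX' : X' ∈ RightGogTrapezoids n k) (h : ∀ t, ∀ m < k, gogRow n k X t m = gogRow n k X' t m) :
    X = X' := by
  obtain ⟨⟨Y, hY, hXY⟩, h0⟩ := hX
  obtain ⟨⟨Y', hY', hXY'⟩, h0'⟩ := hX'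
  funext i j
  by_cases hij : RightIdx n k i j
  · obtain ⟨h1, h2, h3, h4⟩ := id hij
    have h5 := h i (i - j) (by omega)
    rw [gogRow_congr hXY i (by omega), gogRow_congr hXY' i (by omega), gogRow, gogRow, if_pos h3,
      if_pos h3] at h5
    have h6 := hY.le_gogDepth h3 (i - j)
    have h7 := hY'.le_gogDepth h3 (i - j)
    rw [hXY i j hij, hXY' i j hij]
    simp only [gogDepth, if_pos (show i - j < i by omega), show i - (i - j) = j by omega] at *
    omega
  · rw [h0 i j hij, h0' i j hij]

lemma exists_gogRow_eq {n k : ℕ} {D : ℕ → ℕ → ℕ}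
    (hD : (fun t (i : Fin k) => D t i) ∈ chains 0 n fun i : Fin k => k - (i : ℕ)) :
    ∃ X ∈ RightGogTrapezoids n k, ∀ t, ∀ m < k, gogRow n k X t m = D t m := by
  classical
  obtain ⟨h0, h1, h2, h3⟩ := mem_chains_iff.1 hD
  have hanti : ∀ t ≤ n, ∀ m, m + 1 < k → D t (m + 1) < D t m := fun t ht m hm => by
    cases t with
    | zero =>
      have h4 := h0 ⟨m, by omega⟩
      have h5 := h0 ⟨m + 1, hm⟩
      simp only at h4 h5
      omega
    | succ t => exact ((h1 t ht).2.2 m hm).2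
  have hlow : ∀ t ≤ n, ∀ l m, m + l + 1 = k → l + 1 ≤ D t m := fun t ht l => by
    induction l with
    | zero =>
      intro m hm
      cases t with
      | zero => have h4 := h0 ⟨m, by omega⟩; simp only at h4; omega
      | succ t => exact (h1 t ht).2.1 m (by omega)
    | succ l ih =>
      intro m hm
      have h4 := ih (m + 1) (by omega)
      have h5 := hanti t ht m (by omega)
      omega
  have hup : ∀ t ≤ n, ∀ m < k, t ≤ m → D t m = k - m := fun t => by
    induction t with
    | zero => intro _ m hm _; exact h0 ⟨m, hm⟩
    | succ t ih =>
      intro ht m hm htm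
      obtain ⟨m, rfl⟩ : ∃ m', m = m' + 1 := ⟨m - 1, by omega⟩
      have h4 := ih (by omega) m (by omega) (by omega)
      have h5 := ((h1 t ht).2.2 m hm).1
      have h6 := hlow (t + 1) ht (k - (m + 2)) (m + 1) (by omega)
      omega
  set Y : ℕ → ℕ → ℤ := fun i j => if i < j + k then (D i (i - j) : ℤ) + i - k else j with hY
  have hYin : ∀ i j, i < j + k → Y i j = (D i (i - j) : ℤ) + i - k := fun i j h => if_pos h
  have hYout : ∀ i j, ¬ i < j + k → Y i j = j := fun i j h => if_neg h
  have hYge : ∀ i j, j ≤ i → i ≤ n → (j : ℤ) ≤ Y i j := fun i j hj hi => by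
    by_cases hk : i < j + k
    · have := hlow i hi (k - (i - j) - 1) (i - j) (by omega)
      rw [hYin i j hk]
      omega
    · rw [hYout i j hk]
  refine ⟨fun i j => if RightIdx n k i j then Y i j else 0, ⟨⟨Y, ⟨⟨fun i j hj hji hi => ?_,
    fun i j hj hji hi => ⟨?_, ?_⟩⟩, fun i j hj hji hi => ?_, fun j hj hjn => ?_⟩,
    fun i j h => if_pos h⟩, fun i j h => if_neg h⟩, fun t m hm => ?_⟩
  · have := hYge i j hji hi
    omega
  · by_cases hk : i + 1 < j + k
    · have := ((h1 i hi).2.2 (i - j) (by omega)).1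
      rw [hYin _ _ hk, hYin i j (by omega), show i + 1 - j = i - j + 1 by omega]
      push_cast
      omega
    · rw [hYout _ _ hk]
      exact hYge i j hji (by omega)
  · by_cases hk : i < j + k
    · have := (h1 i hi).1 (i - j) (by omega)
      rw [hYin _ _ hk, hYin (i + 1) (j + 1) (by omega), Nat.add_sub_add_right]
      push_cast
      omega
    · rw [hYout i j hk, hYout (i + 1) (j + 1) (by omega)]
      push_cast
      omega
  · by_cases hk : i < j + k
    · have := hanti i hi (i - (j + 1)) (by omega)
      rw [show i - (j + 1) + 1 = i - j by omega] at this
      rw [hYin _ _ hk, hYin i (j + 1) (by omega)]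
      omega
    · have := hYge i (j + 1) hji hi
      rw [hYout i j hk]
      push_cast at this
      omega
  · by_cases hk : n < j + k
    · rw [hYin _ _ hk, h2 _ (by omega)]
      omega
    · exact hYout _ _ hk
  · unfold gogRow gogDepth
    split_ifs with ht hmt
    · have hr : RightIdx n k t (t - m) := ⟨by omega, by omega, ht, by omega⟩
      simp only [if_pos hr]
      rw [hYin _ _ (by omega), show t - (t - m) = m by omega]
      omega
    · rw [hup t ht m hm (by omega)]
      omega
    · exact (h3 t (by omega) m hm).symm

lemma ncard_rightGogTrapezoids (n k : ℕ) :
    (RightGogTrapezoids n k).ncard = (chains 0 n fun i : Fin k => k - (i : ℕ)).ncard := by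
  refine Set.ncard_congr (fun X _ t (i : Fin k) => gogRow n k X t i)
    (fun X hX => gogRow_mem_chains hX) (fun X X' hX hX' h => gogRow_injOn hX hX' fun t m hm => ?_)
    fun C hC => ?_
  · exact congrFun (congrFun h t) ⟨m, hm⟩
  · obtain ⟨D, rfl⟩ := exists_nat_extension C
    obtain ⟨X, hX, h⟩ := exists_gogRow_eq hC
    exact ⟨X, hX, funext fun t => funext fun i => h t i i.2⟩

end

section

lemma mem_freeChains_iff {k N : ℕ} {D : ℕ → ℕ → ℕ} :
    (fun t (i : Fin k) => D t i) ∈ freeChains k N ↔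
      (∀ t ≤ N, (∀ m < k, 1 ≤ D t m) ∧ ∀ m, m + 1 < k → D t (m + 1) < D t m) ∧
      (∀ t < N, (∀ m < k, D t m ≤ D (t + 1) m + 1) ∧
        ∀ m, m + 1 < k → D (t + 1) (m + 1) + 2 ≤ D t m) ∧
      (∀ m < k, D N m = k - m) ∧ ∀ t, N < t → ∀ m < k, D t m = 0 := by
  constructor
  · rintro ⟨h, ha, hp⟩
    obtain ⟨-, h1, h2, h3⟩ := mem_chains_iff.1 h
    refine ⟨fun t ht => ?_, fun t ht => ⟨(h1 t ht).1, fun m hm => ((h1 t ht).2.2 m hm).1⟩, h2, h3⟩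
    cases t with
    | zero =>
      exact ⟨fun m hm => hp ⟨m, hm⟩, fun m hm =>
        ha (show (⟨m, Nat.lt_of_succ_lt hm⟩ : Fin k) < ⟨m + 1, hm⟩ from Nat.lt_succ_self m)⟩
    | succ t => exact ⟨(h1 t ht).2.1, fun m hm => ((h1 t ht).2.2 m hm).2⟩
  · rintro ⟨h0, h1, h2, h3⟩
    refine ⟨mem_chains_iff.2 ⟨fun _ => rfl, fun t ht => ⟨(h1 t ht).1, (h0 (t + 1) ht).1,
      fun m hm => ⟨(h1 t ht).2 m hm, (h0 (t + 1) ht).2 m hm⟩⟩, h2, h3⟩,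
      strictAnti_of_consecutive fun m m' h => ?_, fun i => (h0 0 N.zero_le).1 i i.2⟩
    have := (h0 0 N.zero_le).2 m' (h ▸ m.2)
    rwa [h] at this

lemma IsMagog.apply_le_succ {n : ℕ} {Y : ℕ → ℕ → ℤ} (h : IsMagog n Y) {i j : ℕ} (hj : 1 ≤ j)
    (hji : j + 1 ≤ i) (hi : i ≤ n) : Y i j ≤ Y i (j + 1) := by
  obtain ⟨i, rfl⟩ : ∃ i', i = i' + 1 := ⟨i - 1, by omega⟩
  have := h.1.2 i j hj (by omega) hi
  exact this.1.trans this.2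

lemma IsMagog.apply_le {n : ℕ} {Y : ℕ → ℕ → ℤ} (h : IsMagog n Y) {i j : ℕ} (hj : 1 ≤ j)
    (hji : j ≤ i) : i ≤ n → Y i j ≤ j := by
  induction i, hji using Nat.le_induction with
  | base => exact h.2 j hj
  | succ i hji ih =>
    intro hi
    exact (h.1.2 i j hj hji hi).1.trans (ih (by omega))

/-- The entries of the `k` rightmost diagonals of row `i`, counted from the left; beyond the left
boundary the minimal value is used. -/
def magEntry (k : ℕ) (X : ℕ → ℕ → ℤ) (i m : ℕ) : ℤ :=
  if k < i + m + 1 then X i (i + m + 1 - k) else 1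

/-- The rows of the chain of a right Magog trapezoid, from the top row downwards. -/
def magRow (n k : ℕ) (X : ℕ → ℕ → ℤ) (t m : ℕ) : ℕ :=
  if t < n then ((n : ℤ) - t - magEntry k X (n - t) m + k - m).toNat else 0

section magEntry

variable {n k : ℕ} {Y : ℕ → ℕ → ℤ}

lemma IsMagog.one_le_magEntry (h : IsMagog n Y) {i m : ℕ} (hi : i ≤ n) (hm : m < k) :
    1 ≤ magEntry k Y i m := by
  unfold magEntry
  split_ifs with hk
  · exact h.1.1 i _ (by omega) (by omega) hi
  · exact le_rfl

lemma IsMagog.magEntry_le (h : IsMagog n Y) {i m : ℕ} (hi1 : 1 ≤ i) (hi : i ≤ n) (hm : m < k) :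
    magEntry k Y i m ≤ i := by
  unfold magEntry
  split_ifs with hk
  · have := h.apply_le (i := i) (j := i + m + 1 - k) (by omega) (by omega) hi
    omega
  · omega

lemma IsMagog.magEntry_le_row_succ (h : IsMagog n Y) {i m : ℕ} (hi : i + 1 ≤ n) (hm : m < k) :
    magEntry k Y i m ≤ magEntry k Y (i + 1) m := by
  by_cases hk : k < i + m + 1
  · have := (h.1.2 i (i + m + 1 - k) (by omega) (by omega) hi).2
    rwa [magEntry, magEntry, if_pos hk, if_pos (by omega),
      show i + 1 + m + 1 - k = i + m + 1 - k + 1 by omega]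
  · rw [magEntry, if_neg hk]
    exact h.one_le_magEntry hi hm

lemma IsMagog.magEntry_row_succ_le (h : IsMagog n Y) {i m : ℕ} (hi : i + 1 ≤ n)
    (hm : m + 1 < k) : magEntry k Y (i + 1) m ≤ magEntry k Y i (m + 1) := by
  by_cases hk : k < i + m + 2
  · have := (h.1.2 i (i + m + 2 - k) (by omega) (by omega) hi).1
    rwa [magEntry, magEntry, if_pos (by omega), if_pos (by omega),
      show i + 1 + m + 1 - k = i + m + 2 - k by omega,
      show i + (m + 1) + 1 - k = i + m + 2 - k by omega]
  · rw [magEntry, magEntry, if_neg (by omega), if_neg (by omega)]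

lemma IsMagog.magEntry_le_succ (h : IsMagog n Y) {i m : ℕ} (hi : i ≤ n) (hm : m + 1 < k) :
    magEntry k Y i m ≤ magEntry k Y i (m + 1) := by
  by_cases hk : k < i + m + 1
  · have := h.apply_le_succ (i := i) (j := i + m + 1 - k) (by omega) (by omega) hi
    rwa [magEntry, magEntry, if_pos hk, if_pos (by omega),
      show i + (m + 1) + 1 - k = i + m + 1 - k + 1 by omega]
  · rw [magEntry, if_neg hk]
    exact h.one_le_magEntry hi hm

end magEntry

lemma magRow_congr {n k : ℕ} {X Y : ℕ → ℕ → ℤ} (h : ∀ i j, RightIdx n k i j → X i j = Y i j)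
    (t : ℕ) {m : ℕ} (hm : m < k) : magRow n k X t m = magRow n k Y t m := by
  unfold magRow magEntry
  split_ifs with ht hmt
  · rw [h _ _ ⟨by omega, by omega, by omega, by omega⟩]
  · rfl
  · rfl

lemma magRow_mem_freeChains {n k : ℕ} (hn : 1 ≤ n) {X : ℕ → ℕ → ℤ}
    (hX : X ∈ RightMagogTrapezoids n k) :
    (fun t (i : Fin k) => magRow n k X t i) ∈ freeChains k (n - 1) := by
  obtain ⟨⟨Y, hY, hXY⟩, -⟩ := hX
  rw [show (fun t (i : Fin k) => magRow n k X t i) = fun t (i : Fin k) => magRow n k Y t i from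
    funext fun t => funext fun i => magRow_congr hXY t i.2, mem_freeChains_iff]
  refine ⟨fun t ht => ⟨fun m hm => ?_, fun m hm => ?_⟩, fun t ht => ⟨fun m hm => ?_, fun m hm => ?_⟩,
    fun m hm => ?_, fun t ht m hm => ?_⟩
  · have := hY.magEntry_le (i := n - t) (by omega) (by omega) hm
    rw [magRow, if_pos (by omega)]
    omega
  · have h1 := hY.magEntry_le_succ (i := n - t) (by omega) hm
    have h2 := hY.magEntry_le (i := n - t) (by omega) (by omega) hm
    rw [magRow, magRow, if_pos (by omega), if_pos (by omega)]
    omega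
  · have h1 := hY.magEntry_le_row_succ (i := n - (t + 1)) (by omega) hm
    have h2 := hY.magEntry_le (i := n - (t + 1)) (by omega) (by omega) hm
    rw [show n - (t + 1) + 1 = n - t by omega] at h1
    rw [magRow, magRow, if_pos (by omega), if_pos (by omega)]
    omega
  · have h1 := hY.magEntry_row_succ_le (i := n - (t + 1)) (by omega) hm
    have h2 := hY.magEntry_le (i := n - (t + 1)) (by omega) (by omega) hm
    rw [show n - (t + 1) + 1 = n - t by omega] at h1
    rw [magRow, magRow, if_pos (by omega), if_pos (by omega)]
    omega
  · have h1 := hY.one_le_magEntry (i := 1) hn hm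
    have h2 := hY.magEntry_le (i := 1) le_rfl hn hm
    rw [magRow, if_pos (by omega), show n - (n - 1) = 1 by omega]
    omega
  · rw [magRow, if_neg (by omega)]

lemma magRow_injOn {n k : ℕ} {X X' : ℕ → ℕ → ℤ} (hX : X ∈ RightMagogTrapezoids n k)
    (hX' : X' ∈ RightMagogTrapezoids n k)
    (h : ∀ t, ∀ m < k, magRow n k X t m = magRow n k X' t m) : X = X' := by
  obtain ⟨⟨Y, hY, hXY⟩, h0⟩ := hX
  obtain ⟨⟨Y', hY', hXY'⟩, h0'⟩ := hX'
  funext i j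
  by_cases hij : RightIdx n k i j
  · obtain ⟨h1, h2, h3, h4⟩ := id hij
    have hm : j + k - i - 1 < k := by omega
    have h5 := h (n - i) (j + k - i - 1) hm
    rw [magRow_congr hXY _ hm, magRow_congr hXY' _ hm, magRow, magRow, if_pos (by omega),
      if_pos (by omega), show n - (n - i) = i by omega] at h5
    have h6 := hY.magEntry_le (by omega) h3 hm
    have h7 := hY'.magEntry_le (by omega) h3 hm
    rw [hXY i j hij, hXY' i j hij]
    simp only [magEntry, if_pos (show k < i + (j + k - i - 1) + 1 by omega),
      show i + (j + k - i - 1) + 1 - k = j by omega] at *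
    omega
  · rw [h0 i j hij, h0' i j hij]

lemma exists_magRow_eq {n k : ℕ} (hk : 1 ≤ k) (hn : 1 ≤ n) {D : ℕ → ℕ → ℕ}
    (hD : (fun t (i : Fin k) => D t i) ∈ freeChains k (n - 1)) :
    ∃ X ∈ RightMagogTrapezoids n k, ∀ t, ∀ m < k, magRow n k X t m = D t m := by
  classical
  obtain ⟨h0, h1, h2, h3⟩ := mem_freeChains_iff.1 hD
  have hle : ∀ t ≤ n - 1, ∀ m < k, D t m ≤ k - m + (n - 1 - t) := fun t ht m hm =>
    le_of_mem_chains hD.1 ht ⟨m, hm⟩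
  have hge : ∀ i, i + 1 ≤ n → ∀ m, i + 1 + m + 1 ≤ k → k - m + i ≤ D (n - (i + 1)) m := fun i => by
    induction i with
    | zero => intro _ m hm; exact (h2 m (by omega)).ge
    | succ i ih =>
      intro hi m hm
      have h4 := ih (by omega) (m + 1) (by omega)
      have h5 := (h1 (n - (i + 1 + 1)) (by omega)).2 m (by omega)
      rw [show n - (i + 1 + 1) + 1 = n - (i + 1) by omega] at h5
      omega
  set Y : ℕ → ℕ → ℤ := fun i j =>
    if i < j + k then 2 * (i : ℤ) - j + 1 - D (n - i) (j + k - i - 1) else 1 with hY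
  have hYin : ∀ i j, i < j + k → Y i j = 2 * (i : ℤ) - j + 1 - D (n - i) (j + k - i - 1) :=
    fun i j h => if_pos h
  have hYout : ∀ i j, ¬ i < j + k → Y i j = 1 := fun i j h => if_neg h
  have hYge : ∀ i j, 1 ≤ j → j ≤ i → i ≤ n → 1 ≤ Y i j := fun i j hj hji hi => by
    by_cases hk : i < j + k
    · have := hle (n - i) (by omega) (j + k - i - 1) (by omega)
      rw [hYin i j hk]
      omega
    · rw [hYout i j hk]
  refine ⟨fun i j => if RightIdx n k i j then Y i j else 0, ⟨⟨Y, ⟨⟨hYge,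
    fun i j hj hji hi => ⟨?_, ?_⟩⟩, fun j hj hjn => ?_⟩,
    fun i j h => if_pos h⟩, fun i j h => if_neg h⟩, fun t m hm => ?_⟩
  · by_cases hk : i + 1 < j + k
    · have := (h1 (n - (i + 1)) (by omega)).2 (j + k - (i + 1) - 1) (by omega)
      rw [show n - (i + 1) + 1 = n - i by omega,
        show j + k - (i + 1) - 1 + 1 = j + k - i - 1 by omega] at this
      rw [hYin _ _ hk, hYin i j (by omega)]
      push_cast
      omega
    · rw [hYout _ _ hk]
      exact hYge i j hj hji (by omega)
  · by_cases hk : i < j + k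
    · have := (h1 (n - (i + 1)) (by omega)).1 (j + k - i - 1) (by omega)
      rw [show n - (i + 1) + 1 = n - i by omega] at this
      rw [hYin _ _ hk, hYin (i + 1) (j + 1) (by omega),
        show j + 1 + k - (i + 1) - 1 = j + k - i - 1 by omega]
      push_cast
      omega
    · rw [hYout i j hk, hYout (i + 1) (j + 1) (by omega)]
  · have := (h0 (n - j) (by omega)).1 (j + k - j - 1) (by omega)
    rw [hYin _ _ (by omega)]
    omega
  · unfold magRow magEntry
    split_ifs with ht hmt
    · have hr : RightIdx n k (n - t) (n - t + m + 1 - k) :=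
        ⟨by omega, by omega, by omega, by omega⟩
      simp only [if_pos hr]
      rw [hYin _ _ (by omega), show n - (n - t) = t by omega,
        show n - t + m + 1 - k + k - (n - t) - 1 = m by omega]
      omega
    · have h4 := hle t (by omega) m hm
      have h5 := hge (n - t - 1) (by omega) m (by omega)
      rw [show n - (n - t - 1 + 1) = t by omega] at h5
      omega
    · exact (h3 t (by omega) m hm).symm

lemma ncard_rightMagogTrapezoids {n k : ℕ} (hk : 1 ≤ k) (hkn : k ≤ n) :
    (RightMagogTrapezoids n k).ncard = (freeChains k (n - 1)).ncard := by
  refine Set.ncard_congr (fun X _ t (i : Fin k) => magRow n k X t i)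
    (fun X hX => magRow_mem_freeChains (hk.trans hkn) hX)
    (fun X X' hX hX' h => magRow_injOn hX hX' fun t m hm => ?_) fun C hC => ?_
  · exact congrFun (congrFun h t) ⟨m, hm⟩
  · obtain ⟨D, rfl⟩ := exists_nat_extension C
    obtain ⟨X, hX, h⟩ := exists_magRow_eq hk (hk.trans hkn) hC
    exact ⟨X, hX, funext fun t => funext fun i => h t i i.2⟩

end

/-- (Zeilberger) The `(n,k)` right Gog and right Magog trapezoids are equienumerated. -/
theorem stmt6 (n k : ℕ) (hk1 : 1 ≤ k) (hkn : k ≤ n) :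
    (RightGogTrapezoids n k).ncard = (RightMagogTrapezoids n k).ncard := by
  rw [ncard_rightGogTrapezoids, ncard_chains_eq_ncard_freeChains hk1 hkn,
    ncard_rightMagogTrapezoids hk1 hkn]
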